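/- As a ↗ a*, the minimal energy satisfies the asymptotic expansion e(a) = (a*)²/4 − ((a*)²/2) ln a* + (1/2)∫_{ℝ²}∫_{ℝ²} ln|x−y| Q²(x) Q²(y) dx dy + (a²/4) ln[4(a*−a)] + o(1). -/

import Mathlib

open MeasureTheory Filter Topology Set Metric

noncomputable section

/-- The plane `ℝ²` with the Euclidean norm. -/
abbrev Plane : Type := EuclideanSpace ℝ (Fin 2)

def e0 : Plane := EuclideanSpace.single (0 : Fin 2) (1 : ℝ)
def e1 : Plane := EuclideanSpace.single (1 : Fin 2) (1 : ℝ)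

/-- Partial derivatives of a complex-valued function. -/
def d0 (u : Plane → ℂ) (x : Plane) : ℂ := fderiv ℝ u x e0
def d1 (u : Plane → ℂ) (x : Plane) : ℂ := fderiv ℝ u x e1

/-- `|∇u|²` for complex-valued `u`. -/
def gradSq (u : Plane → ℂ) (x : Plane) : ℝ := ‖d0 u x‖ ^ 2 + ‖d1 u x‖ ^ 2

/-- `|∇|u||²`. -/
def gradAbsSq (u : Plane → ℂ) (x : Plane) : ℝ := ‖fderiv ℝ (fun y => ‖u y‖) x‖ ^ 2

/-- Membership in `H¹(ℝ², ℂ)` (smooth-representative formulation). -/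
def InH1 (u : Plane → ℂ) : Prop :=
  Differentiable ℝ u ∧ Integrable (fun x => ‖u x‖ ^ 2) ∧ Integrable (gradSq u)

/-- Membership in the space `𝓗 = {u ∈ H¹ : ∫ V |u|² < ∞}`. -/
def InH (V : Plane → ℝ) (u : Plane → ℂ) : Prop :=
  InH1 u ∧ Integrable (fun x => V x * ‖u x‖ ^ 2)

/-- The constraint set `S_a`. -/
def Sset (V : Plane → ℝ) (a : ℝ) : Set (Plane → ℂ) :=
  {u | InH V u ∧ (∫ x : Plane, ‖u x‖ ^ 2) = a}

/-- The momentum density `x^⊥ · (iu, ∇u)`, with `x^⊥ = (-x₂, x₁)` and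
`(iu,∇u)_j = Im(ū ∂_j u)`. -/
def momentum (u : Plane → ℂ) (x : Plane) : ℝ :=
  (-(x 1)) * ((starRingEnd ℂ) (u x) * d0 u x).im + (x 0) * ((starRingEnd ℂ) (u x) * d1 u x).im

/-- The logarithmic convolution term `∫∫ ln|x-y| |u(x)|²|u(y)|²`. -/
def logConv (u : Plane → ℂ) : ℝ :=
  ∫ x : Plane, ∫ y : Plane, Real.log ‖x - y‖ * ‖u x‖ ^ 2 * ‖u y‖ ^ 2

/-- The energy functional `E_a`. -/
def Ea (V : Plane → ℝ) (Ω : ℝ) (u : Plane → ℂ) : ℝ :=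
  (∫ x : Plane, (gradSq u x + V x * ‖u x‖ ^ 2)) + (1 / 2) * logConv u
    - (1 / 2) * (∫ x : Plane, ‖u x‖ ^ 4) - Ω * (∫ x : Plane, momentum u x)

/-- `u` is a minimizer of `e(a) = inf_{S_a} E_a`. -/
def IsMinimizer (V : Plane → ℝ) (Ω a : ℝ) (u : Plane → ℂ) : Prop :=
  u ∈ Sset V a ∧ ∀ v ∈ Sset V a, Ea V Ω u ≤ Ea V Ω v

/-- `e(a) = inf_{u ∈ S_a} E_a(u)`. -/
def eInf (V : Plane → ℝ) (Ω a : ℝ) : ℝ := sInf (Ea V Ω '' Sset V a)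

/-- `f(x) → ∞` as `|x| → ∞`. -/
def TendsInfty (f : Plane → ℝ) : Prop := ∀ M : ℝ, ∃ R : ℝ, ∀ x : Plane, R ≤ ‖x‖ → M ≤ f x

/-- Hypotheses (1.10): `0 ≤ V ∈ L^∞_loc` and `liminf_{|x|→∞} V(x)/|x|² > 0`. -/
def V110 (V : Plane → ℝ) : Prop :=
  Measurable V ∧ (∀ x, 0 ≤ V x) ∧
  (∀ R : ℝ, ∃ C : ℝ, ∀ x : Plane, ‖x‖ ≤ R → V x ≤ C) ∧
  (∃ c : ℝ, 0 < c ∧ ∃ R : ℝ, ∀ x : Plane, R ≤ ‖x‖ → c * ‖x‖ ^ 2 ≤ V x)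

/-- The set of rotational velocities `W > 0` with `V(x) - (W²/4)|x|² → ∞`;
`Ω* = sup RotSet V`. -/
def RotSet (V : Plane → ℝ) : Set ℝ :=
  {W : ℝ | 0 < W ∧ TendsInfty (fun x => V x - W ^ 2 / 4 * ‖x‖ ^ 2)}

/-- `Ω < Ω*` where `Ω* = sup RotSet V` (possibly `+∞`). -/
def SubCritical (V : Plane → ℝ) (Ω : ℝ) : Prop := ∃ W ∈ RotSet V, Ω < W

def d0R (q : Plane → ℝ) (x : Plane) : ℝ := fderiv ℝ q x e0
def d1R (q : Plane → ℝ) (x : Plane) : ℝ := fderiv ℝ q x e1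

/-- `|∇q|²` for real-valued `q`. -/
def gradSqR (q : Plane → ℝ) (x : Plane) : ℝ := (d0R q x) ^ 2 + (d1R q x) ^ 2

/-- The Laplacian of a real-valued function. -/
def lapR (q : Plane → ℝ) (x : Plane) : ℝ := fderiv ℝ (d0R q) x e0 + fderiv ℝ (d1R q) x e1

/-- `Q` is the positive radially symmetric `H¹` solution of `-ΔQ + Q - Q³ = 0` on `ℝ²`. -/
def IsGroundState (Q : Plane → ℝ) : Prop :=
  ContDiff ℝ 2 Q ∧ (∀ x, 0 < Q x) ∧ (∀ x y : Plane, ‖x‖ = ‖y‖ → Q x = Q y) ∧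
  Integrable (fun x => (Q x) ^ 2) ∧ Integrable (fun x => ‖fderiv ℝ Q x‖ ^ 2) ∧
  (∀ x, - lapR Q x + Q x - (Q x) ^ 3 = 0)

/-- The Laplacian of a complex-valued function. -/
def lapC (u : Plane → ℂ) (x : Plane) : ℂ := fderiv ℝ (d0 u) x e0 + fderiv ℝ (d1 u) x e1

/-- The Euler–Lagrange equation (1.18):
`-Δu + V u + (∫ ln|x-y||u(y)|² dy) u + iΩ (x^⊥·∇u) = μ u + |u|² u`. -/
def EulerLagrange (V : Plane → ℝ) (Ω : ℝ) (u : Plane → ℂ) (μ : ℝ) : Prop :=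
  ∀ x : Plane,
    - lapC u x + (V x : ℂ) * u x
      + (((∫ y : Plane, Real.log ‖x - y‖ * ‖u y‖ ^ 2) : ℝ) : ℂ) * u x
      + Complex.I * (Ω : ℂ) * (((-(x 1) : ℝ) : ℂ) * d0 u x + ((x 0 : ℝ) : ℂ) * d1 u x)
    = (μ : ℂ) * u x + ((‖u x‖ ^ 2 : ℝ) : ℂ) * u x

/-- Condition (V): `0 ≤ V_Ω ∈ C^α_loc`, `V_Ω` vanishes only at the origin, and `V` has at
most exponential growth. Here `V_Ω(x) = V(x) - (Ω²/4)|x|²`. -/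
def CondV (V : Plane → ℝ) (Ω α : ℝ) : Prop :=
  α ∈ Ioo (0 : ℝ) 1 ∧
  (∀ x : Plane, 0 ≤ V x - Ω ^ 2 / 4 * ‖x‖ ^ 2) ∧
  (∀ x : Plane, V x - Ω ^ 2 / 4 * ‖x‖ ^ 2 = 0 ↔ x = 0) ∧
  (∀ R : ℝ, 0 < R → ∃ C : ℝ, ∀ x ∈ closedBall (0 : Plane) R, ∀ y ∈ closedBall (0 : Plane) R,
    |(V x - Ω ^ 2 / 4 * ‖x‖ ^ 2) - (V y - Ω ^ 2 / 4 * ‖y‖ ^ 2)| ≤ C * ‖x - y‖ ^ α) ∧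
  (∃ C γ : ℝ, 0 < γ ∧ ∀ x : Plane, V x ≤ C * Real.exp (γ * ‖x‖))

/-- `ε_a = (∫ |∇|u_a||²)^{-1/2}` for a family of minimizers. -/
def epsOf (u : ℝ → Plane → ℂ) (a : ℝ) : ℝ :=
  (∫ x : Plane, gradAbsSq (u a) x) ^ (-(1 : ℝ) / 2)

/-- The rescaled family
`w_a(y) = ε_a u_a(ε_a y + x_a) e^{-i((ε_a Ω/2) y·x_a^⊥ - θ)}`. -/
def wfam (Ω : ℝ) (u : ℝ → Plane → ℂ) (xa : ℝ → Plane) (a θv : ℝ) (y : Plane) : ℂ :=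
  ((epsOf u a : ℝ) : ℂ) * u a ((epsOf u a) • y + xa a) *
    Complex.exp (-Complex.I *
      ((((epsOf u a * Ω / 2) * (-(y 0) * (xa a 1) + (y 1) * (xa a 0)) - θv) : ℝ) : ℂ))

/-- The limit profile `(1/√a*) Q(x/√a*)` where `a* = ‖Q‖₂²`. -/
def Qstar (Q : Plane → ℝ) (x : Plane) : ℝ :=
  (Real.sqrt (∫ y : Plane, (Q y) ^ 2))⁻¹ * Q ((Real.sqrt (∫ y : Plane, (Q y) ^ 2))⁻¹ • x)

open scoped ENNReal

/-! ### Uniqueness of the ground state: comparison of inverse profiles -/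

/-- The pair `(r, -u' ∘ r)`, where `r` is the inverse function of a decreasing positive radial
solution `u` of `u'' + u'/r = u - u³` with `u 0 = α`. -/
structure Branch (r p : ℝ → ℝ) (α : ℝ) : Prop where
  one_lt : 1 < α
  r_pos : ∀ u ∈ Ioo 0 α, 0 < r u
  p_pos : ∀ u ∈ Ioo 0 α, 0 < p u
  hr : ∀ u ∈ Ioo 0 α, HasDerivAt r (-1 / p u) u
  hp : ∀ u ∈ Ioo 0 α, HasDerivAt p (1 / r u - (u ^ 3 - u) / p u) u
  energy : ∀ u ∈ Ioo 0 α, 0 < p u ^ 2 / 2 + (u ^ 4 / 4 - u ^ 2 / 2)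
  p_zero : Tendsto p (𝓝[>] 0) (𝓝 0)
  rp_zero : Tendsto (fun u => r u * p u) (𝓝[>] 0) (𝓝 0)
  ru_zero : Tendsto (fun u => r u * u) (𝓝[>] 0) (𝓝 0)
  r_top : Tendsto r (𝓝[<] α) (𝓝 0)
  p_top : Tendsto p (𝓝[<] α) (𝓝 0)

lemma strictMonoOn_of_hasDerivAt_pos {g g' : ℝ → ℝ} {a b : ℝ}
    (hg : ∀ u ∈ Ioo a b, HasDerivAt g (g' u) u) (hpos : ∀ u ∈ Ioo a b, 0 < g' u) :
    StrictMonoOn g (Ioo a b) := by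
  apply strictMonoOn_of_deriv_pos (convex_Ioo a b)
  · exact fun u hu => (hg u hu).continuousAt.continuousWithinAt
  · intro u hu
    rw [interior_Ioo] at hu
    rw [(hg u hu).deriv]; exact hpos u hu

lemma lt_of_tendsto_left_of_deriv_pos {g g' : ℝ → ℝ} {a b l : ℝ}
    (hg : ∀ u ∈ Ioo a b, HasDerivAt g (g' u) u) (hpos : ∀ u ∈ Ioo a b, 0 < g' u)
    (hl : Tendsto g (𝓝[>] a) (𝓝 l)) {u : ℝ} (hu : u ∈ Ioo a b) : l < g u := by
  have hm := strictMonoOn_of_hasDerivAt_pos hg hpos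
  have hv : (a + u) / 2 ∈ Ioo a b := ⟨by linarith [hu.1], by linarith [hu.1, hu.2]⟩
  have h1 : l ≤ g ((a + u) / 2) := by
    refine le_of_tendsto hl ?_
    have : Ioo a ((a + u) / 2) ∈ 𝓝[>] a := Ioo_mem_nhdsGT hv.1
    filter_upwards [this] with x hx
    exact (hm ⟨hx.1, hx.2.trans hv.2⟩ hv hx.2).le
  exact h1.trans_lt (hm hv hu (by linarith [hu.1]))

lemma lt_of_tendsto_right_of_deriv_pos {g g' : ℝ → ℝ} {a b l : ℝ}
    (hg : ∀ u ∈ Ioo a b, HasDerivAt g (g' u) u) (hpos : ∀ u ∈ Ioo a b, 0 < g' u)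
    (hl : Tendsto g (𝓝[<] b) (𝓝 l)) {u : ℝ} (hu : u ∈ Ioo a b) : g u < l := by
  have hm := strictMonoOn_of_hasDerivAt_pos hg hpos
  have hv : (u + b) / 2 ∈ Ioo a b := ⟨by linarith [hu.1, hu.2], by linarith [hu.2]⟩
  have h1 : g ((u + b) / 2) ≤ l := by
    refine ge_of_tendsto hl ?_
    have : Ioo ((u + b) / 2) b ∈ 𝓝[<] b := Ioo_mem_nhdsLT hv.2
    filter_upwards [this] with x hx
    exact (hm hv ⟨hv.1.trans hx.1, hx.2⟩ hx.1).le
  exact (hm hu hv (by linarith [hu.2])).trans_le h1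

/-- A function that is decreasing wherever it is nonnegative increases to the left of a point
where it is nonnegative. -/
lemma lt_of_deriv_neg_where_nonneg {g g' : ℝ → ℝ} {a b : ℝ}
    (hg : ∀ u ∈ Ioc a b, HasDerivAt g (g' u) u) (hneg : ∀ u ∈ Ioc a b, 0 ≤ g u → g' u < 0)
    {u v : ℝ} (hv : v ∈ Ioc a b) (hgv : 0 ≤ g v) (hau : a < u) (huv : u < v) : g v < g u := by
  by_contra! hcon
  have hcont : ContinuousOn g (Icc u v) := fun x hx =>
    (hg x ⟨hau.trans_le hx.1, hx.2.trans hv.2⟩).continuousAt.continuousWithinAt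
  obtain ⟨m, hm, hmax⟩ := isCompact_Icc.exists_isMaxOn (nonempty_Icc.2 huv.le) hcont
  have key : ∃ m ∈ Ioc u v, (∀ x ∈ Icc u v, g x ≤ g m) := by
    rcases eq_or_lt_of_le hm.1 with h | h
    · refine ⟨v, ⟨huv, le_rfl⟩, fun x hx => (hmax hx).trans ?_⟩
      simpa [← h] using hcon
    · exact ⟨m, ⟨h, hm.2⟩, fun x hx => hmax hx⟩
  obtain ⟨m, hm, hmax⟩ := key
  have hmI : m ∈ Ioc a b := ⟨hau.trans hm.1, hm.2.trans hv.2⟩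
  have hgm : 0 ≤ g m := hgv.trans (hmax v ⟨huv.le, le_rfl⟩)
  have hd := hneg m hmI hgm
  have h1 := (hg m hmI).hasDerivWithinAt (s := Iio m)
  have h2 := hasDerivWithinAt_iff_tendsto_slope.1 h1
  have h3 : ∀ᶠ x in 𝓝[<] m, slope g m x < 0 := by
    have : Iio m \ {m} = Iio m := by ext; simp
    rw [this] at h2
    exact h2.eventually_lt_const hd
  have h4 : Ioo u m ∈ 𝓝[<] m := Ioo_mem_nhdsLT hm.1
  obtain ⟨x, hx1, hx2⟩ := (h3.and h4).exists
  have hx3 := hmax x ⟨hx2.1.le, hx2.2.le.trans hm.2⟩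
  rw [slope_def_field] at hx1
  have : 0 ≤ (g x - g m) / (x - m) := div_nonneg_of_nonpos (by linarith) (by linarith [hx2.2])
  linarith

namespace Branch

variable {r p s q : ℝ → ℝ} {α β : ℝ}

lemma cont_r (h : Branch r p α) {u : ℝ} (hu : u ∈ Ioo 0 α) : ContinuousAt r u :=
  (h.hr u hu).continuousAt

lemma cont_p (h : Branch r p α) {u : ℝ} (hu : u ∈ Ioo 0 α) : ContinuousAt p u :=
  (h.hp u hu).continuousAt

lemma energy_zero (h : Branch r p α) :
    Tendsto (fun u => r u ^ 2 * (p u ^ 2 / 2 + (u ^ 4 / 4 - u ^ 2 / 2))) (𝓝[>] 0) (𝓝 0) := by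
  have h0 : Tendsto (fun u : ℝ => u) (𝓝[>] 0) (𝓝 0) := tendsto_nhdsWithin_of_tendsto_nhds tendsto_id
  have h1 := ((h.rp_zero.pow 2).div_const 2).add
    ((((h.ru_zero.pow 2).mul (h0.pow 2)).div_const 4).sub ((h.ru_zero.pow 2).div_const 2))
  simp only [ne_eq, OfNat.ofNat_ne_zero, not_false_eq_true, zero_pow, zero_div, mul_zero, sub_zero,
    add_zero] at h1
  refine h1.congr fun u => ?_
  ring

lemma hasDerivAt_rp (h : Branch r p α) {u : ℝ} (hu : u ∈ Ioo 0 α) :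
    HasDerivAt (fun u => r u * p u) (-(u ^ 3 - u) * (r u / p u)) u := by
  have := (h.hr u hu).mul (h.hp u hu)
  refine this.congr_deriv ?_
  have := h.r_pos u hu
  have := h.p_pos u hu
  field_simp
  ring

lemma hasDerivAt_energy (h : Branch r p α) {u : ℝ} (hu : u ∈ Ioo 0 α) :
    HasDerivAt (fun u => r u ^ 2 * (p u ^ 2 / 2 + (u ^ 4 / 4 - u ^ 2 / 2)))
      (-2 * (u ^ 4 / 4 - u ^ 2 / 2) * (r u / p u)) u := by
  have h1 := ((h.hr u hu).pow 2).mul ((((h.hp u hu).pow 2).div_const 2).add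
    ((((hasDerivAt_id u).pow 4).div_const 4).sub (((hasDerivAt_id u).pow 2).div_const 2)))
  refine h1.congr_deriv ?_
  have := h.r_pos u hu
  have := h.p_pos u hu
  simp
  field_simp
  ring

/-- The generalized Pohozaev function. -/
def poho (r p : ℝ → ℝ) (u : ℝ) : ℝ :=
  r u ^ 2 * (p u ^ 2 / 2 + (u ^ 4 / 4 - u ^ 2 / 2))
    - 2 * (u * (u ^ 2 - 2) / (4 * (u ^ 2 - 1))) * (r u * p u)

lemma hasDerivAt_poho (h : Branch r p α) {u : ℝ} (hu : u ∈ Ioo 0 α) (h1 : u ≠ 1) :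
    HasDerivAt (poho r p)
      (-2 * ((u ^ 4 - u ^ 2 + 2) / (4 * (u ^ 2 - 1) ^ 2)) * (r u * p u)) u := by
  have hne : u ^ 2 - 1 ≠ 0 := by
    intro h0
    have : (u - 1) * (u + 1) = 0 := by linarith
    rcases mul_eq_zero.1 this with h2 | h2
    · exact h1 (by linarith)
    · linarith [hu.1]
  have hH : HasDerivAt (fun u : ℝ => u * (u ^ 2 - 2) / (4 * (u ^ 2 - 1)))
      ((u ^ 4 - u ^ 2 + 2) / (4 * (u ^ 2 - 1) ^ 2)) u := by
    have h2 := ((hasDerivAt_id u).mul (((hasDerivAt_id u).pow 2).sub_const 2)).div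
      ((((hasDerivAt_id u).pow 2).sub_const 1).const_mul 4)
      (by simpa using hne)
    refine h2.congr_deriv ?_
    simp
    field_simp
    ring
  have h3 := (h.hasDerivAt_energy hu).sub ((hH.const_mul 2).mul (h.hasDerivAt_rp hu))
  refine (h3.congr_deriv ?_)
  have := h.r_pos u hu
  have := h.p_pos u hu
  simp
  field_simp
  ring

lemma poho_coeff_pos {u : ℝ} (h0 : 0 < u) (h1 : u ≠ 1) :
    0 < (u ^ 4 - u ^ 2 + 2) / (4 * (u ^ 2 - 1) ^ 2) := by
  have hne : u ^ 2 - 1 ≠ 0 := by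
    intro h0'
    have : (u - 1) * (u + 1) = 0 := by linarith
    rcases mul_eq_zero.1 this with h2 | h2
    · exact h1 (by linarith)
    · linarith
  have : 0 < u ^ 4 - u ^ 2 + 2 := by nlinarith [sq_nonneg (u ^ 2 - 1)]
  positivity

lemma poho_top (h : Branch r p α) : Tendsto (poho r p) (𝓝[<] α) (𝓝 0) := by
  have h0 : Tendsto (fun u : ℝ => u) (𝓝[<] α) (𝓝 α) := tendsto_nhdsWithin_of_tendsto_nhds tendsto_id
  have hne : (4 * (α ^ 2 - 1)) ≠ 0 := by nlinarith [h.one_lt]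
  have h1 := ((h.r_top.pow 2).mul (((h.p_top.pow 2).div_const 2).add
    (((h0.pow 4).div_const 4).sub ((h0.pow 2).div_const 2)))).sub
    (((((h0.mul ((h0.pow 2).sub_const 2)).div (((h0.pow 2).sub_const 1).const_mul 4) hne)).const_mul 2).mul
      (h.r_top.mul h.p_top))
  simp only [ne_eq, OfNat.ofNat_ne_zero, not_false_eq_true, zero_pow, zero_div, zero_mul, mul_zero, sub_zero] at h1
  exact h1

lemma poho_pos (h : Branch r p α) {u : ℝ} (hu : u ∈ Ioo 1 α) : 0 < poho r p u := by
  have h1 := lt_of_tendsto_right_of_deriv_pos (g := fun u => -poho r p u) (a := 1) (b := α)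
    (fun u hu => (h.hasDerivAt_poho ⟨by linarith [hu.1], hu.2⟩ hu.1.ne').neg)
    (fun u hu => by
      have h2 := poho_coeff_pos (u := u) (by linarith [hu.1]) hu.1.ne'
      have h3 := h.r_pos u ⟨by linarith [hu.1], hu.2⟩
      have h4 := h.p_pos u ⟨by linarith [hu.1], hu.2⟩
      have := mul_pos h2 (mul_pos h3 h4)
      linarith)
    h.poho_top.neg hu
  simp at h1; exact h1

lemma tail_lt (hr : Branch r p α) (hs : Branch s q β) {c : ℝ} (hc1 : c ≤ 1)
    (hlt : ∀ u ∈ Ioc 0 c, s u < r u) : ∀ u ∈ Ioc 0 c, p u < q u := by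
  intro v hv
  by_contra! hcon
  have hd : ∀ u ∈ Ioc 0 c, HasDerivAt (fun u => p u - q u)
      ((1 / r u - (u ^ 3 - u) / p u) - (1 / s u - (u ^ 3 - u) / q u)) u := fun u hu =>
    (hr.hp u ⟨hu.1, (hu.2.trans hc1).trans_lt hr.one_lt⟩).sub
      (hs.hp u ⟨hu.1, (hu.2.trans hc1).trans_lt hs.one_lt⟩)
  have hn : ∀ u ∈ Ioc 0 c, 0 ≤ p u - q u →
      ((1 / r u - (u ^ 3 - u) / p u) - (1 / s u - (u ^ 3 - u) / q u)) < 0 := by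
    intro u hu hpq
    have hur : u ∈ Ioo 0 α := ⟨hu.1, (hu.2.trans hc1).trans_lt hr.one_lt⟩
    have hus : u ∈ Ioo 0 β := ⟨hu.1, (hu.2.trans hc1).trans_lt hs.one_lt⟩
    have h1 : 1 / r u < 1 / s u := one_div_lt_one_div_of_lt (hs.r_pos u hus) (hlt u hu)
    have hf : 0 ≤ u - u ^ 3 := by
      have h5 : u ^ 3 ≤ u := by
        calc u ^ 3 ≤ u ^ 1 := pow_le_pow_of_le_one hu.1.le (hu.2.trans hc1) (by norm_num)
          _ = u := pow_one u
      linarith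
    have h2 : (u - u ^ 3) / p u ≤ (u - u ^ 3) / q u :=
      div_le_div_of_nonneg_left hf (hs.p_pos u hus) (by linarith)
    have e1 : (u ^ 3 - u) / p u = -((u - u ^ 3) / p u) := by ring
    have e2 : (u ^ 3 - u) / q u = -((u - u ^ 3) / q u) := by ring
    rw [e1, e2]; linarith
  have h1 := fun {u v : ℝ} => lt_of_deriv_neg_where_nonneg (u := u) (v := v) hd hn
  have hv2 : v / 2 ∈ Ioc 0 c := ⟨by linarith [hv.1], by linarith [hv.1, hv.2]⟩
  have h2 := h1 hv (by linarith) hv2.1 (by linarith [hv.1])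
  have h3 : Tendsto (fun u => p u - q u) (𝓝[>] 0) (𝓝 0) := by simpa using hr.p_zero.sub hs.p_zero
  have h4 : p (v / 2) - q (v / 2) ≤ 0 := by
    refine ge_of_tendsto h3 ?_
    filter_upwards [Ioo_mem_nhdsGT hv2.1] with u hu
    exact (h1 hv2 (by linarith) hu.1 hu.2).le
  linarith

lemma tail_lt_r (hr : Branch r p α) (hs : Branch s q β) {u₀ : ℝ} (hu0 : 0 < u₀)
    (hlt : ∀ u ∈ Ioo 0 u₀, s u < r u) : ∀ u ∈ Ioc (0 : ℝ) 1, s u < r u := by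
  by_contra! hcon
  obtain ⟨v, hv, hvle⟩ := hcon
  have hmr : ∀ u ∈ Ioc (0 : ℝ) 1, u ∈ Ioo 0 α := fun u hu => ⟨hu.1, hu.2.trans_lt hr.one_lt⟩
  have hms : ∀ u ∈ Ioc (0 : ℝ) 1, u ∈ Ioo 0 β := fun u hu => ⟨hu.1, hu.2.trans_lt hs.one_lt⟩
  have hvu : u₀ ≤ v := by
    by_contra! h
    linarith [hlt v ⟨hv.1, h⟩]
  have hsub : ∀ u ∈ Icc u₀ v, u ∈ Ioc (0 : ℝ) 1 := fun u hu =>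
    ⟨hu0.trans_le hu.1, hu.2.trans hv.2⟩
  let Z := Icc u₀ v ∩ {u | r u - s u ≤ 0}
  have hcont : ContinuousOn (fun u => r u - s u) (Icc u₀ v) := fun u hu =>
    ((hr.cont_r (hmr u (hsub u hu))).sub (hs.cont_r (hms u (hsub u hu)))).continuousWithinAt
  have hZ : IsClosed Z := hcont.preimage_isClosed_of_isClosed isClosed_Icc isClosed_Iic
  have hZne : Z.Nonempty := ⟨v, ⟨hvu, le_rfl⟩, by simp; linarith⟩
  have hZb : BddBelow Z := ⟨u₀, fun u hu => hu.1.1⟩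
  have hcZ : sInf Z ∈ Z := hZ.csInf_mem hZne hZb
  set c := sInf Z with hc
  have hcI := hsub c hcZ.1
  have hbelow : ∀ u ∈ Ioo 0 c, s u < r u := by
    intro u hu
    by_contra! h
    by_cases h2 : u < u₀
    · linarith [hlt u ⟨hu.1, h2⟩]
    · have : u ∈ Z := ⟨⟨not_lt.1 h2, hu.2.le.trans hcZ.1.2⟩, by simp; linarith⟩
      linarith [csInf_le hZb this, hu.2]
  have hpq : ∀ u ∈ Ioo 0 c, p u < q u := fun u hu =>
    tail_lt hr hs (hu.2.le.trans hcI.2)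
      (fun x hx => hbelow x ⟨hx.1, hx.2.trans_lt hu.2⟩) u ⟨hu.1, le_rfl⟩
  have hnb : (𝓝[<] c).NeBot := inferInstance
  have hIoo : Ioo 0 c ∈ 𝓝[<] c := Ioo_mem_nhdsLT hcI.1
  have hr1 : s c = r c := by
    apply le_antisymm
    · refine le_of_tendsto_of_tendsto
        ((hs.cont_r (hms c hcI)).tendsto.mono_left nhdsWithin_le_nhds)
        ((hr.cont_r (hmr c hcI)).tendsto.mono_left nhdsWithin_le_nhds)
        (show ∀ᶠ u in 𝓝[<] c, s u ≤ r u from ?_)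
      filter_upwards [hIoo] with u hu using (hbelow u hu).le
    · have := hcZ.2; simp at this; linarith
  have hp1 : p c ≤ q c := by
    refine le_of_tendsto_of_tendsto
        ((hr.cont_p (hmr c hcI)).tendsto.mono_left nhdsWithin_le_nhds)
        ((hs.cont_p (hms c hcI)).tendsto.mono_left nhdsWithin_le_nhds)
        (show ∀ᶠ u in 𝓝[<] c, p u ≤ q u from ?_)
    filter_upwards [hIoo] with u hu using (hpq u hu).le
  -- the difference of the Pohozaev functions
  have hdD := fun u (hu : u ∈ Ioc (0:ℝ) 1) =>
    (hr.hasDerivAt_energy (hmr u hu)).sub (hs.hasDerivAt_energy (hms u hu))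
  have hmem : ∀ u ∈ Ioo 0 c, u ∈ Ioc (0:ℝ) 1 := fun u hu => ⟨hu.1, hu.2.le.trans hcI.2⟩
  have hpos : ∀ u ∈ Ioo 0 c, 0 < -2 * (u ^ 4 / 4 - u ^ 2 / 2) * (r u / p u)
      - -2 * (u ^ 4 / 4 - u ^ 2 / 2) * (s u / q u) := by
    intro u hu
    have h1 := hs.r_pos u (hms u (hmem u hu))
    have h2 := hr.p_pos u (hmr u (hmem u hu))
    have h3 : s u / q u < r u / p u := by
      have hq := hs.p_pos u (hms u (hmem u hu))
      rw [div_lt_div_iff₀ hq h2]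
      nlinarith [hbelow u hu, hpq u hu]
    have hF : 0 < -2 * (u ^ 4 / 4 - u ^ 2 / 2) := by
      have hu1 : u < 1 := hu.2.trans_le hcI.2
      have : u ^ 4 < u ^ 2 := by
        have := pow_pos hu.1 2
        have : u ^ 2 < 1 := by nlinarith [hu.1]
        nlinarith
      nlinarith [pow_pos hu.1 2]
    nlinarith [mul_pos hF (sub_pos.2 h3)]
  have hDlim := hr.energy_zero.sub hs.energy_zero
  rw [sub_zero] at hDlim
  have hD2 := (hdD c hcI).continuousAt.tendsto.mono_left (nhdsWithin_le_nhds (s := Iio c))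
  have hc2 : c / 2 ∈ Ioo 0 c := ⟨by linarith [hcI.1], by linarith [hcI.1]⟩
  have h5 := lt_of_tendsto_left_of_deriv_pos (fun u hu => hdD u (hmem u hu)) hpos hDlim hc2
  have h6 := lt_of_tendsto_right_of_deriv_pos (fun u hu => hdD u (hmem u hu)) hpos hD2 hc2
  have h7 := h5.trans h6
  simp only [Pi.sub_apply] at h7
  rw [hr1] at h7
  have h8 : p c ^ 2 ≤ q c ^ 2 := pow_le_pow_left₀ (hr.p_pos c (hmr c hcI)).le hp1 2
  nlinarith [sq_nonneg (r c)]

lemma hasDerivAt_ratio (hr : Branch r p α) (hs : Branch s q β) {u : ℝ}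
    (h1 : u ∈ Ioo 0 α) (h2 : u ∈ Ioo 0 β) :
    HasDerivAt (fun u => (r u * p u) / (s u * q u))
      (-(u ^ 3 - u) * (1 / p u ^ 2 - 1 / q u ^ 2) * ((r u * p u) / (s u * q u))) u := by
  have a1 := hr.r_pos u h1
  have a2 := hr.p_pos u h1
  have a3 := hs.r_pos u h2
  have a4 := hs.p_pos u h2
  refine ((hr.hasDerivAt_rp h1).div (hs.hasDerivAt_rp h2) (mul_pos a3 a4).ne').congr_deriv ?_
  field_simp
  ring

lemma top_lt (hr : Branch r p α) (hs : Branch s q β) (hαβ : α < β) :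
    ∀ u ∈ Ioo 1 α, p u < q u := by
  by_contra! hcon
  obtain ⟨v, hv, hvle⟩ := hcon
  have hmr : ∀ u ∈ Ioo 1 α, u ∈ Ioo 0 α := fun u hu => ⟨by linarith [hu.1], hu.2⟩
  have hms : ∀ u ∈ Ioo 1 α, u ∈ Ioo 0 β := fun u hu => ⟨by linarith [hu.1], hu.2.trans hαβ⟩
  have hαs : α ∈ Ioo 0 β := ⟨by linarith [hr.one_lt], hαβ⟩
  have hnear : ∀ᶠ u in 𝓝[<] α, p u < q u :=
    hr.p_top.eventually_lt ((hs.cont_p hαs).tendsto.mono_left nhdsWithin_le_nhds)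
      (hs.p_pos α hαs)
  obtain ⟨w, hw, hwlt⟩ := (mem_nhdsLT_iff_exists_Ioo_subset' (hr.one_lt)).1 hnear
  let w' := (max v w + α) / 2
  have hmax : max v w < α := max_lt hv.2 hw
  have hw'1 : max v w < w' := by simp only [w']; linarith
  have hw'2 : w' < α := by simp only [w']; linarith
  have hvw' : v ≤ w' := (le_max_left _ _).trans hw'1.le
  have hsub : ∀ u ∈ Icc v w', u ∈ Ioo 1 α := fun u hu =>
    ⟨hv.1.trans_le hu.1, hu.2.trans_lt hw'2⟩
  let Z := Icc v w' ∩ {u | q u - p u ≤ 0}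
  have hcont : ContinuousOn (fun u => q u - p u) (Icc v w') := fun u hu =>
    ((hs.cont_p (hms u (hsub u hu))).sub (hr.cont_p (hmr u (hsub u hu)))).continuousWithinAt
  have hZ : IsClosed Z := hcont.preimage_isClosed_of_isClosed isClosed_Icc isClosed_Iic
  have hZne : Z.Nonempty := ⟨v, ⟨le_rfl, hvw'⟩, by simp; linarith⟩
  have hZb : BddAbove Z := ⟨w', fun u hu => hu.1.2⟩
  have hcZ : sSup Z ∈ Z := hZ.csSup_mem hZne hZb
  set c := sSup Z with hc
  have hcI := hsub c hcZ.1
  have habove : ∀ u ∈ Ioo c α, p u < q u := by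
    intro u hu
    by_contra! h
    by_cases h2 : u ≤ w'
    · have : u ∈ Z := ⟨⟨hcZ.1.1.trans hu.1.le, h2⟩, by simp; linarith⟩
      linarith [le_csSup hZb this, hu.1]
    · have : p u < q u := hwlt ⟨(le_max_right _ _).trans_lt (hw'1.trans (not_le.1 h2)), hu.2⟩
      linarith
  have hIoo : Ioo c α ∈ 𝓝[>] c := Ioo_mem_nhdsGT hcI.2
  have hp1 : p c = q c := by
    apply le_antisymm
    · refine le_of_tendsto_of_tendsto
        ((hr.cont_p (hmr c hcI)).tendsto.mono_left nhdsWithin_le_nhds)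
        ((hs.cont_p (hms c hcI)).tendsto.mono_left nhdsWithin_le_nhds)
        (show ∀ᶠ u in 𝓝[>] c, p u ≤ q u from ?_)
      filter_upwards [hIoo] with u hu using (habove u hu).le
    · have := hcZ.2; simp at this; linarith
  have a1 := hr.r_pos c (hmr c hcI)
  have a2 := hr.p_pos c (hmr c hcI)
  have a3 := hs.r_pos c (hms c hcI)
  have hmem : ∀ u ∈ Ioo c α, u ∈ Ioo 1 α := fun u hu => ⟨hcI.1.trans hu.1, hu.2⟩
  rcases lt_or_ge (r c) (s c) with hlt | hge
  · -- the difference of the slopes becomes positive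
    have hd := (hr.hp c (hmr c hcI)).sub (hs.hp c (hms c hcI))
    have hdpos : 0 < (1 / r c - (c ^ 3 - c) / p c) - (1 / s c - (c ^ 3 - c) / q c) := by
      rw [hp1]
      have := one_div_lt_one_div_of_lt a1 hlt
      linarith
    have h1 := hd.hasDerivWithinAt (s := Ioi c)
    have h2 := hasDerivWithinAt_iff_tendsto_slope.1 h1
    have : Ioi c \ {c} = Ioi c := by ext; simp
    rw [this] at h2
    obtain ⟨x, hx1, hx2⟩ := ((h2.eventually_const_lt hdpos).and hIoo).exists
    rw [slope_def_field] at hx1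
    simp only [Pi.sub_apply, hp1, sub_self, sub_zero] at hx1
    have := habove x hx2
    have : (p x - q x) / (x - c) ≤ 0 :=
      div_nonpos_of_nonpos_of_nonneg (by linarith) (by linarith [hx2.1])
    linarith
  · set μ := r c / s c with hμ
    have hμpos : 0 < μ := div_pos a1 a3
    have hω : ∀ u ∈ Ioo c α, r u * p u < μ * (s u * q u) := by
      intro u hu
      have h1 := lt_of_tendsto_left_of_deriv_pos (a := c) (b := α)
        (g := fun u => -((r u * p u) / (s u * q u)))
        (fun u hu => (hasDerivAt_ratio hr hs (hmr u (hmem u hu)) (hms u (hmem u hu))).neg)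
        (fun u hu => by
          have b1 := hr.r_pos u (hmr u (hmem u hu))
          have b2 := hr.p_pos u (hmr u (hmem u hu))
          have b3 := hs.r_pos u (hms u (hmem u hu))
          have b4 := hs.p_pos u (hms u (hmem u hu))
          have b5 : 0 < u ^ 3 - u := by
            have := (hmem u hu).1
            nlinarith [mul_pos (mul_pos (show 0 < u by linarith) (show 0 < u - 1 by linarith)) (show 0 < u + 1 by linarith)]
          have b6 : 1 / q u ^ 2 < 1 / p u ^ 2 :=
            one_div_lt_one_div_of_lt (by positivity)
              (pow_lt_pow_left₀ (habove u hu) b2.le (by norm_num))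
          have := mul_pos (mul_pos b5 (sub_pos.2 b6)) (show 0 < (r u * p u) / (s u * q u) by positivity)
          linarith)
        ((hasDerivAt_ratio hr hs (hmr c hcI) (hms c hcI)).continuousAt.tendsto.neg.mono_left
          nhdsWithin_le_nhds) hu
      have b3 := hs.r_pos u (hms u (hmem u hu))
      have b4 := hs.p_pos u (hms u (hmem u hu))
      have h2 : (r u * p u) / (s u * q u) < μ := by
        have : r c * p c / (s c * q c) = μ := by rw [hμ, hp1]; rw [hp1] at a2; field_simp
        rw [this] at h1; linarith
      rwa [div_lt_iff₀ (by positivity)] at h2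
    have hcont1 : ContinuousAt (fun u => poho r p u - μ * poho s q u) c :=
      ((hr.hasDerivAt_poho (hmr c hcI) hcI.1.ne').sub
        ((hs.hasDerivAt_poho (hms c hcI) hcI.1.ne').const_mul μ)).continuousAt
    have hα1 : ContinuousAt (poho s q) α :=
      (hs.hasDerivAt_poho hαs hr.one_lt.ne').continuousAt
    have hd := fun u (hu : u ∈ Ioo c α) =>
      (hr.hasDerivAt_poho (hmr u (hmem u hu)) (hmem u hu).1.ne').sub
        ((hs.hasDerivAt_poho (hms u (hmem u hu)) (hmem u hu).1.ne').const_mul μ)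
    have hpos : ∀ u ∈ Ioo c α, 0 <
        -2 * ((u ^ 4 - u ^ 2 + 2) / (4 * (u ^ 2 - 1) ^ 2)) * (r u * p u)
        - μ * (-2 * ((u ^ 4 - u ^ 2 + 2) / (4 * (u ^ 2 - 1) ^ 2)) * (s u * q u)) := by
      intro u hu
      have h1 := poho_coeff_pos (u := u) (hmr u (hmem u hu)).1 (hmem u hu).1.ne'
      nlinarith [mul_pos h1 (sub_pos.2 (hω u hu))]
    have hmid : (c + α) / 2 ∈ Ioo c α := ⟨by linarith [hcI.2], by linarith [hcI.2]⟩
    have h5 := lt_of_tendsto_left_of_deriv_pos hd hpos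
      (hcont1.tendsto.mono_left nhdsWithin_le_nhds) hmid
    have h6 := lt_of_tendsto_right_of_deriv_pos hd hpos
      (hr.poho_top.sub ((hα1.tendsto.const_mul μ).mono_left nhdsWithin_le_nhds)) hmid
    have h7 := h5.trans h6
    have h8 := hs.poho_pos (u := α) ⟨hr.one_lt, hαβ⟩
    have h9 : poho r p c - μ * poho s q c < 0 := by
      have := mul_pos hμpos h8
      linarith
    have h10 : poho r p c - μ * poho s q c =
        r c * (r c - s c) * (p c ^ 2 / 2 + (c ^ 4 / 4 - c ^ 2 / 2)) := by
      simp only [poho, hμ, ← hp1]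
      generalize c * (c ^ 2 - 2) / (4 * (c ^ 2 - 1)) = H
      field_simp
      ring
    rw [h10] at h9
    have := mul_nonneg (mul_nonneg a1.le (sub_nonneg.2 hge)) (hr.energy c (hmr c hcI)).le
    linarith

lemma false_of_lt (hr : Branch r p α) (hs : Branch s q β) (hαβ : α < β)
    (h1 : ∀ u ∈ Ioc (0 : ℝ) 1, p u < q u) : False := by
  have h2 := top_lt hr hs hαβ
  have hαs : α ∈ Ioo 0 β := ⟨by linarith [hr.one_lt], hαβ⟩
  have hms : ∀ u ∈ Ioo 0 α, u ∈ Ioo 0 β := fun u hu => ⟨hu.1, hu.2.trans hαβ⟩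
  have hpq : ∀ u ∈ Ioo 0 α, p u < q u := fun u hu => by
    rcases le_or_gt u 1 with h | h
    · exact h1 u ⟨hu.1, h⟩
    · exact h2 u ⟨h, hu.2⟩
  have h1r : (1 : ℝ) ∈ Ioo 0 α := ⟨one_pos, hr.one_lt⟩
  have h1s := hms 1 h1r
  set ω := fun u => (r u * p u) / (s u * q u) with hωdef
  set μ := ω 1 with hμ
  have hωpos : ∀ u ∈ Ioo 0 α, 0 < ω u := fun u hu => by
    have b1 := hr.r_pos u hu
    have b2 := hr.p_pos u hu
    have b3 := hs.r_pos u (hms u hu)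
    have b4 := hs.p_pos u (hms u hu)
    simp only [hωdef]; positivity
  have hμpos : 0 < μ := hωpos 1 h1r
  have hωd := fun u (hu : u ∈ Ioo 0 α) => hasDerivAt_ratio hr hs hu (hms u hu)
  have hinv : ∀ u ∈ Ioo 0 α, 0 < 1 / p u ^ 2 - 1 / q u ^ 2 := fun u hu => by
    have b2 := hr.p_pos u hu
    have := one_div_lt_one_div_of_lt (by positivity)
      (pow_lt_pow_left₀ (hpq u hu) b2.le (show 2 ≠ 0 by norm_num))
    linarith
  have hω1 : ContinuousAt ω 1 := (hωd 1 h1r).continuousAt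
  have hωlt : ∀ u ∈ Ioo 0 α, u ≠ 1 → r u * p u < μ * (s u * q u) := by
    intro u hu hne
    have b3 := hs.r_pos u (hms u hu)
    have b4 := hs.p_pos u (hms u hu)
    rw [← div_lt_iff₀ (by positivity)]
    rcases lt_or_gt_of_ne hne with h | h
    · refine lt_of_tendsto_right_of_deriv_pos (a := 0) (b := 1)
        (fun u hu => hωd u ⟨hu.1, hu.2.trans hr.one_lt⟩) (fun u hu => ?_)
        (hω1.tendsto.mono_left nhdsWithin_le_nhds) ⟨hu.1, h⟩
      have hu' : u ∈ Ioo 0 α := ⟨hu.1, hu.2.trans hr.one_lt⟩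
      have b5 : 0 < -(u ^ 3 - u) := by
        nlinarith [mul_pos (mul_pos hu.1 (sub_pos.2 hu.2)) (show 0 < u + 1 by linarith [hu.1])]
      exact mul_pos (mul_pos b5 (hinv u hu')) (hωpos u hu')
    · have := lt_of_tendsto_left_of_deriv_pos (a := 1) (b := α)
        (fun u hu => (hωd u ⟨by linarith [hu.1], hu.2⟩).neg) (fun u hu => ?_)
        (hω1.tendsto.neg.mono_left nhdsWithin_le_nhds) ⟨h, hu.2⟩
      · simp only [Pi.neg_apply] at this; linarith
      · have hu' : u ∈ Ioo 0 α := ⟨by linarith [hu.1], hu.2⟩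
        have b5 : 0 < (u ^ 3 - u) := by
          nlinarith [mul_pos (mul_pos hu'.1 (sub_pos.2 hu.1)) (show 0 < u + 1 by linarith [hu.1])]
        have := mul_pos (mul_pos b5 (hinv u hu')) (hωpos u hu')
        simp only [hωdef] at this
        linarith
  set Ψ := fun u => poho r p u - μ * poho s q u with hΨ
  have hΨd : ∀ u ∈ Ioo 0 α, u ≠ 1 → HasDerivAt Ψ _ u := fun u hu hne =>
    (hr.hasDerivAt_poho hu hne).sub ((hs.hasDerivAt_poho (hms u hu) hne).const_mul μ)
  have hΨpos : ∀ u ∈ Ioo 0 α, u ≠ 1 → 0 <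
      -2 * ((u ^ 4 - u ^ 2 + 2) / (4 * (u ^ 2 - 1) ^ 2)) * (r u * p u)
        - μ * (-2 * ((u ^ 4 - u ^ 2 + 2) / (4 * (u ^ 2 - 1) ^ 2)) * (s u * q u)) := by
    intro u hu hne
    have h1 := poho_coeff_pos hu.1 hne
    nlinarith [mul_pos h1 (sub_pos.2 (hωlt u hu hne))]
  -- behaviour at the removable singularity
  have hEd := (hr.hasDerivAt_energy h1r).sub ((hs.hasDerivAt_energy h1s).const_mul μ)
  have hTd := (hr.hasDerivAt_rp h1r).sub ((hs.hasDerivAt_rp h1s).const_mul μ)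
  have hT1 : r 1 * p 1 - μ * (s 1 * q 1) = 0 := by
    have b3 := hs.r_pos 1 h1s
    have b4 := hs.p_pos 1 h1s
    simp only [hμ, hωdef]; field_simp; ring
  set ℓ := r 1 ^ 2 * (p 1 ^ 2 / 2 + (1 ^ 4 / 4 - 1 ^ 2 / 2))
    - μ * (s 1 ^ 2 * (q 1 ^ 2 / 2 + (1 ^ 4 / 4 - 1 ^ 2 / 2))) with hℓ
  have hΨ1 : Tendsto Ψ (𝓝[≠] 1) (𝓝 ℓ) := by
    have hsl := hasDerivAt_iff_tendsto_slope.1 hTd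
    have h0 : -((1 : ℝ) ^ 3 - 1) * (r 1 / p 1) - μ * (-(1 ^ 3 - 1) * (s 1 / q 1)) = 0 := by
      norm_num
    rw [h0] at hsl
    have hk : Tendsto (fun u : ℝ => 2 * (u * (u ^ 2 - 2) / (4 * (u + 1)))) (𝓝[≠] 1)
        (𝓝 (2 * (1 * (1 ^ 2 - 2) / (4 * (1 + 1))))) := by
      have : ContinuousAt (fun u : ℝ => 2 * (u * (u ^ 2 - 2) / (4 * (u + 1)))) 1 := by
        apply ContinuousAt.mul continuousAt_const
        apply ContinuousAt.div (by fun_prop) (by fun_prop) (by norm_num)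
      exact this.tendsto.mono_left nhdsWithin_le_nhds
    have h3 := (hEd.continuousAt.tendsto.mono_left (nhdsWithin_le_nhds (s := {1}ᶜ))).sub (hk.mul hsl)
    rw [mul_zero, sub_zero] at h3
    refine h3.congr' ?_
    have hgt : ∀ᶠ u : ℝ in 𝓝[≠] 1, 0 < u :=
      nhdsWithin_le_nhds (lt_mem_nhds one_pos)
    filter_upwards [self_mem_nhdsWithin, hgt] with u hu hu0
    have hu1 : u - 1 ≠ 0 := sub_ne_zero.2 hu
    have hu2 : u + 1 ≠ 0 := by linarith
    have hu3 : u ^ 2 - 1 ≠ 0 := by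
      have : u ^ 2 - 1 = (u - 1) * (u + 1) := by ring
      rw [this]; exact mul_ne_zero hu1 hu2
    rw [slope_def_field]
    simp only [Pi.sub_apply, hT1, hΨ, poho, sub_zero]
    have e : u * (u ^ 2 - 2) / (4 * (u ^ 2 - 1)) = u * (u ^ 2 - 2) / (4 * (u + 1)) / (u - 1) := by
      rw [show u ^ 2 - 1 = (u + 1) * (u - 1) by ring]; field_simp
    rw [e]
    field_simp
    ring
  have hlim0 : Tendsto Ψ (𝓝[>] 0) (𝓝 0) := by
    have h0 : Tendsto (fun u : ℝ => 2 * (u * (u ^ 2 - 2) / (4 * (u ^ 2 - 1)))) (𝓝[>] 0) (𝓝 0) := by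
      have : ContinuousAt (fun u : ℝ => 2 * (u * (u ^ 2 - 2) / (4 * (u ^ 2 - 1)))) 0 := by
        apply ContinuousAt.mul continuousAt_const
        apply ContinuousAt.div (by fun_prop) (by fun_prop) (by norm_num)
      have h2 := this.tendsto
      simp only [zero_mul, zero_div, mul_zero] at h2
      exact h2.mono_left nhdsWithin_le_nhds
    have h3 := (hr.energy_zero.sub (h0.mul hr.rp_zero)).sub
      ((hs.energy_zero.sub (h0.mul hs.rp_zero)).const_mul μ)
    simp only [mul_zero, sub_zero] at h3
    exact h3
  have hhalf : (1 / 2 : ℝ) ∈ Ioo (0 : ℝ) 1 := by constructor <;> norm_num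
  have hd01 := fun u (hu : u ∈ Ioo (0:ℝ) 1) => hΨd u ⟨hu.1, hu.2.trans hr.one_lt⟩ hu.2.ne
  have hp01 := fun u (hu : u ∈ Ioo (0:ℝ) 1) => hΨpos u ⟨hu.1, hu.2.trans hr.one_lt⟩ hu.2.ne
  have hd1α := fun u (hu : u ∈ Ioo 1 α) => hΨd u ⟨by linarith [hu.1], hu.2⟩ hu.1.ne'
  have hp1α := fun u (hu : u ∈ Ioo 1 α) => hΨpos u ⟨by linarith [hu.1], hu.2⟩ hu.1.ne'
  have e1 := lt_of_tendsto_left_of_deriv_pos hd01 hp01 hlim0 hhalf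
  have e2 := lt_of_tendsto_right_of_deriv_pos hd01 hp01
    (hΨ1.mono_left (nhdsWithin_mono _ fun x hx => (ne_of_lt hx : x ≠ 1))) hhalf
  have hmid : (1 + α) / 2 ∈ Ioo 1 α := ⟨by linarith [hr.one_lt], by linarith [hr.one_lt]⟩
  have e3 := lt_of_tendsto_left_of_deriv_pos hd1α hp1α
    (hΨ1.mono_left (nhdsWithin_mono _ fun x hx => (ne_of_gt hx : x ≠ 1))) hmid
  have hα1 : ContinuousAt (poho s q) α :=
    (hs.hasDerivAt_poho hαs hr.one_lt.ne').continuousAt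
  have e4 := lt_of_tendsto_right_of_deriv_pos hd1α hp1α
    (hr.poho_top.sub ((hα1.tendsto.const_mul μ).mono_left nhdsWithin_le_nhds)) hmid
  have e5 := mul_pos hμpos (hs.poho_pos (u := α) ⟨hr.one_lt, hαβ⟩)
  linarith

/-- Two branches that do not cross near `0` have the same top value. -/
theorem top_eq (hr : Branch r p α) (hs : Branch s q β) {u₀ : ℝ} (hu0 : 0 < u₀)
    (hlt : ∀ u ∈ Ioo 0 u₀, s u < r u) : α = β := by
  have h1 := tail_lt_r hr hs hu0 hlt
  have h2 := tail_lt hr hs le_rfl h1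
  rcases lt_trichotomy α β with h | h | h
  · exact (false_of_lt hr hs h h2).elim
  · exact h
  · have h3 := top_lt hs hr h
    have h1r : (1 : ℝ) ∈ Ioo 0 α := ⟨one_pos, hr.one_lt⟩
    have h1s : (1 : ℝ) ∈ Ioo 0 β := ⟨one_pos, hs.one_lt⟩
    have h4 : q 1 ≤ p 1 := by
      refine le_of_tendsto_of_tendsto
        ((hs.cont_p h1s).tendsto.mono_left nhdsWithin_le_nhds)
        ((hr.cont_p h1r).tendsto.mono_left nhdsWithin_le_nhds)
        (show ∀ᶠ u in 𝓝[>] 1, q u ≤ p u from ?_)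
      filter_upwards [Ioo_mem_nhdsGT hs.one_lt] with u hu using (h3 u hu).le
    linarith [h2 1 ⟨one_pos, le_rfl⟩]

end Branch

lemma antitoneOn_Ioi_of_hasDerivAt_nonpos {g g' : ℝ → ℝ} {a : ℝ}
    (hg : ∀ t, a < t → HasDerivAt g (g' t) t) (h : ∀ t, a < t → g' t ≤ 0) :
    AntitoneOn g (Ioi a) := by
  apply antitoneOn_of_deriv_nonpos (convex_Ioi a)
  · exact fun u hu => (hg u hu).continuousAt.continuousWithinAt
  · intro u hu
    rw [interior_Ioi] at hu
    exact (hg u hu).differentiableAt.differentiableWithinAt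
  · intro u hu
    rw [interior_Ioi] at hu
    rw [(hg u hu).deriv]; exact h u hu

lemma monotoneOn_Ioi_of_hasDerivAt_nonneg {g g' : ℝ → ℝ} {a : ℝ}
    (hg : ∀ t, a < t → HasDerivAt g (g' t) t) (h : ∀ t, a < t → 0 ≤ g' t) :
    MonotoneOn g (Ioi a) := by
  have := antitoneOn_Ioi_of_hasDerivAt_nonpos (g := fun t => -g t) (fun t ht => (hg t ht).neg)
    (fun t ht => by linarith [h t ht])
  intro x hx y hy hxy
  simpa using this hx hy hxy

/-- If a function tends to zero at infinity and its derivative converges, the limit is zero. -/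
lemma eq_zero_of_tendsto_zero_of_hasDerivAt {g g' : ℝ → ℝ} {a L : ℝ}
    (hg : ∀ t, a < t → HasDerivAt g (g' t) t) (h0 : Tendsto g atTop (𝓝 0))
    (hL : Tendsto g' atTop (𝓝 L)) : L = 0 := by
  have hex : ∀ t : ℝ, ∃ ξ, a < t → (t < ξ ∧ g' ξ = g (t + 1) - g t) := by
    intro t
    by_cases ht : a < t
    · obtain ⟨ξ, hξ, h⟩ := exists_hasDerivAt_eq_slope g g' (show t < t + 1 by linarith)
        (fun x hx => (hg x (ht.trans_le hx.1)).continuousAt.continuousWithinAt)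
        (fun x hx => hg x (ht.trans hx.1))
      exact ⟨ξ, fun _ => ⟨hξ.1, by rw [h]; simp⟩⟩
    · exact ⟨0, fun h => absurd h ht⟩
  choose ξ hξ using hex
  have h1 : Tendsto ξ atTop atTop := by
    refine tendsto_atTop_mono' _ ?_ tendsto_id
    filter_upwards [eventually_gt_atTop a] with t ht using (hξ t ht).1.le
  have h2 := hL.comp h1
  have h3 : Tendsto (fun t => g (t + 1) - g t) atTop (𝓝 (0 - 0)) :=
    (h0.comp (tendsto_atTop_add_const_right _ 1 tendsto_id)).sub h0
  have h4 : Tendsto (g' ∘ ξ) atTop (𝓝 (0 - 0)) := by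
    refine h3.congr' ?_
    filter_upwards [eventually_gt_atTop a] with t ht using (hξ t ht).2.symm
  simpa using tendsto_nhds_unique h2 h4

/-- A positive radial profile `y`, with derivative `z`, of `-Δu + u - u³ = 0` in the plane, as a
function of the radius. -/
structure RadialSol (y z : ℝ → ℝ) (α : ℝ) : Prop where
  hy : ∀ t, 0 < t → HasDerivAt y (z t) t
  hz : ∀ t, 0 < t → HasDerivAt z (-(z t) / t + y t - y t ^ 3) t
  pos : ∀ t, 0 < t → 0 < y t
  z_zero : Tendsto z (𝓝[>] 0) (𝓝 0)
  y_zero : Tendsto y (𝓝[>] 0) (𝓝 α)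
  int : IntegrableOn (fun t => t * y t ^ 2) (Ioi 0)

namespace RadialSol

variable {y z : ℝ → ℝ} {α : ℝ}

lemma hasDerivAt_energy (h : RadialSol y z α) (t : ℝ) (ht : 0 < t) :
    HasDerivAt (fun t => z t ^ 2 / 2 + (y t ^ 4 / 4 - y t ^ 2 / 2)) (-(z t ^ 2) / t) t := by
  refine ((((h.hz t ht).pow 2).div_const 2).add ((((h.hy t ht).pow 4).div_const 4).sub
    (((h.hy t ht).pow 2).div_const 2))).congr_deriv ?_
  field_simp
  ring

lemma hasDerivAt_mul (h : RadialSol y z α) (t : ℝ) (ht : 0 < t) :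
    HasDerivAt (fun t => t * z t) (t * (y t - y t ^ 3)) t := by
  refine ((hasDerivAt_id t).mul (h.hz t ht)).congr_deriv ?_
  simp only [id]
  field_simp
  ring

lemma energy_antitone (h : RadialSol y z α) :
    AntitoneOn (fun t => z t ^ 2 / 2 + (y t ^ 4 / 4 - y t ^ 2 / 2)) (Ioi 0) :=
  antitoneOn_Ioi_of_hasDerivAt_nonpos h.hasDerivAt_energy fun t ht => by
    rw [neg_div]; have := div_nonneg (sq_nonneg (z t)) ht.le; linarith

lemma cont_y (h : RadialSol y z α) : ContinuousOn y (Ioi 0) :=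
  fun t ht => (h.hy t ht).continuousAt.continuousWithinAt

lemma cont_z (h : RadialSol y z α) : ContinuousOn z (Ioi 0) :=
  fun t ht => (h.hz t ht).continuousAt.continuousWithinAt

lemma integrable_sq (h : RadialSol y z α) : IntegrableOn (fun t => y t ^ 2) (Ioi 1) := by
  have h1 : IntegrableOn (fun t => t * y t ^ 2) (Ioi 1) :=
    h.int.mono_set (Ioi_subset_Ioi zero_le_one)
  refine Integrable.mono' h1 ?_ ?_
  · exact ((h.cont_y.mono (Ioi_subset_Ioi zero_le_one)).pow 2).aestronglyMeasurable
      measurableSet_Ioi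
  · refine (ae_restrict_iff' measurableSet_Ioi).2 (ae_of_all _ fun t ht => ?_)
    rw [Real.norm_of_nonneg (sq_nonneg _)]
    have : (1 : ℝ) < t := ht
    nlinarith [sq_nonneg (y t)]

lemma bounds (h : RadialSol y z α) : ∃ M, 0 < M ∧ ∀ t, 1 < t → y t ≤ M ∧ |z t| ≤ M := by
  let E := z 1 ^ 2 / 2 + (y 1 ^ 4 / 4 - y 1 ^ 2 / 2)
  have hE : ∀ t, 1 < t → z t ^ 2 / 2 + (y t ^ 4 / 4 - y t ^ 2 / 2) ≤ E := fun t ht =>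
    h.energy_antitone (show (1:ℝ) ∈ Ioi 0 by simp) (show (0:ℝ) < t by linarith) ht.le
  refine ⟨4 * |E| + 4, by positivity, fun t ht => ?_⟩
  have h1 := hE t ht
  have hp := h.pos t (by linarith)
  have hEa := le_abs_self E
  have hE0 := abs_nonneg E
  constructor
  · by_contra! hc
    have : 4 ≤ y t := by linarith
    have h4 : y t ^ 2 / 2 ≤ y t ^ 4 / 4 - y t ^ 2 / 2 := by
      have : 16 ≤ y t ^ 2 := by nlinarith
      nlinarith
    nlinarith [sq_nonneg (z t)]
  · have h4 : -(1 / 4) ≤ y t ^ 4 / 4 - y t ^ 2 / 2 := by nlinarith [sq_nonneg (y t ^ 2 - 1)]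
    apply abs_le_of_sq_le_sq _ (by positivity)
    nlinarith

lemma y_top (h : RadialSol y z α) : Tendsto y atTop (𝓝 0) := by
  obtain ⟨M, hM, hb⟩ := h.bounds
  have hi := h.integrable_sq
  have hcy := h.cont_y.mono (Ioi_subset_Ioi zero_le_one)
  have hcz := h.cont_z.mono (Ioi_subset_Ioi zero_le_one)
  have h3 : Tendsto (fun t => y t ^ 3) atTop (𝓝 0) := by
    refine tendsto_zero_of_hasDerivAt_of_integrableOn_Ioi (a := 1)
      (f' := fun t => 3 * y t ^ 2 * z t) (fun t ht => ?_) ?_ ?_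
    · have ht0 : 0 < t := zero_lt_one.trans ht
      exact ((h.hy t ht0).pow 3).congr_deriv (by norm_num)
    · refine Integrable.mono' (hi.const_mul (3 * M)) ?_ ?_
      · exact ((continuousOn_const.mul (hcy.pow 2)).mul hcz).aestronglyMeasurable measurableSet_Ioi
      · refine (ae_restrict_iff' measurableSet_Ioi).2 (ae_of_all _ fun t ht => ?_)
        rw [norm_mul, Real.norm_of_nonneg (by positivity), Real.norm_eq_abs]
        have := (hb t ht).2
        nlinarith [mul_le_mul_of_nonneg_left this (sq_nonneg (y t))]
    · refine Integrable.mono' (hi.const_mul M) ?_ ?_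
      · exact (hcy.pow 3).aestronglyMeasurable measurableSet_Ioi
      · refine (ae_restrict_iff' measurableSet_Ioi).2 (ae_of_all _ fun t ht => ?_)
        have hp := h.pos t (by have : (1:ℝ) < t := ht; linarith)
        rw [Real.norm_of_nonneg (by positivity)]
        have := (hb t ht).1
        nlinarith [mul_le_mul_of_nonneg_left this (sq_nonneg (y t))]
  rw [Metric.tendsto_atTop] at h3 ⊢
  intro ε hε
  obtain ⟨N, hN⟩ := h3 (ε ^ 3) (by positivity)
  refine ⟨max N 1, fun t ht => ?_⟩
  have h1 := hN t ((le_max_left _ _).trans ht)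
  have ht1 : 1 ≤ t := (le_max_right _ _).trans ht
  have hp := h.pos t (by linarith)
  rw [Real.dist_0_eq_abs, abs_of_pos (by positivity)] at h1 ⊢
  exact lt_of_pow_lt_pow_left₀ 3 hε.le h1

lemma energy_top (h : RadialSol y z α) :
    ∃ L, Tendsto (fun t => z t ^ 2 / 2 + (y t ^ 4 / 4 - y t ^ 2 / 2)) atTop (𝓝 L) := by
  let g : ℝ → ℝ := fun t => z (max t 1) ^ 2 / 2 + (y (max t 1) ^ 4 / 4 - y (max t 1) ^ 2 / 2)
  have hg : Antitone g := fun s t hst =>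
    h.energy_antitone (show (0:ℝ) < max s 1 by positivity) (show (0:ℝ) < max t 1 by positivity)
      (max_le_max_right 1 hst)
  have hbd : BddBelow (range g) := by
    refine ⟨-(1 / 4), ?_⟩
    rintro _ ⟨t, rfl⟩
    simp only [g]
    nlinarith [sq_nonneg (y (max t 1) ^ 2 - 1), sq_nonneg (z (max t 1))]
  refine ⟨_, (tendsto_atTop_ciInf hg hbd).congr' ?_⟩
  filter_upwards [eventually_ge_atTop 1] with t ht
  simp only [g, max_eq_left ht]

lemma z_top (h : RadialSol y z α) : Tendsto z atTop (𝓝 0) := by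
  obtain ⟨L, hL⟩ := h.energy_top
  obtain ⟨M, hM, hb⟩ := h.bounds
  have hy0 := h.y_top
  have hzsq : Tendsto (fun t => z t ^ 2) atTop (𝓝 (2 * L)) := by
    have h1 := (hL.sub (((hy0.pow 4).div_const 4).sub ((hy0.pow 2).div_const 2))).const_mul 2
    have e : (2 * (L - ((0:ℝ) ^ 4 / 4 - 0 ^ 2 / 2))) = 2 * L := by ring
    rw [e] at h1
    exact h1.congr fun t => by ring
  have hyz : Tendsto (fun t => y t * z t) atTop (𝓝 0) := by
    refine squeeze_zero_norm' ?_ (by simpa using hy0.mul_const M)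
    filter_upwards [eventually_gt_atTop 1] with t ht
    have hp := h.pos t (by linarith)
    rw [norm_mul, Real.norm_of_nonneg hp.le, Real.norm_eq_abs]
    exact mul_le_mul_of_nonneg_left (hb t ht).2 hp.le
  have hd : ∀ t, (1:ℝ) < t → HasDerivAt (fun t => y t * z t)
      (z t ^ 2 - (y t * z t) / t + y t ^ 2 - y t ^ 4) t := fun t ht => by
    have ht0 : 0 < t := by linarith
    refine ((h.hy t ht0).mul (h.hz t ht0)).congr_deriv ?_
    field_simp
    ring
  have hlim : Tendsto (fun t => z t ^ 2 - (y t * z t) / t + y t ^ 2 - y t ^ 4) atTop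
      (𝓝 (2 * L)) := by
    have := ((hzsq.sub (hyz.div_atTop tendsto_id)).add (hy0.pow 2)).sub (hy0.pow 4)
    simpa using this
  have hL0 := eq_zero_of_tendsto_zero_of_hasDerivAt hd hyz hlim
  rw [hL0] at hzsq
  have := hzsq.sqrt
  simp only [Real.sqrt_sq_eq_abs, Real.sqrt_zero] at this
  exact (tendsto_zero_iff_abs_tendsto_zero z).2 this

lemma energy_pos (h : RadialSol y z α) {t : ℝ} (ht : 0 < t) :
    0 < z t ^ 2 / 2 + (y t ^ 4 / 4 - y t ^ 2 / 2) := by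
  have hlim : Tendsto (fun t => z t ^ 2 / 2 + (y t ^ 4 / 4 - y t ^ 2 / 2)) atTop (𝓝 0) := by
    have := ((h.z_top.pow 2).div_const 2).add
      (((h.y_top.pow 4).div_const 4).sub ((h.y_top.pow 2).div_const 2))
    simpa using this
  have hge : ∀ s, 0 < s → 0 ≤ z s ^ 2 / 2 + (y s ^ 4 / 4 - y s ^ 2 / 2) := by
    intro s hs
    refine le_of_tendsto hlim ?_
    filter_upwards [eventually_ge_atTop s] with t hst
    exact h.energy_antitone hs (hs.trans_le hst) hst
  refine (hge t ht).lt_of_ne' fun h0 => ?_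
  have hzero : ∀ s, t < s → z s = 0 := by
    intro s hs
    have hloc : (fun t => z t ^ 2 / 2 + (y t ^ 4 / 4 - y t ^ 2 / 2)) =ᶠ[𝓝 s] fun _ => (0 : ℝ) := by
      filter_upwards [Ioi_mem_nhds hs] with v hv
      have h1 := h.energy_antitone ht (ht.trans hv) (le_of_lt hv)
      simp only [h0] at h1
      exact le_antisymm h1 (hge v (ht.trans hv))
    have h1 := (h.hasDerivAt_energy s (ht.trans hs)).unique
      ((hasDerivAt_const s (0 : ℝ)).congr_of_eventuallyEq hloc)
    have hs0 : 0 < s := ht.trans hs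
    rw [div_eq_zero_iff] at h1
    rcases h1 with h1 | h1
    · simpa using h1
    · exact absurd h1 hs0.ne'
  have hmono := monotoneOn_Ioi_of_hasDerivAt_nonneg (g := y) (g' := z) (a := t)
    (fun s hs => h.hy s (ht.trans hs)) (fun s hs => (hzero s hs).ge)
  have hp := h.pos (t + 1) (by linarith)
  have : y (t + 1) ≤ 0 := by
    refine ge_of_tendsto h.y_top ?_
    filter_upwards [eventually_ge_atTop (t + 1)] with s hs
    exact hmono (show t < t + 1 by linarith) (show t < s by linarith) hs
  linarith

lemma top_sq (h : RadialSol y z α) : 2 < α ^ 2 := by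
  have hlim := ((h.z_zero.pow 2).div_const 2).add
      (((h.y_zero.pow 4).div_const 4).sub ((h.y_zero.pow 2).div_const 2))
  have h1 : z 1 ^ 2 / 2 + (y 1 ^ 4 / 4 - y 1 ^ 2 / 2) ≤ 0 ^ 2 / 2 + (α ^ 4 / 4 - α ^ 2 / 2) := by
    refine ge_of_tendsto hlim ?_
    filter_upwards [Ioo_mem_nhdsGT (zero_lt_one (α := ℝ))] with t ht
    exact h.energy_antitone ht.1 (show (0:ℝ) < 1 by simp) ht.2.le
  have h2 := h.energy_pos one_pos
  nlinarith [sq_nonneg α]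

lemma one_lt_top (h : RadialSol y z α) : 1 < α := by
  have h0 : 0 ≤ α := by
    refine ge_of_tendsto h.y_zero ?_
    filter_upwards [self_mem_nhdsWithin] with t ht using (h.pos t ht).le
  nlinarith [h.top_sq]

lemma z_neg (h : RadialSol y z α) {t : ℝ} (ht : 0 < t) : z t < 0 := by
  have hcross : ∀ t, 0 < t → z t = 0 → -(z t) / t + y t - y t ^ 3 < 0 := by
    intro t ht h0
    have h1 := h.energy_pos ht
    have hp := h.pos t ht
    rw [h0] at h1 ⊢
    have h2 : 2 < y t ^ 2 := by
      have : 0 < y t ^ 2 := by positivity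
      nlinarith
    have : y t * 2 < y t * y t ^ 2 := mul_lt_mul_of_pos_left h2 hp
    simp only [neg_zero, zero_div, zero_add]
    nlinarith
  obtain ⟨δ, hδ, hsub⟩ := (mem_nhdsGT_iff_exists_Ioo_subset' (zero_lt_one (α := ℝ))).1
    (h.y_zero.eventually_const_lt h.one_lt_top)
  have hδ : 0 < δ := hδ
  have hneg : ∀ t ∈ Ioo 0 δ, z t < 0 := by
    intro t ht
    have hlim : Tendsto (fun t => -(t * z t)) (𝓝[>] 0) (𝓝 0) := by
      have h0 : Tendsto (fun t : ℝ => t) (𝓝[>] 0) (𝓝 0) :=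
        tendsto_nhdsWithin_of_tendsto_nhds tendsto_id
      simpa using (h0.mul h.z_zero).neg
    have h1 := lt_of_tendsto_left_of_deriv_pos (fun t ht => (h.hasDerivAt_mul t ht.1).neg)
      (fun t ht => by
        have h2 : 1 < y t := hsub ht
        have h3 : y t < y t ^ 3 := lt_self_pow₀ h2 (by norm_num)
        nlinarith [mul_lt_mul_of_pos_left h3 ht.1]) hlim ht
    simp only [Pi.neg_apply, Left.neg_pos_iff] at h1
    exact neg_of_mul_neg_right h1 ht.1.le
  have hle : ∀ t, 0 < t → z t ≤ 0 := by
    intro t ht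
    rcases lt_or_ge t δ with h1 | h1
    · exact (hneg t ⟨ht, h1⟩).le
    · have hpos : ∀ x, δ / 2 ≤ x → 0 < x := fun x hx => by linarith
      refine image_le_of_deriv_right_lt_deriv_boundary (f := z)
        (f' := fun t => -(z t) / t + y t - y t ^ 3) (a := δ / 2) (b := t) (B := fun _ => 0)
        (B' := fun _ => 0)
        (fun x hx => (h.hz x (hpos x hx.1)).continuousAt.continuousWithinAt)
        (fun x hx => (h.hz x (hpos x hx.1)).hasDerivWithinAt)
        (hneg _ ⟨by linarith, by linarith⟩).le (fun x => hasDerivAt_const x _)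
        (fun x hx h0 => hcross x (hpos x hx.1) h0) ⟨by linarith, le_rfl⟩
  refine (hle t ht).lt_of_ne fun h0 => ?_
  have hmax : IsLocalMax z t := by
    filter_upwards [Ioi_mem_nhds ht] with s hs
    rw [h0]; exact hle s hs
  have := hmax.hasDerivAt_eq_zero (h.hz t ht)
  linarith [hcross t ht h0]

lemma strictAnti (h : RadialSol y z α) : StrictAntiOn y (Ioi 0) := by
  apply strictAntiOn_of_deriv_neg (convex_Ioi 0) h.cont_y
  intro t ht
  rw [interior_Ioi] at ht
  rw [(h.hy t ht).deriv]; exact h.z_neg ht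

lemma lt_top (h : RadialSol y z α) {t : ℝ} (ht : 0 < t) : y t < α := by
  have := lt_of_tendsto_left_of_deriv_pos (g := fun t => -y t) (a := 0) (b := t + 1)
    (fun t ht => (h.hy t ht.1).neg) (fun t ht => by linarith [h.z_neg ht.1]) h.y_zero.neg
    (u := t) ⟨ht, by linarith⟩
  linarith

lemma mul_y_top (h : RadialSol y z α) : Tendsto (fun t => t * y t) atTop (𝓝 0) := by
  have hi : ∀ a b, 0 < a → 0 < b → IntervalIntegrable (fun t => t * y t ^ 2) volume a b :=
    fun a b ha hb => ContinuousOn.intervalIntegrable fun t ht =>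
      (continuousAt_id.mul ((h.hy t ((lt_min ha hb).trans_le ht.1)).continuousAt.pow 2)).continuousWithinAt
  have h1 := intervalIntegral_tendsto_integral_Ioi 1 (h.int.mono_set (Ioi_subset_Ioi zero_le_one))
    tendsto_id
  have h2 := (h1.comp ((tendsto_id (α := ℝ) (x := atTop)).const_mul_atTop (zero_lt_two (α := ℝ)))).sub h1
  rw [sub_self] at h2
  have h3 : Tendsto (fun t => (2 * t * y (2 * t)) ^ 2) atTop (𝓝 0) := by
    refine squeeze_zero' (g := fun t => 4 * ((∫ s in (1:ℝ)..(2 * t), s * y s ^ 2) -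
      ∫ s in (1:ℝ)..t, s * y s ^ 2)) (Eventually.of_forall fun t => sq_nonneg _) ?_
      (by simpa using h2.const_mul 4)
    filter_upwards [eventually_gt_atTop 0] with t ht
    rw [intervalIntegral.integral_interval_sub_left (hi _ _ one_pos (by positivity)) (hi _ _ one_pos ht)]
    have h4 : ∫ s in t..(2 * t), t * y (2 * t) ^ 2 ≤ ∫ s in t..(2 * t), s * y s ^ 2 := by
      refine intervalIntegral.integral_mono_on (by linarith) (by simp) (hi _ _ ht (by linarith))
        fun s hs => ?_
      have hs0 : 0 < s := ht.trans_le hs.1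
      have h5 : y (2 * t) ≤ y s := h.strictAnti.antitoneOn hs0 (show (0:ℝ) < 2 * t by linarith) hs.2
      have h6 := h.pos (2 * t) (by linarith)
      exact mul_le_mul hs.1 (pow_le_pow_left₀ h6.le h5 2) (by positivity) hs0.le
    rw [intervalIntegral.integral_const, smul_eq_mul] at h4
    nlinarith
  have h7 := h3.sqrt
  simp only [Real.sqrt_sq_eq_abs, Real.sqrt_zero] at h7
  have h8 := (tendsto_zero_iff_abs_tendsto_zero _).2 h7
  have h9 := h8.comp ((tendsto_id (α := ℝ) (x := atTop)).const_mul_atTop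
    (show (0:ℝ) < 1 / 2 by norm_num))
  refine h9.congr fun t => ?_
  simp only [Function.comp, id]
  ring_nf

/-- A tail on which the profile is small. -/
lemma exists_tail (h : RadialSol y z α) : ∃ T, 1 ≤ T ∧ ∀ t, T ≤ t → y t ≤ 1 / 2 := by
  obtain ⟨T, hT⟩ := eventually_atTop.1 (h.y_top.eventually_le_const (show (0:ℝ) < 1 / 2 by norm_num))
  exact ⟨max T 1, le_max_right _ _, fun t ht => hT t ((le_max_left _ _).trans ht)⟩

lemma exp_decay (h : RadialSol y z α) : ∃ C T, 0 < C ∧ 1 ≤ T ∧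
    ∀ t, T ≤ t → y t ≤ C * Real.exp (-t / 2) ∧ |z t| ≤ C * Real.exp (-t / 2) := by
  obtain ⟨T, hT1, hT⟩ := h.exists_tail
  have hz' : ∀ t, T < t → 3 / 4 * y t ≤ -(z t) / t + y t - y t ^ 3 := fun t ht => by
    have h0 : 0 < t := by linarith
    have h1 := h.pos t h0
    have h2 := hT t ht.le
    have h3 : 0 ≤ -(z t) / t := div_nonneg (by linarith [h.z_neg h0]) h0.le
    nlinarith [mul_nonneg h1.le (mul_nonneg h1.le h1.le), mul_self_nonneg (y t)]
  have hexp : ∀ t : ℝ, HasDerivAt (fun t => Real.exp (-t / 2)) (Real.exp (-t / 2) * (-1 / 2)) t :=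
    fun t => ((hasDerivAt_id t).neg.div_const 2).exp
  have hexp2 : ∀ t : ℝ, HasDerivAt (fun t => Real.exp (t / 2)) (Real.exp (t / 2) * (1 / 2)) t :=
    fun t => ((hasDerivAt_id t).div_const 2).exp
  have hg : ∀ t, T < t → z t + y t / 2 ≤ 0 := by
    intro t ht
    have hm := monotoneOn_Ioi_of_hasDerivAt_nonneg
      (g := fun t => Real.exp (-t / 2) * (z t + y t / 2)) (a := T)
      (fun t ht => (hexp t).mul ((h.hz t (by linarith)).add ((h.hy t (by linarith)).div_const 2)))
      (fun t ht => by
        have h1 := hz' t ht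
        have h2 := h.pos t (by linarith)
        have h3 := Real.exp_pos (-t / 2)
        have : 0 ≤ Real.exp (-t / 2) * ((-(z t) / t + y t - y t ^ 3) - y t / 4) :=
          mul_nonneg h3.le (by linarith)
        linarith)
    have hlim : Tendsto (fun t => Real.exp (-t / 2) * (z t + y t / 2)) atTop (𝓝 0) := by
      have e1 : Tendsto (fun t : ℝ => Real.exp (-t / 2)) atTop (𝓝 0) := by
        refine Real.tendsto_exp_atBot.comp ?_
        exact (tendsto_neg_atTop_atBot).atBot_div_const (by norm_num)
      simpa using e1.mul (h.z_top.add (h.y_top.div_const 2))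
    have : Real.exp (-t / 2) * (z t + y t / 2) ≤ 0 := by
      refine ge_of_tendsto hlim ?_
      filter_upwards [eventually_ge_atTop t] with s hs
      exact hm ht (ht.trans_le hs) hs
    nlinarith [Real.exp_pos (-t / 2)]
  have hanti := antitoneOn_Ioi_of_hasDerivAt_nonpos (g := fun t => Real.exp (t / 2) * y t) (a := T)
    (fun t ht => (hexp2 t).mul (h.hy t (by linarith)))
    (fun t ht => by nlinarith [hg t ht, Real.exp_pos (t / 2)])
  let C := Real.exp ((T + 1) / 2) * y (T + 1)
  have hC : 0 < C := mul_pos (Real.exp_pos _) (h.pos _ (by linarith))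
  have hyC : ∀ t, T + 1 ≤ t → y t ≤ C * Real.exp (-t / 2) := fun t ht => by
    have h1 : Real.exp (t / 2) * y t ≤ C :=
      hanti (show T < T + 1 by linarith) (show T < t by linarith) ht
    have h2 : Real.exp (t / 2) * Real.exp (-t / 2) = 1 := by
      rw [← Real.exp_add]; simp [neg_div]
    calc y t = Real.exp (t / 2) * y t * Real.exp (-t / 2) := by linear_combination (-y t) * h2
      _ ≤ _ := mul_le_mul_of_nonneg_right h1 (Real.exp_pos _).le
  have hzm := monotoneOn_Ioi_of_hasDerivAt_nonneg (g := z) (a := T)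
    (fun t ht => h.hz t (by linarith)) (fun t ht => by
      linarith [hz' t ht, h.pos t (by linarith)])
  have he1 : 1 ≤ Real.exp (1 / 2) := Real.one_le_exp (by norm_num)
  refine ⟨C * Real.exp (1 / 2), T + 2, by positivity, by linarith, fun t ht => ⟨?_, ?_⟩⟩
  · refine (hyC t (by linarith)).trans ?_
    have := Real.exp_pos (-t / 2)
    have : 0 ≤ C * Real.exp (-t / 2) := by positivity
    nlinarith
  · obtain ⟨ξ, hξ, hξe⟩ := exists_hasDerivAt_eq_slope y z (show t - 1 < t by linarith)
        (fun x hx => (h.hy x (by linarith [hx.1])).continuousAt.continuousWithinAt)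
        (fun x hx => h.hy x (by linarith [hx.1]))
    have h1 : z ξ ≤ z t := hzm (show T < ξ by linarith [hξ.1]) (show T < t by linarith) hξ.2.le
    have h2 : z ξ = y t - y (t - 1) := by rw [hξe]; simp
    rw [abs_of_neg (h.z_neg (by linarith))]
    have h3 := hyC (t - 1) (by linarith)
    have h4 := h.pos t (by linarith)
    have h5 : Real.exp (-(t - 1) / 2) = Real.exp (1 / 2) * Real.exp (-t / 2) := by
      rw [← Real.exp_add]; congr 1; ring
    rw [h5] at h3
    linarith

lemma mul_z_top (h : RadialSol y z α) : Tendsto (fun t => t * z t) atTop (𝓝 0) := by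
  obtain ⟨C, T, hC, hT, hb⟩ := h.exp_decay
  have h1 : Tendsto (fun t : ℝ => 2 * C * ((t / 2) ^ 1 * Real.exp (-(t / 2)))) atTop (𝓝 0) := by
    have := ((Real.tendsto_pow_mul_exp_neg_atTop_nhds_zero 1).comp
      ((tendsto_id (α := ℝ) (x := atTop)).atTop_div_const zero_lt_two)).const_mul (2 * C)
    simpa using this
  refine squeeze_zero_norm' ?_ h1
  filter_upwards [eventually_ge_atTop T] with t ht
  rw [norm_mul, Real.norm_of_nonneg (by linarith), Real.norm_eq_abs]
  have := mul_le_mul_of_nonneg_left (hb t ht).2 (show 0 ≤ t by linarith)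
  rw [neg_div] at this
  linarith

end RadialSol

namespace RadialSol

variable {y z : ℝ → ℝ} {α : ℝ} {y₁ z₁ : ℝ → ℝ} {α₁ : ℝ} {y₂ z₂ : ℝ → ℝ} {α₂ : ℝ}

lemma exists_eq (h : RadialSol y z α) {u : ℝ} (hu : u ∈ Ioo 0 α) : ∃ t ∈ Ioi (0 : ℝ), y t = u := by
  obtain ⟨a, ha, ha'⟩ := ((h.y_zero.eventually_const_lt hu.2).and self_mem_nhdsWithin).exists
  have ha0 : (0 : ℝ) < a := ha'
  obtain ⟨b, hb, hab⟩ := ((h.y_top.eventually_lt_const hu.1).and (eventually_gt_atTop a)).exists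
  have := intermediate_value_Icc' hab.le (h.cont_y.mono fun x hx => ha0.trans_le hx.1)
  obtain ⟨t, ht, hyt⟩ := this ⟨hb.le, ha.le⟩
  exact ⟨t, ha0.trans_le ht.1, hyt⟩

/-- The radius as a function of the value of the profile. -/
def radius (y : ℝ → ℝ) (u : ℝ) : ℝ := Function.invFunOn y (Ioi 0) u

lemma radius_pos (h : RadialSol y z α) {u : ℝ} (hu : u ∈ Ioo 0 α) : 0 < radius y u :=
  Function.invFunOn_mem (h.exists_eq hu)

lemma y_radius (h : RadialSol y z α) {u : ℝ} (hu : u ∈ Ioo 0 α) : y (radius y u) = u :=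
  Function.invFunOn_eq (h.exists_eq hu)

lemma lt_radius_iff (h : RadialSol y z α) {t u : ℝ} (ht : 0 < t) (hu : u ∈ Ioo 0 α) :
    t < radius y u ↔ u < y t := by
  have := h.strictAnti.lt_iff_gt (h.radius_pos hu) ht
  rw [h.y_radius hu] at this
  exact this.symm

lemma radius_lt_iff (h : RadialSol y z α) {t u : ℝ} (ht : 0 < t) (hu : u ∈ Ioo 0 α) :
    radius y u < t ↔ y t < u := by
  have := h.strictAnti.lt_iff_gt ht (h.radius_pos hu)
  rw [h.y_radius hu] at this
  exact this.symm

lemma continuousAt_radius (h : RadialSol y z α) {u : ℝ} (hu : u ∈ Ioo 0 α) :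
    ContinuousAt (radius y) u := by
  rw [ContinuousAt, tendsto_order]
  have hI := Ioo_mem_nhds hu.1 hu.2
  constructor
  · intro a ha
    rcases le_or_gt a 0 with h0 | h0
    · filter_upwards [hI] with v hv using h0.trans_lt (h.radius_pos hv)
    · rw [h.lt_radius_iff h0 hu] at ha
      filter_upwards [hI, Iio_mem_nhds ha] with v hv hv2 using (h.lt_radius_iff h0 hv).2 hv2
  · intro b hb
    have h0 : 0 < b := (h.radius_pos hu).trans hb
    have hb := (h.radius_lt_iff h0 hu).1 hb
    filter_upwards [hI, Ioi_mem_nhds hb] with v hv hv2 using (h.radius_lt_iff h0 hv).2 hv2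

lemma hasDerivAt_radius (h : RadialSol y z α) {u : ℝ} (hu : u ∈ Ioo 0 α) :
    HasDerivAt (radius y) (-1 / -z (radius y u)) u := by
  have hr := h.radius_pos hu
  have := HasDerivAt.of_local_left_inverse (h.continuousAt_radius hu) (h.hy _ hr) (h.z_neg hr).ne
    (by filter_upwards [Ioo_mem_nhds hu.1 hu.2] with v hv using h.y_radius hv)
  refine this.congr_deriv ?_
  rw [neg_div_neg_eq, one_div]

lemma radius_zero (h : RadialSol y z α) : Tendsto (radius y) (𝓝[>] 0) atTop := by
  have hα := h.one_lt_top
  rw [Filter.tendsto_atTop]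
  intro b
  have hb : 0 < max b 1 := by positivity
  have hm : 0 < min α (y (max b 1)) := lt_min (by linarith) (h.pos _ hb)
  filter_upwards [Ioo_mem_nhdsGT hm] with u hu
  exact (le_max_left _ _).trans ((h.lt_radius_iff hb ⟨hu.1, hu.2.trans_le (min_le_left _ _)⟩).2
    (hu.2.trans_le (min_le_right _ _))).le

lemma radius_top (h : RadialSol y z α) : Tendsto (radius y) (𝓝[<] α) (𝓝[>] 0) := by
  have hα := h.one_lt_top
  have hI : Ioo 0 α ∈ 𝓝[<] α := Ioo_mem_nhdsLT (by linarith)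
  rw [tendsto_nhdsWithin_iff]
  refine ⟨?_, by filter_upwards [hI] with u hu using h.radius_pos hu⟩
  rw [tendsto_order]
  constructor
  · intro a ha
    filter_upwards [hI] with u hu using ha.trans (h.radius_pos hu)
  · intro b hb
    filter_upwards [hI, Ioo_mem_nhdsLT (h.lt_top hb)] with u hu hu2
      using (h.radius_lt_iff hb hu).2 hu2.1

theorem branch (h : RadialSol y z α) : Branch (radius y) (fun u => -z (radius y u)) α where
  one_lt := h.one_lt_top
  r_pos u hu := h.radius_pos hu
  p_pos u hu := by linarith [h.z_neg (h.radius_pos hu)]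
  hr u hu := h.hasDerivAt_radius hu
  hp u hu := by
    have hr := h.radius_pos hu
    have hz := h.z_neg hr
    refine ((h.hz _ hr).comp u (h.hasDerivAt_radius hu)).neg.congr_deriv ?_
    rw [h.y_radius hu]
    have := hz.ne
    field_simp
    ring
  energy u hu := by
    have := h.energy_pos (h.radius_pos hu)
    rw [h.y_radius hu] at this
    rwa [neg_sq]
  p_zero := by simpa using (h.z_top.comp h.radius_zero).neg
  rp_zero := by simpa using (h.mul_z_top.comp h.radius_zero).neg
  ru_zero := by
    refine (h.mul_y_top.comp h.radius_zero).congr' ?_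
    filter_upwards [Ioo_mem_nhdsGT (show 0 < α by linarith [h.one_lt_top])] with u hu
    simp [h.y_radius hu]
  r_top := h.radius_top.mono_right nhdsWithin_le_nhds
  p_top := by simpa using (h.z_zero.comp h.radius_top).neg

/-- The squared distance of the data of two solutions. -/
lemma hasDerivAt_dist (hy₁ : ∀ t, 0 < t → HasDerivAt y₁ (z₁ t) t)
    (hz₁ : ∀ t, 0 < t → HasDerivAt z₁ (-(z₁ t) / t + y₁ t - y₁ t ^ 3) t)
    (hy₂ : ∀ t, 0 < t → HasDerivAt y₂ (z₂ t) t)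
    (hz₂ : ∀ t, 0 < t → HasDerivAt z₂ (-(z₂ t) / t + y₂ t - y₂ t ^ 3) t) {t : ℝ} (ht : 0 < t) :
    HasDerivAt (fun t => (y₁ t - y₂ t) ^ 2 + (z₁ t - z₂ t) ^ 2)
      (2 * (y₁ t - y₂ t) * (z₁ t - z₂ t) * (2 - (y₁ t ^ 2 + y₁ t * y₂ t + y₂ t ^ 2))
        - 2 * (z₁ t - z₂ t) ^ 2 / t) t := by
  refine ((((hy₁ t ht).sub (hy₂ t ht)).pow 2).add (((hz₁ t ht).sub (hz₂ t ht)).pow 2)).congr_deriv ?_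
  simp only [Pi.sub_apply]
  field_simp
  ring

/-- Backward uniqueness of the radial equation away from the origin. -/
lemma eq_of_eq_right (hy₁ : ∀ t, 0 < t → HasDerivAt y₁ (z₁ t) t)
    (hz₁ : ∀ t, 0 < t → HasDerivAt z₁ (-(z₁ t) / t + y₁ t - y₁ t ^ 3) t)
    (hy₂ : ∀ t, 0 < t → HasDerivAt y₂ (z₂ t) t)
    (hz₂ : ∀ t, 0 < t → HasDerivAt z₂ (-(z₂ t) / t + y₂ t - y₂ t ^ 3) t) {t₀ t : ℝ}
    (ht : 0 < t) (htt : t ≤ t₀) (h0 : y₁ t₀ = y₂ t₀) (h0' : z₁ t₀ = z₂ t₀) : y₁ t = y₂ t := by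
  have hmem : ∀ s ∈ Icc t t₀, 0 < s := fun s hs => ht.trans_le hs.1
  have hc : ContinuousOn (fun t => 2 - (y₁ t ^ 2 + y₁ t * y₂ t + y₂ t ^ 2)) (Icc t t₀) := fun s hs => by
    have h1 := (hy₁ s (hmem s hs)).continuousAt
    have h2 := (hy₂ s (hmem s hs)).continuousAt
    exact (continuousAt_const.sub (((h1.pow 2).add (h1.mul h2)).add (h2.pow 2))).continuousWithinAt
  obtain ⟨K, hK⟩ := isCompact_Icc.exists_bound_of_continuousOn hc
  let L := K + 2 / t
  have hm : MonotoneOn (fun s => Real.exp (L * s) * ((y₁ s - y₂ s) ^ 2 + (z₁ s - z₂ s) ^ 2))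
      (Icc t t₀) := by
    have hd := fun s (hs : s ∈ Icc t t₀) => (((hasDerivAt_id s).const_mul L).exp).mul
      (hasDerivAt_dist hy₁ hz₁ hy₂ hz₂ (hmem s hs))
    refine monotoneOn_of_deriv_nonneg (convex_Icc _ _)
      (fun s hs => (hd s hs).continuousAt.continuousWithinAt)
      (fun s hs => ?_) fun s hs => ?_
    · rw [interior_Icc] at hs
      exact (hd s ⟨hs.1.le, hs.2.le⟩).differentiableAt.differentiableWithinAt
    · rw [interior_Icc] at hs
      have hs' : s ∈ Icc t t₀ := ⟨hs.1.le, hs.2.le⟩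
      have hkk := hK s hs'
      refine (hd s hs').deriv.symm ▸ ?_
      generalize y₁ s - y₂ s = d at *
      generalize z₁ s - z₂ s = e at *
      generalize 2 - (y₁ s ^ 2 + y₁ s * y₂ s + y₂ s ^ 2) = c at *
      rw [Real.norm_eq_abs, abs_le] at hkk
      have hst : 2 * e ^ 2 / s ≤ 2 / t * e ^ 2 := by
        rw [mul_comm 2, mul_div_assoc, mul_comm]
        exact mul_le_mul_of_nonneg_right
          (div_le_div_of_nonneg_left (by norm_num) ht hs.1.le) (sq_nonneg e)
      have h3 : 0 ≤ K * (d ^ 2 + e ^ 2) + 2 * d * e * c := by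
        nlinarith [mul_nonneg (show 0 ≤ K + c by linarith) (sq_nonneg (d + e)),
          mul_nonneg (show 0 ≤ K - c by linarith) (sq_nonneg (d - e))]
      have h4 : 0 ≤ 2 / t * d ^ 2 := by positivity
      have h5 := Real.exp_pos (L * id s)
      have : 0 ≤ Real.exp (L * id s) * ((L * (d ^ 2 + e ^ 2)) + (2 * d * e * c - 2 * e ^ 2 / s)) := by
        refine mul_nonneg h5.le ?_
        simp only [L]; linarith
      linarith
  have h1 := hm ⟨le_rfl, htt⟩ ⟨htt, le_rfl⟩ htt
  simp only [h0, h0', sub_self, ne_eq, OfNat.ofNat_ne_zero, not_false_eq_true, zero_pow, add_zero,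
    mul_zero] at h1
  have h2 := nonpos_of_mul_nonpos_right h1 (Real.exp_pos _)
  nlinarith [sq_nonneg (y₁ t - y₂ t), sq_nonneg (z₁ t - z₂ t)]

/-- If two profiles meet in the region where both are small, they agree from there on. -/
lemma eq_tail (h₁ : RadialSol y₁ z₁ α₁) (h₂ : RadialSol y₂ z₂ α₂) {T : ℝ} (hT : 1 ≤ T)
    (hs₁ : ∀ t, T ≤ t → y₁ t ≤ 1 / 2) (hs₂ : ∀ t, T ≤ t → y₂ t ≤ 1 / 2) {t₀ : ℝ} (ht₀ : T ≤ t₀)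
    (h0 : y₁ t₀ = y₂ t₀) : ∀ t, t₀ < t → y₁ t = y₂ t ∧ z₁ t = z₂ t := by
  let W : ℝ → ℝ := fun t => (t * z₁ t - t * z₂ t) * (y₁ t - y₂ t)
  have hd : ∀ t, 0 < t → HasDerivAt W
      (t * ((y₁ t - y₂ t) ^ 2 * (1 - (y₁ t ^ 2 + y₁ t * y₂ t + y₂ t ^ 2)) + (z₁ t - z₂ t) ^ 2)) t := by
    intro t ht
    refine (((h₁.hasDerivAt_mul t ht).sub (h₂.hasDerivAt_mul t ht)).mul
      ((h₁.hy t ht).sub (h₂.hy t ht))).congr_deriv ?_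
    simp only [Pi.sub_apply]
    ring
  have hcoef : ∀ t, t₀ ≤ t → 1 / 4 ≤ 1 - (y₁ t ^ 2 + y₁ t * y₂ t + y₂ t ^ 2) := fun t ht => by
    have a1 := hs₁ t (ht₀.trans ht)
    have a2 := hs₂ t (ht₀.trans ht)
    have b1 := h₁.pos t (by linarith)
    have b2 := h₂.pos t (by linarith)
    nlinarith [mul_le_mul a1 a2 b2.le (by norm_num)]
  have hnn : ∀ t, t₀ < t →
      0 ≤ t * ((y₁ t - y₂ t) ^ 2 * (1 - (y₁ t ^ 2 + y₁ t * y₂ t + y₂ t ^ 2)) + (z₁ t - z₂ t) ^ 2) :=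
    fun t ht => mul_nonneg (by linarith) (add_nonneg (mul_nonneg (sq_nonneg _)
      (by linarith [hcoef t ht.le])) (sq_nonneg _))
  have hm := monotoneOn_Ioi_of_hasDerivAt_nonneg (fun t ht => hd t (by linarith)) hnn
  have hlim : Tendsto W atTop (𝓝 0) := by
    simpa using (h₁.mul_z_top.sub h₂.mul_z_top).mul (h₁.y_top.sub h₂.y_top)
  have hW0 : W t₀ = 0 := by simp [W, h0]
  have hW : ∀ t, t₀ < t → W t = 0 := by
    intro t ht
    apply le_antisymm
    · refine ge_of_tendsto hlim ?_
      filter_upwards [eventually_ge_atTop t] with s hs using hm ht (ht.trans_le hs) hs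
    · have h1 := (hd t₀ (by linarith)).continuousAt.tendsto.mono_left
        (nhdsWithin_le_nhds (s := Ioi t₀))
      rw [hW0] at h1
      refine le_of_tendsto h1 ?_
      filter_upwards [Ioo_mem_nhdsGT ht] with s hs using hm hs.1 ht hs.2.le
  intro t ht
  have hder := (hd t (by linarith)).unique ((hasDerivAt_const t (0 : ℝ)).congr_of_eventuallyEq (by
    filter_upwards [Ioi_mem_nhds ht] with s hs using hW s hs))
  have ht0 : 0 < t := by linarith
  have h3 := (mul_eq_zero.1 hder).resolve_left ht0.ne'
  have h4 := hcoef t ht.le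
  have h5 := mul_le_mul_of_nonneg_left h4 (sq_nonneg (y₁ t - y₂ t))
  constructor
  · have : (y₁ t - y₂ t) ^ 2 = 0 := by nlinarith [sq_nonneg (y₁ t - y₂ t), sq_nonneg (z₁ t - z₂ t)]
    have := pow_eq_zero_iff (two_ne_zero) |>.1 this
    linarith
  · have : (z₁ t - z₂ t) ^ 2 = 0 := by nlinarith [sq_nonneg (y₁ t - y₂ t), sq_nonneg (z₁ t - z₂ t)]
    have := pow_eq_zero_iff (two_ne_zero) |>.1 this
    linarith

/-- Two profiles with the same value at the origin agree. -/
lemma eq_of_top_eq (h₁ : RadialSol y₁ z₁ α) (h₂ : RadialSol y₂ z₂ α) {t : ℝ} (ht : 0 < t) :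
    y₁ t = y₂ t := by
  let L := 2 + 3 * α ^ 2
  have hd := fun s (hs : 0 < s) => (((hasDerivAt_id s).const_mul (-L)).exp).mul
      (hasDerivAt_dist h₁.hy h₁.hz h₂.hy h₂.hz hs)
  have hm := antitoneOn_Ioi_of_hasDerivAt_nonpos hd (fun s hs => by
    have a1 := h₁.lt_top hs
    have a2 := h₂.lt_top hs
    have b1 := h₁.pos s hs
    have b2 := h₂.pos s hs
    have hc1 : 2 - (y₁ s ^ 2 + y₁ s * y₂ s + y₂ s ^ 2) ≤ L := by
      simp only [L]; nlinarith [mul_pos b1 b2, sq_nonneg (y₁ s), sq_nonneg (y₂ s), sq_nonneg α]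
    have hc2 : -L ≤ 2 - (y₁ s ^ 2 + y₁ s * y₂ s + y₂ s ^ 2) := by
      simp only [L]; nlinarith [mul_le_mul a1.le a2.le b2.le (by linarith)]
    generalize y₁ s - y₂ s = d at *
    generalize z₁ s - z₂ s = e at *
    generalize 2 - (y₁ s ^ 2 + y₁ s * y₂ s + y₂ s ^ 2) = c at *
    have h3 : 0 ≤ L * (d ^ 2 + e ^ 2) - 2 * d * e * c := by
      nlinarith [mul_nonneg (show 0 ≤ L + c by linarith) (sq_nonneg (d - e)),
        mul_nonneg (show 0 ≤ L - c by linarith) (sq_nonneg (d + e))]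
    have h4 : 0 ≤ 2 * e ^ 2 / s := by positivity
    have : 0 ≤ Real.exp (-L * id s) *
        ((L * (d ^ 2 + e ^ 2)) - (2 * d * e * c - 2 * e ^ 2 / s)) :=
      mul_nonneg (Real.exp_pos _).le (by linarith)
    linarith)
  have hlim : Tendsto (fun t => Real.exp (-L * t) * ((y₁ t - y₂ t) ^ 2 + (z₁ t - z₂ t) ^ 2))
      (𝓝[>] 0) (𝓝 0) := by
    have he : Tendsto (fun t : ℝ => Real.exp (-L * t)) (𝓝[>] 0) (𝓝 (Real.exp (-L * 0))) :=
      (Continuous.tendsto (by fun_prop) 0).mono_left nhdsWithin_le_nhds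
    have := he.mul (((h₁.y_zero.sub h₂.y_zero).pow 2).add ((h₁.z_zero.sub h₂.z_zero).pow 2))
    simpa using this
  have h1 : Real.exp (-L * t) * ((y₁ t - y₂ t) ^ 2 + (z₁ t - z₂ t) ^ 2) ≤ 0 := by
    refine ge_of_tendsto hlim ?_
    filter_upwards [Ioo_mem_nhdsGT ht] with s hs using hm hs.1 ht hs.2.le
  have h2 := nonpos_of_mul_nonpos_right h1 (Real.exp_pos _)
  nlinarith [sq_nonneg (y₁ t - y₂ t), sq_nonneg (z₁ t - z₂ t)]

lemma eq_of_lt_tail (h₁ : RadialSol y₁ z₁ α₁) (h₂ : RadialSol y₂ z₂ α₂) {T : ℝ} (hT : 1 ≤ T)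
    (hlt : ∀ t, T < t → y₂ t < y₁ t) : False := by
  have ha₁ := h₁.one_lt_top
  have ha₂ := h₂.one_lt_top
  have hm : 0 < min (y₂ (T + 1)) (min α₁ α₂) :=
    lt_min (h₂.pos _ (by linarith)) (lt_min (by linarith) (by linarith))
  have htop := h₁.branch.top_eq h₂.branch hm (fun u hu => by
    have hu1 : u ∈ Ioo 0 α₁ := ⟨hu.1, hu.2.trans_le ((min_le_right _ _).trans (min_le_left _ _))⟩
    have hu2 : u ∈ Ioo 0 α₂ := ⟨hu.1, hu.2.trans_le ((min_le_right _ _).trans (min_le_right _ _))⟩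
    have h3 := (h₂.lt_radius_iff (by linarith : 0 < T + 1) hu2).2 (hu.2.trans_le (min_le_left _ _))
    rw [h₁.lt_radius_iff (h₂.radius_pos hu2) hu1]
    have := hlt (radius y₂ u) (by linarith)
    rwa [h₂.y_radius hu2] at this)
  subst htop
  have := hlt (T + 1) (by linarith)
  rw [h₁.eq_of_top_eq h₂ (by linarith)] at this
  exact lt_irrefl _ this

/-- The positive decaying radial profile is unique. -/
theorem unique (h₁ : RadialSol y₁ z₁ α₁) (h₂ : RadialSol y₂ z₂ α₂) {t : ℝ} (ht : 0 < t) :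
    y₁ t = y₂ t := by
  obtain ⟨T₁, hT₁, hs₁⟩ := h₁.exists_tail
  obtain ⟨T₂, hT₂, hs₂⟩ := h₂.exists_tail
  let T := max T₁ T₂
  have hT : 1 ≤ T := hT₁.trans (le_max_left _ _)
  by_cases hmeet : ∃ t₀, T ≤ t₀ ∧ y₁ t₀ = y₂ t₀
  · obtain ⟨t₀, ht₀, h0⟩ := hmeet
    have htail := h₁.eq_tail h₂ hT (fun t ht => hs₁ t ((le_max_left _ _).trans ht))
      (fun t ht => hs₂ t ((le_max_right _ _).trans ht)) ht₀ h0
    rcases le_or_gt t (t₀ + 1) with h | h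
    · obtain ⟨e1, e2⟩ := htail (t₀ + 1) (by linarith)
      exact eq_of_eq_right h₁.hy h₁.hz h₂.hy h₂.hz ht h e1 e2
    · exact (htail t (by linarith)).1
  · push Not at hmeet
    exfalso
    have hpre : IsPreconnected (Ioi T) := isPreconnected_Ioi
    have hc₁ : ContinuousOn y₁ (Ioi T) := h₁.cont_y.mono (Ioi_subset_Ioi (by linarith))
    have hc₂ : ContinuousOn y₂ (Ioi T) := h₂.cont_y.mono (Ioi_subset_Ioi (by linarith))
    have key : (∀ t, T < t → y₂ t < y₁ t) ∨ (∀ t, T < t → y₁ t < y₂ t) := by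
      by_contra! hcon
      obtain ⟨⟨a, ha, ha'⟩, b, hb, hb'⟩ := hcon
      obtain ⟨t, ht, hte⟩ := hpre.intermediate_value₂ ha hb hc₁ hc₂ ha' hb'
      exact hmeet t (le_of_lt ht) hte
    rcases key with h | h
    · exact h₁.eq_of_lt_tail h₂ hT h
    · exact h₂.eq_of_lt_tail h₁ hT h

end RadialSol

lemma sq_lintegral_mul_le {X : Type*} [MeasurableSpace X] {μ : Measure X} {f g : X → ℝ≥0∞}
    (hf : AEMeasurable f μ) (hg : AEMeasurable g μ) :
    (∫⁻ x, f x * g x ∂μ) ^ 2 ≤ (∫⁻ x, f x ^ 2 ∂μ) * ∫⁻ x, g x ^ 2 ∂μ := by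
  have h := ENNReal.lintegral_mul_le_Lp_mul_Lq μ Real.HolderConjugate.two_two hf hg
  simp only [Pi.mul_apply, ENNReal.rpow_two] at h
  calc (∫⁻ x, f x * g x ∂μ) ^ 2
      ≤ ((∫⁻ x, f x ^ 2 ∂μ) ^ (1 / 2 : ℝ) * (∫⁻ x, g x ^ 2 ∂μ) ^ (1 / 2 : ℝ)) ^ 2 := by gcongr
    _ = _ := by
      rw [mul_pow, ← ENNReal.rpow_natCast, ← ENNReal.rpow_natCast, ← ENNReal.rpow_mul,
        ← ENNReal.rpow_mul]
      norm_num

lemma sq_lintegral_le {X : Type*} [MeasurableSpace X] {μ : Measure X} [IsProbabilityMeasure μ]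
    {g : X → ℝ≥0∞} (hg : AEMeasurable g μ) :
    (∫⁻ x, g x ∂μ) ^ 2 ≤ ∫⁻ x, g x ^ 2 ∂μ := by
  have := sq_lintegral_mul_le (μ := μ) (f := fun _ => 1) (g := g) aemeasurable_const hg
  simpa using this

lemma ENNReal.add_sq_le (a b : ℝ≥0∞) : (a + b) ^ 2 ≤ 2 * a ^ 2 + 2 * b ^ 2 := by
  rcases eq_or_ne a ∞ with rfl | ha
  · simp
  rcases eq_or_ne b ∞ with rfl | hb
  · simp
  lift a to NNReal using ha
  lift b to NNReal using hb
  norm_cast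
  rw [← NNReal.coe_le_coe]
  push_cast
  nlinarith [sq_nonneg ((a : ℝ) - b)]

lemma enorm_add_sq_le {E : Type*} [NormedAddCommGroup E] (a b : E) :
    ‖a + b‖ₑ ^ 2 ≤ 2 * ‖a‖ₑ ^ 2 + 2 * ‖b‖ₑ ^ 2 :=
  (pow_le_pow_left' (enorm_add_le a b) 2).trans (ENNReal.add_sq_le _ _)

lemma enorm_sub_sq_le {E : Type*} [NormedAddCommGroup E] (a b : E) :
    ‖a - b‖ₑ ^ 2 ≤ 2 * ‖a‖ₑ ^ 2 + 2 * ‖b‖ₑ ^ 2 := by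
  have := enorm_add_sq_le a (-b)
  rwa [← sub_eq_add_neg, enorm_neg] at this

lemma lintegral_comp_isometry (e : Plane ≃ₗᵢ[ℝ] Plane) (f : Plane → ℝ≥0∞) :
    ∫⁻ h, f (e h) = ∫⁻ h, f h :=
  e.measurePreserving.lintegral_comp_emb e.toHomeomorph.measurableEmbedding f

lemma lintegral_ball_comp_isometry (e : Plane ≃ₗᵢ[ℝ] Plane) (f : Plane → ℝ≥0∞) (ε : ℝ) :
    ∫⁻ h in ball (0 : Plane) ε, f (e h) = ∫⁻ h in ball (0 : Plane) ε, f h := by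
  rw [← lintegral_indicator measurableSet_ball, ← lintegral_indicator measurableSet_ball,
    ← lintegral_comp_isometry e ((ball (0 : Plane) ε).indicator f)]
  congr 1
  ext h
  simp [indicator]

lemma lintegral_comp_smul_plane (f : Plane → ℝ≥0∞) {τ : ℝ} (hτ : 0 < τ) :
    ∫⁻ x, f (τ • x) = ENNReal.ofReal (τ ^ 2)⁻¹ * ∫⁻ x, f x := by
  have h := Measure.map_addHaar_smul (volume : Measure Plane) hτ.ne'
  have e : MeasurableEmbedding (fun x : Plane => τ • x) :=
    (Homeomorph.smulOfNeZero τ hτ.ne').measurableEmbedding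
  rw [← e.lintegral_map, h, lintegral_smul_measure]
  simp [abs_of_pos hτ]

/-- The second moment of a coordinate over a ball. -/
def mom (ε : ℝ) : ℝ≥0∞ := ∫⁻ h in ball (0 : Plane) ε, ‖h 0‖ₑ ^ 2

lemma mom_eq {ε : ℝ} (hε : 0 < ε) : mom ε = ENNReal.ofReal (ε ^ 4) * mom 1 := by
  have h := lintegral_comp_smul_plane
    ((ball (0 : Plane) ε).indicator fun h => ‖h 0‖ₑ ^ 2) hε
  have h2 : ∀ x : Plane, (ball (0 : Plane) ε).indicator (fun h => ‖h 0‖ₑ ^ 2) (ε • x)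
      = ENNReal.ofReal (ε ^ 2) * (ball (0 : Plane) 1).indicator (fun h => ‖h 0‖ₑ ^ 2) x := by
    intro x
    have : ε • x ∈ ball (0 : Plane) ε ↔ x ∈ ball (0 : Plane) 1 := by
      simp only [mem_ball_zero_iff, norm_smul, Real.norm_eq_abs, abs_of_pos hε]
      exact mul_lt_iff_lt_one_right hε
    by_cases hx : x ∈ ball (0 : Plane) 1
    · rw [indicator_of_mem hx, indicator_of_mem (this.2 hx)]
      simp [enorm_mul, mul_pow, Real.enorm_eq_ofReal hε.le, ENNReal.ofReal_pow hε.le]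
    · rw [indicator_of_notMem hx, indicator_of_notMem (fun h => hx (this.1 h)), mul_zero]
  simp only [h2] at h
  rw [lintegral_const_mul' _ _ ENNReal.ofReal_ne_top, lintegral_indicator measurableSet_ball,
    lintegral_indicator measurableSet_ball] at h
  change ENNReal.ofReal (ε ^ 2) * mom 1 = ENNReal.ofReal (ε ^ 2)⁻¹ * mom ε at h
  have h3 : ENNReal.ofReal (ε ^ 2) * ENNReal.ofReal (ε ^ 2)⁻¹ = 1 := by
    rw [← ENNReal.ofReal_mul (by positivity), mul_inv_cancel₀ (by positivity), ENNReal.ofReal_one]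
  calc mom ε = (ENNReal.ofReal (ε ^ 2) * ENNReal.ofReal (ε ^ 2)⁻¹) * mom ε := by rw [h3, one_mul]
    _ = ENNReal.ofReal (ε ^ 2) * (ENNReal.ofReal (ε ^ 2) * mom 1) := by rw [mul_assoc, ← h]
    _ = _ := by rw [← mul_assoc, ← ENNReal.ofReal_mul (by positivity)]; ring_nf

lemma enorm_coord_le (h : Plane) (i : Fin 2) : ‖h i‖ₑ ≤ ‖h‖ₑ := by
  rw [enorm_le_iff_norm_le]; exact PiLp.norm_apply_le h i

lemma mom_lt_top (ε : ℝ) : mom ε < ∞ := by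
  calc mom ε ≤ ∫⁻ h in ball (0 : Plane) ε, ENNReal.ofReal ε ^ 2 := by
        refine setLIntegral_mono measurable_const fun h hh => ?_
        gcongr
        refine (enorm_coord_le h 0).trans ?_
        rw [← ofReal_norm]
        exact ENNReal.ofReal_le_ofReal (mem_ball_zero_iff.1 hh).le
    _ < ∞ := by
        rw [setLIntegral_const]
        exact ENNReal.mul_lt_top (by finiteness) measure_ball_lt_top

lemma mom_ne_top (ε : ℝ) : mom ε ≠ ∞ := (mom_lt_top ε).ne

lemma mom_ne_zero {ε : ℝ} (hε : 0 < ε) : mom ε ≠ 0 := by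
  intro h
  have hm : Measurable fun h : Plane => ‖h 0‖ₑ ^ 2 := by fun_prop
  rw [mom, lintegral_eq_zero_iff hm, Filter.EventuallyEq, ae_restrict_iff' measurableSet_ball] at h
  have hopen : IsOpen (ball (0 : Plane) ε ∩ {h | h 0 ≠ 0}) :=
    isOpen_ball.inter (isOpen_ne_fun (by fun_prop) (by fun_prop))
  have hne : (ball (0 : Plane) ε ∩ {h | h 0 ≠ 0}).Nonempty := by
    refine ⟨(ε / 2) • e0, ?_, ?_⟩
    · rw [mem_ball_zero_iff, norm_smul]
      simp [e0, abs_of_pos hε]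
      linarith
    · simp [e0, hε.ne']
  have := hopen.measure_pos volume hne
  refine this.ne' (measure_mono_null ?_ (ae_iff.1 h))
  rintro x ⟨hx, hx0⟩
  simp only [mem_ofPred_eq, Pi.zero_apply, Classical.not_imp]
  refine ⟨hx, ?_⟩
  simpa using hx0

/-- Reflection in the first coordinate axis. -/
def flip1 : Plane ≃ₗᵢ[ℝ] Plane := (ℝ ∙ e0).reflection

lemma flip1_apply (h : Plane) : flip1 h 0 = h 0 ∧ flip1 h 1 = - h 1 := by
  have : flip1 h = 2 • (inner ℝ e0 h / (‖e0‖ : ℝ) ^ 2) • e0 - h :=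
    Submodule.reflection_singleton_apply e0 h
  rw [this]
  simp [e0, EuclideanSpace.inner_single_left]
  ring

/-- Exchange of the two coordinates. -/
def swap01 : Plane ≃ₗᵢ[ℝ] Plane := LinearIsometryEquiv.piLpCongrLeft 2 ℝ ℝ (Equiv.swap 0 1)

lemma swap01_apply (h : Plane) : swap01 h 0 = h 1 ∧ swap01 h 1 = h 0 := by
  constructor <;> simp [swap01, LinearIsometryEquiv.piLpCongrLeft_apply, Equiv.piCongrLeft']

lemma mom_eq_one_coord (ε : ℝ) : ∫⁻ h in ball (0 : Plane) ε, ‖h 1‖ₑ ^ 2 = mom ε := by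
  rw [mom, ← lintegral_ball_comp_isometry swap01]
  simp [swap01_apply]

lemma lintegral_ball_linear {E : Type*} [NormedAddCommGroup E] [InnerProductSpace ℝ E]
    (A B : E) (ε : ℝ) :
    ∫⁻ h in ball (0 : Plane) ε, ‖h 0 • A + h 1 • B‖ₑ ^ 2 = (‖A‖ₑ ^ 2 + ‖B‖ₑ ^ 2) * mom ε := by
  have key : ∀ x y : E, ‖x + y‖ₑ ^ 2 + ‖x - y‖ₑ ^ 2 = 2 * (‖x‖ₑ ^ 2 + ‖y‖ₑ ^ 2) := by
    intro x y
    simp only [← ofReal_norm, ← ENNReal.ofReal_pow (norm_nonneg _)]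
    rw [← ENNReal.ofReal_add (by positivity) (by positivity),
      ← ENNReal.ofReal_add (by positivity) (by positivity),
      show (2 : ℝ≥0∞) = ENNReal.ofReal 2 by simp, ← ENNReal.ofReal_mul (by positivity)]
    congr 1
    have := parallelogram_law_with_norm ℝ x y
    nlinarith
  have h1 : ∫⁻ h in ball (0 : Plane) ε, ‖h 0 • A - h 1 • B‖ₑ ^ 2
      = ∫⁻ h in ball (0 : Plane) ε, ‖h 0 • A + h 1 • B‖ₑ ^ 2 := by
    rw [← lintegral_ball_comp_isometry flip1]
    simp [flip1_apply, sub_neg_eq_add]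
  have hm : Measurable fun h : Plane => ‖h 0 • A + h 1 • B‖ₑ ^ 2 := by
    have : Continuous fun h : Plane => ‖h 0 • A + h 1 • B‖ₑ ^ 2 :=
      (ENNReal.continuous_pow 2).comp (by fun_prop)
    exact this.measurable
  have h2 : 2 * ∫⁻ h in ball (0 : Plane) ε, ‖h 0 • A + h 1 • B‖ₑ ^ 2
      = 2 * ((‖A‖ₑ ^ 2 + ‖B‖ₑ ^ 2) * mom ε) := by
    calc _ = (∫⁻ h in ball (0 : Plane) ε, ‖h 0 • A + h 1 • B‖ₑ ^ 2)
          + ∫⁻ h in ball (0 : Plane) ε, ‖h 0 • A - h 1 • B‖ₑ ^ 2 := by rw [h1, two_mul]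
      _ = ∫⁻ h in ball (0 : Plane) ε, 2 * (‖A‖ₑ ^ 2 * ‖h 0‖ₑ ^ 2 + ‖B‖ₑ ^ 2 * ‖h 1‖ₑ ^ 2) := by
          rw [← lintegral_add_left hm]
          congr 1; ext h
          rw [key, enorm_smul, enorm_smul]
          ring
      _ = _ := by
          rw [lintegral_const_mul' _ _ (by simp), lintegral_add_left (by fun_prop),
            lintegral_const_mul' _ _ (by finiteness), lintegral_const_mul' _ _ (by finiteness),
            mom_eq_one_coord, ← mom, add_mul]
  exact (ENNReal.mul_right_inj (by simp) (by simp)).1 h2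

/-- The squared `L²` norm of an increment. -/
def incr (f : Plane → ℝ) (h : Plane) : ℝ≥0∞ := ∫⁻ x, ‖f (x + h) - f x‖ₑ ^ 2

/-- A quantitative form of `∫ |∇f|² ≤ K` which does not refer to derivatives. -/
def EnergyLE (f : Plane → ℝ) (K : ℝ≥0∞) : Prop :=
  ∀ ε > 0, ∫⁻ h in ball (0 : Plane) ε, incr f h ≤ K * mom ε

lemma measurable_incr {f : Plane → ℝ} (hf : Measurable f) : Measurable (incr f) := by
  unfold incr
  apply Measurable.lintegral_prod_right' (f := fun p : Plane × Plane => ‖f (p.2 + p.1) - f p.2‖ₑ ^ 2)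
  fun_prop

lemma incr_translate (f : Plane → ℝ) (c h : Plane) :
    ∫⁻ x, ‖f (x + c + h) - f (x + c)‖ₑ ^ 2 = incr f h :=
  lintegral_add_right_eq_self (fun x => ‖f (x + h) - f x‖ₑ ^ 2) c

lemma incr_le_two (f : Plane → ℝ) (hf : Measurable f) (y h : Plane) :
    incr f y ≤ 2 * incr f h + 2 * incr f (y - h) := by
  have hm : Measurable fun x => 2 * ‖f (x + h) - f x‖ₑ ^ 2 := by fun_prop
  rw [← incr_translate f h (y - h)]
  unfold incr
  rw [← lintegral_const_mul' _ _ (by simp), ← lintegral_const_mul' _ _ (by simp),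
    ← lintegral_add_left hm]
  refine lintegral_mono fun x => ?_
  have := enorm_add_sq_le (f (x + h) - f x) (f (x + h + (y - h)) - f (x + h))
  refine le_trans (le_of_eq ?_) this
  congr 2
  have : x + h + (y - h) = x + y := by abel
  rw [this]; ring

/-- The constant in the quadratic bound for increments. -/
def incrConst : ℝ≥0∞ := 64 * mom 1 / volume (ball (0 : Plane) 1)

lemma incrConst_ne_top : incrConst ≠ ∞ :=
  ENNReal.div_ne_top (ENNReal.mul_ne_top (by simp) (mom_ne_top 1))
    (measure_ball_pos volume _ one_pos).ne'

lemma EnergyLE.incr_le {f : Plane → ℝ} {K : ℝ≥0∞} (hf : Measurable f) (hK : EnergyLE f K)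
    (y : Plane) : incr f y ≤ incrConst * K * ENNReal.ofReal (‖y‖ ^ 2) := by
  rcases eq_or_ne y 0 with rfl | hy
  · simp [incr]
  have hr : 0 < ‖y‖ := norm_pos_iff.2 hy
  set r := ‖y‖
  have hv : volume (ball (0 : Plane) r) = ENNReal.ofReal (r ^ 2) * volume (ball (0 : Plane) 1) := by
    have := Measure.addHaar_ball_of_pos (volume : Measure Plane) 0 hr
    simpa using this
  have hmono : mom r ≤ mom (2 * r) :=
    lintegral_mono_set (ball_subset_ball (by linarith))
  have h1 : incr f y * volume (ball (0 : Plane) r) ≤ 4 * K * mom (2 * r) := by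
    calc incr f y * volume (ball (0 : Plane) r)
        = ∫⁻ h in ball (0 : Plane) r, incr f y := by rw [setLIntegral_const]
      _ ≤ ∫⁻ h in ball (0 : Plane) r, (2 * incr f h + 2 * incr f (y - h)) :=
          lintegral_mono fun h => incr_le_two f hf y h
      _ = 2 * (∫⁻ h in ball (0 : Plane) r, incr f h)
          + 2 * ∫⁻ h in ball (0 : Plane) r, incr f (y - h) := by
          rw [lintegral_add_left ((measurable_incr hf).const_mul 2),
            lintegral_const_mul' _ _ (by simp), lintegral_const_mul' _ _ (by simp)]
      _ ≤ 2 * (K * mom (2 * r)) + 2 * (K * mom (2 * r)) := by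
          gcongr 2 * ?_ + 2 * ?_
          · exact (hK r hr).trans (by gcongr)
          · refine le_trans ?_ (hK (2 * r) (by positivity))
            rw [← lintegral_indicator measurableSet_ball, ← lintegral_indicator measurableSet_ball,
              ← lintegral_sub_left_eq_self ((ball (0 : Plane) (2 * r)).indicator (incr f)) y]
            refine lintegral_mono fun h => ?_
            by_cases hh : h ∈ ball (0 : Plane) r
            · have : y - h ∈ ball (0 : Plane) (2 * r) := by
                rw [mem_ball_zero_iff] at hh ⊢
                calc ‖y - h‖ ≤ ‖y‖ + ‖h‖ := norm_sub_le _ _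
                  _ < 2 * r := by linarith
              rw [indicator_of_mem hh, indicator_of_mem this]
            · rw [indicator_of_notMem hh]; exact zero_le
      _ = 4 * K * mom (2 * r) := by ring
  have hv0 : volume (ball (0 : Plane) r) ≠ 0 := (measure_ball_pos volume _ hr).ne'
  have hvt : volume (ball (0 : Plane) r) ≠ ∞ := measure_ball_lt_top.ne
  have hv1 : volume (ball (0 : Plane) 1) ≠ 0 := (measure_ball_pos volume _ one_pos).ne'
  have hv1t : volume (ball (0 : Plane) 1) ≠ ∞ := measure_ball_lt_top.ne
  refine (ENNReal.le_div_iff_mul_le (Or.inl hv0) (Or.inl hvt)).2 h1 |>.trans (le_of_eq ?_)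
  rw [mom_eq (by positivity), hv, incrConst,
    show (2 * r) ^ 4 = 16 * (r ^ 2) * r ^ 2 by ring, ENNReal.ofReal_mul (by positivity),
    ENNReal.ofReal_mul (by positivity)]
  have hr0 : ENNReal.ofReal (r ^ 2) ≠ 0 := by simp [hr.ne']
  rw [div_eq_mul_inv, div_eq_mul_inv, ENNReal.mul_inv (Or.inl hr0) (Or.inl ENNReal.ofReal_ne_top)]
  have : ENNReal.ofReal (r ^ 2) * (ENNReal.ofReal (r ^ 2))⁻¹ = 1 :=
    ENNReal.mul_inv_cancel hr0 ENNReal.ofReal_ne_top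
  have h16 : ENNReal.ofReal 16 = 16 := by simp
  rw [h16]
  calc _ = 64 * mom 1 * (volume (ball (0 : Plane) 1))⁻¹ * K * ENNReal.ofReal (r ^ 2)
        * (ENNReal.ofReal (r ^ 2) * (ENNReal.ofReal (r ^ 2))⁻¹) := by ring
    _ = _ := by rw [this, mul_one]

lemma EnergyLE.of_incr_le {f g : Plane → ℝ} {K : ℝ≥0∞} (hK : EnergyLE f K)
    (h : ∀ y, incr g y ≤ incr f y) : EnergyLE g K :=
  fun ε hε => (lintegral_mono fun y => h y).trans (hK ε hε)

lemma EnergyLE.translate {f : Plane → ℝ} {K : ℝ≥0∞} (hK : EnergyLE f K) (c : Plane) :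
    EnergyLE (fun x => f (x + c)) K := by
  refine hK.of_incr_le fun y => le_of_eq ?_
  rw [← incr_translate f c y, incr]
  simp only [add_right_comm]

lemma EnergyLE.const_mul {f : Plane → ℝ} {K : ℝ≥0∞} (hK : EnergyLE f K) (c : ℝ) :
    EnergyLE (fun x => c * f x) (‖c‖ₑ ^ 2 * K) := by
  have : ∀ y, incr (fun x => c * f x) y = ‖c‖ₑ ^ 2 * incr f y := by
    intro y
    unfold incr
    rw [← lintegral_const_mul' _ _ (by finiteness)]
    congr 1; ext x
    rw [← mul_sub, enorm_mul, mul_pow]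
  intro ε hε
  simp only [this]
  rw [lintegral_const_mul' _ _ (by finiteness), mul_assoc]
  gcongr
  exact hK ε hε

lemma incr_comp_smul (f : Plane → ℝ) {τ : ℝ} (hτ : 0 < τ) (y : Plane) :
    incr (fun x => f (τ • x)) y = ENNReal.ofReal (τ ^ 2)⁻¹ * incr f (τ • y) := by
  unfold incr
  rw [← lintegral_comp_smul_plane (fun x => ‖f (x + τ • y) - f x‖ₑ ^ 2) hτ]
  simp only [smul_add]

lemma EnergyLE.comp_smul {f : Plane → ℝ} {K : ℝ≥0∞} (hK : EnergyLE f K) {τ : ℝ} (hτ : 0 < τ) :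
    EnergyLE (fun x => f (τ • x)) K := by
  intro ε hε
  simp only [incr_comp_smul f hτ]
  rw [lintegral_const_mul' _ _ ENNReal.ofReal_ne_top]
  have h1 : ∫⁻ h in ball (0 : Plane) ε, incr f (τ • h)
      = ENNReal.ofReal (τ ^ 2)⁻¹ * ∫⁻ h in ball (0 : Plane) (τ * ε), incr f h := by
    rw [← lintegral_indicator measurableSet_ball, ← lintegral_indicator measurableSet_ball,
      ← lintegral_comp_smul_plane _ hτ]
    congr 1; ext h
    have : τ • h ∈ ball (0 : Plane) (τ * ε) ↔ h ∈ ball (0 : Plane) ε := by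
      simp only [mem_ball_zero_iff, norm_smul, Real.norm_eq_abs, abs_of_pos hτ]
      exact mul_lt_mul_iff_right₀ hτ
    by_cases hh : h ∈ ball (0 : Plane) ε
    · rw [indicator_of_mem hh, indicator_of_mem (this.2 hh)]
    · rw [indicator_of_notMem hh, indicator_of_notMem fun h' => hh (this.1 h')]
  rw [h1]
  calc _ ≤ ENNReal.ofReal (τ ^ 2)⁻¹ * (ENNReal.ofReal (τ ^ 2)⁻¹ * (K * mom (τ * ε))) := by
        gcongr; exact hK _ (by positivity)
    _ = (ENNReal.ofReal (τ ^ 2)⁻¹ * ENNReal.ofReal (τ ^ 2)⁻¹ * ENNReal.ofReal (τ ^ 4)) *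
        (K * mom ε) := by
        rw [mom_eq (by positivity), mom_eq hε, mul_pow, ENNReal.ofReal_mul (by positivity)]
        ring
    _ = K * mom ε := by
        rw [← ENNReal.ofReal_mul (by positivity), ← ENNReal.ofReal_mul (by positivity)]
        have : (τ ^ 2)⁻¹ * (τ ^ 2)⁻¹ * τ ^ 4 = 1 := by field_simp
        rw [this]; simp

lemma EnergyLE.sub {f g : Plane → ℝ} {K K' : ℝ≥0∞} (hf : Measurable f) (hK : EnergyLE f K)
    (hK' : EnergyLE g K') : EnergyLE (fun x => f x - g x) (2 * K + 2 * K') := by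
  have : ∀ y, incr (fun x => f x - g x) y ≤ 2 * incr f y + 2 * incr g y := by
    intro y
    have hm : Measurable fun x => 2 * ‖f (x + y) - f x‖ₑ ^ 2 := by fun_prop
    unfold incr
    rw [← lintegral_const_mul' _ _ (by simp), ← lintegral_const_mul' _ _ (by simp),
      ← lintegral_add_left hm]
    refine lintegral_mono fun x => ?_
    refine le_trans (le_of_eq ?_) (enorm_sub_sq_le (f (x + y) - f x) (g (x + y) - g x))
    congr 2; ring
  intro ε hε
  calc _ ≤ ∫⁻ h in ball (0 : Plane) ε, (2 * incr f h + 2 * incr g h) :=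
        lintegral_mono fun y => this y
    _ = 2 * (∫⁻ h in ball (0 : Plane) ε, incr f h)
          + 2 * ∫⁻ h in ball (0 : Plane) ε, incr g h := by
        rw [lintegral_add_left ((measurable_incr hf).const_mul 2),
          lintegral_const_mul' _ _ (by simp), lintegral_const_mul' _ _ (by simp)]
    _ ≤ 2 * (K * mom ε) + 2 * (K' * mom ε) := by
        gcongr 2 * ?_ + 2 * ?_
        · exact hK ε hε
        · exact hK' ε hε
    _ = _ := by ring

lemma ae_add_right {p : Plane → Prop} (h : ∀ᵐ x, p x) (c : Plane) : ∀ᵐ x, p (x + c) :=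
  (measurePreserving_add_right (volume : Measure Plane) c).quasiMeasurePreserving.ae h

lemma EnergyLE.of_tendsto {F : ℕ → Plane → ℝ} {f : Plane → ℝ} {K : ℕ → ℝ≥0∞} {K' : ℝ≥0∞}
    (hF : ∀ n, Measurable (F n)) (hlim : ∀ᵐ x, Tendsto (fun n => F n x) atTop (𝓝 (f x)))
    (hK : ∀ n, EnergyLE (F n) (K n)) (hK' : Tendsto K atTop (𝓝 K')) : EnergyLE f K' := by
  have h1 : ∀ y, incr f y ≤ liminf (fun n => incr (F n) y) atTop := by
    intro y
    unfold incr
    calc _ = ∫⁻ x, liminf (fun n => ‖F n (x + y) - F n x‖ₑ ^ 2) atTop := by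
          refine lintegral_congr_ae ?_
          filter_upwards [hlim, ae_add_right hlim y] with x hx hxy
          exact (((ENNReal.continuous_pow 2).tendsto _).comp (hxy.sub hx).enorm).liminf_eq.symm
      _ ≤ _ := lintegral_liminf_le fun n => by have := hF n; fun_prop
  intro ε hε
  calc _ ≤ ∫⁻ h in ball (0 : Plane) ε, liminf (fun n => incr (F n) h) atTop :=
        lintegral_mono fun y => h1 y
    _ ≤ liminf (fun n => ∫⁻ h in ball (0 : Plane) ε, incr (F n) h) atTop :=
        lintegral_liminf_le fun n => measurable_incr (hF n)
    _ ≤ liminf (fun n => K n * mom ε) atTop :=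
        liminf_le_liminf (Eventually.of_forall fun n => hK n ε hε)
    _ = K' * mom ε := (ENNReal.Tendsto.mul_const hK' (Or.inr (mom_ne_top ε))).liminf_eq

/-- The average of the translates of `f` with respect to `ν`. -/
def avg (ν : Measure Plane) (f : Plane → ℝ) (x : Plane) : ℝ := ∫ y, f (x - y) ∂ν

section avg
variable {ν : Measure Plane} [IsProbabilityMeasure ν] {f : Plane → ℝ}

lemma lintegral_sq_integral_le {G : Plane → Plane → ℝ} (hG : Measurable (Function.uncurry G)) :
    ∫⁻ x, ‖∫ y, G x y ∂ν‖ₑ ^ 2 ≤ ∫⁻ y, (∫⁻ x, ‖G x y‖ₑ ^ 2) ∂ν := by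
  calc ∫⁻ x, ‖∫ y, G x y ∂ν‖ₑ ^ 2 ≤ ∫⁻ x, ∫⁻ y, ‖G x y‖ₑ ^ 2 ∂ν := by
        refine lintegral_mono fun x => ?_
        refine (pow_le_pow_left' (enorm_integral_le_lintegral_enorm _) 2).trans ?_
        exact sq_lintegral_le (hG.of_uncurry_left (x := x)).enorm.aemeasurable
    _ = _ := by
        rw [lintegral_lintegral_swap]
        exact (hG.enorm.pow_const 2).aemeasurable

lemma lintegral_avg_sq_le (hf : Measurable f) :
    ∫⁻ x, ‖avg ν f x‖ₑ ^ 2 ≤ ∫⁻ x, ‖f x‖ₑ ^ 2 := by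
  refine (lintegral_sq_integral_le (G := fun x y => f (x - y)) (by fun_prop)).trans ?_
  simp only [lintegral_sub_right_eq_self (fun x => ‖f x‖ₑ ^ 2)]
  simp

lemma measurable_avg (hf : Measurable f) : Measurable (avg ν f) := by
  have : StronglyMeasurable (Function.uncurry fun x y : Plane => f (x - y)) :=
    (hf.comp (measurable_fst.sub measurable_snd)).stronglyMeasurable
  exact this.integral_prod_right.measurable

lemma incr_avg_le (hf : Measurable f) (hi : ∀ x, Integrable (fun y => f (x - y)) ν)
    (h : Plane) : incr (avg ν f) h ≤ incr f h := by
  have h1 : ∀ x, avg ν f (x + h) - avg ν f x = ∫ y, (f (x - y + h) - f (x - y)) ∂ν := by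
    intro x
    have e : ∀ y, x - y + h = x + h - y := fun y => by abel
    simp only [avg, e]
    exact (integral_sub (hi _) (hi _)).symm
  unfold incr
  simp only [h1]
  refine (lintegral_sq_integral_le (G := fun x y => f (x - y + h) - f (x - y))
    (by fun_prop)).trans ?_
  simp only [lintegral_sub_right_eq_self (fun x => ‖f (x + h) - f x‖ₑ ^ 2)]
  simp

lemma EnergyLE.avg {K : ℝ≥0∞} (hK : EnergyLE f K) (hf : Measurable f)
    (hi : ∀ x, Integrable (fun y => f (x - y)) ν) : EnergyLE (avg ν f) K :=
  hK.of_incr_le (incr_avg_le hf hi)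

lemma lintegral_avg_sub_sq_le (hf : Measurable f) (hi : ∀ x, Integrable (fun y => f (x - y)) ν) :
    ∫⁻ x, ‖avg ν f x - f x‖ₑ ^ 2 ≤ ∫⁻ y, incr f (-y) ∂ν := by
  have h1 : ∀ x, avg ν f x - f x = ∫ y, (f (x - y) - f x) ∂ν := by
    intro x
    rw [integral_sub (hi x) (integrable_const _)]
    simp [_root_.avg]
  simp only [h1]
  refine (lintegral_sq_integral_le (G := fun x y => f (x - y) - f x) (by fun_prop)).trans ?_
  simp only [incr, sub_eq_add_neg, le_refl]

lemma EnergyLE.lintegral_avg_sub_sq_le {K : ℝ≥0∞} (hK : EnergyLE f K) (hf : Measurable f)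
    (hi : ∀ x, Integrable (fun y => f (x - y)) ν) {η : ℝ} (hν : ∀ᵐ y ∂ν, y ∈ ball (0 : Plane) η) :
    ∫⁻ x, ‖_root_.avg ν f x - f x‖ₑ ^ 2 ≤ incrConst * K * ENNReal.ofReal (η ^ 2) := by
  refine (_root_.lintegral_avg_sub_sq_le hf hi).trans ?_
  calc _ ≤ ∫⁻ y, incrConst * K * ENNReal.ofReal (η ^ 2) ∂ν := by
        refine lintegral_mono_ae ?_
        filter_upwards [hν] with y hy
        refine (hK.incr_le hf _).trans ?_
        rw [norm_neg]
        gcongr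
        exact (mem_ball_zero_iff.1 hy).le
    _ = _ := by simp

end avg

lemma exists_mollifier {η : ℝ} (hη : 0 < η) : ∃ ν : Measure Plane, IsProbabilityMeasure ν ∧
    (∀ᵐ y ∂ν, y ∈ ball (0 : Plane) η) ∧ ∀ f : Plane → ℝ, LocallyIntegrable f →
      (∀ x, Integrable (fun y => f (x - y)) ν) ∧ ContDiff ℝ 1 (avg ν f) := by
  let φ : ContDiffBump (0 : Plane) := ⟨η / 2, η, by linarith, by linarith⟩
  have hc : Continuous (φ.normed volume) := φ.continuous_normed
  let ρ : Plane → ℝ≥0∞ := fun y => ENNReal.ofReal (φ.normed volume y)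
  have hρm : Measurable ρ := hc.measurable.ennreal_ofReal
  refine ⟨volume.withDensity ρ, ⟨?_⟩, ?_, ?_⟩
  · rw [withDensity_apply _ MeasurableSet.univ, setLIntegral_univ,
      ← ofReal_integral_eq_lintegral_ofReal φ.integrable_normed
      (ae_of_all _ fun x => φ.nonneg_normed x), φ.integral_normed, ENNReal.ofReal_one]
  · rw [ae_withDensity_iff hρm]
    refine ae_of_all _ fun x hx => ?_
    by_contra hn
    apply hx
    have : x ∉ Function.support (φ.normed volume) := by rwa [φ.support_normed_eq]
    simp only [Function.mem_support, not_not] at this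
    simp [ρ, this]
  · intro f hf
    have h_int : ∀ x, Integrable (fun y => φ.normed volume y • f (x - y)) := by
      intro x
      exact (φ.hasCompactSupport_normed.convolutionExists_left (ContinuousLinearMap.lsmul ℝ ℝ)
        hc hf x)
    have e : avg (volume.withDensity ρ) f
        = convolution (φ.normed volume) f (ContinuousLinearMap.lsmul ℝ ℝ) volume := by
      ext x
      simp only [avg, convolution, ContinuousLinearMap.lsmul_apply]
      rw [integral_withDensity_eq_integral_toReal_smul hρm (by simp [ρ])]
      simp [ρ, ENNReal.toReal_ofReal (φ.nonneg_normed _)]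
    refine ⟨fun x => ?_, ?_⟩
    · rw [integrable_withDensity_iff_integrable_smul' hρm (by simp [ρ])]
      simpa [ρ, ENNReal.toReal_ofReal (φ.nonneg_normed _)] using h_int x
    · rw [e]
      exact φ.hasCompactSupport_normed.contDiff_convolution_left _ φ.contDiff_normed hf

lemma plane_eq (h : Plane) : h = h 0 • e0 + h 1 • e1 := by
  ext i
  fin_cases i <;> simp [e0, e1]

lemma fderiv_apply_eq {E : Type*} [NormedAddCommGroup E] [NormedSpace ℝ E]
    (L : Plane →L[ℝ] E) (h : Plane) : L h = h 0 • L e0 + h 1 • L e1 := by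
  conv_lhs => rw [plane_eq h]
  simp

lemma lintegral_ball_lintegral_linear {E : Type*} [NormedAddCommGroup E] [InnerProductSpace ℝ E]
    [MeasurableSpace E] [BorelSpace E] [SecondCountableTopology E]
    {A B : Plane → E} (hA : Measurable A) (hB : Measurable B) (ε : ℝ) :
    ∫⁻ h in ball (0 : Plane) ε, ∫⁻ x, ‖h 0 • A x + h 1 • B x‖ₑ ^ 2
      = (∫⁻ x, (‖A x‖ₑ ^ 2 + ‖B x‖ₑ ^ 2)) * mom ε := by
  rw [lintegral_lintegral_swap, ← lintegral_mul_const' _ _ (mom_ne_top ε)]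
  · simp only [lintegral_ball_linear]
  · apply Measurable.aemeasurable
    apply Measurable.pow_const
    apply Measurable.enorm
    fun_prop

lemma EnergyLE.lintegral_deriv_le {f : Plane → ℝ} {K : ℝ≥0∞} (hK : EnergyLE f K)
    (hf : Differentiable ℝ f) :
    ∫⁻ x, (‖fderiv ℝ f x e0‖ₑ ^ 2 + ‖fderiv ℝ f x e1‖ₑ ^ 2) ≤ K := by
  have hm : Measurable f := hf.continuous.measurable
  let s : ℕ → ℝ := fun n => 1 / ((n : ℝ) + 1)
  have hs : ∀ n, 0 < s n := fun n => by positivity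
  have hs0 : Tendsto s atTop (𝓝 0) := tendsto_one_div_add_atTop_nhds_zero_nat
  let q : ℕ → Plane → Plane → ℝ := fun n h x => (s n)⁻¹ * (f (x + s n • h) - f x)
  have hqm : ∀ n, Measurable fun p : Plane × Plane => ‖q n p.1 p.2‖ₑ ^ 2 := fun n => by
    simp only [q]; fun_prop
  have hqm1 : ∀ n h, Measurable fun x => ‖q n h x‖ₑ ^ 2 := fun n h => by
    simp only [q]; fun_prop
  have hqm2 : ∀ n, Measurable fun h => ∫⁻ x, ‖q n h x‖ₑ ^ 2 := fun n =>
    Measurable.lintegral_prod_right' (f := fun p : Plane × Plane => ‖q n p.1 p.2‖ₑ ^ 2) (hqm n)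
  have hq : ∀ h x, Tendsto (fun n => q n h x) atTop (𝓝 (fderiv ℝ f x h)) := by
    intro h x
    have h1 := (hf x).hasFDerivAt.hasLineDerivAt h
    have h2 := hasDerivAt_iff_tendsto_slope_zero.1 h1
    have h3 : Tendsto s atTop (𝓝[≠] 0) := tendsto_nhdsWithin_iff.2
      ⟨hs0, Eventually.of_forall fun n => (hs n).ne'⟩
    have := h2.comp h3
    simpa [q, Function.comp_def] using this
  have hb : ∀ n, ∫⁻ h in ball (0 : Plane) 1, ∫⁻ x, ‖q n h x‖ₑ ^ 2 ≤ K * mom 1 := by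
    intro n
    refine le_trans (le_of_eq ?_) (hK.comp_smul (hs n) 1 one_pos)
    congr 1; ext h
    rw [incr_comp_smul f (hs n), incr, ← lintegral_const_mul' _ _ ENNReal.ofReal_ne_top]
    congr 1; ext x
    simp only [q]
    rw [enorm_mul, mul_pow, Real.enorm_eq_ofReal (inv_pos.2 (hs n)).le,
      ← ENNReal.ofReal_pow (inv_pos.2 (hs n)).le, inv_pow]
  have key : (∫⁻ x, (‖fderiv ℝ f x e0‖ₑ ^ 2 + ‖fderiv ℝ f x e1‖ₑ ^ 2)) * mom 1 ≤ K * mom 1 := by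
    rw [← lintegral_ball_lintegral_linear (measurable_fderiv_apply_const ℝ f e0)
      (measurable_fderiv_apply_const ℝ f e1)]
    calc _ = ∫⁻ h in ball (0 : Plane) 1, ∫⁻ x, liminf (fun n => ‖q n h x‖ₑ ^ 2) atTop := by
          congr 1; ext h; congr 1; ext x
          rw [← fderiv_apply_eq]
          exact (((ENNReal.continuous_pow 2).tendsto _).comp (hq h x).enorm).liminf_eq.symm
      _ ≤ ∫⁻ h in ball (0 : Plane) 1, liminf (fun n => ∫⁻ x, ‖q n h x‖ₑ ^ 2) atTop :=
          lintegral_mono fun h => lintegral_liminf_le fun n => hqm1 n h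
      _ ≤ liminf (fun n => ∫⁻ h in ball (0 : Plane) 1, ∫⁻ x, ‖q n h x‖ₑ ^ 2) atTop :=
          lintegral_liminf_le fun n => hqm2 n
      _ ≤ liminf (fun _ : ℕ => K * mom 1) atTop :=
          liminf_le_liminf (Eventually.of_forall hb)
      _ = _ := liminf_const _
  exact (ENNReal.mul_le_mul_iff_left (mom_ne_zero one_pos) (mom_ne_top 1)).1 key

lemma enorm_sub_le_lintegral_deriv {v v' : ℝ → ℂ} (hv : ∀ t, HasDerivAt v (v' t) t) :
    ‖v 1 - v 0‖ₑ ≤ ∫⁻ t in Ioc (0 : ℝ) 1, ‖v' t‖ₑ := by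
  have e : v' = deriv v := funext fun t => (hv t).deriv.symm
  by_cases h : ∫⁻ t in Ioc (0 : ℝ) 1, ‖v' t‖ₑ = ∞
  · rw [h]; exact le_top
  have hi : IntervalIntegrable v' volume 0 1 := by
    rw [intervalIntegrable_iff_integrableOn_Ioc_of_le zero_le_one]
    refine ⟨?_, lt_top_iff_ne_top.2 h⟩
    rw [e]; exact (measurable_deriv v).aestronglyMeasurable
  rw [← intervalIntegral.integral_eq_sub_of_hasDerivAt (fun t _ => hv t) hi,
    intervalIntegral.integral_of_le zero_le_one]
  exact enorm_integral_le_lintegral_enorm _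

/-- The components of the magnetic gradient `∇u - iκ x^⊥ u`. -/
def mag0 (κ : ℝ) (u : Plane → ℂ) (x : Plane) : ℂ := d0 u x - Complex.I * κ * (-(x 1) : ℝ) * u x
def mag1 (κ : ℝ) (u : Plane → ℂ) (x : Plane) : ℂ := d1 u x - Complex.I * κ * (x 0 : ℝ) * u x

lemma measurable_mag0 (κ : ℝ) {u : Plane → ℂ} (hu : Differentiable ℝ u) :
    Measurable (mag0 κ u) := by
  have h1 : Measurable (d0 u) := measurable_fderiv_apply_const ℝ u e0
  have h2 : Measurable u := hu.continuous.measurable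
  unfold mag0; fun_prop

lemma measurable_mag1 (κ : ℝ) {u : Plane → ℂ} (hu : Differentiable ℝ u) :
    Measurable (mag1 κ u) := by
  have h1 : Measurable (d1 u) := measurable_fderiv_apply_const ℝ u e1
  have h2 : Measurable u := hu.continuous.measurable
  unfold mag1; fun_prop

lemma enorm_norm_sub_le_lintegral_mag (κ : ℝ) {u : Plane → ℂ} (hu : Differentiable ℝ u)
    (x h : Plane) : ‖‖u (x + h)‖ - ‖u x‖‖ₑ
      ≤ ∫⁻ t in Ioc (0 : ℝ) 1, ‖h 0 • mag0 κ u (x + t • h) + h 1 • mag1 κ u (x + t • h)‖ₑ := by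
  set c : ℝ := κ * (-(x 1) * h 0 + x 0 * h 1)
  let g : ℝ → ℂ := fun t => Complex.exp (-(Complex.I * c * t))
  have hg : ∀ t, HasDerivAt g (-(Complex.I * c) * g t) t := by
    intro t
    have h1 : HasDerivAt (fun t : ℝ => -(Complex.I * c * (t : ℂ))) (-(Complex.I * c)) t := by
      have := ((hasDerivAt_id t).ofReal_comp.const_mul (Complex.I * c)).neg
      exact this.congr_deriv (by simp)
    exact h1.cexp.congr_deriv (by simp only [g]; ring)
  have hgn : ∀ t, ‖g t‖ = 1 := by
    intro t
    have : g t = Complex.exp (((-(c * t) : ℝ) : ℂ) * Complex.I) := by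
      simp only [g]; congr 1; push_cast; ring
    rw [this, Complex.norm_exp_ofReal_mul_I]
  have hu' : ∀ t : ℝ, HasDerivAt (fun t : ℝ => u (x + t • h)) (fderiv ℝ u (x + t • h) h) t := by
    intro t
    have h1 : HasDerivAt (fun t : ℝ => x + t • h) h t := by
      simpa using ((hasDerivAt_id t).smul_const h).const_add x
    exact (hu _).hasFDerivAt.comp_hasDerivAt t h1
  have hv := fun t => (hu' t).mul (hg t)
  have h1 := enorm_sub_le_lintegral_deriv hv
  have h2 : ‖‖u (x + h)‖ - ‖u x‖‖ₑ ≤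
      ‖u (x + (1 : ℝ) • h) * g 1 - u (x + (0 : ℝ) • h) * g 0‖ₑ := by
    rw [enorm_le_iff_norm_le]
    refine le_trans (le_of_eq ?_) (abs_norm_sub_norm_le _ _)
    rw [norm_mul, norm_mul, hgn, hgn]
    simp
  refine h2.trans (h1.trans (lintegral_mono fun t => le_of_eq ?_))
  rw [← ofReal_norm, ← ofReal_norm]
  congr 1
  have e : fderiv ℝ u (x + t • h) h * g t + u (x + t • h) * (-(Complex.I * c) * g t)
      = (h 0 • mag0 κ u (x + t • h) + h 1 • mag1 κ u (x + t • h)) * g t := by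
    rw [fderiv_apply_eq]
    simp only [mag0, mag1, d0, d1, c, Complex.real_smul, PiLp.add_apply, PiLp.smul_apply,
      smul_eq_mul]
    push_cast
    ring
  rw [e, norm_mul, hgn, mul_one]

lemma energyLE_norm (κ : ℝ) {u : Plane → ℂ} (hu : Differentiable ℝ u) :
    EnergyLE (fun x => ‖u x‖) (∫⁻ x, (‖mag0 κ u x‖ₑ ^ 2 + ‖mag1 κ u x‖ₑ ^ 2)) := by
  have h0 := measurable_mag0 κ hu
  have h1 := measurable_mag1 κ hu
  have key : ∀ h, incr (fun x => ‖u x‖) h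
      ≤ ∫⁻ x, ‖h 0 • mag0 κ u x + h 1 • mag1 κ u x‖ₑ ^ 2 := by
    intro h
    set D : Plane → ℂ := fun x => h 0 • mag0 κ u x + h 1 • mag1 κ u x
    have hD : Measurable D := by fun_prop
    have hp : IsProbabilityMeasure ((volume : Measure ℝ).restrict (Ioc 0 1)) := ⟨by simp⟩
    calc incr (fun x => ‖u x‖) h
        ≤ ∫⁻ x, ∫⁻ t in Ioc (0 : ℝ) 1, ‖D (x + t • h)‖ₑ ^ 2 := by
          refine lintegral_mono fun x => ?_
          refine (pow_le_pow_left' (enorm_norm_sub_le_lintegral_mag κ hu x h) 2).trans ?_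
          refine sq_lintegral_le (g := fun t : ℝ => ‖D (x + t • h)‖ₑ) ?_
          exact (hD.comp (by fun_prop)).enorm.aemeasurable
      _ = ∫⁻ t in Ioc (0 : ℝ) 1, ∫⁻ x, ‖D (x + t • h)‖ₑ ^ 2 := by
          rw [lintegral_lintegral_swap]
          apply Measurable.aemeasurable
          apply Measurable.pow_const
          apply Measurable.enorm
          exact hD.comp (f := fun p : Plane × ℝ => p.1 + p.2 • h) (by fun_prop)
      _ = _ := by
          simp only [fun c => lintegral_add_right_eq_self (μ := volume) (fun x => ‖D x‖ₑ ^ 2) c]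
          simp [D]
  intro ε hε
  rw [← lintegral_ball_lintegral_linear h0 h1]
  exact lintegral_mono fun h => key h

/-- The logarithmic interaction density. -/
def logDens (f : Plane → ℝ) (z : Plane × Plane) : ℝ :=
  Real.log ‖z.1 - z.2‖ * f z.1 ^ 2 * f z.2 ^ 2

def logPos (f : Plane → ℝ) : ℝ≥0∞ := ∫⁻ z, ENNReal.ofReal (logDens f z)
def logNeg (f : Plane → ℝ) : ℝ≥0∞ := ∫⁻ z, ENNReal.ofReal (-logDens f z)

/-- The logarithmic interaction energy as an integral over the product space. -/
def logEn (f : Plane → ℝ) : ℝ := ∫ z, logDens f z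

lemma measurable_logDens {f : Plane → ℝ} (hf : Measurable f) : Measurable (logDens f) := by
  unfold logDens; fun_prop

lemma integrable_logDens {f : Plane → ℝ} (hf : Measurable f) (hp : logPos f ≠ ∞)
    (hn : logNeg f ≠ ∞) : Integrable (logDens f) := by
  refine ⟨(measurable_logDens hf).aestronglyMeasurable, ?_⟩
  have h : ∀ z, ‖logDens f z‖ₑ = ENNReal.ofReal (logDens f z) + ENNReal.ofReal (-logDens f z) := by
    intro z
    rw [← ofReal_norm, Real.norm_eq_abs]
    rcases le_total 0 (logDens f z) with h | h
    · rw [abs_of_nonneg h, ENNReal.ofReal_of_nonpos (neg_nonpos.2 h), add_zero]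
    · rw [abs_of_nonpos h, ENNReal.ofReal_of_nonpos h, zero_add]
  unfold HasFiniteIntegral
  simp only [h]
  rw [lintegral_add_left (measurable_logDens hf).ennreal_ofReal]
  exact ENNReal.add_lt_top.2 ⟨lt_top_iff_ne_top.2 hp, lt_top_iff_ne_top.2 hn⟩

lemma logPos_ne_top {f : Plane → ℝ} (h : Integrable (logDens f)) : logPos f ≠ ∞ :=
  ((lintegral_mono fun z => by
    rw [← ofReal_norm]; exact ENNReal.ofReal_le_ofReal (le_abs_self _)).trans_lt h.2).ne

lemma logEn_eq {f : Plane → ℝ} (h : Integrable (logDens f)) :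
    logEn f = (logPos f).toReal - (logNeg f).toReal :=
  integral_eq_lintegral_pos_part_sub_lintegral_neg_part h

lemma logEn_eq_iterated {f : Plane → ℝ} (h : Integrable (logDens f)) :
    ∫ x : Plane, ∫ y : Plane, Real.log ‖x - y‖ * f x ^ 2 * f y ^ 2 = logEn f :=
  (integral_prod _ h).symm

lemma volume_diag_ae : ∀ᵐ z : Plane × Plane, z.1 ≠ z.2 := by
  have hm : MeasurableSet {z : Plane × Plane | z.1 ≠ z.2} :=
    (measurableSet_eq_fun measurable_fst measurable_snd).compl
  rw [Measure.volume_eq_prod, Measure.ae_prod_iff_ae_ae hm]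
  refine ae_of_all _ fun x => ?_
  have : ∀ᵐ y : Plane, y ≠ x := by simp [ae_iff]
  filter_upwards [this] with y hy using hy.symm

/-- The squared `L²` norm of the negative part of the logarithm. -/
def logSq : ℝ≥0∞ := ∫⁻ h : Plane, ENNReal.ofReal (-Real.log ‖h‖) ^ 2

lemma logSq_ne_top : logSq ≠ ∞ := by
  have hb : ∀ r : ℝ, 0 ≤ r → ENNReal.ofReal (-Real.log r) ^ 2
      ≤ ENNReal.ofReal ((Iio (1 : ℝ)).indicator (fun r => 4 * r⁻¹) r) := by
    intro r hr
    rcases hr.eq_or_lt with rfl | hr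
    · simp
    rcases lt_or_ge r 1 with h1 | h1
    · rw [indicator_of_mem (by exact h1), ← ENNReal.ofReal_pow
        (neg_nonneg.2 (Real.log_nonpos hr.le h1.le))]
      apply ENNReal.ofReal_le_ofReal
      have h2 := Real.log_le_rpow_div (x := r⁻¹) (by positivity) (show (0 : ℝ) < 1 / 2 by norm_num)
      rw [Real.log_inv] at h2
      have h3 : 0 ≤ -Real.log r := neg_nonneg.2 (Real.log_nonpos hr.le h1.le)
      have h4 : (r⁻¹ ^ (1 / 2 : ℝ)) ^ 2 = r⁻¹ := by
        rw [← Real.rpow_natCast, ← Real.rpow_mul (by positivity)]; norm_num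
      calc (-Real.log r) ^ 2 ≤ (r⁻¹ ^ (1 / 2 : ℝ) / (1 / 2)) ^ 2 := by gcongr
        _ = 4 * r⁻¹ := by rw [div_pow, h4]; ring
    · rw [ENNReal.ofReal_of_nonpos (neg_nonpos.2 (Real.log_nonneg h1))]; simp
  have hi : Integrable (fun h : Plane => (Iio (1 : ℝ)).indicator (fun r => 4 * r⁻¹) ‖h‖) := by
    rw [integrable_fun_norm_addHaar (μ := (volume : Measure Plane))
      (f := (Iio (1 : ℝ)).indicator (fun r => 4 * r⁻¹))]
    have h2 : IntegrableOn (fun _ : ℝ => (4 : ℝ)) (Ioo (0 : ℝ) 1) := by simp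
    rw [← integrable_indicator_iff measurableSet_Ioo] at h2
    rw [← integrable_indicator_iff measurableSet_Ioi]
    refine h2.congr (ae_of_all _ fun r => ?_)
    by_cases hr : 0 < r
    · by_cases h1 : r < 1
      · simp [indicator, hr, h1]; field_simp
      · simp [indicator, hr, h1]
    · simp [indicator, hr]
  refine ((lintegral_mono fun h => hb ‖h‖ (norm_nonneg h)).trans_lt ?_).ne
  refine (lintegral_mono fun h => ?_).trans_lt hi.2
  rw [← ofReal_norm]; exact ENNReal.ofReal_le_ofReal (le_abs_self _)

/-- The bilinear form associated with the negative part of the logarithm. -/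
def negForm (F G : Plane → ℝ≥0∞) : ℝ≥0∞ :=
  ∫⁻ y, ∫⁻ x, ENNReal.ofReal (-Real.log ‖x - y‖) * F x * G y

lemma negForm_le {F G : Plane → ℝ≥0∞} (hF : Measurable F) (hG : Measurable G) :
    negForm F G ≤ (logSq * ∫⁻ x, F x ^ 2) ^ (1 / 2 : ℝ) * ∫⁻ y, G y := by
  unfold negForm
  rw [← lintegral_const_mul _ hG]
  refine lintegral_mono fun y => ?_
  have hm : Measurable fun x : Plane => ENNReal.ofReal (-Real.log ‖x - y‖) := by fun_prop
  rw [lintegral_mul_const (f := fun x => ENNReal.ofReal (-Real.log ‖x - y‖) * F x) _ (hm.mul hF)]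
  gcongr
  have h := sq_lintegral_mul_le (μ := volume) hm.aemeasurable hF.aemeasurable
  rw [lintegral_sub_right_eq_self (fun x : Plane => ENNReal.ofReal (-Real.log ‖x‖) ^ 2) y] at h
  calc (∫⁻ x, ENNReal.ofReal (-Real.log ‖x - y‖) * F x)
      = ((∫⁻ x, ENNReal.ofReal (-Real.log ‖x - y‖) * F x) ^ 2) ^ (1 / 2 : ℝ) := by
        rw [← ENNReal.rpow_natCast, ← ENNReal.rpow_mul]; norm_num
    _ ≤ _ := by gcongr; exact h

lemma logNeg_eq_negForm {f : Plane → ℝ} (hf : Measurable f) :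
    logNeg f = negForm (fun x => ‖f x‖ₑ ^ 2) (fun x => ‖f x‖ₑ ^ 2) := by
  unfold logNeg negForm
  rw [Measure.volume_eq_prod, lintegral_prod_symm (fun z => ENNReal.ofReal (-logDens f z))
    (measurable_logDens hf).neg.ennreal_ofReal.aemeasurable]
  congr 1; ext y; congr 1; ext x
  have : -logDens f (x, y) = -Real.log ‖x - y‖ * (f x ^ 2 * f y ^ 2) := by
    simp only [logDens]; ring
  rw [this, ENNReal.ofReal_mul' (by positivity), ENNReal.ofReal_mul (by positivity), mul_assoc,
    ← sq_abs (f x), ← sq_abs (f y), ENNReal.ofReal_pow (abs_nonneg _),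
    ENNReal.ofReal_pow (abs_nonneg _), ← Real.norm_eq_abs, ← Real.norm_eq_abs, ofReal_norm,
    ofReal_norm]

lemma logNeg_le {f : Plane → ℝ} (hf : Measurable f) :
    logNeg f ≤ (logSq * ∫⁻ x, ‖f x‖ₑ ^ 4) ^ (1 / 2 : ℝ) * ∫⁻ y, ‖f y‖ₑ ^ 2 := by
  rw [logNeg_eq_negForm hf]
  refine (negForm_le (by fun_prop) (by fun_prop)).trans (le_of_eq ?_)
  simp only [← pow_mul]

lemma logNeg_ne_top_of {f : Plane → ℝ} (hf : Measurable f) (h2 : ∫⁻ x, ‖f x‖ₑ ^ 2 ≠ ∞)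
    (h4 : ∫⁻ x, ‖f x‖ₑ ^ 4 ≠ ∞) : logNeg f ≠ ∞ :=
  ne_top_of_le_ne_top (ENNReal.mul_ne_top (ENNReal.rpow_ne_top_of_nonneg (by norm_num)
    (ENNReal.mul_ne_top logSq_ne_top h4)) h2) (logNeg_le hf)

lemma ofReal_sq_eq_enorm (a : ℝ) : ENNReal.ofReal (a ^ 2) = ‖a‖ₑ ^ 2 := by
  rw [← sq_abs, ENNReal.ofReal_pow (abs_nonneg _), ← Real.norm_eq_abs, ofReal_norm]

lemma log_norm_sub_le (x y : Plane) :
    Real.log ‖x - y‖ ≤ (1 + ‖x‖ ^ 2) * (1 + ‖y‖ ^ 2) := by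
  calc Real.log ‖x - y‖ ≤ ‖x - y‖ := Real.log_le_self (norm_nonneg _)
    _ ≤ ‖x‖ + ‖y‖ := norm_sub_le _ _
    _ ≤ _ := by
      nlinarith [sq_nonneg (‖x‖ - 1), sq_nonneg (‖y‖ - 1), mul_nonneg (sq_nonneg ‖x‖) (sq_nonneg ‖y‖)]

lemma logPos_ne_top_of {f : Plane → ℝ} (h : Integrable (fun x => (1 + ‖x‖ ^ 2) * f x ^ 2)) : logPos f ≠ ∞ := by
  have h2 := h.mul_prod h
  refine ((lintegral_mono fun z => ?_).trans_lt h2.2).ne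
  rw [← ofReal_norm]
  apply ENNReal.ofReal_le_ofReal
  refine le_trans ?_ (le_abs_self _)
  unfold logDens
  calc _ ≤ ((1 + ‖z.1‖ ^ 2) * (1 + ‖z.2‖ ^ 2)) * f z.1 ^ 2 * f z.2 ^ 2 := by
        gcongr; exact log_norm_sub_le _ _
    _ = _ := by ring

lemma logDens_smul (f : Plane → ℝ) (c : ℝ) (z : Plane × Plane) :
    logDens (fun x => c * f x) z = c ^ 4 * logDens f z := by
  simp only [logDens]; ring

instance : (volume : Measure (Plane × Plane)).IsAddHaarMeasure :=
  inferInstanceAs ((volume : Measure Plane).prod (volume : Measure Plane)).IsAddHaarMeasure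

lemma logEn_scale {f : Plane → ℝ} (h : Integrable (logDens f))
    (h2 : Integrable (fun x => f x ^ 2)) {τ : ℝ} (hτ : 0 < τ) :
    Integrable (logDens fun x => τ * f (τ • x)) ∧
    logEn (fun x => τ * f (τ • x)) = logEn f - Real.log τ * (∫ x, f x ^ 2) ^ 2 := by
  have h22 : Integrable fun z : Plane × Plane => f z.1 ^ 2 * f z.2 ^ 2 := h2.mul_prod h2
  set g : Plane × Plane → ℝ := fun z => logDens f z - Real.log τ * (f z.1 ^ 2 * f z.2 ^ 2)
  have hg : Integrable g := h.sub (h22.const_mul _)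
  have e : (logDens fun x => τ * f (τ • x)) =ᵐ[volume] fun z => τ ^ 4 * g (τ • z) := by
    filter_upwards [volume_diag_ae] with z hz
    have : Real.log ‖τ • z.1 - τ • z.2‖ = Real.log τ + Real.log ‖z.1 - z.2‖ := by
      rw [← smul_sub, norm_smul, Real.norm_eq_abs, abs_of_pos hτ,
        Real.log_mul hτ.ne' (norm_ne_zero_iff.2 (sub_ne_zero.2 hz))]
    simp only [g, logDens, Prod.smul_fst, Prod.smul_snd, this]
    ring
  refine ⟨((hg.comp_smul hτ.ne').const_mul _).congr e.symm, ?_⟩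
  unfold logEn
  have hfin : Module.finrank ℝ (Plane × Plane) = 4 := by simp
  rw [integral_congr_ae e, integral_const_mul, Measure.integral_comp_smul, hfin,
    integral_sub h (h22.const_mul _), integral_const_mul]
  have h3 : ∫ z : Plane × Plane, f z.1 ^ 2 * f z.2 ^ 2 = (∫ x, f x ^ 2) ^ 2 := by
    rw [Measure.volume_eq_prod, integral_prod_mul (fun x => f x ^ 2) (fun x => f x ^ 2), sq]
  rw [h3, abs_of_pos (by positivity), smul_eq_mul]
  field_simp

lemma d0_ofReal {g : Plane → ℝ} (hg : Differentiable ℝ g) (x : Plane) :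
    d0 (fun y => (g y : ℂ)) x = (d0R g x : ℂ) := by
  have := Complex.ofRealCLM.hasFDerivAt.comp x (hg x).hasFDerivAt
  unfold d0 d0R
  have e : HasFDerivAt (fun y => (g y : ℂ)) (Complex.ofRealCLM.comp (fderiv ℝ g x)) x := this
  rw [e.fderiv]; simp

lemma d1_ofReal {g : Plane → ℝ} (hg : Differentiable ℝ g) (x : Plane) :
    d1 (fun y => (g y : ℂ)) x = (d1R g x : ℂ) := by
  have := Complex.ofRealCLM.hasFDerivAt.comp x (hg x).hasFDerivAt
  unfold d1 d1R
  have e : HasFDerivAt (fun y => (g y : ℂ)) (Complex.ofRealCLM.comp (fderiv ℝ g x)) x := this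
  rw [e.fderiv]; simp

lemma gradSq_ofReal {g : Plane → ℝ} (hg : Differentiable ℝ g) :
    gradSq (fun y => (g y : ℂ)) = gradSqR g := by
  ext x
  simp [gradSq, gradSqR, d0_ofReal hg, d1_ofReal hg]

lemma momentum_ofReal {g : Plane → ℝ} (hg : Differentiable ℝ g) :
    momentum (fun y => (g y : ℂ)) = 0 := by
  ext x
  simp [momentum, d0_ofReal hg, d1_ofReal hg]

lemma ofReal_mem_Sset {V : Plane → ℝ} {g : Plane → ℝ} (hg : Differentiable ℝ g)
    (h2 : Integrable fun x => g x ^ 2) (hgrad : Integrable (gradSqR g))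
    (hV : Integrable fun x => V x * g x ^ 2) :
    (fun x => (g x : ℂ)) ∈ Sset V (∫ x, g x ^ 2) := by
  refine ⟨⟨⟨Complex.ofRealCLM.differentiable.comp hg, ?_, ?_⟩, ?_⟩, ?_⟩
  · simpa using h2
  · rwa [gradSq_ofReal hg]
  · simpa using hV
  · simp

lemma logConv_ofReal {g : Plane → ℝ} (hlog : Integrable (logDens g)) :
    logConv (fun x => (g x : ℂ)) = logEn g := by
  rw [← logEn_eq_iterated hlog]
  simp [logConv]

lemma Ea_ofReal {V : Plane → ℝ} {Ω : ℝ} {g : Plane → ℝ} (hg : Differentiable ℝ g)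
    (hgrad : Integrable (gradSqR g)) (hV : Integrable fun x => V x * g x ^ 2)
    (hlog : Integrable (logDens g)) :
    Ea V Ω (fun x => (g x : ℂ)) = (∫ x, gradSqR g x) + (∫ x, V x * g x ^ 2) + 1 / 2 * logEn g
      - 1 / 2 * ∫ x, g x ^ 4 := by
  rw [Ea, logConv_ofReal hlog, gradSq_ofReal hg, momentum_ofReal hg, ← integral_add hgrad hV]
  have : ∀ x, |g x| ^ 4 = g x ^ 4 := fun x => Even.pow_abs (by decide) _
  simp [this]

lemma integral_comp_smul_plane (f : Plane → ℝ) (τ : ℝ) :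
    ∫ x, f (τ • x) = (τ ^ 2)⁻¹ * ∫ x, f x := by
  rw [Measure.integral_comp_smul]
  simp

lemma gradSqR_scale {q : Plane → ℝ} (hq : Differentiable ℝ q) (c τ : ℝ) :
    gradSqR (fun x => c * (τ * q (τ • x))) = fun x => c ^ 2 * τ ^ 4 * gradSqR q (τ • x) := by
  ext x
  have h1 : HasFDerivAt (fun x => q (τ • x))
      ((fderiv ℝ q (τ • x)).comp (τ • ContinuousLinearMap.id ℝ Plane)) x :=
    (hq (τ • x)).hasFDerivAt.comp x ((hasFDerivAt_id x).const_smul τ)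
  have h2 := (h1.const_mul τ).const_mul c
  simp only [gradSqR, d0R, d1R]
  rw [h2.fderiv]
  simp
  ring

lemma Ea_trial {V : Plane → ℝ} {Ω : ℝ} {q : Plane → ℝ} {c τ : ℝ} (hτ : 0 < τ)
    (hq : Differentiable ℝ q)
    (h2 : Integrable fun x => q x ^ 2) (hgrad : Integrable (gradSqR q))
    (hV : Integrable fun x => V (τ⁻¹ • x) * q x ^ 2) (hlog : Integrable (logDens q)) :
    (fun x => ((c * (τ * q (τ • x)) : ℝ) : ℂ)) ∈ Sset V (c ^ 2 * ∫ x, q x ^ 2) ∧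
    Ea V Ω (fun x => ((c * (τ * q (τ • x)) : ℝ) : ℂ)) =
      c ^ 2 * τ ^ 2 * (∫ x, gradSqR q x) + c ^ 2 * (∫ x, V (τ⁻¹ • x) * q x ^ 2)
        + 1 / 2 * c ^ 4 * (logEn q - Real.log τ * (∫ x, q x ^ 2) ^ 2)
        - 1 / 2 * c ^ 4 * τ ^ 2 * ∫ x, q x ^ 4 := by
  have hτ0 : τ ≠ 0 := hτ.ne'
  have hg : Differentiable ℝ fun x => c * (τ * q (τ • x)) := by fun_prop
  have i2 : Integrable fun x => (c * (τ * q (τ • x))) ^ 2 := by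
    refine ((h2.comp_smul hτ0).const_mul (c ^ 2 * τ ^ 2)).congr (ae_of_all _ fun x => ?_)
    simp only; ring
  have ig : Integrable (gradSqR fun x => c * (τ * q (τ • x))) := by
    rw [gradSqR_scale hq]
    exact (hgrad.comp_smul hτ0).const_mul _
  have eV : (fun x => V x * (c * (τ * q (τ • x))) ^ 2) = fun x =>
      c ^ 2 * τ ^ 2 * (fun x => V (τ⁻¹ • x) * q x ^ 2) (τ • x) := by
    ext x
    simp only [smul_smul, inv_mul_cancel₀ hτ0, one_smul]; ring
  have iV : Integrable fun x => V x * (c * (τ * q (τ • x))) ^ 2 := by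
    rw [eV]; exact (hV.comp_smul hτ0).const_mul _
  have hl := logEn_scale hlog h2 hτ
  have eL : (logDens fun x => c * (τ * q (τ • x))) = fun z =>
      c ^ 4 * logDens (fun x => τ * q (τ • x)) z := by
    ext z; exact logDens_smul (fun x => τ * q (τ • x)) c z
  have iL : Integrable (logDens fun x => c * (τ * q (τ • x))) := by
    rw [eL]; exact hl.1.const_mul _
  have e2 : ∫ x, (c * (τ * q (τ • x))) ^ 2 = c ^ 2 * ∫ x, q x ^ 2 := by
    have : ∀ x, (c * (τ * q (τ • x))) ^ 2 = c ^ 2 * τ ^ 2 * (fun x => q x ^ 2) (τ • x) :=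
      fun x => by simp only; ring
    simp only [this]
    rw [integral_const_mul, integral_comp_smul_plane (fun x => q x ^ 2) τ]
    field_simp
  have e4 : ∫ x, (c * (τ * q (τ • x))) ^ 4 = c ^ 4 * τ ^ 2 * ∫ x, q x ^ 4 := by
    have : ∀ x, (c * (τ * q (τ • x))) ^ 4 = c ^ 4 * τ ^ 4 * (fun x => q x ^ 4) (τ • x) :=
      fun x => by simp only; ring
    simp only [this]
    rw [integral_const_mul, integral_comp_smul_plane (fun x => q x ^ 4) τ]
    field_simp
  refine ⟨e2 ▸ ofReal_mem_Sset hg i2 ig iV, ?_⟩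
  rw [Ea_ofReal hg ig iV iL, e4, gradSqR_scale hq, integral_const_mul,
    integral_comp_smul_plane _ τ, eV, integral_const_mul,
    integral_comp_smul_plane (fun x => V (τ⁻¹ • x) * q x ^ 2) τ]
  have : logEn (fun x => c * (τ * q (τ • x))) = c ^ 4 * logEn fun x => τ * q (τ • x) := by
    unfold logEn; rw [eL, integral_const_mul]
  rw [this, hl.2]
  field_simp

lemma lintegral_enorm_ne_top {f : Plane → ℝ} {n : ℕ} (h : Integrable fun x => f x ^ n) :
    ∫⁻ x, ‖f x‖ₑ ^ n ≠ ∞ := by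
  have := h.2.ne
  simpa [HasFiniteIntegral, enorm_pow] using this

lemma integrable_logDens_of {f : Plane → ℝ} (hf : Measurable f)
    (h2 : Integrable fun x => f x ^ 2) (h4 : Integrable fun x => f x ^ 4)
    (h : Integrable fun x => (1 + ‖x‖ ^ 2) * f x ^ 2) : Integrable (logDens f) :=
  integrable_logDens hf (logPos_ne_top_of h)
    (logNeg_ne_top_of hf (lintegral_enorm_ne_top h2) (lintegral_enorm_ne_top h4))

lemma continuous_gradSqR {f : Plane → ℝ} (hf : ContDiff ℝ 1 f) : Continuous (gradSqR f) := by
  have := hf.continuous_fderiv (by norm_num)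
  unfold gradSqR d0R d1R
  fun_prop

lemma hasCompactSupport_gradSqR {f : Plane → ℝ} (h : HasCompactSupport f) :
    HasCompactSupport (gradSqR f) := by
  refine (h.fderiv ℝ).comp_left (g := fun L : Plane →L[ℝ] ℝ => L e0 ^ 2 + L e1 ^ 2) (by simp)

lemma nonpos_of_forall_mul_sq_le {k D : ℝ} (h : ∀ τ : ℝ, 1 ≤ τ → k * τ ^ 2 ≤ D) : k ≤ 0 := by
  by_contra! hk
  have h1 := h (1 + |D| / k) (by have := div_nonneg (abs_nonneg D) hk.le; linarith)
  have h2 : 0 ≤ |D| / k := div_nonneg (abs_nonneg D) hk.le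
  have h3 : k * (|D| / k) = |D| := by field_simp
  nlinarith [le_abs_self D, mul_nonneg hk.le (sq_nonneg (|D| / k))]


lemma le_of_forall_Ioo_mul_le {b C D : ℝ} (hC : 0 ≤ C) (hD : 0 ≤ D)
    (h : ∀ a ∈ Ioo (0 : ℝ) b, a * C ≤ D) : b * C ≤ D := by
  rcases le_or_gt b 0 with h0 | h0
  · exact (mul_nonpos_of_nonpos_of_nonneg h0 hC).trans hD
  · have h1 : Tendsto (fun a => a * C) (𝓝[<] b) (𝓝 (b * C)) :=
      ((continuous_mul_const C).tendsto b).mono_left nhdsWithin_le_nhds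
    refine le_of_tendsto h1 ?_
    filter_upwards [Ioo_mem_nhdsLT h0] with a ha using h a ha

lemma mul_le_of_trial_bound {a A B C M L m : ℝ} (ha : 0 < a) (hB : 0 < B)
    (h : ∀ c τ : ℝ, 1 ≤ τ → c ^ 2 * B = a → m ≤ c ^ 2 * τ ^ 2 * A + c ^ 2 * M
        + 1 / 2 * c ^ 4 * (L - Real.log τ * B ^ 2) - 1 / 2 * c ^ 4 * τ ^ 2 * C) :
    a * C ≤ 2 * A * B := by
  have hc2 : Real.sqrt (a / B) ^ 2 = a / B := Real.sq_sqrt (div_nonneg ha.le hB.le)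
  have hcB : Real.sqrt (a / B) ^ 2 * B = a := by rw [hc2]; field_simp
  obtain ⟨c, hc2, hcB⟩ : ∃ c : ℝ, c ^ 2 = a / B ∧ c ^ 2 * B = a := ⟨_, hc2, hcB⟩
  have h1 : 1 / 2 * c ^ 4 * C - c ^ 2 * A ≤ 0 := by
    refine nonpos_of_forall_mul_sq_le (D := c ^ 2 * M + 1 / 2 * c ^ 4 * L - m) ?_
    intro τ hτ
    have h3 := h c τ hτ hcB
    have h5 : 0 ≤ c ^ 4 * (Real.log τ * B ^ 2) :=
      mul_nonneg (by positivity) (mul_nonneg (Real.log_nonneg hτ) (sq_nonneg _))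
    linarith
  have h7 : c ^ 4 = (a / B) ^ 2 := by rw [← hc2]; ring
  rw [h7, hc2] at h1
  have h8 : 1 / 2 * (a / B) ^ 2 * C - a / B * A = (a / (2 * B ^ 2)) * (a * C - 2 * A * B) := by
    field_simp
  rw [h8] at h1
  have h9 : 0 < a / (2 * B ^ 2) := div_pos ha (by positivity)
  by_contra! hlt
  have := mul_pos h9 (sub_pos.2 hlt)
  linarith

lemma gradSqR_nonneg (f : Plane → ℝ) (x : Plane) : 0 ≤ gradSqR f x :=
  add_nonneg (sq_nonneg _) (sq_nonneg _)

lemma integrable_pow_of_hasCompactSupport {f : Plane → ℝ} (hf : Continuous f)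
    (hc : HasCompactSupport f) {n : ℕ} (hn : n ≠ 0) : Integrable fun x => f x ^ n :=
  (hf.pow n).integrable_of_hasCompactSupport
    (hc.comp_left (g := fun t : ℝ => t ^ n) (zero_pow hn))

lemma potential_comp_smul_le {V φ : Plane → ℝ} (hV : V110 V) (hc : HasCompactSupport φ) :
    ∃ M : ℝ, 0 ≤ M ∧ ∀ τ : ℝ, 1 ≤ τ → ∀ x, V (τ⁻¹ • x) * φ x ^ 2 ≤ M * φ x ^ 2 := by
  obtain ⟨R, hR⟩ := hc.isCompact.isBounded.exists_norm_le
  obtain ⟨M, hM⟩ := hV.2.2.1 R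
  refine ⟨|M|, abs_nonneg M, fun τ hτ x => ?_⟩
  by_cases hx : x ∈ tsupport φ
  · refine mul_le_mul_of_nonneg_right ((hM _ ?_).trans (le_abs_self M)) (sq_nonneg _)
    rw [norm_smul, norm_inv, Real.norm_eq_abs, abs_of_pos (by linarith)]
    calc τ⁻¹ * ‖x‖ ≤ 1 * ‖x‖ :=
          mul_le_mul_of_nonneg_right (inv_le_one_of_one_le₀ hτ) (norm_nonneg x)
      _ ≤ R := by rw [one_mul]; exact hR x hx
  · simp [image_eq_zero_of_notMem_tsupport hx]

lemma integral_pow_four_eq_zero {f : Plane → ℝ} (i2 : Integrable fun x => f x ^ 2)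
    (h : ∫ x, f x ^ 2 = 0) : ∫ x, f x ^ 4 = 0 := by
  have h0 : (fun x => f x ^ 2) =ᵐ[volume] 0 :=
    (integral_eq_zero_iff_of_nonneg (fun x => sq_nonneg (f x)) i2).1 h
  refine integral_eq_zero_of_ae ?_
  filter_upwards [h0] with x hx
  have : f x = 0 := by simpa using hx
  simp [this]

/-- The Gagliardo–Nirenberg inequality follows from the energy being bounded below. -/
lemma gn_compact {V : Plane → ℝ} {Ω astar : ℝ} (hV : V110 V)
    (hbelow : ∀ a ∈ Ioo (0 : ℝ) astar, ∃ m : ℝ, ∀ v ∈ Sset V a, m ≤ Ea V Ω v)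
    {φ : Plane → ℝ} (hφ : ContDiff ℝ 1 φ) (hc : HasCompactSupport φ) :
    astar * ∫ x, φ x ^ 4 ≤ 2 * (∫ x, gradSqR φ x) * ∫ x, φ x ^ 2 := by
  have hcont := hφ.continuous
  have i2 : Integrable fun x => φ x ^ 2 := integrable_pow_of_hasCompactSupport hcont hc two_ne_zero
  have i4 : Integrable fun x => φ x ^ 4 := integrable_pow_of_hasCompactSupport hcont hc four_ne_zero
  have ig : Integrable (gradSqR φ) :=
    (continuous_gradSqR hφ).integrable_of_hasCompactSupport (hasCompactSupport_gradSqR hc)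
  have iw : Integrable fun x => (1 + ‖x‖ ^ 2) * φ x ^ 2 := by
    have h1 : Continuous fun x : Plane => (1 + ‖x‖ ^ 2) * φ x ^ 2 := by fun_prop
    exact h1.integrable_of_hasCompactSupport
      (HasCompactSupport.mul_left (hc.comp_left (g := fun t : ℝ => t ^ 2) (zero_pow two_ne_zero)))
  have il := integrable_logDens_of hcont.measurable i2 i4 iw
  have hA : 0 ≤ ∫ x, gradSqR φ x := integral_nonneg (gradSqR_nonneg φ)
  have hB : 0 ≤ ∫ x, φ x ^ 2 := integral_nonneg fun x => sq_nonneg (φ x)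
  have hC : 0 ≤ ∫ x, φ x ^ 4 := integral_nonneg fun x => Even.pow_nonneg (by decide) (φ x)
  rcases hB.eq_or_lt with hB0 | hB0
  · rw [integral_pow_four_eq_zero i2 hB0.symm, ← hB0, mul_zero, mul_zero]
  obtain ⟨M, hM0, hM⟩ := potential_comp_smul_le hV hc
  have hVi : ∀ τ : ℝ, 1 ≤ τ → Integrable fun x => V (τ⁻¹ • x) * φ x ^ 2 := by
    intro τ hτ
    refine (i2.const_mul M).mono' ?_ (ae_of_all _ fun x => ?_)
    · exact ((hV.1.comp (measurable_const_smul τ⁻¹)).mul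
        (hcont.measurable.pow_const 2)).aestronglyMeasurable
    · rw [Real.norm_eq_abs, abs_of_nonneg (mul_nonneg (hV.2.1 _) (sq_nonneg _))]
      exact hM τ hτ x
  refine le_of_forall_Ioo_mul_le hC (mul_nonneg (mul_nonneg zero_le_two hA) hB) fun a ha => ?_
  obtain ⟨m, hm⟩ := hbelow a ha
  refine mul_le_of_trial_bound (M := M * ∫ x, φ x ^ 2) (L := logEn φ) (m := m) ha.1 hB0
    fun c τ hτ hcB => ?_
  obtain ⟨hmem, hE⟩ := Ea_trial (Ω := Ω) (c := c) (zero_lt_one.trans_le hτ)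
    (hφ.differentiable one_ne_zero) i2 ig (hVi τ hτ) il
  rw [hcB] at hmem
  have h3 := hm _ hmem
  rw [hE] at h3
  have h4 : ∫ x, V (τ⁻¹ • x) * φ x ^ 2 ≤ M * ∫ x, φ x ^ 2 := by
    rw [← integral_const_mul]
    exact integral_mono (hVi τ hτ) (i2.const_mul M) (hM τ hτ)
  have h6 := mul_le_mul_of_nonneg_left h4 (sq_nonneg c)
  linarith

/-- The Dirichlet energy `∫ |∇f|²`. -/
def dirE (f : Plane → ℝ) : ℝ≥0∞ := ∫⁻ x, (‖d0R f x‖ₑ ^ 2 + ‖d1R f x‖ₑ ^ 2)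

/-- The Gagliardo–Nirenberg inequality with constant `b` on test functions. -/
def GNIneq (b : ℝ≥0∞) : Prop := ∀ φ : Plane → ℝ, ContDiff ℝ 1 φ → HasCompactSupport φ →
  b * ∫⁻ x, ‖φ x‖ₑ ^ 4 ≤ 2 * dirE φ * ∫⁻ x, ‖φ x‖ₑ ^ 2

lemma dirE_eq (f : Plane → ℝ) : dirE f = ∫⁻ x, ENNReal.ofReal (gradSqR f x) := by
  unfold dirE gradSqR
  congr 1; ext x
  rw [ENNReal.ofReal_add (sq_nonneg _) (sq_nonneg _), ofReal_sq_eq_enorm, ofReal_sq_eq_enorm]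

lemma ofReal_pow_four_eq_enorm (a : ℝ) : ENNReal.ofReal (a ^ 4) = ‖a‖ₑ ^ 4 := by
  rw [show a ^ 4 = (a ^ 2) ^ 2 by ring, ofReal_sq_eq_enorm, enorm_pow]; ring

lemma lintegral_enorm_sq {f : Plane → ℝ} (h : Integrable fun x => f x ^ 2) :
    ∫⁻ x, ‖f x‖ₑ ^ 2 = ENNReal.ofReal (∫ x, f x ^ 2) := by
  rw [ofReal_integral_eq_lintegral_ofReal h (ae_of_all _ fun x => sq_nonneg (f x))]
  simp_rw [ofReal_sq_eq_enorm]

lemma lintegral_enorm_four {f : Plane → ℝ} (h : Integrable fun x => f x ^ 4) :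
    ∫⁻ x, ‖f x‖ₑ ^ 4 = ENNReal.ofReal (∫ x, f x ^ 4) := by
  rw [ofReal_integral_eq_lintegral_ofReal h
    (ae_of_all _ fun x => Even.pow_nonneg (by decide) (f x))]
  simp_rw [ofReal_pow_four_eq_enorm]

lemma dirE_eq_ofReal {f : Plane → ℝ} (h : Integrable (gradSqR f)) :
    dirE f = ENNReal.ofReal (∫ x, gradSqR f x) := by
  rw [dirE_eq, ofReal_integral_eq_lintegral_ofReal h (ae_of_all _ (gradSqR_nonneg f))]

lemma gnIneq_of_energy {V : Plane → ℝ} {Ω astar : ℝ} (hV : V110 V)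
    (hbelow : ∀ a ∈ Ioo (0 : ℝ) astar, ∃ m : ℝ, ∀ v ∈ Sset V a, m ≤ Ea V Ω v) :
    GNIneq (ENNReal.ofReal astar) := by
  intro φ hφ hc
  have h := gn_compact hV hbelow hφ hc
  have hcont := hφ.continuous
  rw [lintegral_enorm_four (integrable_pow_of_hasCompactSupport hcont hc four_ne_zero),
    lintegral_enorm_sq (integrable_pow_of_hasCompactSupport hcont hc two_ne_zero),
    dirE_eq_ofReal ((continuous_gradSqR hφ).integrable_of_hasCompactSupport
      (hasCompactSupport_gradSqR hc)), show ∀ c d : ℝ≥0∞, 2 * c * d = ENNReal.ofReal 2 * c * d by simp,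
    ← ENNReal.ofReal_mul' (integral_nonneg fun x => Even.pow_nonneg (by decide) (φ x)),
    ← ENNReal.ofReal_mul (by norm_num), ← ENNReal.ofReal_mul']
  · exact ENNReal.ofReal_le_ofReal h
  · exact integral_nonneg fun x => sq_nonneg (φ x)

lemma gradSqR_cutoff_le {f χ : Plane → ℝ} (hf : Differentiable ℝ f) (hχ : Differentiable ℝ χ)
    {M θ : ℝ} (hM : ∀ x, ‖fderiv ℝ χ x‖ ≤ M) (h1 : ∀ x, |χ x| ≤ 1) (hθ : 0 < θ) (hθ1 : θ ≤ 1)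
    (x : Plane) :
    gradSqR (fun x => χ (θ • x) * f x) x ≤ (1 + θ) * gradSqR f x + 4 * θ * M ^ 2 * f x ^ 2 := by
  have e1' : HasFDerivAt (fun x => χ (θ • x))
      ((fderiv ℝ χ (θ • x)).comp (θ • ContinuousLinearMap.id ℝ Plane)) x :=
    (hχ (θ • x)).hasFDerivAt.comp x ((hasFDerivAt_id x).const_smul θ)
  have e2 := (e1'.mul (hf x).hasFDerivAt).fderiv
  have hb : ∀ e : Plane, ‖e‖ = 1 → |fderiv ℝ χ (θ • x) e| ≤ M := fun e he =>
    (((fderiv ℝ χ (θ • x)).le_opNorm e).trans (by rw [he, mul_one])).trans (hM _)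
  have hsq : ∀ a g c : ℝ, |c| ≤ 1 → |g| ≤ M →
      (c * a + f x * (θ * g)) ^ 2 ≤ (1 + θ) * a ^ 2 + 2 * θ * M ^ 2 * f x ^ 2 := by
    intro a g c hc hg
    have i1 : c ^ 2 ≤ 1 := by rw [← sq_abs]; exact pow_le_one₀ (abs_nonneg c) hc
    have i2 : g ^ 2 ≤ M ^ 2 := by rw [← sq_abs]; exact pow_le_pow_left₀ (abs_nonneg g) hg 2
    have i3 : (c * a + f x * (θ * g)) ^ 2
        ≤ (1 + θ) * (c * a) ^ 2 + (θ + θ ^ 2) * (f x ^ 2 * g ^ 2) := by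
      nlinarith [mul_nonneg hθ.le (sq_nonneg (c * a - f x * g))]
    have i4 : (c * a) ^ 2 ≤ a ^ 2 := by
      rw [mul_pow]; exact mul_le_of_le_one_left (sq_nonneg a) i1
    have i5 : f x ^ 2 * g ^ 2 ≤ f x ^ 2 * M ^ 2 := mul_le_mul_of_nonneg_left i2 (sq_nonneg _)
    have i6 : θ + θ ^ 2 ≤ 2 * θ := by nlinarith
    calc _ ≤ (1 + θ) * a ^ 2 + (2 * θ) * (f x ^ 2 * M ^ 2) := by
          refine i3.trans (add_le_add (by gcongr) ?_)
          exact mul_le_mul i6 i5 (by positivity) (by positivity)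
      _ = _ := by ring
  have ha := hsq (d0R f x) _ _ (h1 (θ • x)) (hb e0 (by simp [e0]))
  have hb' := hsq (d1R f x) _ _ (h1 (θ • x)) (hb e1 (by simp [e1]))
  unfold gradSqR
  have hd : ∀ e : Plane, fderiv ℝ (fun x => χ (θ • x) * f x) x e
      = χ (θ • x) * fderiv ℝ f x e + f x * (θ * fderiv ℝ χ (θ • x) e) := by
    intro e
    have : fderiv ℝ (fun x => χ (θ • x) * f x) x = _ := e2
    rw [this]; simp
  unfold d0R d1R at *
  rw [hd, hd]
  linarith

lemma lintegral_enorm_pow_le_liminf {F : ℕ → Plane → ℝ} {f : Plane → ℝ} (m : ℕ)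
    (hF : ∀ n, Measurable (F n)) (hlim : ∀ᵐ x, Tendsto (fun n => F n x) atTop (𝓝 (f x))) :
    ∫⁻ x, ‖f x‖ₑ ^ m ≤ liminf (fun n => ∫⁻ x, ‖F n x‖ₑ ^ m) atTop := by
  refine le_trans (lintegral_mono_ae ?_)
    (lintegral_liminf_le fun n => (hF n).enorm.pow_const m)
  filter_upwards [hlim] with x hx
  exact (((ENNReal.continuous_pow m).comp continuous_enorm).tendsto _ |>.comp hx).liminf_eq.ge

lemma GNIneq.of_contDiff {b : ℝ≥0∞} (h : GNIneq b) (hb : b ≠ ∞) {f : Plane → ℝ}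
    (hf : ContDiff ℝ 1 f) (h2 : ∫⁻ x, ‖f x‖ₑ ^ 2 ≠ ∞) (hd : dirE f ≠ ∞) :
    b * ∫⁻ x, ‖f x‖ₑ ^ 4 ≤ 2 * dirE f * ∫⁻ x, ‖f x‖ₑ ^ 2 := by
  let χ : ContDiffBump (0 : Plane) := ⟨1, 2, one_pos, one_lt_two⟩
  have hχ : ContDiff ℝ 1 χ := χ.contDiff
  obtain ⟨M, hM⟩ := (χ.hasCompactSupport.fderiv ℝ).exists_bound_of_continuous
    (hχ.continuous_fderiv one_ne_zero)
  have hχ1 : ∀ x, |χ x| ≤ 1 := fun x => by rw [abs_of_nonneg χ.nonneg]; exact χ.le_one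
  let θ : ℕ → ℝ := fun n => 1 / ((n : ℝ) + 1)
  have hθ : ∀ n, 0 < θ n := fun n => by positivity
  have hθ1 : ∀ n, θ n ≤ 1 := fun n => by
    rw [div_le_one (by positivity)]; linarith [Nat.cast_nonneg (α := ℝ) n]
  have hθ0 : Tendsto θ atTop (𝓝 0) := tendsto_one_div_add_atTop_nhds_zero_nat
  let φ : ℕ → Plane → ℝ := fun n x => χ (θ n • x) * f x
  have hφ : ∀ n, ContDiff ℝ 1 (φ n) := fun n => by
    have : ContDiff ℝ 1 fun x : Plane => χ (θ n • x) :=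
      hχ.comp (contDiff_const_smul (θ n))
    exact this.mul hf
  have hφc : ∀ n, HasCompactSupport (φ n) := fun n =>
    (χ.hasCompactSupport.comp_smul (hθ n).ne').mul_right
  have hlim : ∀ x, Tendsto (fun n => φ n x) atTop (𝓝 (f x)) := by
    intro x
    have : Tendsto (fun n => χ (θ n • x)) atTop (𝓝 1) := by
      have h0 : Tendsto (fun n => θ n • x) atTop (𝓝 0) := by simpa using hθ0.smul_const x
      have := (hχ.continuous.tendsto 0).comp h0
      rwa [show χ (0 : Plane) = 1 from χ.one_of_mem_closedBall (by simp [χ])] at this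
    simpa using this.mul_const (f x)
  have hgm : ∀ n, dirE (φ n) ≤ ENNReal.ofReal (1 + θ n) * dirE f
      + ENNReal.ofReal (4 * θ n * M ^ 2) * ∫⁻ x, ‖f x‖ₑ ^ 2 := by
    intro n
    have m1 : Measurable fun x => ENNReal.ofReal (gradSqR f x) :=
      (continuous_gradSqR hf).measurable.ennreal_ofReal
    have m2 : Measurable fun x => ‖f x‖ₑ ^ 2 := hf.continuous.measurable.enorm.pow_const 2
    rw [dirE_eq, dirE_eq, ← lintegral_const_mul _ m1, ← lintegral_const_mul _ m2,
      ← lintegral_add_left (m1.const_mul _)]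
    refine lintegral_mono fun x => ?_
    have := gradSqR_cutoff_le (hf.differentiable one_ne_zero) (hχ.differentiable one_ne_zero)
      hM hχ1 (hθ n) (hθ1 n) x
    refine (ENNReal.ofReal_le_ofReal this).trans ?_
    have p1 : 0 ≤ 1 + θ n := by linarith [hθ n]
    have p2 : 0 ≤ 4 * θ n * M ^ 2 := by have := hθ n; positivity
    rw [ENNReal.ofReal_add (mul_nonneg p1 (gradSqR_nonneg f x)) (mul_nonneg p2 (sq_nonneg _)),
      ENNReal.ofReal_mul p1, ENNReal.ofReal_mul p2, ofReal_sq_eq_enorm]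
  have hle2 : ∀ n, ∫⁻ x, ‖φ n x‖ₑ ^ 2 ≤ ∫⁻ x, ‖f x‖ₑ ^ 2 := by
    intro n
    refine lintegral_mono fun x => ?_
    have : ‖φ n x‖ₑ ≤ ‖f x‖ₑ := by
      rw [enorm_le_iff_norm_le, Real.norm_eq_abs, Real.norm_eq_abs, abs_mul]
      exact mul_le_of_le_one_left (abs_nonneg _) (hχ1 _)
    gcongr
  have hn : ∀ n, b * ∫⁻ x, ‖φ n x‖ₑ ^ 4 ≤ 2 * (ENNReal.ofReal (1 + θ n) * dirE f
      + ENNReal.ofReal (4 * θ n * M ^ 2) * ∫⁻ x, ‖f x‖ₑ ^ 2) * ∫⁻ x, ‖f x‖ₑ ^ 2 := fun n =>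
    (h (φ n) (hφ n) (hφc n)).trans (mul_le_mul' (mul_le_mul_right (hgm n) 2) (hle2 n))
  have hR : Tendsto (fun n => 2 * (ENNReal.ofReal (1 + θ n) * dirE f
      + ENNReal.ofReal (4 * θ n * M ^ 2) * ∫⁻ x, ‖f x‖ₑ ^ 2) * ∫⁻ x, ‖f x‖ₑ ^ 2) atTop
      (𝓝 (2 * (ENNReal.ofReal (1 + 0) * dirE f
      + ENNReal.ofReal (4 * 0 * M ^ 2) * ∫⁻ x, ‖f x‖ₑ ^ 2) * ∫⁻ x, ‖f x‖ₑ ^ 2)) := by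
    refine ENNReal.Tendsto.mul_const (ENNReal.Tendsto.const_mul (Tendsto.add ?_ ?_)
      (Or.inr (by simp))) (Or.inr h2)
    · exact ENNReal.Tendsto.mul_const (ENNReal.tendsto_ofReal (tendsto_const_nhds.add hθ0))
        (Or.inr hd)
    · exact ENNReal.Tendsto.mul_const (ENNReal.tendsto_ofReal
        ((tendsto_const_nhds.mul hθ0).mul_const _)) (Or.inr h2)
  have hfat : ∫⁻ x, ‖f x‖ₑ ^ 4 ≤ liminf (fun n => ∫⁻ x, ‖φ n x‖ₑ ^ 4) atTop := by
    exact lintegral_enorm_pow_le_liminf 4 (fun n => (hφ n).continuous.measurable)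
      (ae_of_all _ hlim)
  calc b * ∫⁻ x, ‖f x‖ₑ ^ 4 ≤ b * liminf (fun n => ∫⁻ x, ‖φ n x‖ₑ ^ 4) atTop := by gcongr
    _ ≤ liminf (fun n => b * ∫⁻ x, ‖φ n x‖ₑ ^ 4) atTop :=
        (ENNReal.liminf_const_mul_of_ne_top hb).ge
    _ ≤ liminf (fun n => 2 * (ENNReal.ofReal (1 + θ n) * dirE f
      + ENNReal.ofReal (4 * θ n * M ^ 2) * ∫⁻ x, ‖f x‖ₑ ^ 2) * ∫⁻ x, ‖f x‖ₑ ^ 2) atTop :=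
        liminf_le_liminf (Eventually.of_forall hn)
    _ = _ := by rw [hR.liminf_eq]; simp

lemma exists_seq_ae_of_lintegral_sq {F : ℕ → Plane → ℝ} {f : Plane → ℝ}
    (hF : ∀ n, Measurable (F n)) (hf : Measurable f)
    (h : Tendsto (fun n => ∫⁻ x, ‖F n x - f x‖ₑ ^ 2) atTop (𝓝 0)) :
    ∃ k : ℕ → ℕ, StrictMono k ∧ ∀ᵐ x, Tendsto (fun n => F (k n) x) atTop (𝓝 (f x)) := by
  refine (tendstoInMeasure_of_tendsto_eLpNorm (p := 2) two_ne_zero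
    (fun n => (hF n).aestronglyMeasurable) hf.aestronglyMeasurable ?_).exists_seq_tendsto_ae
  have : ∀ n, eLpNorm (F n - f) 2 volume = (∫⁻ x, ‖F n x - f x‖ₑ ^ 2) ^ (1 / 2 : ℝ) := by
    intro n
    rw [eLpNorm_eq_lintegral_rpow_enorm_toReal two_ne_zero (by simp)]
    simp
  simp_rw [this]
  simpa using h.ennrpow_const (1 / 2 : ℝ)

lemma locallyIntegrable_of_lintegral_sq {f : Plane → ℝ} (hf : Measurable f)
    (h2 : ∫⁻ x, ‖f x‖ₑ ^ 2 ≠ ∞) : LocallyIntegrable f := by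
  have : MemLp f 2 := by
    refine ⟨hf.aestronglyMeasurable, ?_⟩
    rw [eLpNorm_lt_top_iff_lintegral_rpow_enorm_lt_top two_ne_zero (by simp)]
    simpa using h2.lt_top
  exact this.locallyIntegrable (by norm_num)

lemma dirE_eq_lintegral (f : Plane → ℝ) :
    dirE f = ∫⁻ x, (‖fderiv ℝ f x e0‖ₑ ^ 2 + ‖fderiv ℝ f x e1‖ₑ ^ 2) := rfl

lemma exists_mollified_seq {f : Plane → ℝ} {K : ℝ≥0∞} (hf : Measurable f)
    (h2 : ∫⁻ x, ‖f x‖ₑ ^ 2 ≠ ∞) (hK : EnergyLE f K) (hKt : K ≠ ∞) :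
    ∃ ν : ℕ → Measure Plane, (∀ n, IsProbabilityMeasure (ν n)) ∧
      (∀ n, ∀ x, Integrable (fun y => f (x - y)) (ν n)) ∧
      (∀ n, ContDiff ℝ 1 (avg (ν n) f)) ∧ (∀ n, dirE (avg (ν n) f) ≤ K) ∧
      (∀ n, ∫⁻ x, ‖avg (ν n) f x‖ₑ ^ 2 ≤ ∫⁻ x, ‖f x‖ₑ ^ 2) ∧
      Tendsto (fun n => ∫⁻ x, ‖avg (ν n) f x - f x‖ₑ ^ 2) atTop (𝓝 0) ∧
      ∀ᵐ x, Tendsto (fun n => avg (ν n) f x) atTop (𝓝 (f x)) := by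
  have hpos : ∀ n : ℕ, (0 : ℝ) < 1 / ((n : ℝ) + 1) := fun n => by positivity
  choose ν hν1 hν2 hν3 using fun n => exists_mollifier (hpos n)
  have hloc := locallyIntegrable_of_lintegral_sq hf h2
  have hi := fun n => (hν3 n f hloc).1
  have hlim : Tendsto (fun n => ∫⁻ x, ‖avg (ν n) f x - f x‖ₑ ^ 2) atTop (𝓝 0) := by
    refine tendsto_of_tendsto_of_tendsto_of_le_of_le tendsto_const_nhds ?_ (fun n => bot_le)
      (fun n => hK.lintegral_avg_sub_sq_le hf (hi n) (hν2 n))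
    have h0 : Tendsto (fun n : ℕ => ENNReal.ofReal ((1 / ((n : ℝ) + 1)) ^ 2)) atTop (𝓝 0) := by
      simpa using ENNReal.tendsto_ofReal
        ((tendsto_one_div_add_atTop_nhds_zero_nat (𝕜 := ℝ)).pow 2)
    simpa using ENNReal.Tendsto.const_mul h0
      (Or.inr (ENNReal.mul_ne_top incrConst_ne_top hKt))
  obtain ⟨k, hk, hae⟩ := exists_seq_ae_of_lintegral_sq (fun n => measurable_avg hf) hf hlim
  refine ⟨fun n => ν (k n), fun n => hν1 _, fun n => hi _, fun n => (hν3 _ f hloc).2, fun n => ?_,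
    fun n => lintegral_avg_sq_le hf, hlim.comp hk.tendsto_atTop, hae⟩
  rw [dirE_eq_lintegral]
  exact (hK.avg hf (hi _)).lintegral_deriv_le (((hν3 _ f hloc).2).differentiable one_ne_zero)

lemma GNIneq.of_energyLE {b : ℝ≥0∞} (h : GNIneq b) (hb : b ≠ ∞) {f : Plane → ℝ} {K : ℝ≥0∞}
    (hf : Measurable f) (h2 : ∫⁻ x, ‖f x‖ₑ ^ 2 ≠ ∞) (hK : EnergyLE f K) (hKt : K ≠ ∞) :
    b * ∫⁻ x, ‖f x‖ₑ ^ 4 ≤ 2 * K * ∫⁻ x, ‖f x‖ₑ ^ 2 := by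
  obtain ⟨ν, hν, -, hc, hd, hs, -, hae⟩ := exists_mollified_seq hf h2 hK hKt
  have hn : ∀ n, b * ∫⁻ x, ‖avg (ν n) f x‖ₑ ^ 4 ≤ 2 * K * ∫⁻ x, ‖f x‖ₑ ^ 2 := fun n =>
    (h.of_contDiff hb (hc n) (ne_top_of_le_ne_top h2 (hs n))
      (ne_top_of_le_ne_top hKt (hd n))).trans (mul_le_mul' (mul_le_mul_right (hd n) 2) (hs n))
  calc b * ∫⁻ x, ‖f x‖ₑ ^ 4 ≤ b * liminf (fun n => ∫⁻ x, ‖avg (ν n) f x‖ₑ ^ 4) atTop := by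
        gcongr
        exact lintegral_enorm_pow_le_liminf 4 (fun n => (hc n).continuous.measurable) hae
    _ ≤ liminf (fun n => b * ∫⁻ x, ‖avg (ν n) f x‖ₑ ^ 4) atTop :=
        (ENNReal.liminf_const_mul_of_ne_top hb).ge
    _ ≤ _ := liminf_le_of_le (by isBoundedDefault) fun c hc => by
        obtain ⟨n, hn'⟩ := hc.exists
        exact hn'.trans (hn n)

lemma memLp_two_of_lintegral {f : Plane → ℝ} (hf : Measurable f)
    (h2 : ∫⁻ x, ‖f x‖ₑ ^ 2 ≠ ∞) : MemLp f 2 := by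
  refine ⟨hf.aestronglyMeasurable, ?_⟩
  rw [eLpNorm_lt_top_iff_lintegral_rpow_enorm_lt_top two_ne_zero (by simp)]
  simpa using h2.lt_top

lemma eLpNorm_nat_eq (f : Plane → ℝ) {p : ℕ} (hp : p ≠ 0) :
    eLpNorm f p volume = (∫⁻ x, ‖f x‖ₑ ^ p) ^ (1 / (p : ℝ)) := by
  rw [eLpNorm_eq_lintegral_rpow_enorm_toReal (by exact_mod_cast hp) (by simp)]
  simp

lemma eLpNorm_two_eq (f : Plane → ℝ) :
    eLpNorm f 2 volume = (∫⁻ x, ‖f x‖ₑ ^ 2) ^ (1 / 2 : ℝ) := by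
  simpa using eLpNorm_nat_eq f two_ne_zero

/-- Weak sequential compactness of bounded sequences in `L²`, tested on indicators. -/
lemma exists_subseq_setIntegral_tendsto {F : ℕ → Plane → ℝ} {C : ℝ≥0∞} (hC : C ≠ ∞)
    (hF : ∀ n, Measurable (F n)) (h2 : ∀ n, ∫⁻ x, ‖F n x‖ₑ ^ 2 ≤ C) :
    ∃ k : ℕ → ℕ, StrictMono k ∧ ∀ s : Set Plane, MeasurableSet s → volume s ≠ ∞ →
      ∃ l : ℝ, Tendsto (fun n => ∫ x in s, F (k n) x) atTop (𝓝 l) := by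
  have hM : ∀ n, MemLp (F n) 2 := fun n =>
    memLp_two_of_lintegral (hF n) (ne_top_of_le_ne_top hC (h2 n))
  let v : ℕ → Lp ℝ 2 (volume : Measure Plane) := fun n => (hM n).toLp
  have hv : ∀ n, ‖v n‖ ≤ (C ^ (1 / 2 : ℝ)).toReal := by
    intro n
    rw [Lp.norm_toLp, eLpNorm_two_eq]
    refine ENNReal.toReal_mono (ENNReal.rpow_ne_top_of_nonneg (by norm_num) hC) ?_
    exact ENNReal.rpow_le_rpow (h2 n) (by norm_num)
  have : Fact ((2 : ℝ≥0∞) ≠ ∞) := ⟨by simp⟩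
  let w : ℕ → WeakDual ℝ (Lp ℝ 2 (volume : Measure Plane)) := fun n =>
    StrongDual.toWeakDual (InnerProductSpace.toDual ℝ _ (v n))
  obtain ⟨a, -, k, hk, hlim⟩ := WeakDual.isSeqCompact_closedBall
    (𝕜 := ℝ) (E := Lp ℝ 2 (volume : Measure Plane)) 0 (C ^ (1 / 2 : ℝ)).toReal
    (x := w) (fun n => by
      have h0 : InnerProductSpace.toDual ℝ _ (v n) ∈
          closedBall (0 : StrongDual ℝ (Lp ℝ 2 (volume : Measure Plane)))
            (C ^ (1 / 2 : ℝ)).toReal := by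
        rw [mem_closedBall_zero_iff]
        exact ((InnerProductSpace.toDual ℝ _).norm_map (v n)).le.trans (hv n)
      exact h0)
  refine ⟨k, hk, fun s hs hμ => ⟨a (indicatorConstLp 2 hs hμ 1), ?_⟩⟩
  have h1 := ((WeakDual.eval_continuous (indicatorConstLp 2 hs hμ (1 : ℝ))).tendsto a).comp hlim
  refine h1.congr fun n => ?_
  show inner ℝ (v (k n)) _ = _
  rw [real_inner_comm, L2.inner_indicatorConstLp_one]
  exact integral_congr_ae (ae_restrict_of_ae (hM (k n)).coeFn_toLp)

/-- Completeness of `L²` for honest functions. -/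
lemma exists_lim_of_cauchy_sq {F : ℕ → Plane → ℝ} (hF : ∀ n, Measurable (F n))
    (h2 : ∀ n, ∫⁻ x, ‖F n x‖ₑ ^ 2 ≠ ∞)
    (hc : ∀ ε : ℝ≥0∞, 0 < ε → ∃ N, ∀ m ≥ N, ∀ n ≥ N, ∫⁻ x, ‖F m x - F n x‖ₑ ^ 2 ≤ ε) :
    ∃ f : Plane → ℝ, Measurable f ∧ Tendsto (fun n => ∫⁻ x, ‖F n x - f x‖ₑ ^ 2) atTop (𝓝 0) := by
  have hM : ∀ n, MemLp (F n) 2 := fun n => memLp_two_of_lintegral (hF n) (h2 n)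
  let v : ℕ → Lp ℝ 2 (volume : Measure Plane) := fun n => (hM n).toLp
  have hsq : ∀ g : Plane → ℝ, ∫⁻ x, ‖g x‖ₑ ^ 2 = eLpNorm g 2 volume ^ (2 : ℝ) := by
    intro g
    rw [eLpNorm_two_eq, ← ENNReal.rpow_mul]; simp
  have hv : CauchySeq v := by
    rw [EMetric.cauchySeq_iff]
    intro ε hε
    obtain ⟨δ, hδ0, hδ⟩ := exists_between hε
    obtain ⟨N, hN⟩ := hc (δ ^ (2 : ℝ)) (ENNReal.rpow_pos hδ0 hδ.ne_top)
    refine ⟨N, fun m hm n hn => lt_of_le_of_lt ?_ hδ⟩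
    rw [Lp.edist_toLp_toLp, ← ENNReal.rpow_le_rpow_iff (zero_lt_two (α := ℝ)), ← hsq]
    exact hN m hm n hn
  obtain ⟨a, ha⟩ := cauchySeq_tendsto_of_complete hv
  refine ⟨a, (Lp.stronglyMeasurable a).measurable, ?_⟩
  have h1 : Tendsto (fun n => edist (v n) a ^ (2 : ℝ)) atTop (𝓝 0) := by
    simpa using (tendsto_iff_edist_tendsto_0.1 ha).ennrpow_const 2
  refine h1.congr fun n => ?_
  rw [Lp.edist_def, show (∫⁻ x, ‖F n x - a x‖ₑ ^ 2) = ∫⁻ x, ‖(F n - ⇑a) x‖ₑ ^ 2 from rfl, hsq]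
  congr 1
  exact eLpNorm_congr_ae ((hM n).coeFn_toLp.sub (ae_eq_refl _))

/-- Convergence of `p`-th moments under strong `L^p` convergence. -/
lemma tendsto_lintegral_pow {F : ℕ → Plane → ℝ} {f : Plane → ℝ} {p : ℕ} (hp : 1 ≤ p)
    (hF : ∀ n, Measurable (F n)) (hf : Measurable f) {c : ℝ≥0∞}
    (h : Tendsto (fun n => ∫⁻ x, ‖F n x - f x‖ₑ ^ p) atTop (𝓝 0))
    (hc : Tendsto (fun n => ∫⁻ x, ‖F n x‖ₑ ^ p) atTop (𝓝 c)) : ∫⁻ x, ‖f x‖ₑ ^ p = c := by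
  have hp0 : p ≠ 0 := by omega
  have hp1 : (1 : ℝ≥0∞) ≤ p := by exact_mod_cast hp
  have hpos : (0 : ℝ) < p := by exact_mod_cast hp
  have d0' : Tendsto (fun n => eLpNorm (F n - f) p volume) atTop (𝓝 0) := by
    simp_rw [eLpNorm_nat_eq _ hp0]
    have := h.ennrpow_const (1 / (p : ℝ))
    rwa [ENNReal.zero_rpow_of_pos (by positivity)] at this
  have c0 : Tendsto (fun n => eLpNorm (F n) p volume) atTop (𝓝 (c ^ (1 / (p : ℝ)))) := by
    simp_rw [eLpNorm_nat_eq _ hp0]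
    exact hc.ennrpow_const _
  have h1 : eLpNorm f p volume ≤ c ^ (1 / (p : ℝ)) := by
    have := c0.add d0'
    rw [add_zero] at this
    refine ge_of_tendsto' this fun n => ?_
    have e : f = F n - (F n - f) := by ext; simp
    calc eLpNorm f p volume = eLpNorm (F n - (F n - f)) p volume := by rw [← e]
      _ ≤ _ := eLpNorm_sub_le (hF n).aestronglyMeasurable
          ((hF n).sub hf).aestronglyMeasurable hp1
  have h2 : c ^ (1 / (p : ℝ)) ≤ eLpNorm f p volume := by
    have := (tendsto_const_nhds (x := eLpNorm f p volume)).add d0'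
    rw [add_zero] at this
    refine le_of_tendsto_of_tendsto' c0 this fun n => ?_
    have e : F n = f + (F n - f) := by ext; simp
    calc eLpNorm (F n) p volume = eLpNorm (f + (F n - f)) p volume := by rw [← e]
      _ ≤ _ := eLpNorm_add_le hf.aestronglyMeasurable
          ((hF n).sub hf).aestronglyMeasurable hp1
  have h3 := le_antisymm h1 h2
  rw [eLpNorm_nat_eq _ hp0] at h3
  exact ENNReal.rpow_left_injective (by positivity) h3

/-- The normalised restriction of Lebesgue measure to the disc of radius `η`. -/
def ballMeasure (η : ℝ) : Measure Plane :=
  (volume (ball (0 : Plane) η))⁻¹ • volume.restrict (ball 0 η)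

lemma volume_ball_ne_zero {η : ℝ} (hη : 0 < η) : volume (ball (0 : Plane) η) ≠ 0 :=
  (measure_ball_pos _ _ hη).ne'

lemma isProbabilityMeasure_ballMeasure {η : ℝ} (hη : 0 < η) :
    IsProbabilityMeasure (ballMeasure η) :=
  ⟨by
    rw [ballMeasure, Measure.smul_apply, Measure.restrict_apply_univ, smul_eq_mul,
      ENNReal.inv_mul_cancel (volume_ball_ne_zero hη) measure_ball_lt_top.ne]⟩

lemma ae_ballMeasure (η : ℝ) : ∀ᵐ y ∂ballMeasure η, y ∈ ball (0 : Plane) η :=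
  Measure.ae_smul_measure (ae_restrict_mem measurableSet_ball) _

lemma integrable_ballMeasure {f : Plane → ℝ} (hf : LocallyIntegrable f) {η : ℝ} (hη : 0 < η)
    (x : Plane) : Integrable (fun y => f (x - y)) (ballMeasure η) := by
  refine Integrable.smul_measure ?_ (ENNReal.inv_ne_top.2 (volume_ball_ne_zero hη))
  have h1 : IntegrableOn f (closedBall x η) :=
    hf.integrableOn_isCompact (isCompact_closedBall x η)
  have h2 : IntegrableOn (fun y => f (x - y)) ((fun y => x - y) ⁻¹' closedBall x η) :=
    ((Measure.measurePreserving_sub_left volume x).integrableOn_comp_preimage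
      (MeasurableEquiv.subLeft x).measurableEmbedding).2 h1
  refine h2.mono_set fun y hy => ?_
  simpa [dist_eq_norm] using (mem_ball_zero_iff.1 hy).le

lemma avg_ballMeasure (f : Plane → ℝ) (η : ℝ) (x : Plane) :
    avg (ballMeasure η) f x = (volume (ball (0 : Plane) η)).toReal⁻¹ * ∫ y in ball x η, f y := by
  unfold avg ballMeasure
  rw [integral_smul_measure, ENNReal.toReal_inv, smul_eq_mul]
  congr 1
  have := (Measure.measurePreserving_sub_left volume x).setIntegral_preimage_emb
    (MeasurableEquiv.subLeft x).measurableEmbedding f (ball x η)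
  rw [← this]
  congr 2
  ext y
  simp [dist_eq_norm]

lemma enorm_integral_sq_le {ν : Measure Plane} [IsProbabilityMeasure ν] {g : Plane → ℝ}
    (hg : Measurable g) : ‖∫ y, g y ∂ν‖ₑ ^ 2 ≤ ∫⁻ y, ‖g y‖ₑ ^ 2 ∂ν :=
  (pow_le_pow_left₀ bot_le (enorm_integral_le_lintegral_enorm _) 2).trans
    (sq_lintegral_le hg.enorm.aemeasurable)

lemma measurable_enorm_sub_sq {f g : Plane → ℝ} (hf : Measurable f) (hg : Measurable g) :
    Measurable fun x => ‖f x - g x‖ₑ ^ 2 := (hf.sub hg).enorm.pow_const 2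

lemma tendsto_enorm_sq_zero {u : ℕ → ℝ} (h : Tendsto u atTop (𝓝 0)) :
    Tendsto (fun n => ‖u n‖ₑ ^ 2) atTop (𝓝 0) := by
  have h1 := (((ENNReal.continuous_pow 2).comp continuous_enorm).tendsto (0 : ℝ)).comp h
  have e : ((fun a : ℝ≥0∞ => a ^ 2) ∘ fun a : ℝ => ‖a‖ₑ) 0 = 0 := by simp
  rw [e] at h1
  exact h1

lemma lintegral_comp_sub_left (f : Plane → ℝ≥0∞) (x : Plane) :
    ∫⁻ y, f (x - y) = ∫⁻ y, f y :=
  (Measure.measurePreserving_sub_left volume x).lintegral_comp_emb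
    (MeasurableEquiv.subLeft x).measurableEmbedding f

lemma enorm_avg_ballMeasure_sq_le {f : Plane → ℝ} (hf : Measurable f) {η : ℝ} (hη : 0 < η)
    (x : Plane) : ‖avg (ballMeasure η) f x‖ₑ ^ 2
      ≤ (volume (ball (0 : Plane) η))⁻¹ * ∫⁻ y, ‖f y‖ₑ ^ 2 := by
  have := isProbabilityMeasure_ballMeasure hη
  refine (enorm_integral_sq_le (hf.comp (measurable_const.sub measurable_id))).trans ?_
  rw [ballMeasure, lintegral_smul_measure, smul_eq_mul]
  refine mul_le_mul_right ((setLIntegral_le_lintegral _ _).trans ?_) _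
  exact (lintegral_comp_sub_left (fun y => ‖f y‖ₑ ^ 2) x).le

lemma exists_cauchy_ball {T : ℕ → Plane → ℝ} {D : ℝ≥0∞} (hD : D ≠ ∞)
    (hT : ∀ n, Measurable (T n)) (hb : ∀ n x, ‖T n x‖ₑ ^ 2 ≤ D)
    (hlim : ∀ x, ∃ l, Tendsto (fun n => T n x) atTop (𝓝 l)) (R : ℝ) {ε : ℝ≥0∞} (hε : 0 < ε) :
    ∃ N, ∀ m ≥ N, ∀ n ≥ N, ∫⁻ x in ball (0 : Plane) R, ‖T m x - T n x‖ₑ ^ 2 ≤ ε := by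
  choose h hh using hlim
  have hhm : Measurable h := measurable_of_tendsto_metrizable hT (tendsto_pi_nhds.2 hh)
  have hhb : ∀ x, ‖h x‖ₑ ^ 2 ≤ D := fun x =>
    le_of_tendsto' ((((ENNReal.continuous_pow 2).comp continuous_enorm).tendsto _).comp (hh x))
      fun n => hb n x
  have hdiff : ∀ n x, ‖T n x - h x‖ₑ ^ 2 ≤ 2 * D + 2 * D := fun n x =>
    (enorm_sub_sq_le _ _).trans (add_le_add (mul_le_mul_right (hb n x) 2)
      (mul_le_mul_right (hhb x) 2))
  have hto : Tendsto (fun n => ∫⁻ x in ball (0 : Plane) R, ‖T n x - h x‖ₑ ^ 2) atTop (𝓝 0) := by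
    have := tendsto_lintegral_of_dominated_convergence
      (μ := volume.restrict (ball (0 : Plane) R)) (F := fun n x => ‖T n x - h x‖ₑ ^ 2)
      (f := fun _ => 0) (fun _ => 2 * D + 2 * D)
      (fun n => ((hT n).sub hhm).enorm.pow_const 2) (fun n => ae_of_all _ fun x => hdiff n x)
      (by
        rw [lintegral_const]
        refine ENNReal.mul_ne_top (ENNReal.add_ne_top.2 ⟨?_, ?_⟩) ?_
        · exact ENNReal.mul_ne_top (by simp) hD
        · exact ENNReal.mul_ne_top (by simp) hD
        · rw [Measure.restrict_apply_univ]; exact measure_ball_lt_top.ne)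
      (ae_of_all _ fun x => by
        refine tendsto_enorm_sq_zero ?_
        simpa using (hh x).sub_const (h x))
    simpa using this
  have hε4 : 0 < ε / 4 := ENNReal.div_pos hε.ne' (by simp)
  obtain ⟨N, hN⟩ := eventually_atTop.1 (hto.eventually (ge_mem_nhds hε4))
  refine ⟨N, fun m hm n hn => ?_⟩
  calc ∫⁻ x in ball (0 : Plane) R, ‖T m x - T n x‖ₑ ^ 2
      ≤ ∫⁻ x in ball (0 : Plane) R, (2 * ‖T m x - h x‖ₑ ^ 2 + 2 * ‖T n x - h x‖ₑ ^ 2) := by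
        refine lintegral_mono fun x => ?_
        rw [show T m x - T n x = (T m x - h x) - (T n x - h x) by ring]
        exact enorm_sub_sq_le _ _
    _ = 2 * (∫⁻ x in ball (0 : Plane) R, ‖T m x - h x‖ₑ ^ 2)
        + 2 * ∫⁻ x in ball (0 : Plane) R, ‖T n x - h x‖ₑ ^ 2 := by
        have m1 := fun n => measurable_enorm_sub_sq (hT n) hhm
        rw [lintegral_add_left ((m1 m).const_mul 2), lintegral_const_mul _ (m1 m),
          lintegral_const_mul _ (m1 n)]
    _ ≤ 2 * (ε / 4) + 2 * (ε / 4) := by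
        gcongr
        · exact hN m hm
        · exact hN n hn
    _ = ε := by
        rw [← add_mul, show (2 : ℝ≥0∞) + 2 = 4 by norm_num]
        exact ENNReal.mul_div_cancel (by simp) (by simp)

/-- Bounded energy and tightness give strong `L²` compactness. -/
lemma exists_subseq_tendsto_sq {F : ℕ → Plane → ℝ} {C K : ℝ≥0∞} (hC : C ≠ ∞) (hK : K ≠ ∞)
    (hF : ∀ n, Measurable (F n)) (h2 : ∀ n, ∫⁻ x, ‖F n x‖ₑ ^ 2 ≤ C)
    (hE : ∀ n, EnergyLE (F n) K)
    (ht : ∀ ε : ℝ≥0∞, 0 < ε → ∃ R : ℝ, ∀ n, ∫⁻ x in (ball (0 : Plane) R)ᶜ, ‖F n x‖ₑ ^ 2 ≤ ε) :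
    ∃ k : ℕ → ℕ, StrictMono k ∧ ∃ f : Plane → ℝ, Measurable f ∧
      Tendsto (fun n => ∫⁻ x, ‖F (k n) x - f x‖ₑ ^ 2) atTop (𝓝 0) := by
  obtain ⟨k, hk, hw⟩ := exists_subseq_setIntegral_tendsto hC hF h2
  refine ⟨k, hk, exists_lim_of_cauchy_sq (fun n => hF (k n))
    (fun n => ne_top_of_le_ne_top hC (h2 _)) fun ε hε => ?_⟩
  have hloc : ∀ n, LocallyIntegrable (F n) := fun n =>
    locallyIntegrable_of_lintegral_sq (hF n) (ne_top_of_le_ne_top hC (h2 n))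
  set δ : ℝ≥0∞ := ε / 14 with hδ
  have hδ0 : 0 < δ := ENNReal.div_pos hε.ne' (by simp)
  obtain ⟨R, hR⟩ := ht δ hδ0
  obtain ⟨η, hη, hηδ⟩ : ∃ η : ℝ, 0 < η ∧ incrConst * K * ENNReal.ofReal (η ^ 2) ≤ δ := by
    have h0 : Tendsto (fun n : ℕ => ENNReal.ofReal ((1 / ((n : ℝ) + 1)) ^ 2)) atTop (𝓝 0) := by
      simpa using ENNReal.tendsto_ofReal
        ((tendsto_one_div_add_atTop_nhds_zero_nat (𝕜 := ℝ)).pow 2)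
    have h1 : Tendsto (fun n : ℕ => incrConst * K * ENNReal.ofReal ((1 / ((n : ℝ) + 1)) ^ 2))
        atTop (𝓝 0) := by
      simpa using ENNReal.Tendsto.const_mul h0
        (Or.inr (ENNReal.mul_ne_top incrConst_ne_top hK))
    obtain ⟨n, hn⟩ := (h1.eventually (ge_mem_nhds hδ0)).exists
    exact ⟨_, by positivity, hn⟩
  have hprob := isProbabilityMeasure_ballMeasure hη
  let T : ℕ → Plane → ℝ := fun n => avg (ballMeasure η) (F (k n))
  have hTm : ∀ n, Measurable (T n) := fun n => measurable_avg (hF (k n))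
  have hTF : ∀ n, ∫⁻ x, ‖T n x - F (k n) x‖ₑ ^ 2 ≤ δ := fun n =>
    ((hE (k n)).lintegral_avg_sub_sq_le (hF (k n)) (integrable_ballMeasure (hloc _) hη)
      (ae_ballMeasure η)).trans hηδ
  obtain ⟨N, hN⟩ := exists_cauchy_ball (T := T)
    (D := (volume (ball (0 : Plane) η))⁻¹ * C)
    (ENNReal.mul_ne_top (ENNReal.inv_ne_top.2 (volume_ball_ne_zero hη)) hC) hTm
    (fun n x => (enorm_avg_ballMeasure_sq_le (hF (k n)) hη x).trans
      (mul_le_mul_right (h2 (k n)) _))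
    (fun x => by
      obtain ⟨l, hl⟩ := hw (ball x η) measurableSet_ball measure_ball_lt_top.ne
      refine ⟨_, (hl.const_mul (volume (ball (0 : Plane) η)).toReal⁻¹).congr fun n => ?_⟩
      exact (avg_ballMeasure _ _ _).symm) R hδ0
  refine ⟨N, fun m hm n hn => ?_⟩
  have mF := fun n => (hF (k n)).enorm.pow_const 2
  have mTF := fun n => measurable_enorm_sub_sq (hTm n) (hF (k n))
  have mTT := fun m n => measurable_enorm_sub_sq (hTm m) (hTm n)
  have hin : ∫⁻ x in ball (0 : Plane) R, ‖F (k m) x - F (k n) x‖ₑ ^ 2 ≤ 2 * δ + (4 * δ + 4 * δ) := by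
    calc ∫⁻ x in ball (0 : Plane) R, ‖F (k m) x - F (k n) x‖ₑ ^ 2
        ≤ ∫⁻ x in ball (0 : Plane) R, (2 * ‖T m x - T n x‖ₑ ^ 2
          + (4 * ‖T m x - F (k m) x‖ₑ ^ 2 + 4 * ‖T n x - F (k n) x‖ₑ ^ 2)) := by
          refine lintegral_mono fun x => ?_
          rw [show F (k m) x - F (k n) x
            = (T m x - T n x) - ((T m x - F (k m) x) - (T n x - F (k n) x)) by ring]
          refine (enorm_sub_sq_le _ _).trans (add_le_add le_rfl ?_)
          calc 2 * ‖(T m x - F (k m) x) - (T n x - F (k n) x)‖ₑ ^ 2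
              ≤ 2 * (2 * ‖T m x - F (k m) x‖ₑ ^ 2 + 2 * ‖T n x - F (k n) x‖ₑ ^ 2) := by
                gcongr; exact enorm_sub_sq_le _ _
            _ = _ := by ring
      _ = 2 * (∫⁻ x in ball (0 : Plane) R, ‖T m x - T n x‖ₑ ^ 2)
          + (4 * (∫⁻ x in ball (0 : Plane) R, ‖T m x - F (k m) x‖ₑ ^ 2)
            + 4 * ∫⁻ x in ball (0 : Plane) R, ‖T n x - F (k n) x‖ₑ ^ 2) := by
          rw [lintegral_add_left ((mTT m n).const_mul 2), lintegral_const_mul _ (mTT m n),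
            lintegral_add_left ((mTF m).const_mul 4), lintegral_const_mul _ (mTF m),
            lintegral_const_mul _ (mTF n)]
      _ ≤ _ := by
          gcongr
          · exact hN m hm n hn
          · exact (setLIntegral_le_lintegral _ _).trans (hTF m)
          · exact (setLIntegral_le_lintegral _ _).trans (hTF n)
  have hout : ∫⁻ x in (ball (0 : Plane) R)ᶜ, ‖F (k m) x - F (k n) x‖ₑ ^ 2 ≤ 2 * δ + 2 * δ := by
    calc ∫⁻ x in (ball (0 : Plane) R)ᶜ, ‖F (k m) x - F (k n) x‖ₑ ^ 2
        ≤ ∫⁻ x in (ball (0 : Plane) R)ᶜ, (2 * ‖F (k m) x‖ₑ ^ 2 + 2 * ‖F (k n) x‖ₑ ^ 2) :=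
          lintegral_mono fun x => enorm_sub_sq_le _ _
      _ = 2 * (∫⁻ x in (ball (0 : Plane) R)ᶜ, ‖F (k m) x‖ₑ ^ 2)
          + 2 * ∫⁻ x in (ball (0 : Plane) R)ᶜ, ‖F (k n) x‖ₑ ^ 2 := by
          rw [lintegral_add_left ((mF m).const_mul 2), lintegral_const_mul _ (mF m),
            lintegral_const_mul _ (mF n)]
      _ ≤ _ := by
          gcongr
          · exact hR _
          · exact hR _
  rw [← lintegral_add_compl _ (measurableSet_ball (x := (0 : Plane)) (ε := R))]
  refine (add_le_add hin hout).trans (le_of_eq ?_)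
  rw [show 2 * δ + (4 * δ + 4 * δ) + (2 * δ + 2 * δ) = 14 * δ by ring, hδ]
  exact ENNReal.mul_div_cancel (by simp) (by simp)

/-- Optimisers of the Gagliardo–Nirenberg inequality, normalised so that
`‖∇P‖² = ‖P‖² = A`, with finite logarithmic energy. -/
structure IsOpt (A : ℝ) (P : Plane → ℝ) : Prop where
  meas : Measurable P
  nonneg : ∀ x, 0 ≤ P x
  mass : ∫⁻ x, ‖P x‖ₑ ^ 2 = ENNReal.ofReal A
  energy : EnergyLE P (ENNReal.ofReal A)
  four : ∫⁻ x, ‖P x‖ₑ ^ 4 = ENNReal.ofReal (2 * A)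
  log : logPos P ≠ ∞

lemma measurePreserving_add_diag (c : Plane) :
    MeasurePreserving (fun z : Plane × Plane => (z.1 + c, z.2 + c)) :=
  (measurePreserving_add_right volume c).prod (measurePreserving_add_right volume c)

lemma logDens_translate (f : Plane → ℝ) (c : Plane) (z : Plane × Plane) :
    logDens (fun x => f (x + c)) z = logDens f (z.1 + c, z.2 + c) := by
  simp [logDens]

lemma logPos_translate {f : Plane → ℝ} (hf : Measurable f) (c : Plane) :
    logPos (fun x => f (x + c)) = logPos f := by
  unfold logPos
  simp_rw [logDens_translate]
  exact (measurePreserving_add_diag c).lintegral_comp (measurable_logDens hf).ennreal_ofReal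

lemma logNeg_translate {f : Plane → ℝ} (hf : Measurable f) (c : Plane) :
    logNeg (fun x => f (x + c)) = logNeg f := by
  unfold logNeg
  simp_rw [logDens_translate]
  exact (measurePreserving_add_diag c).lintegral_comp (measurable_logDens hf).neg.ennreal_ofReal

lemma logPos_eq_iterated {f : Plane → ℝ} (hf : Measurable f) :
    logPos f = ∫⁻ y, (∫⁻ x, ENNReal.ofReal (Real.log ‖x - y‖) * ‖f x‖ₑ ^ 2) * ‖f y‖ₑ ^ 2 := by
  unfold logPos
  rw [Measure.volume_eq_prod, lintegral_prod_symm (fun z => ENNReal.ofReal (logDens f z))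
    (measurable_logDens hf).ennreal_ofReal.aemeasurable]
  congr 1; ext y
  rw [← lintegral_mul_const _ (by fun_prop)]
  congr 1; ext x
  rw [logDens, ENNReal.ofReal_mul' (sq_nonneg _), ENNReal.ofReal_mul' (sq_nonneg _),
    ofReal_sq_eq_enorm, ofReal_sq_eq_enorm]

lemma exists_log_weight_le {f : Plane → ℝ} (hf : Measurable f) {D c : ℝ≥0∞} (hD : logPos f ≤ D)
    (hDt : D ≠ ∞) (hc : c ≤ ∫⁻ x, ‖f x‖ₑ ^ 2) (hc0 : c ≠ 0) (hct : c ≠ ∞) :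
    ∃ y : Plane, ∫⁻ x, ENNReal.ofReal (Real.log ‖x‖) * ‖f (x + y)‖ₑ ^ 2 ≤ D / c + 1 := by
  by_contra! h
  have h1 : (D / c + 1) * c ≤ D := by
    calc (D / c + 1) * c ≤ (D / c + 1) * ∫⁻ x, ‖f x‖ₑ ^ 2 := by gcongr
      _ = ∫⁻ y, (D / c + 1) * ‖f y‖ₑ ^ 2 := (lintegral_const_mul _ (by fun_prop)).symm
      _ ≤ ∫⁻ y, (∫⁻ x, ENNReal.ofReal (Real.log ‖x - y‖) * ‖f x‖ₑ ^ 2) * ‖f y‖ₑ ^ 2 := by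
          refine lintegral_mono fun y => mul_le_mul_left ((h y).le.trans (le_of_eq ?_)) _
          have := lintegral_add_right_eq_self (μ := (volume : Measure Plane))
            (fun x => ENNReal.ofReal (Real.log ‖x - y‖) * ‖f x‖ₑ ^ 2) y
          simpa using this
      _ ≤ D := (logPos_eq_iterated hf).ge.trans hD
  rw [add_mul, ENNReal.div_mul_cancel hc0 hct, one_mul] at h1
  exact absurd h1 (not_le.2 (ENNReal.lt_add_right hDt hc0))

lemma lintegral_tail_le (g : Plane → ℝ≥0∞) {R : ℝ} (hR : 1 < R) {D : ℝ≥0∞}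
    (hD : ∫⁻ x, ENNReal.ofReal (Real.log ‖x‖) * g x ≤ D) :
    ∫⁻ x in (ball (0 : Plane) R)ᶜ, g x ≤ D / ENNReal.ofReal (Real.log R) := by
  have h0 : ENNReal.ofReal (Real.log R) ≠ 0 := by
    simpa using Real.log_pos hR
  rw [ENNReal.le_div_iff_mul_le (Or.inl h0) (Or.inl ENNReal.ofReal_ne_top), mul_comm,
    ← lintegral_const_mul' _ _ ENNReal.ofReal_ne_top]
  refine le_trans ?_ hD
  refine le_trans ?_ (setLIntegral_le_lintegral (ball (0 : Plane) R)ᶜ _)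
  refine setLIntegral_mono' measurableSet_ball.compl fun x hx => ?_
  gcongr
  simpa using hx

lemma exists_tail_radius {D ε : ℝ≥0∞} (hD : D ≠ ∞) (hε : 0 < ε) :
    ∃ R : ℝ, 1 < R ∧ D / ENNReal.ofReal (Real.log R) ≤ ε := by
  have h1 : Tendsto (fun R : ℝ => D / ENNReal.ofReal (Real.log R)) atTop (𝓝 (D / ∞)) :=
    ENNReal.Tendsto.const_div (ENNReal.tendsto_ofReal_atTop.comp Real.tendsto_log_atTop)
      (Or.inr hD)
  rw [ENNReal.div_top] at h1
  obtain ⟨R, hR, hR'⟩ := ((eventually_gt_atTop 1).and (h1.eventually (ge_mem_nhds hε))).exists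
  exact ⟨R, hR, hR'⟩

lemma negForm_comm {F G : Plane → ℝ≥0∞} (hF : Measurable F) (hG : Measurable G) :
    negForm F G = negForm G F := by
  unfold negForm
  rw [lintegral_lintegral_swap (by fun_prop)]
  congr 1; ext x; congr 1; ext y
  rw [norm_sub_rev]; ring

lemma negForm_add_left {F F' G : Plane → ℝ≥0∞} (hF : Measurable F)
    (hG : Measurable G) : negForm (F + F') G = negForm F G + negForm F' G := by
  unfold negForm
  rw [← lintegral_add_left]
  · congr 1; ext y
    rw [← lintegral_add_left (by fun_prop)]
    congr 1; ext x; simp only [Pi.add_apply]; ring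
  · exact Measurable.lintegral_prod_left'
      (f := fun p : Plane × Plane => ENNReal.ofReal (-Real.log ‖p.1 - p.2‖) * F p.1 * G p.2)
      (by fun_prop)

lemma negForm_mono {F F' G G' : Plane → ℝ≥0∞} (h : F ≤ F') (h' : G ≤ G') :
    negForm F G ≤ negForm F' G' := by
  unfold negForm
  refine lintegral_mono fun y => lintegral_mono fun x => ?_
  have := h x; have := h' y
  gcongr

/-- Upper semicontinuity of the negative logarithmic part. -/
lemma logNeg_le_add {f g : Plane → ℝ} (hf : Measurable f) (hg : Measurable g) {C : ℝ≥0∞}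
    (hf4 : ∫⁻ x, ‖f x‖ₑ ^ 4 ≤ C) (hg4 : ∫⁻ x, ‖g x‖ₑ ^ 4 ≤ C) :
    logNeg f ≤ logNeg g + 2 * ((logSq * C) ^ (1 / 2 : ℝ) * ∫⁻ x, ‖f x ^ 2 - g x ^ 2‖ₑ) := by
  set F : Plane → ℝ≥0∞ := fun x => ‖f x‖ₑ ^ 2
  set G : Plane → ℝ≥0∞ := fun x => ‖g x‖ₑ ^ 2
  set D : Plane → ℝ≥0∞ := fun x => ‖f x ^ 2 - g x ^ 2‖ₑ
  have mF : Measurable F := by fun_prop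
  have mG : Measurable G := by fun_prop
  have mD : Measurable D := by fun_prop
  have hle : F ≤ G + D := by
    intro x
    have : ‖f x ^ 2‖ₑ ≤ ‖g x ^ 2‖ₑ + ‖f x ^ 2 - g x ^ 2‖ₑ := by
      calc ‖f x ^ 2‖ₑ = ‖g x ^ 2 + (f x ^ 2 - g x ^ 2)‖ₑ := by congr 1; ring
        _ ≤ _ := enorm_add_le _ _
    simpa [F, G, D, enorm_pow] using this
  have hF2 : ∫⁻ x, F x ^ 2 ≤ C := by simpa only [F, ← pow_mul] using hf4
  have hG2 : ∫⁻ x, G x ^ 2 ≤ C := by simpa only [G, ← pow_mul] using hg4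
  have b1 : negForm F D ≤ (logSq * C) ^ (1 / 2 : ℝ) * ∫⁻ x, D x :=
    (negForm_le mF mD).trans (by gcongr)
  have b2 : negForm G D ≤ (logSq * C) ^ (1 / 2 : ℝ) * ∫⁻ x, D x :=
    (negForm_le mG mD).trans (by gcongr)
  rw [logNeg_eq_negForm hf, logNeg_eq_negForm hg]
  calc negForm F F ≤ negForm (G + D) F := negForm_mono hle le_rfl
    _ = negForm G F + negForm D F := negForm_add_left mG mF
    _ = negForm F G + negForm F D := by rw [negForm_comm mG mF, negForm_comm mD mF]
    _ ≤ negForm (G + D) G + negForm F D := add_le_add (negForm_mono hle le_rfl) le_rfl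
    _ = negForm G G + negForm G D + negForm F D := by
        rw [negForm_add_left mG mG, negForm_comm mD mG]
    _ ≤ negForm G G + (logSq * C) ^ (1 / 2 : ℝ) * (∫⁻ x, D x)
        + (logSq * C) ^ (1 / 2 : ℝ) * ∫⁻ x, D x := by gcongr
    _ = _ := by ring

lemma lintegral_sq_sub_sq_le {f g : Plane → ℝ} (hf : Measurable f) (hg : Measurable g) :
    ∫⁻ x, ‖f x ^ 2 - g x ^ 2‖ₑ ≤ ((∫⁻ x, ‖f x - g x‖ₑ ^ 2)
      * (2 * (∫⁻ x, ‖f x‖ₑ ^ 2) + 2 * ∫⁻ x, ‖g x‖ₑ ^ 2)) ^ (1 / 2 : ℝ) := by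
  have e : ∀ x, ‖f x ^ 2 - g x ^ 2‖ₑ = ‖f x - g x‖ₑ * ‖f x + g x‖ₑ := fun x => by
    rw [← enorm_mul]; congr 1; ring
  simp_rw [e]
  have h1 := sq_lintegral_mul_le (μ := (volume : Measure Plane))
    (hf.sub hg).enorm.aemeasurable (hf.add hg).enorm.aemeasurable
  have h2 : ∫⁻ x, ‖f x + g x‖ₑ ^ 2 ≤ 2 * (∫⁻ x, ‖f x‖ₑ ^ 2) + 2 * ∫⁻ x, ‖g x‖ₑ ^ 2 := by
    rw [← lintegral_const_mul _ (by fun_prop), ← lintegral_const_mul _ (by fun_prop),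
      ← lintegral_add_left (by fun_prop)]
    exact lintegral_mono fun x => enorm_add_sq_le _ _
  have h3 := h1.trans (mul_le_mul_right h2 _)
  calc ∫⁻ x, ‖f x - g x‖ₑ * ‖f x + g x‖ₑ
      = ((∫⁻ x, ‖f x - g x‖ₑ * ‖f x + g x‖ₑ) ^ 2) ^ (1 / 2 : ℝ) := by
        rw [← ENNReal.rpow_natCast, ← ENNReal.rpow_mul]; norm_num
    _ ≤ _ := ENNReal.rpow_le_rpow h3 (by norm_num)

lemma logPos_le_of_tendsto {F : ℕ → Plane → ℝ} {P : Plane → ℝ} (hF : ∀ n, Measurable (F n))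
    (hae : ∀ᵐ x, Tendsto (fun n => F n x) atTop (𝓝 (P x))) {c : ℝ≥0∞}
    (h : ∀ᶠ n in atTop, logPos (F n) ≤ c) : logPos P ≤ c := by
  have e1 : ∀ᵐ z : Plane × Plane, Tendsto (fun n => F n z.1) atTop (𝓝 (P z.1)) :=
    Measure.quasiMeasurePreserving_fst.ae hae
  have e2 : ∀ᵐ z : Plane × Plane, Tendsto (fun n => F n z.2) atTop (𝓝 (P z.2)) :=
    Measure.quasiMeasurePreserving_snd.ae hae
  calc logPos P = ∫⁻ z, liminf (fun n => ENNReal.ofReal (logDens (F n) z)) atTop := by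
        refine lintegral_congr_ae ?_
        filter_upwards [e1, e2] with z h1 h2
        exact (((ENNReal.continuous_ofReal.tendsto _).comp
          ((tendsto_const_nhds.mul (h1.pow 2)).mul (h2.pow 2))).liminf_eq).symm
    _ ≤ liminf (fun n => logPos (F n)) atTop :=
        lintegral_liminf_le fun n => (measurable_logDens (hF n)).ennreal_ofReal
    _ ≤ c := liminf_le_of_frequently_le' h.frequently

lemma logNeg_limsup {F : ℕ → Plane → ℝ} {P : Plane → ℝ} (hF : ∀ n, Measurable (F n))
    (hP : Measurable P) {C2 C4 : ℝ≥0∞} (hC2 : C2 ≠ ∞) (hC4 : C4 ≠ ∞)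
    (h2 : ∀ n, ∫⁻ x, ‖F n x‖ₑ ^ 2 ≤ C2) (h4 : ∀ n, ∫⁻ x, ‖F n x‖ₑ ^ 4 ≤ C4)
    (h2' : ∫⁻ x, ‖P x‖ₑ ^ 2 ≤ C2) (h4' : ∫⁻ x, ‖P x‖ₑ ^ 4 ≤ C4)
    (hc : Tendsto (fun n => ∫⁻ x, ‖F n x - P x‖ₑ ^ 2) atTop (𝓝 0)) {ε : ℝ} (hε : 0 < ε) :
    ∀ᶠ n in atTop, (logNeg (F n)).toReal ≤ (logNeg P).toReal + ε := by
  have hlim : Tendsto (fun n => 2 * ((logSq * C4) ^ (1 / 2 : ℝ) *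
      ((∫⁻ x, ‖F n x - P x‖ₑ ^ 2) * (2 * C2 + 2 * C2)) ^ (1 / 2 : ℝ))) atTop (𝓝 0) := by
    have a1 : Tendsto (fun n => (∫⁻ x, ‖F n x - P x‖ₑ ^ 2) * (2 * C2 + 2 * C2)) atTop
        (𝓝 (0 * (2 * C2 + 2 * C2))) :=
      ENNReal.Tendsto.mul_const hc (Or.inr (by finiteness))
    rw [zero_mul] at a1
    have a2 := (ENNReal.continuous_rpow_const (y := (1 / 2 : ℝ))).continuousAt.tendsto.comp a1
    rw [ENNReal.zero_rpow_of_pos (by norm_num)] at a2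
    have hne : (logSq * C4) ^ (1 / 2 : ℝ) ≠ ∞ :=
      ENNReal.rpow_ne_top_of_nonneg (by norm_num) (ENNReal.mul_ne_top logSq_ne_top hC4)
    have a3 := ENNReal.Tendsto.const_mul (a := (2 : ℝ≥0∞))
      (ENNReal.Tendsto.const_mul a2 (Or.inr hne)) (Or.inr (by norm_num))
    simpa using a3
  have hNP : logNeg P ≠ ∞ :=
    logNeg_ne_top_of hP (ne_top_of_le_ne_top hC2 h2') (ne_top_of_le_ne_top hC4 h4')
  filter_upwards [hlim.eventually (ge_mem_nhds (ENNReal.ofReal_pos.2 hε))] with n hn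
  have key : logNeg (F n) ≤ logNeg P + ENNReal.ofReal ε := by
    refine (logNeg_le_add (hF n) hP (h4 n) h4').trans ?_
    refine add_le_add le_rfl (le_trans ?_ hn)
    gcongr
    refine (lintegral_sq_sub_sq_le (hF n) hP).trans ?_
    gcongr
    exact h2 n
  have := ENNReal.toReal_mono (by finiteness) key
  rwa [ENNReal.toReal_add hNP ENNReal.ofReal_ne_top, ENNReal.toReal_ofReal hε.le] at this

lemma isOpt_of_tendsto {A : ℝ} (hGN : GNIneq (ENNReal.ofReal A)) (hA : 0 < A)
    {F : ℕ → Plane → ℝ} {P : Plane → ℝ} (hF : ∀ n, Measurable (F n)) (hP : Measurable P)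
    (hP0 : ∀ x, 0 ≤ P x) (hE : ∀ n, EnergyLE (F n) (ENNReal.ofReal A))
    (h2 : Tendsto (fun n => ∫⁻ x, ‖F n x‖ₑ ^ 2) atTop (𝓝 (ENNReal.ofReal A)))
    (h4 : Tendsto (fun n => ∫⁻ x, ‖F n x‖ₑ ^ 4) atTop (𝓝 (ENNReal.ofReal (2 * A))))
    (hc : Tendsto (fun n => ∫⁻ x, ‖F n x - P x‖ₑ ^ 2) atTop (𝓝 0))
    (hae : ∀ᵐ x, Tendsto (fun n => F n x) atTop (𝓝 (P x))) (hlog : logPos P ≠ ∞) :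
    IsOpt A P := by
  have hEP : EnergyLE P (ENNReal.ofReal A) := EnergyLE.of_tendsto hF hae hE tendsto_const_nhds
  have hA0 : ENNReal.ofReal A ≠ 0 := by simpa using hA
  refine ⟨hP, hP0, tendsto_lintegral_pow (by norm_num) hF hP hc h2, hEP,
    tendsto_lintegral_pow (by norm_num) hF hP ?_ h4, hlog⟩
  have hb : ∀ᶠ n in atTop, ∫⁻ x, ‖F n x - P x‖ₑ ^ 4 ≤
      (ENNReal.ofReal A)⁻¹ * (2 * (2 * ENNReal.ofReal A + 2 * ENNReal.ofReal A) *
        ∫⁻ x, ‖F n x - P x‖ₑ ^ 2) := by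
    filter_upwards [hc.eventually (gt_mem_nhds ENNReal.zero_lt_top)] with n hn
    have := hGN.of_energyLE ENNReal.ofReal_ne_top ((hF n).sub hP) hn.ne
      ((hE n).sub (hF n) hEP) (by finiteness)
    calc ∫⁻ x, ‖F n x - P x‖ₑ ^ 4
        = (ENNReal.ofReal A)⁻¹ * (ENNReal.ofReal A * ∫⁻ x, ‖F n x - P x‖ₑ ^ 4) := by
          rw [← mul_assoc, ENNReal.inv_mul_cancel hA0 ENNReal.ofReal_ne_top, one_mul]
      _ ≤ _ := mul_le_mul_right this _
  have hz : Tendsto (fun n => (ENNReal.ofReal A)⁻¹ * (2 * (2 * ENNReal.ofReal A +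
      2 * ENNReal.ofReal A) * ∫⁻ x, ‖F n x - P x‖ₑ ^ 2)) atTop (𝓝 0) := by
    have := ENNReal.Tendsto.const_mul (a := (ENNReal.ofReal A)⁻¹) (ENNReal.Tendsto.const_mul
      (a := 2 * (2 * ENNReal.ofReal A + 2 * ENNReal.ofReal A)) hc (Or.inr (by finiteness)))
      (Or.inr (ENNReal.inv_ne_top.2 hA0))
    simpa using this
  exact tendsto_of_tendsto_of_tendsto_of_le_of_le' tendsto_const_nhds hz
    (Eventually.of_forall fun _ => bot_le) hb

lemma logPos_le_ofReal {f : Plane → ℝ} (hp : logPos f ≠ ∞) {ℓ B : ℝ}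
    (h : (logPos f).toReal ≤ (logNeg f).toReal + ℓ) (hB : (logNeg f).toReal + ℓ ≤ B) :
    logPos f ≤ ENNReal.ofReal B :=
  (ENNReal.ofReal_toReal hp).symm.le.trans (ENNReal.ofReal_le_ofReal (h.trans hB))

/-- Compactness, modulo translations, of almost optimal sequences for the
Gagliardo–Nirenberg inequality with bounded logarithmic energy. -/
theorem exists_isOpt {A : ℝ} (hGN : GNIneq (ENNReal.ofReal A)) (hA : 0 < A)
    {F : ℕ → Plane → ℝ} (hF : ∀ n, Measurable (F n)) (hnn : ∀ n x, 0 ≤ F n x)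
    (hE : ∀ n, EnergyLE (F n) (ENNReal.ofReal A)) {c C2 C4 : ℝ≥0∞} (hc : c ≠ 0)
    (hC2 : C2 ≠ ∞) (hC4 : C4 ≠ ∞) (hcm : ∀ n, c ≤ ∫⁻ x, ‖F n x‖ₑ ^ 2)
    (hm : ∀ n, ∫⁻ x, ‖F n x‖ₑ ^ 2 ≤ C2) (hq : ∀ n, ∫⁻ x, ‖F n x‖ₑ ^ 4 ≤ C4)
    (h2 : Tendsto (fun n => ∫⁻ x, ‖F n x‖ₑ ^ 2) atTop (𝓝 (ENNReal.ofReal A)))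
    (h4 : Tendsto (fun n => ∫⁻ x, ‖F n x‖ₑ ^ 4) atTop (𝓝 (ENNReal.ofReal (2 * A))))
    (hp : ∀ n, logPos (F n) ≠ ∞) {ℓ : ℕ → ℝ} {l : ℝ}
    (hle : ∀ n, (logPos (F n)).toReal ≤ (logNeg (F n)).toReal + ℓ n)
    (hl : Tendsto ℓ atTop (𝓝 l)) :
    ∃ P, IsOpt A P ∧ (logPos P).toReal ≤ (logNeg P).toReal + l := by
  obtain ⟨M, hM⟩ := hl.bddAbove_range
  have hM' : ∀ n, ℓ n ≤ M := fun n => hM ⟨n, rfl⟩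
  set N : ℝ≥0∞ := (logSq * C4) ^ (1 / 2 : ℝ) * C2
  have hNt : N ≠ ∞ := ENNReal.mul_ne_top
    (ENNReal.rpow_ne_top_of_nonneg (by norm_num) (ENNReal.mul_ne_top logSq_ne_top hC4)) hC2
  have hN : ∀ n, logNeg (F n) ≤ N := fun n => (logNeg_le (hF n)).trans
    (mul_le_mul' (ENNReal.rpow_le_rpow (mul_le_mul_right (hq n) _) (by norm_num)) (hm n))
  set D : ℝ≥0∞ := ENNReal.ofReal (N.toReal + M)
  have hD : ∀ n, logPos (F n) ≤ D := fun n => logPos_le_ofReal (hp n) (hle n)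
    (add_le_add (ENNReal.toReal_mono hNt (hN n)) (hM' n))
  have hct : c ≠ ∞ := ne_top_of_le_ne_top hC2 ((hcm 0).trans (hm 0))
  choose y hy using fun n => exists_log_weight_le (hF n) (hD n) ENNReal.ofReal_ne_top (hcm n) hc hct
  set G : ℕ → Plane → ℝ := fun n x => F n (x + y n)
  have hG : ∀ n, Measurable (G n) := fun n => (hF n).comp (measurable_add_const _)
  have inv : ∀ (k n : ℕ), ∫⁻ x, ‖G n x‖ₑ ^ k = ∫⁻ x, ‖F n x‖ₑ ^ k := fun k n =>
    lintegral_add_right_eq_self (μ := (volume : Measure Plane)) (fun x => ‖F n x‖ₑ ^ k) (y n)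
  have hGE : ∀ n, EnergyLE (G n) (ENNReal.ofReal A) := fun n => (hE n).translate _
  have tight : ∀ ε : ℝ≥0∞, 0 < ε →
      ∃ R : ℝ, ∀ n, ∫⁻ x in (ball (0 : Plane) R)ᶜ, ‖G n x‖ₑ ^ 2 ≤ ε := by
    intro ε hε
    obtain ⟨R, hR, hR'⟩ := exists_tail_radius (D := D / c + 1)
      (ENNReal.add_ne_top.2 ⟨ENNReal.div_ne_top ENNReal.ofReal_ne_top hc, ENNReal.one_ne_top⟩) hε
    exact ⟨R, fun n => (lintegral_tail_le _ hR (hy n)).trans hR'⟩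
  obtain ⟨k, hk, f, hf, hlim⟩ := exists_subseq_tendsto_sq hC2 ENNReal.ofReal_ne_top hG
    (fun n => (inv 2 n).le.trans (hm n)) hGE tight
  obtain ⟨j, hj, hae⟩ := exists_seq_ae_of_lintegral_sq (fun n => hG (k n)) hf hlim
  set P : Plane → ℝ := fun x => |f x|
  have hP : Measurable P := hf.norm
  have hkj : Tendsto (fun n => k (j n)) atTop atTop := hk.tendsto_atTop.comp hj.tendsto_atTop
  have hlim' : Tendsto (fun n => ∫⁻ x, ‖G (k (j n)) x - P x‖ₑ ^ 2) atTop (𝓝 0) := by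
    refine tendsto_of_tendsto_of_tendsto_of_le_of_le tendsto_const_nhds
      (hlim.comp hj.tendsto_atTop) (fun _ => bot_le) fun n => lintegral_mono fun x => ?_
    have h1 : |G (k (j n)) x - P x| ≤ |G (k (j n)) x - f x| := by
      have h := abs_abs_sub_abs_le_abs_sub (G (k (j n)) x) (f x)
      rwa [abs_of_nonneg (hnn (k (j n)) _ : 0 ≤ G (k (j n)) x)] at h
    have h2 : ‖G (k (j n)) x - P x‖ₑ ≤ ‖G (k (j n)) x - f x‖ₑ := by
      rw [← ofReal_norm, ← ofReal_norm]; exact ENNReal.ofReal_le_ofReal h1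
    exact pow_le_pow_left' h2 2
  have hae' : ∀ᵐ x, Tendsto (fun n => G (k (j n)) x) atTop (𝓝 (P x)) := by
    filter_upwards [hae] with x hx
    refine hx.abs.congr fun n => abs_of_nonneg (hnn _ _)
  have hlogG : ∀ n, logPos (G n) = logPos (F n) := fun n => logPos_translate (hF n) _
  have hnegG : ∀ n, logNeg (G n) = logNeg (F n) := fun n => logNeg_translate (hF n) _
  have hPD : logPos P ≤ D := logPos_le_of_tendsto (fun n => hG _) hae'
    (Eventually.of_forall fun n => (hlogG _).le.trans (hD _))
  have hopt : IsOpt A P := isOpt_of_tendsto hGN hA (fun n => hG _) hP (fun x => abs_nonneg _)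
    (fun n => hGE _) ((h2.comp hkj).congr fun n => (inv 2 _).symm)
    ((h4.comp hkj).congr fun n => (inv 4 _).symm) hlim' hae'
    (ne_top_of_le_ne_top ENNReal.ofReal_ne_top hPD)
  refine ⟨P, hopt, le_of_forall_pos_le_add fun ε hε => ?_⟩
  have b2 : ∫⁻ x, ‖P x‖ₑ ^ 2 ≤ C2 := hopt.mass.le.trans (le_of_tendsto' h2 hm)
  have b4 : ∫⁻ x, ‖P x‖ₑ ^ 4 ≤ C4 := hopt.four.le.trans (le_of_tendsto' h4 hq)
  have ev : ∀ᶠ n in atTop, (logNeg (F (k (j n)))).toReal + ℓ (k (j n)) ≤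
      (logNeg P).toReal + l + ε := by
    filter_upwards [logNeg_limsup (fun n => hG (k (j n))) hP hC2 hC4
      (fun n => (inv 2 _).le.trans (hm _)) (fun n => (inv 4 _).le.trans (hq _)) b2 b4 hlim'
      (half_pos hε), (hl.comp hkj).eventually (gt_mem_nhds (show l < l + ε / 2 by linarith))]
      with n h1 h2
    rw [hnegG] at h1
    simp only [Function.comp_apply] at h2
    linarith
  have hfin : logPos P ≤ ENNReal.ofReal ((logNeg P).toReal + l + ε) :=
    logPos_le_of_tendsto (fun n => hG _) hae'
      (ev.mono fun n hn => (hlogG _).le.trans (logPos_le_ofReal (hp _) (hle _) hn))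
  have hnn' : 0 ≤ (logNeg P).toReal + l + ε := by
    obtain ⟨n, hn⟩ := ev.exists
    exact ENNReal.toReal_nonneg.trans ((hle _).trans hn)
  exact (ENNReal.toReal_mono ENNReal.ofReal_ne_top hfin).trans
    (ENNReal.toReal_ofReal hnn').le

lemma IsOpt.logNeg_ne_top {A : ℝ} {P : Plane → ℝ} (h : IsOpt A P) : logNeg P ≠ ∞ :=
  logNeg_ne_top_of h.meas (by rw [h.mass]; exact ENNReal.ofReal_ne_top)
    (by rw [h.four]; exact ENNReal.ofReal_ne_top)

lemma IsOpt.integrable {A : ℝ} {P : Plane → ℝ} (h : IsOpt A P) : Integrable (logDens P) :=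
  integrable_logDens h.meas h.log h.logNeg_ne_top

lemma IsOpt.logEn_eq {A : ℝ} {P : Plane → ℝ} (h : IsOpt A P) :
    logEn P = (logPos P).toReal - (logNeg P).toReal :=
  _root_.logEn_eq h.integrable

/-- The logarithmic energy attains its minimum over the Gagliardo–Nirenberg optimisers. -/
theorem exists_isOpt_min {A : ℝ} (hGN : GNIneq (ENNReal.ofReal A)) (hA : 0 < A)
    {P : Plane → ℝ} (hP : IsOpt A P) :
    ∃ P₀, IsOpt A P₀ ∧ ∀ P', IsOpt A P' → logEn P₀ ≤ logEn P' := by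
  set S : Set ℝ := logEn '' {f | IsOpt A f}
  have hne : S.Nonempty := ⟨_, P, hP, rfl⟩
  set N : ℝ≥0∞ := (logSq * ENNReal.ofReal (2 * A)) ^ (1 / 2 : ℝ) * ENNReal.ofReal A
  have hNt : N ≠ ∞ := ENNReal.mul_ne_top
    (ENNReal.rpow_ne_top_of_nonneg (by norm_num) (ENNReal.mul_ne_top logSq_ne_top
      ENNReal.ofReal_ne_top)) ENNReal.ofReal_ne_top
  have hbdd : BddBelow S := by
    refine ⟨-N.toReal, ?_⟩
    rintro _ ⟨f, hf, rfl⟩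
    have hf : IsOpt A f := hf
    have h1 : logNeg f ≤ N := by
      have := logNeg_le hf.meas
      rwa [hf.mass, hf.four] at this
    have := ENNReal.toReal_mono hNt h1
    rw [hf.logEn_eq]
    linarith [ENNReal.toReal_nonneg (a := logPos f)]
  obtain ⟨s, -, hs, hsS⟩ := exists_seq_tendsto_sInf hne hbdd
  choose F hF hFs using hsS
  have hF : ∀ n, IsOpt A (F n) := hF
  have hA0 : ENNReal.ofReal A ≠ 0 := by simpa using hA
  obtain ⟨P₀, h₀, hle⟩ := exists_isOpt hGN hA (fun n => (hF n).meas) (fun n => (hF n).nonneg)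
    (fun n => (hF n).energy) hA0 (ENNReal.ofReal_ne_top (r := A))
    (ENNReal.ofReal_ne_top (r := 2 * A)) (fun n => (hF n).mass.ge) (fun n => (hF n).mass.le)
    (fun n => (hF n).four.le) (by simp [(hF _).mass]) (by simp [(hF _).four])
    (fun n => (hF n).log) (ℓ := s) (fun n => by
      have := (hF n).logEn_eq; have := hFs n; linarith) hs
  refine ⟨P₀, h₀, fun P' hP' => ?_⟩
  have h1 : sInf S ≤ logEn P' := csInf_le hbdd ⟨P', hP', rfl⟩
  rw [h₀.logEn_eq]; linarith

/-- The reflection across the line through the origin orthogonal to `v`. -/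
def hrefl (v : Plane) : Plane ≃ₗᵢ[ℝ] Plane := (Submodule.span ℝ {v})ᗮ.reflection

lemma hrefl_hrefl (v x : Plane) : hrefl v (hrefl v x) = x := Submodule.reflection_reflection _ _

lemma hrefl_apply (v x : Plane) : hrefl v x = x - (2 * (inner ℝ v x / ‖v‖ ^ 2)) • v := by
  rw [hrefl, Submodule.reflection_orthogonal_apply, Submodule.reflection_singleton_apply, mul_smul,
    neg_sub, two_smul, two_smul]
  rfl

lemma inner_hrefl (v x : Plane) : inner ℝ v (hrefl v x) = -inner ℝ v x := by
  rcases eq_or_ne v 0 with rfl | hv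
  · simp
  · have := norm_pos_iff.2 hv
    rw [hrefl_apply, inner_sub_right, inner_smul_right, real_inner_self_eq_norm_sq]
    field_simp; ring

lemma norm_sub_hrefl_sq {v : Plane} (hv : v ≠ 0) (x y : Plane) :
    ‖x - hrefl v y‖ ^ 2 = ‖x - y‖ ^ 2 + 4 * (inner ℝ v x * inner ℝ v y) / ‖v‖ ^ 2 := by
  have := norm_pos_iff.2 hv
  rw [hrefl_apply, sub_sub_eq_add_sub, add_sub_right_comm, norm_add_sq_real, inner_smul_right,
    norm_smul, real_inner_comm (x - y) v |>.symm, inner_sub_right, mul_pow, Real.norm_eq_abs, sq_abs]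
  field_simp; ring

lemma norm_sub_le_norm_sub_hrefl {v x y : Plane} (hv : v ≠ 0) (hx : 0 ≤ inner ℝ v x)
    (hy : 0 ≤ inner ℝ v y) : ‖x - y‖ ≤ ‖x - hrefl v y‖ := by
  refine (sq_le_sq₀ (norm_nonneg _) (norm_nonneg _)).1 ?_
  rw [norm_sub_hrefl_sq hv]
  have : 0 ≤ 4 * (inner ℝ v x * inner ℝ v y) / ‖v‖ ^ 2 := by positivity
  linarith

lemma norm_sub_lt_norm_sub_hrefl {v x y : Plane} (hv : v ≠ 0) (hx : 0 < inner ℝ v x)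
    (hy : 0 < inner ℝ v y) : ‖x - y‖ < ‖x - hrefl v y‖ := by
  refine lt_of_pow_lt_pow_left₀ 2 (norm_nonneg _) ?_
  rw [norm_sub_hrefl_sq hv]
  have := norm_pos_iff.2 hv
  have : 0 < 4 * (inner ℝ v x * inner ℝ v y) / ‖v‖ ^ 2 := by positivity
  linarith

lemma norm_hrefl_sub_hrefl (v x y : Plane) : ‖hrefl v x - hrefl v y‖ = ‖x - y‖ := by
  rw [← map_sub, LinearIsometryEquiv.norm_map]

lemma norm_hrefl_sub (v x y : Plane) : ‖hrefl v x - y‖ = ‖x - hrefl v y‖ := by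
  rw [← norm_hrefl_sub_hrefl v x, hrefl_hrefl]

/-- Two-point rearrangement with respect to a reflection. -/
def polar (v : Plane) (P : Plane → ℝ) (x : Plane) : ℝ :=
  if 0 ≤ inner ℝ v x then max (P x) (P (hrefl v x)) else min (P x) (P (hrefl v x))

lemma polar_of_nonneg {v : Plane} {P : Plane → ℝ} {x : Plane} (hx : 0 ≤ inner ℝ v x) :
    polar v P x = max (P x) (P (hrefl v x)) := if_pos hx

lemma polar_hrefl_of_nonneg {v : Plane} {P : Plane → ℝ} {x : Plane} (hx : 0 ≤ inner ℝ v x) :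
    polar v P (hrefl v x) = min (P x) (P (hrefl v x)) := by
  rcases hx.eq_or_lt with h | h
  · have e : hrefl v x = x := by rw [hrefl_apply, ← h]; simp
    rw [e, polar_of_nonneg hx, e]; simp
  · rw [polar, if_neg (by rw [inner_hrefl]; linarith), hrefl_hrefl, min_comm]

lemma measurable_polar {v : Plane} {P : Plane → ℝ} (hP : Measurable P) :
    Measurable (polar v P) := by
  have h1 : Measurable fun x => P (hrefl v x) := hP.comp (hrefl v).continuous.measurable
  exact Measurable.ite (measurableSet_le measurable_const (by fun_prop)) (hP.max h1) (hP.min h1)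

lemma nonneg_or_hrefl (v x : Plane) : 0 ≤ inner ℝ v x ∨ 0 ≤ inner ℝ v (hrefl v x) := by
  rw [inner_hrefl]; rcases le_total 0 (inner ℝ v x) with h | h
  · exact Or.inl h
  · exact Or.inr (by linarith)

lemma lintegral_hrefl (v : Plane) (f : Plane → ℝ≥0∞) : ∫⁻ x, f (hrefl v x) = ∫⁻ x, f x :=
  lintegral_comp_isometry _ _

lemma two_mul_lintegral_hrefl (v : Plane) {f : Plane → ℝ≥0∞} (hf : Measurable f) :
    2 * ∫⁻ x, f x = ∫⁻ x, (f x + f (hrefl v x)) := by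
  rw [lintegral_add_left hf, lintegral_hrefl, two_mul]

lemma lintegral_polar_eq {v : Plane} {P : Plane → ℝ} (hP : Measurable P) {g : ℝ → ℝ≥0∞}
    (hg : Measurable g) : ∫⁻ x, g (polar v P x) = ∫⁻ x, g (P x) := by
  have key : ∀ x, g (polar v P x) + g (polar v P (hrefl v x)) = g (P x) + g (P (hrefl v x)) := by
    have aux : ∀ x, 0 ≤ inner ℝ v x →
        g (polar v P x) + g (polar v P (hrefl v x)) = g (P x) + g (P (hrefl v x)) := by
      intro x hx
      rw [polar_of_nonneg hx, polar_hrefl_of_nonneg hx]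
      rcases le_total (P x) (P (hrefl v x)) with h | h
      · rw [max_eq_right h, min_eq_left h, add_comm]
      · rw [max_eq_left h, min_eq_right h]
    intro x
    rcases nonneg_or_hrefl v x with h | h
    · exact aux x h
    · have := aux _ h
      rw [hrefl_hrefl] at this
      rw [add_comm, this, add_comm]
  have h1 := two_mul_lintegral_hrefl v (hg.comp (measurable_polar (v := v) hP))
  have h2 := two_mul_lintegral_hrefl v (hg.comp hP)
  simp only [Function.comp_apply] at h1 h2
  simp_rw [key] at h1
  rw [← h2] at h1
  exact (ENNReal.mul_right_inj (by norm_num) (by norm_num)).1 h1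

lemma measurePreserving_hrefl_prod (v w : Plane) : MeasurePreserving
    (fun z : Plane × Plane => (hrefl v z.1, hrefl w z.2)) :=
  (hrefl v).measurePreserving.prod (hrefl w).measurePreserving

lemma hrefl_zero (x : Plane) : hrefl 0 x = x := by simp [hrefl_apply]

/-- Symmetrisation of a function of two variables under a reflection in each variable. -/
def symm4 {E : Type*} [Add E] (v : Plane) (Φ : Plane × Plane → E) (z : Plane × Plane) : E :=
  (Φ z + Φ (hrefl v z.1, hrefl v z.2)) + (Φ (hrefl v z.1, z.2) + Φ (z.1, hrefl v z.2))

lemma symm4_hrefl_left {E : Type*} [AddCommMonoid E] (v : Plane) (Φ : Plane × Plane → E)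
    (z : Plane × Plane) : symm4 v Φ (hrefl v z.1, z.2) = symm4 v Φ z := by
  simp only [symm4, hrefl_hrefl, Prod.mk.eta]; exact add_comm _ _

lemma symm4_hrefl_right {E : Type*} [AddCommMonoid E] (v : Plane) (Φ : Plane × Plane → E)
    (z : Plane × Plane) : symm4 v Φ (z.1, hrefl v z.2) = symm4 v Φ z := by
  simp only [symm4, hrefl_hrefl, Prod.mk.eta]
  rw [add_comm, add_comm (Φ z), add_comm (Φ (hrefl v z.1, z.2))]

lemma lintegral_symm4 (v : Plane) {Φ : Plane × Plane → ℝ≥0∞} (hΦ : Measurable Φ) :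
    ∫⁻ z, symm4 v Φ z = 4 * ∫⁻ z, Φ z := by
  have h1 := (measurePreserving_hrefl_prod v v).lintegral_comp hΦ
  have h2 := (measurePreserving_hrefl_prod v 0).lintegral_comp hΦ
  have h3 := (measurePreserving_hrefl_prod 0 v).lintegral_comp hΦ
  have m : Measurable (hrefl v) := (hrefl v).continuous.measurable
  simp only [hrefl_zero] at h2 h3
  unfold symm4
  rw [lintegral_add_left (by fun_prop), lintegral_add_left hΦ, lintegral_add_left (by fun_prop),
    h1, h2, h3]
  ring

lemma integral_symm4 (v : Plane) {Φ : Plane × Plane → ℝ} (hΦ : Integrable Φ) :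
    Integrable (symm4 v Φ) ∧ ∫ z, symm4 v Φ z = 4 * ∫ z, Φ z := by
  have e : ∀ a b : Plane, MeasurableEmbedding fun z : Plane × Plane => (hrefl a z.1, hrefl b z.2) :=
    fun a b => ((hrefl a).toHomeomorph.prodCongr (hrefl b).toHomeomorph).measurableEmbedding
  have h1 := (measurePreserving_hrefl_prod v v).integral_comp (e v v) Φ
  have h2 := (measurePreserving_hrefl_prod v 0).integral_comp (e v 0) Φ
  have h3 := (measurePreserving_hrefl_prod 0 v).integral_comp (e 0 v) Φ
  have i1 := (measurePreserving_hrefl_prod v v).integrable_comp_of_integrable hΦ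
  have i2 := (measurePreserving_hrefl_prod v 0).integrable_comp_of_integrable hΦ
  have i3 := (measurePreserving_hrefl_prod 0 v).integrable_comp_of_integrable hΦ
  simp only [hrefl_zero, Function.comp_def] at h1 h2 h3 i1 i2 i3
  refine ⟨(hΦ.add i1).add (i2.add i3), ?_⟩
  change ∫ z, ((Φ z + Φ (hrefl v z.1, hrefl v z.2)) +
    (Φ (hrefl v z.1, z.2) + Φ (z.1, hrefl v z.2))) = _
  have k1 : ∫ z, (Φ z + Φ (hrefl v z.1, hrefl v z.2)) = _ := integral_add hΦ i1
  have k2 : ∫ z : Plane × Plane, (Φ (hrefl v z.1, z.2) + Φ (z.1, hrefl v z.2)) = _ := integral_add i2 i3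
  have k3 := integral_add (hΦ.add i1) (i2.add i3)
  simp only [Pi.add_apply] at k3
  rw [k3, k1, k2, h1, h2, h3]
  ring

lemma of_nonneg_of_symm {v : Plane} {p : Plane × Plane → Prop}
    (h : ∀ z : Plane × Plane, 0 ≤ inner ℝ v z.1 → 0 ≤ inner ℝ v z.2 → p z)
    (hl : ∀ z : Plane × Plane, p (hrefl v z.1, z.2) → p z)
    (hr : ∀ z : Plane × Plane, p (z.1, hrefl v z.2) → p z) (z : Plane × Plane) : p z := by
  rcases nonneg_or_hrefl v z.1 with h1 | h1 <;> rcases nonneg_or_hrefl v z.2 with h2 | h2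
  · exact h z h1 h2
  · exact hr z (h _ h1 h2)
  · exact hl z (h _ h1 h2)
  · exact hl z (hr _ (h _ h1 h2))

lemma lintegral_le_of_symm4_le (v : Plane) {Φ Ψ : Plane × Plane → ℝ≥0∞} (hΦ : Measurable Φ)
    (hΨ : Measurable Ψ) (h : ∀ z : Plane × Plane, 0 ≤ inner ℝ v z.1 → 0 ≤ inner ℝ v z.2 →
      symm4 v Φ z ≤ symm4 v Ψ z) : ∫⁻ z, Φ z ≤ ∫⁻ z, Ψ z := by
  have h' : ∀ z, symm4 v Φ z ≤ symm4 v Ψ z := of_nonneg_of_symm h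
    (fun z hz => by rwa [symm4_hrefl_left, symm4_hrefl_left] at hz)
    (fun z hz => by rwa [symm4_hrefl_right, symm4_hrefl_right] at hz)
  have := lintegral_mono h' (μ := volume)
  rw [lintegral_symm4 v hΦ, lintegral_symm4 v hΨ] at this
  exact (ENNReal.mul_le_mul_iff_right (by norm_num) (by norm_num)).1 this

lemma lintegral_ball_incr_eq {f : Plane → ℝ} (hf : Measurable f) (ε : ℝ) :
    ∫⁻ h in ball (0 : Plane) ε, incr f h =
      ∫⁻ z : Plane × Plane, if ‖z.1 - z.2‖ < ε then ENNReal.ofReal ((f z.1 - f z.2) ^ 2) else 0 := by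
  have hm : Measurable fun z : Plane × Plane =>
      if ‖z.1 - z.2‖ < ε then ENNReal.ofReal ((f z.1 - f z.2) ^ 2) else 0 :=
    Measurable.ite (measurableSet_lt (by fun_prop) measurable_const) (by fun_prop) measurable_const
  rw [Measure.volume_eq_prod, lintegral_prod_symm _ hm.aemeasurable]
  have e : ∀ y : Plane, (∫⁻ x, if ‖x - y‖ < ε then ENNReal.ofReal ((f x - f y) ^ 2) else 0) =
      ∫⁻ h, if ‖h‖ < ε then ‖f (y + h) - f y‖ₑ ^ 2 else 0 := by
    intro y
    rw [← lintegral_add_left_eq_self (μ := (volume : Measure Plane)) _ y]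
    simp_rw [add_sub_cancel_left, ofReal_sq_eq_enorm]
  simp_rw [e]
  rw [lintegral_lintegral_swap, ← lintegral_indicator measurableSet_ball]
  · refine lintegral_congr fun h => ?_
    by_cases hh : ‖h‖ < ε
    · rw [indicator_of_mem (by simpa using hh)]; simp [hh, incr]
    · rw [indicator_of_notMem (by simpa using hh)]; simp [hh]
  · exact (Measurable.ite (measurableSet_lt (by fun_prop) measurable_const)
      (by fun_prop) measurable_const).aemeasurable

lemma sq_sub_max_min_le (a a' b b' : ℝ) : (max a a' - max b b') ^ 2 + (min a a' - min b b') ^ 2 ≤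
    (a - b) ^ 2 + (a' - b') ^ 2 := by
  rcases le_total a a' with h | h <;> rcases le_total b b' with h' | h' <;> simp only [h, h', max_eq_left, max_eq_right, min_eq_left, min_eq_right] <;>
    nlinarith [mul_nonneg (sub_nonneg.2 h) (sub_nonneg.2 h')]

lemma sq_sub_max_min_eq (a a' b b' : ℝ) :
    (max a a' - max b b') ^ 2 + (min a a' - min b b') ^ 2 +
      ((min a a' - max b b') ^ 2 + (max a a' - min b b') ^ 2) =
    (a - b) ^ 2 + (a' - b') ^ 2 + ((a' - b) ^ 2 + (a - b') ^ 2) := by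
  rcases le_total a a' with h | h <;> rcases le_total b b' with h' | h' <;> simp only [h, h', max_eq_left, max_eq_right, min_eq_left, min_eq_right] <;> ring

lemma EnergyLE.polar {P : Plane → ℝ} {K : ℝ≥0∞} (h : EnergyLE P K) (hP : Measurable P)
    {v : Plane} (hv : v ≠ 0) : EnergyLE (polar v P) K := by
  intro ε hε
  refine le_trans ?_ (h ε hε)
  have hm : ∀ {f : Plane → ℝ}, Measurable f → Measurable fun z : Plane × Plane =>
      if ‖z.1 - z.2‖ < ε then ENNReal.ofReal ((f z.1 - f z.2) ^ 2) else 0 := fun hf =>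
    Measurable.ite (measurableSet_lt (by fun_prop) measurable_const) (by fun_prop) measurable_const
  rw [lintegral_ball_incr_eq hP, lintegral_ball_incr_eq (measurable_polar hP)]
  refine lintegral_le_of_symm4_le v (hm (measurable_polar hP)) (hm hP) ?_
  rintro ⟨x, y⟩ hx hy
  have hle := norm_sub_le_norm_sub_hrefl hv hx hy
  simp only [symm4, norm_hrefl_sub, hrefl_hrefl]
  simp only at hx hy
  rw [polar_of_nonneg hx, polar_of_nonneg hy, polar_hrefl_of_nonneg hx, polar_hrefl_of_nonneg hy]
  by_cases h1 : ‖x - y‖ < ε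
  · by_cases h2 : ‖x - hrefl v y‖ < ε
    · simp only [h1, h2, if_true]
      rw [← ENNReal.ofReal_add (by positivity) (by positivity),
        ← ENNReal.ofReal_add (by positivity) (by positivity),
        ← ENNReal.ofReal_add (by positivity) (by positivity),
        ← ENNReal.ofReal_add (by positivity) (by positivity),
        ← ENNReal.ofReal_add (by positivity) (by positivity),
        ← ENNReal.ofReal_add (by positivity) (by positivity), sq_sub_max_min_eq]
    · simp only [h1, h2, if_true, if_false, add_zero]
      rw [← ENNReal.ofReal_add (by positivity) (by positivity),
        ← ENNReal.ofReal_add (by positivity) (by positivity)]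
      exact ENNReal.ofReal_le_ofReal (sq_sub_max_min_le _ _ _ _)
  · have h2 : ¬ ‖x - hrefl v y‖ < ε := fun h => h1 (hle.trans_lt h)
    simp [h1, h2]

lemma symm4_logDens {v : Plane} (f : Plane → ℝ) (x y : Plane) : symm4 v (logDens f) (x, y) =
    Real.log ‖x - y‖ * (f x ^ 2 * f y ^ 2 + f (hrefl v x) ^ 2 * f (hrefl v y) ^ 2) +
    Real.log ‖x - hrefl v y‖ * (f (hrefl v x) ^ 2 * f y ^ 2 + f x ^ 2 * f (hrefl v y) ^ 2) := by
  simp only [symm4, logDens, norm_hrefl_sub, hrefl_hrefl]; ring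

lemma max_sq_add_min_sq (a b : ℝ) : max a b ^ 2 + min a b ^ 2 = a ^ 2 + b ^ 2 := by
  rcases le_total a b with h | h <;> simp only [h, max_eq_left, max_eq_right, min_eq_left, min_eq_right]; ring

lemma max_sq_sub_min_sq {a b : ℝ} (ha : 0 ≤ a) (hb : 0 ≤ b) :
    max a b ^ 2 - min a b ^ 2 = |a ^ 2 - b ^ 2| := by
  rcases le_total a b with h | h <;> simp only [h, max_eq_left, max_eq_right, min_eq_left, min_eq_right]
  · rw [abs_of_nonpos (by nlinarith)]; ring
  · rw [abs_of_nonneg (by nlinarith)]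

lemma two_point {a a' b b' : ℝ} (k₁ k₂ : ℝ) (ha : 0 ≤ a) (ha' : 0 ≤ a') (hb : 0 ≤ b)
    (hb' : 0 ≤ b') :
    (k₁ * (a ^ 2 * b ^ 2 + a' ^ 2 * b' ^ 2) + k₂ * (a' ^ 2 * b ^ 2 + a ^ 2 * b' ^ 2)) -
    (k₁ * (max a a' ^ 2 * max b b' ^ 2 + min a a' ^ 2 * min b b' ^ 2) +
      k₂ * (min a a' ^ 2 * max b b' ^ 2 + max a a' ^ 2 * min b b' ^ 2)) =
    (k₂ - k₁) * ((|(a ^ 2 - a' ^ 2) * (b ^ 2 - b' ^ 2)| - (a ^ 2 - a' ^ 2) * (b ^ 2 - b' ^ 2)) / 2) := by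
  rw [abs_mul, ← max_sq_sub_min_sq ha ha', ← max_sq_sub_min_sq hb hb']
  have h1 := max_sq_add_min_sq a a'
  have h2 := max_sq_add_min_sq b b'
  generalize max a a' ^ 2 = A at *
  generalize min a a' ^ 2 = A' at *
  generalize max b b' ^ 2 = B at *
  generalize min b b' ^ 2 = B' at *
  obtain rfl : A = a ^ 2 + a' ^ 2 - A' := by linarith
  obtain rfl : B = b ^ 2 + b' ^ 2 - B' := by linarith
  ring

lemma logPos_polar_le {P : Plane → ℝ} (hP : Measurable P) (h0 : ∀ x, 0 ≤ P x)
    {v : Plane} (hv : v ≠ 0) : logPos (polar v P) ≤ logPos P := by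
  have e : ∀ f : Plane → ℝ, logPos f =
      ∫⁻ z : Plane × Plane, ENNReal.ofReal (Real.posLog ‖z.1 - z.2‖ * f z.1 ^ 2 * f z.2 ^ 2) := by
    intro f
    refine lintegral_congr fun z => ?_
    have hp : ENNReal.ofReal (Real.posLog ‖z.1 - z.2‖) = ENNReal.ofReal (Real.log ‖z.1 - z.2‖) := by
      change ENNReal.ofReal (max 0 (Real.log ‖z.1 - z.2‖)) = _
      rw [ENNReal.ofReal_max]; simp
    simp only [logDens, mul_assoc]
    rw [ENNReal.ofReal_mul' (by positivity), ENNReal.ofReal_mul' (by positivity),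
      ENNReal.ofReal_mul' (by positivity), hp, ENNReal.ofReal_mul' (by positivity)]
  have hm : ∀ {f : Plane → ℝ}, Measurable f → Measurable fun z : Plane × Plane =>
      ENNReal.ofReal (Real.posLog ‖z.1 - z.2‖ * f z.1 ^ 2 * f z.2 ^ 2) := fun hf => by
    have : Measurable fun z : Plane × Plane => Real.posLog ‖z.1 - z.2‖ :=
      measurable_const.max (by fun_prop)
    fun_prop
  rw [e, e]
  refine lintegral_le_of_symm4_le v (hm (measurable_polar hP)) (hm hP) ?_
  rintro ⟨x, y⟩ hx hy
  simp only at hx hy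
  have hle : Real.posLog ‖x - y‖ ≤ Real.posLog ‖x - hrefl v y‖ :=
    Real.posLog_le_posLog (norm_nonneg _) (norm_sub_le_norm_sub_hrefl hv hx hy)
  have h1 := Real.posLog_nonneg (x := ‖x - y‖)
  have h2 := Real.posLog_nonneg (x := ‖x - hrefl v y‖)
  simp only [symm4, norm_hrefl_sub, hrefl_hrefl]
  repeat rw [← ENNReal.ofReal_add (by positivity) (by positivity)]
  refine ENNReal.ofReal_le_ofReal ?_
  rw [polar_of_nonneg hx, polar_of_nonneg hy, polar_hrefl_of_nonneg hx, polar_hrefl_of_nonneg hy]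
  have := two_point (Real.posLog ‖x - y‖) (Real.posLog ‖x - hrefl v y‖) (h0 x) (h0 (hrefl v x))
    (h0 y) (h0 (hrefl v y))
  have h3 : 0 ≤ (Real.posLog ‖x - hrefl v y‖ - Real.posLog ‖x - y‖) *
    ((|(P x ^ 2 - P (hrefl v x) ^ 2) * (P y ^ 2 - P (hrefl v y) ^ 2)| -
      (P x ^ 2 - P (hrefl v x) ^ 2) * (P y ^ 2 - P (hrefl v y) ^ 2)) / 2) :=
    mul_nonneg (sub_nonneg.2 hle) (by linarith [le_abs_self ((P x ^ 2 - P (hrefl v x) ^ 2) * (P y ^ 2 - P (hrefl v y) ^ 2))])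
  linarith

lemma IsOpt.polar {A : ℝ} {P : Plane → ℝ} (h : IsOpt A P) {v : Plane} (hv : v ≠ 0) :
    IsOpt A (polar v P) where
  meas := measurable_polar h.meas
  nonneg x := by
    unfold _root_.polar
    split_ifs
    · exact (h.nonneg x).trans (le_max_left _ _)
    · exact le_min (h.nonneg _) (h.nonneg _)
  mass := (lintegral_polar_eq h.meas (g := fun t => ‖t‖ₑ ^ 2) (by fun_prop)).trans h.mass
  energy := h.energy.polar h.meas hv
  four := (lintegral_polar_eq h.meas (g := fun t => ‖t‖ₑ ^ 4) (by fun_prop)).trans h.four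
  log := ne_top_of_le_ne_top h.log (logPos_polar_le h.meas h.nonneg hv)

lemma symm4_logDens_sub_polar {P : Plane → ℝ} (h0 : ∀ x, 0 ≤ P x) {v x y : Plane}
    (hx : 0 ≤ inner ℝ v x) (hy : 0 ≤ inner ℝ v y) :
    symm4 v (logDens P) (x, y) - symm4 v (logDens (polar v P)) (x, y) =
      (Real.log ‖x - hrefl v y‖ - Real.log ‖x - y‖) *
      ((|(P x ^ 2 - P (hrefl v x) ^ 2) * (P y ^ 2 - P (hrefl v y) ^ 2)| -
      (P x ^ 2 - P (hrefl v x) ^ 2) * (P y ^ 2 - P (hrefl v y) ^ 2)) / 2) := by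
  rw [symm4_logDens, symm4_logDens, polar_of_nonneg hx, polar_of_nonneg hy,
    polar_hrefl_of_nonneg hx, polar_hrefl_of_nonneg hy]
  exact two_point _ _ (h0 _) (h0 _) (h0 _) (h0 _)

lemma volume_inner_eq {v : Plane} (hv : v ≠ 0) (t : ℝ) :
    volume {x : Plane | inner ℝ v x = t} = 0 := by
  have h0 : volume ((LinearMap.ker (innerₛₗ ℝ v) : Submodule ℝ Plane) : Set Plane) = 0 := by
    refine Measure.addHaar_submodule _ _ fun h => hv ?_
    have : v ∈ LinearMap.ker (innerₛₗ ℝ v) := h ▸ Submodule.mem_top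
    simpa using this
  have hn := norm_pos_iff.2 hv
  rw [← h0, ← measure_preimage_add_right volume ((t / ‖v‖ ^ 2) • v)]
  congr 1; ext x
  simp only [mem_ofPred_eq, mem_preimage, SetLike.mem_coe, LinearMap.mem_ker, innerₛₗ_apply_apply,
    inner_add_right, inner_smul_right, real_inner_self_eq_norm_sq]
  field_simp
  simp

lemma ae_inner_ne {v : Plane} (hv : v ≠ 0) (t : ℝ) : ∀ᵐ x : Plane, inner ℝ v x ≠ t := by
  simpa [ae_iff] using volume_inner_eq hv t

lemma hrefl_eq_self {v x : Plane} (h : inner ℝ v x = 0) : hrefl v x = x := by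
  simp [hrefl_apply, h]

/-- The asymmetry of `f ^ 2` under a reflection. -/
def asym (v : Plane) (f : Plane → ℝ) (x : Plane) : ℝ := f x ^ 2 - f (hrefl v x) ^ 2

lemma asym_hrefl (v : Plane) (f : Plane → ℝ) (x : Plane) :
    asym v f (hrefl v x) = -asym v f x := by
  simp [asym, hrefl_hrefl]

lemma ae_asym_mul_nonneg {A : ℝ} {P : Plane → ℝ} (hP : IsOpt A P)
    (hmin : ∀ P', IsOpt A P' → logEn P ≤ logEn P') {v : Plane} (hv : v ≠ 0) :
    ∀ᵐ z : Plane × Plane, 0 < inner ℝ v z.1 → 0 < inner ℝ v z.2 →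
      0 ≤ asym v P z.1 * asym v P z.2 := by
  have hQ := hP.polar hv
  obtain ⟨i1, e1⟩ := integral_symm4 v hP.integrable
  obtain ⟨i2, e2⟩ := integral_symm4 v hQ.integrable
  have hle : ∫ z, (symm4 v (logDens P) z - symm4 v (logDens (polar v P)) z) ≤ 0 := by
    rw [integral_sub i1 i2, e1, e2]
    have := hmin _ hQ
    unfold logEn at this
    linarith
  have hd2 : ∀ᵐ z : Plane × Plane, z.1 ≠ hrefl v z.2 := by
    have := (measurePreserving_hrefl_prod 0 v).quasiMeasurePreserving.ae volume_diag_ae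
    simpa only [hrefl_zero] using this
  have hnn : ∀ z : Plane × Plane, z.1 ≠ z.2 → z.1 ≠ hrefl v z.2 →
      0 ≤ symm4 v (logDens P) z - symm4 v (logDens (polar v P)) z := by
    refine of_nonneg_of_symm (v := v) ?_ ?_ ?_
    · rintro ⟨x, y⟩ hx hy hxy -
      rw [symm4_logDens_sub_polar hP.nonneg hx hy]
      refine mul_nonneg (sub_nonneg.2 (Real.log_le_log (norm_pos_iff.2 (sub_ne_zero.2 hxy))
        (norm_sub_le_norm_sub_hrefl hv hx hy))) ?_
      linarith [le_abs_self ((P x ^ 2 - P (hrefl v x) ^ 2) * (P y ^ 2 - P (hrefl v y) ^ 2))]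
    · intro z h h1 h2
      have := h (fun e => h2 (by rw [← e, hrefl_hrefl])) (fun e => h1 ((hrefl v).injective e))
      rwa [symm4_hrefl_left, symm4_hrefl_left] at this
    · intro z h h1 h2
      have := h h2 (by rwa [hrefl_hrefl])
      rwa [symm4_hrefl_right, symm4_hrefl_right] at this
  have hnn' : 0 ≤ᵐ[volume] fun z => symm4 v (logDens P) z - symm4 v (logDens (polar v P)) z := by
    filter_upwards [volume_diag_ae, hd2] with z h1 h2 using hnn z h1 h2
  have h0 := (integral_eq_zero_iff_of_nonneg_ae hnn' (i1.sub i2)).1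
    (le_antisymm hle (integral_nonneg_of_ae hnn'))
  filter_upwards [h0, volume_diag_ae] with z hz hzd h1 h2
  obtain ⟨x, y⟩ := z
  have hz : symm4 v (logDens P) (x, y) - symm4 v (logDens (polar v P)) (x, y) = 0 := hz
  rw [symm4_logDens_sub_polar hP.nonneg h1.le h2.le] at hz
  have hlt : 0 < Real.log ‖x - hrefl v y‖ - Real.log ‖x - y‖ := sub_pos.2 (Real.log_lt_log
    (norm_pos_iff.2 (sub_ne_zero.2 hzd)) (norm_sub_lt_norm_sub_hrefl hv h1 h2))
  have := (mul_eq_zero.1 hz).resolve_left hlt.ne'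
  have e : |asym v P x * asym v P y| = asym v P x * asym v P y := by
    simp only [asym]; linarith
  exact (abs_nonneg _).trans e.le

lemma ae_asym_sign {D : Plane → ℝ} {S : Set Plane}
    (h : ∀ᵐ z : Plane × Plane, z.1 ∈ S → z.2 ∈ S → 0 ≤ D z.1 * D z.2) :
    (∀ᵐ x : Plane, x ∈ S → 0 ≤ D x) ∨ (∀ᵐ x : Plane, x ∈ S → D x ≤ 0) := by
  have h0 : volume ((S ∩ {x | D x < 0}) ×ˢ (S ∩ {x | 0 < D x})) = 0 := by
    refine measure_mono_null ?_ (ae_iff.1 h)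
    rintro ⟨x, y⟩ ⟨⟨hx, hx'⟩, hy, hy'⟩
    simp only [mem_ofPred_eq] at hx' hy'
    simp only [mem_ofPred_eq, not_forall, not_le]
    exact ⟨hx, hy, mul_neg_of_neg_of_pos hx' hy'⟩
  rw [Measure.volume_eq_prod, Measure.prod_prod, mul_eq_zero] at h0
  refine h0.imp (fun h => ?_) fun h => ?_
  · rw [ae_iff]; refine measure_mono_null (fun x hx => ?_) h
    simpa using hx
  · rw [ae_iff]; refine measure_mono_null (fun x hx => ?_) h
    simpa using hx

/-- A real-valued sign function. -/
def sgn (t : ℝ) : ℝ := ((SignType.sign t : SignType) : ℝ)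

lemma sgn_pos {t : ℝ} (h : 0 < t) : sgn t = 1 := by simp [sgn, sign_pos h]
lemma sgn_neg {t : ℝ} (h : t < 0) : sgn t = -1 := by simp [sgn, sign_neg h]
lemma sgn_neg_eq (t : ℝ) : sgn (-t) = -sgn t := by simp [sgn, Left.sign_neg]
lemma abs_sgn_le (t : ℝ) : |sgn t| ≤ 1 := by
  rcases lt_trichotomy t 0 with h | rfl | h
  · simp [sgn_neg h]
  · simp [sgn]
  · simp [sgn_pos h]

lemma measurable_sgn : Measurable sgn := by
  have e : sgn = fun t => if 0 < t then 1 else if t < 0 then -1 else 0 := by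
    ext t
    rcases lt_trichotomy t 0 with h | rfl | h
    · simp [sgn_neg h, h, h.le.not_gt]
    · simp [sgn]
    · simp [sgn_pos h, h]
  rw [e]
  exact Measurable.ite measurableSet_Ioi measurable_const
    (Measurable.ite measurableSet_Iio measurable_const measurable_const)

lemma integrable_sq_mul_sgn {f g : Plane → ℝ} (hf : Integrable f) (hg : Measurable g) :
    Integrable fun x => f x * sgn (g x) := by
  refine hf.mul_bdd (c := 1) (measurable_sgn.comp hg).aestronglyMeasurable
    (Eventually.of_forall fun x => ?_)
  exact abs_sgn_le _

lemma ae_hrefl_eq {A : ℝ} {P : Plane → ℝ} (hP : IsOpt A P)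
    (hi : Integrable fun x => P x ^ 2)
    (hmin : ∀ P', IsOpt A P' → logEn P ≤ logEn P') {v : Plane} (hv : v ≠ 0)
    (hbal : ∫ x, P x ^ 2 * sgn (inner ℝ v x) = 0) : ∀ᵐ x, P (hrefl v x) = P x := by
  have mi : Measurable fun x : Plane => inner ℝ v x := by fun_prop
  have hmp := (hrefl v).measurePreserving
  have i1 := integrable_sq_mul_sgn hi mi
  have i2 : Integrable fun x => P (hrefl v x) ^ 2 * sgn (inner ℝ v x) :=
    integrable_sq_mul_sgn (hmp.integrable_comp_of_integrable hi) mi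
  have e2 : ∫ x, P (hrefl v x) ^ 2 * sgn (inner ℝ v x) = 0 := by
    have := hmp.integral_comp (hrefl v).toHomeomorph.measurableEmbedding
      fun x => P x ^ 2 * sgn (inner ℝ v x)
    rw [hbal] at this
    simp only [inner_hrefl, sgn_neg_eq, mul_neg] at this
    rw [integral_neg] at this
    linarith
  have i3 : Integrable fun x => asym v P x * sgn (inner ℝ v x) := by
    simp only [asym, sub_mul]; exact i1.sub i2
  have e3 : ∫ x, asym v P x * sgn (inner ℝ v x) = 0 := by
    simp only [asym, sub_mul]
    rw [integral_sub i1 i2, hbal, e2, sub_zero]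
  have fin : (fun x => asym v P x * sgn (inner ℝ v x)) =ᵐ[volume] 0 →
      ∀ᵐ x, P (hrefl v x) = P x := by
    intro h
    filter_upwards [h, ae_inner_ne hv 0] with x hx hx0
    have hs : sgn (inner ℝ v x) ≠ 0 := by
      rcases lt_or_gt_of_ne hx0 with h | h
      · simp [sgn_neg h]
      · simp [sgn_pos h]
    have := (mul_eq_zero.1 hx).resolve_right hs
    rw [asym, sub_eq_zero] at this
    exact ((sq_eq_sq₀ (hP.nonneg _) (hP.nonneg _)).1 this).symm
  rcases ae_asym_sign (S := {x | 0 < inner ℝ v x})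
    (ae_asym_mul_nonneg hP hmin hv) with h | h
  · refine fin ((integral_eq_zero_iff_of_nonneg_ae ?_ i3).1 e3)
    filter_upwards [h, hmp.quasiMeasurePreserving.ae h] with x h1 h2
    rcases lt_trichotomy (inner ℝ v x) 0 with hx | hx | hx
    · have := h2 (by rw [inner_hrefl]; linarith)
      rw [asym_hrefl] at this
      simp only [Pi.zero_apply, sgn_neg hx]; linarith
    · simp [asym, hrefl_eq_self hx]
    · simpa [sgn_pos hx] using h1 hx
  · have e3' : ∫ x, -(asym v P x * sgn (inner ℝ v x)) = 0 := by rw [integral_neg, e3, neg_zero]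
    have := (integral_eq_zero_iff_of_nonneg_ae ?_ i3.neg).1 e3'
    · refine fin (this.mono fun x hx => ?_)
      simpa using hx
    filter_upwards [h, hmp.quasiMeasurePreserving.ae h] with x h1 h2
    rcases lt_trichotomy (inner ℝ v x) 0 with hx | hx | hx
    · have := h2 (by rw [inner_hrefl]; linarith)
      rw [asym_hrefl] at this
      simp only [Pi.zero_apply, Pi.neg_apply, sgn_neg hx]; linarith
    · simp [asym, hrefl_eq_self hx]
    · simpa [sgn_pos hx] using h1 hx

lemma continuousAt_sgn {t : ℝ} (h : t ≠ 0) : ContinuousAt sgn t := by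
  rcases lt_or_gt_of_ne h with h | h
  · exact (continuousAt_const (y := (-1 : ℝ))).congr
      ((gt_mem_nhds h).mono fun s hs => (sgn_neg hs).symm)
  · exact (continuousAt_const (y := (1 : ℝ))).congr
      ((lt_mem_nhds h).mono fun s hs => (sgn_pos hs).symm)

lemma exists_balance {f : Plane → ℝ} (hf : Integrable f) (hf0 : ∀ x, 0 ≤ f x) {v : Plane}
    (hv : v ≠ 0) : ∃ t : ℝ, ∫ x, f x * sgn (inner ℝ v x - t) = 0 := by
  have mi : Measurable fun x : Plane => inner ℝ v x := by fun_prop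
  have hm : ∀ t : ℝ, AEStronglyMeasurable (fun x => f x * sgn (inner ℝ v x - t)) volume := fun t =>
    (integrable_sq_mul_sgn hf (mi.sub_const t)).aestronglyMeasurable
  have hb : ∀ t x, ‖f x * sgn (inner ℝ v x - t)‖ ≤ ‖f x‖ := fun t x => by
    rw [norm_mul]
    exact mul_le_of_le_one_right (norm_nonneg _) (abs_sgn_le _)
  have hc : Continuous fun t : ℝ => ∫ x, f x * sgn (inner ℝ v x - t) := by
    refine continuous_iff_continuousAt.2 fun t => ?_
    refine continuousAt_of_dominated (Eventually.of_forall hm)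
      (Eventually.of_forall fun s => Eventually.of_forall (hb s)) hf.norm ?_
    filter_upwards [ae_inner_ne hv t] with x hx
    refine continuousAt_const.mul ?_
    exact ContinuousAt.comp (f := fun s : ℝ => inner ℝ v x - s) (continuousAt_sgn (sub_ne_zero.2 hx))
      (by fun_prop)
  have ht : Tendsto (fun t : ℝ => ∫ x, f x * sgn (inner ℝ v x - t)) atTop (𝓝 (∫ x, f x * (-1))) := by
    refine tendsto_integral_filter_of_dominated_convergence _ (Eventually.of_forall hm)
      (Eventually.of_forall fun s => Eventually.of_forall (hb s)) hf.norm
      (Eventually.of_forall fun x => ?_)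
    refine tendsto_const_nhds.congr' ?_
    filter_upwards [eventually_gt_atTop (inner ℝ v x)] with t ht
    rw [sgn_neg (by linarith)]
  have hbt : Tendsto (fun t : ℝ => ∫ x, f x * sgn (inner ℝ v x - t)) atBot (𝓝 (∫ x, f x * 1)) := by
    refine tendsto_integral_filter_of_dominated_convergence _ (Eventually.of_forall hm)
      (Eventually.of_forall fun s => Eventually.of_forall (hb s)) hf.norm
      (Eventually.of_forall fun x => ?_)
    refine tendsto_const_nhds.congr' ?_
    filter_upwards [eventually_lt_atBot (inner ℝ v x)] with t ht
    rw [sgn_pos (by linarith)]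
  have hI : 0 ≤ ∫ x, f x := integral_nonneg hf0
  rcases hI.eq_or_lt with h0 | h0
  · have h1 := (integral_eq_zero_iff_of_nonneg hf0 hf).1 h0.symm
    refine ⟨0, integral_eq_zero_of_ae (h1.mono fun x hx => ?_)⟩
    simp only [Pi.zero_apply] at hx ⊢
    rw [hx, zero_mul]
  · have e1 : ∃ t : ℝ, ∫ x, f x * sgn (inner ℝ v x - t) ≤ 0 :=
      ((ht.eventually (ge_mem_nhds (show ∫ x, f x * (-1) < 0 by
        rw [integral_mul_const]; linarith))).exists)
    have e2 : ∃ t : ℝ, 0 ≤ ∫ x, f x * sgn (inner ℝ v x - t) :=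
      ((hbt.eventually (le_mem_nhds (show 0 < ∫ x, f x * 1 by
        rw [integral_mul_const]; linarith))).exists)
    exact mem_range_of_exists_le_of_exists_ge hc e1 e2

lemma IsOpt.translate {A : ℝ} {P : Plane → ℝ} (h : IsOpt A P) (c : Plane) :
    IsOpt A (fun x => P (x + c)) where
  meas := h.meas.comp (measurable_add_const c)
  nonneg x := h.nonneg _
  mass := (lintegral_add_right_eq_self (fun x => ‖P x‖ₑ ^ 2) c).trans h.mass
  energy := h.energy.translate c
  four := (lintegral_add_right_eq_self (fun x => ‖P x‖ₑ ^ 4) c).trans h.four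
  log := by rw [logPos_translate h.meas]; exact h.log

lemma logEn_translate {A : ℝ} {P : Plane → ℝ} (h : IsOpt A P) (c : Plane) :
    logEn (fun x => P (x + c)) = logEn P := by
  rw [(h.translate c).logEn_eq, h.logEn_eq, logPos_translate h.meas, logNeg_translate h.meas]

lemma IsOpt.integrable_sq {A : ℝ} {P : Plane → ℝ} (h : IsOpt A P) :
    Integrable fun x => P x ^ 2 := by
  refine ⟨(h.meas.pow_const 2).aestronglyMeasurable, ?_⟩
  rw [hasFiniteIntegral_iff_enorm]
  simp_rw [enorm_pow]
  rw [h.mass]; exact ENNReal.ofReal_lt_top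

lemma hrefl_e0_e1 (x : Plane) : hrefl e0 (hrefl e1 x) = -x := by
  ext i
  fin_cases i <;> simp [hrefl_apply, e0, e1, EuclideanSpace.inner_single_left] <;> ring

/-- There is a minimiser of the logarithmic energy among the Gagliardo–Nirenberg optimisers
which is invariant under every reflection. -/
theorem exists_isOpt_min_symm {A : ℝ} (hGN : GNIneq (ENNReal.ofReal A)) (hA : 0 < A)
    {P : Plane → ℝ} (hP : IsOpt A P) :
    ∃ P₀, IsOpt A P₀ ∧ (∀ P', IsOpt A P' → logEn P₀ ≤ logEn P') ∧
      ∀ v, v ≠ 0 → ∀ᵐ x, P₀ (hrefl v x) = P₀ x := by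
  obtain ⟨P₁, h₁, hmin₁⟩ := exists_isOpt_min hGN hA hP
  have he0 : e0 ≠ 0 := fun h => by simpa [e0] using congrArg (fun x : Plane => x 0) h
  have he1 : e1 ≠ 0 := fun h => by simpa [e1] using congrArg (fun x : Plane => x 1) h
  have i00 : inner ℝ e0 e0 = (1 : ℝ) := by simp [e0]
  have i11 : inner ℝ e1 e1 = (1 : ℝ) := by simp [e1]
  have i01 : inner ℝ e0 e1 = (0 : ℝ) := by simp [e0, e1, EuclideanSpace.inner_single_left]
  have i10 : inner ℝ e1 e0 = (0 : ℝ) := by simp [e0, e1, EuclideanSpace.inner_single_left]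
  obtain ⟨s, hs⟩ := exists_balance h₁.integrable_sq (fun x => sq_nonneg _) he0
  obtain ⟨t, ht⟩ := exists_balance h₁.integrable_sq (fun x => sq_nonneg _) he1
  set c : Plane := s • e0 + t • e1
  have h₀ := h₁.translate c
  set P₀ : Plane → ℝ := fun x => P₁ (x + c)
  have hmin : ∀ P', IsOpt A P' → logEn P₀ ≤ logEn P' := fun P' h' =>
    (logEn_translate h₁ c).le.trans (hmin₁ P' h')
  have b0 : ∫ x, P₀ x ^ 2 * sgn (inner ℝ e0 x) = 0 := by
    rw [← hs, ← integral_add_right_eq_self (μ := volume)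
      (fun x => P₁ x ^ 2 * sgn (inner ℝ e0 x - s)) c]
    refine integral_congr_ae (ae_of_all _ fun x => ?_)
    simp only [P₀, c, inner_add_right, inner_smul_right, i00, i01]
    ring_nf
  have b1 : ∫ x, P₀ x ^ 2 * sgn (inner ℝ e1 x) = 0 := by
    rw [← ht, ← integral_add_right_eq_self (μ := volume)
      (fun x => P₁ x ^ 2 * sgn (inner ℝ e1 x - t)) c]
    refine integral_congr_ae (ae_of_all _ fun x => ?_)
    simp only [P₀, c, inner_add_right, inner_smul_right, i10, i11]
    ring_nf
  have s0 := ae_hrefl_eq h₀ h₀.integrable_sq hmin he0 b0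
  have s1 := ae_hrefl_eq h₀ h₀.integrable_sq hmin he1 b1
  have sneg : ∀ᵐ x, P₀ (-x) = P₀ x := by
    filter_upwards [s1, (hrefl e1).measurePreserving.quasiMeasurePreserving.ae s0] with x h1 h0
    rw [← hrefl_e0_e1, h0, h1]
  refine ⟨P₀, h₀, hmin, fun v hv => ae_hrefl_eq h₀ h₀.integrable_sq hmin hv ?_⟩
  have e : ∫ x, P₀ (-x) ^ 2 * sgn (inner ℝ v (-x)) = ∫ x, P₀ x ^ 2 * sgn (inner ℝ v x) :=
    integral_neg_eq_self (fun x => P₀ x ^ 2 * sgn (inner ℝ v x)) volume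
  have e' : ∫ x, P₀ (-x) ^ 2 * sgn (inner ℝ v (-x)) = ∫ x, -(P₀ x ^ 2 * sgn (inner ℝ v x)) := by
    refine integral_congr_ae (sneg.mono fun x hx => ?_)
    simp only [hx, inner_neg_right, sgn_neg_eq, mul_neg]
  rw [integral_neg, e] at e'
  linarith

lemma continuous_d0R {f : Plane → ℝ} (hf : ContDiff ℝ 1 f) : Continuous (d0R f) := by
  have := hf.continuous_fderiv one_ne_zero
  unfold d0R; fun_prop

lemma continuous_d1R {f : Plane → ℝ} (hf : ContDiff ℝ 1 f) : Continuous (d1R f) := by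
  have := hf.continuous_fderiv one_ne_zero
  unfold d1R; fun_prop

lemma hasCompactSupport_d0R {f : Plane → ℝ} (h : HasCompactSupport f) :
    HasCompactSupport (d0R f) :=
  (h.fderiv ℝ).comp_left (g := fun L : Plane →L[ℝ] ℝ => L e0) rfl

lemma hasCompactSupport_d1R {f : Plane → ℝ} (h : HasCompactSupport f) :
    HasCompactSupport (d1R f) :=
  (h.fderiv ℝ).comp_left (g := fun L : Plane →L[ℝ] ℝ => L e1) rfl

lemma contDiff_d0R {f : Plane → ℝ} (hf : ContDiff ℝ 2 f) : ContDiff ℝ 1 (d0R f) :=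
  (hf.fderiv_right (m := 1) le_rfl).clm_apply contDiff_const

lemma contDiff_d1R {f : Plane → ℝ} (hf : ContDiff ℝ 2 f) : ContDiff ℝ 1 (d1R f) :=
  (hf.fderiv_right (m := 1) le_rfl).clm_apply contDiff_const

lemma continuous_lapR {f : Plane → ℝ} (hf : ContDiff ℝ 2 f) : Continuous (lapR f) :=
  (continuous_d0R (contDiff_d0R hf)).add (continuous_d1R (contDiff_d1R hf))

lemma hasCompactSupport_lapR {f : Plane → ℝ} (h : HasCompactSupport f) :
    HasCompactSupport (lapR f) :=
  (hasCompactSupport_d0R (hasCompactSupport_d0R h)).add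
    (hasCompactSupport_d1R (hasCompactSupport_d1R h))

/-- Green's identity against a compactly supported function. -/
lemma integral_grad_mul_grad {F φ : Plane → ℝ} (hF : ContDiff ℝ 1 F) (hφ : ContDiff ℝ 2 φ)
    (hc : HasCompactSupport φ) :
    ∫ x, (d0R F x * d0R φ x + d1R F x * d1R φ x) = -∫ x, F x * lapR φ x := by
  have hφ1 : ContDiff ℝ 1 φ := hφ.of_le one_le_two
  have c0 := hasCompactSupport_d0R hc
  have c1 := hasCompactSupport_d1R hc
  have i0 : Integrable fun x => d0R F x * d0R φ x :=
    ((continuous_d0R hF).mul (continuous_d0R hφ1)).integrable_of_hasCompactSupport c0.mul_left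
  have i1 : Integrable fun x => d1R F x * d1R φ x :=
    ((continuous_d1R hF).mul (continuous_d1R hφ1)).integrable_of_hasCompactSupport c1.mul_left
  have j0 : Integrable fun x => F x * d0R (d0R φ) x :=
    (hF.continuous.mul (continuous_d0R (contDiff_d0R hφ))).integrable_of_hasCompactSupport
      (hasCompactSupport_d0R c0).mul_left
  have j1 : Integrable fun x => F x * d1R (d1R φ) x :=
    (hF.continuous.mul (continuous_d1R (contDiff_d1R hφ))).integrable_of_hasCompactSupport
      (hasCompactSupport_d1R c1).mul_left
  have k0 : Integrable fun x => F x * d0R φ x :=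
    (hF.continuous.mul (continuous_d0R hφ1)).integrable_of_hasCompactSupport c0.mul_left
  have k1 : Integrable fun x => F x * d1R φ x :=
    (hF.continuous.mul (continuous_d1R hφ1)).integrable_of_hasCompactSupport c1.mul_left
  have e0' := integral_mul_fderiv_eq_neg_fderiv_mul_of_integrable (v := e0) i0 j0 k0
    (fun x _ => hF.differentiable one_ne_zero x)
    (fun x _ => (contDiff_d0R hφ).differentiable one_ne_zero x)
  have e1' := integral_mul_fderiv_eq_neg_fderiv_mul_of_integrable (v := e1) i1 j1 k1
    (fun x _ => hF.differentiable one_ne_zero x)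
    (fun x _ => (contDiff_d1R hφ).differentiable one_ne_zero x)
  have e : ∫ x, F x * lapR φ x = (∫ x, F x * d0R (d0R φ) x) + ∫ x, F x * d1R (d1R φ) x := by
    rw [← integral_add j0 j1]
    simp only [lapR, mul_add]; rfl
  rw [integral_add i0 i1, e]
  change (∫ x, F x * d0R (d0R φ) x) = -∫ x, d0R F x * d0R φ x at e0'
  change (∫ x, F x * d1R (d1R φ) x) = -∫ x, d1R F x * d1R φ x at e1'
  linarith

lemma gradSqR_add_smul {F φ : Plane → ℝ} (hF : Differentiable ℝ F) (hφ : Differentiable ℝ φ)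
    (s : ℝ) (x : Plane) : gradSqR (fun x => F x + s * φ x) x =
      gradSqR F x + 2 * s * (d0R F x * d0R φ x + d1R F x * d1R φ x) + s ^ 2 * gradSqR φ x := by
  have : fderiv ℝ (fun x => F x + s * φ x) x = fderiv ℝ F x + s • fderiv ℝ φ x :=
    ((hF x).hasFDerivAt.add ((hφ x).hasFDerivAt.const_mul s)).fderiv
  simp only [gradSqR, d0R, d1R, this, add_apply,
    smul_apply, smul_eq_mul]
  ring

lemma integral_gradSqR_add_smul {F φ : Plane → ℝ} (hF : ContDiff ℝ 1 F) (hφ : ContDiff ℝ 2 φ)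
    (hc : HasCompactSupport φ) (hi : Integrable (gradSqR F)) (s : ℝ) :
    Integrable (gradSqR fun x => F x + s * φ x) ∧ ∫ x, gradSqR (fun x => F x + s * φ x) x =
      (∫ x, gradSqR F x) - 2 * s * (∫ x, F x * lapR φ x) + s ^ 2 * ∫ x, gradSqR φ x := by
  have hφ1 : ContDiff ℝ 1 φ := hφ.of_le one_le_two
  have e : gradSqR (fun x => F x + s * φ x) = fun x =>
      gradSqR F x + 2 * s * (d0R F x * d0R φ x + d1R F x * d1R φ x) + s ^ 2 * gradSqR φ x :=
    funext (gradSqR_add_smul (hF.differentiable one_ne_zero) (hφ1.differentiable one_ne_zero) s)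
  have i1 : Integrable fun x => d0R F x * d0R φ x + d1R F x * d1R φ x :=
    (((continuous_d0R hF).mul (continuous_d0R hφ1)).add
      ((continuous_d1R hF).mul (continuous_d1R hφ1))).integrable_of_hasCompactSupport
      ((hasCompactSupport_d0R hc).mul_left.add (hasCompactSupport_d1R hc).mul_left)
  have i2 : Integrable (gradSqR φ) :=
    (continuous_gradSqR hφ1).integrable_of_hasCompactSupport (hasCompactSupport_gradSqR hc)
  have j1 : Integrable fun x =>
      gradSqR F x + 2 * s * (d0R F x * d0R φ x + d1R F x * d1R φ x) := hi.add (i1.const_mul _)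
  rw [e]
  refine ⟨j1.add (i2.const_mul _), ?_⟩
  beta_reduce
  rw [integral_add j1 (i2.const_mul _), integral_add hi (i1.const_mul _),
    integral_const_mul, integral_const_mul, integral_grad_mul_grad hF hφ hc]
  ring

lemma eq_zero_of_forall_nonneg_poly {l m n p : ℝ}
    (h : ∀ s : ℝ, 0 ≤ l * s + m * s ^ 2 + n * s ^ 3 + p * s ^ 4) : l = 0 := by
  have hd : HasDerivAt (fun s : ℝ => l * s + m * s ^ 2 + n * s ^ 3 + p * s ^ 4) l 0 := by
    refine (((((hasDerivAt_id (0 : ℝ)).const_mul l).add ((hasDerivAt_pow 2 (0 : ℝ)).const_mul m)).add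
      ((hasDerivAt_pow 3 (0 : ℝ)).const_mul n)).add
      ((hasDerivAt_pow 4 (0 : ℝ)).const_mul p)).congr_deriv (by simp)
  refine IsLocalMin.hasDerivAt_eq_zero (Filter.Eventually.of_forall fun s => ?_) hd
  simpa using h s

lemma integrable_mul_of_sq {f g : Plane → ℝ} (hf : Measurable f) (hg : Measurable g)
    (h2 : Integrable fun x => f x ^ 2) (k2 : Integrable fun x => g x ^ 2) :
    Integrable fun x => f x * g x := by
  refine (h2.add k2).mono' (hf.mul hg).aestronglyMeasurable (ae_of_all _ fun x => ?_)
  rw [Real.norm_eq_abs, abs_le]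
  constructor <;> simp only [Pi.add_apply] <;> nlinarith [sq_nonneg (f x + g x), sq_nonneg (f x - g x)]

lemma integral_add_smul_sq {f g : Plane → ℝ} (hf : Measurable f) (hg : Measurable g)
    (h2 : Integrable fun x => f x ^ 2) (k2 : Integrable fun x => g x ^ 2) (s : ℝ) :
    Integrable (fun x => (f x + s * g x) ^ 2) ∧ ∫ x, (f x + s * g x) ^ 2 =
      (∫ x, f x ^ 2) + 2 * s * (∫ x, f x * g x) + s ^ 2 * ∫ x, g x ^ 2 := by
  have i1 := integrable_mul_of_sq hf hg h2 k2
  have e : (fun x => (f x + s * g x) ^ 2) =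
      fun x => f x ^ 2 + 2 * s * (f x * g x) + s ^ 2 * g x ^ 2 := by ext; ring
  have j1 : Integrable fun x => f x ^ 2 + 2 * s * (f x * g x) := h2.add (i1.const_mul _)
  rw [e]
  refine ⟨j1.add (k2.const_mul _), ?_⟩
  rw [integral_add j1 (k2.const_mul _), integral_add h2 (i1.const_mul _),
    integral_const_mul, integral_const_mul]

lemma integral_add_smul_four {f g : Plane → ℝ} (hf : Measurable f) (hg : Measurable g)
    (h4 : Integrable fun x => f x ^ 4) (k4 : Integrable fun x => g x ^ 4) (s : ℝ) :
    Integrable (fun x => (f x + s * g x) ^ 4) ∧ ∫ x, (f x + s * g x) ^ 4 =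
      (∫ x, f x ^ 4) + 4 * s * (∫ x, f x ^ 3 * g x) + 6 * s ^ 2 * (∫ x, f x ^ 2 * g x ^ 2)
        + 4 * s ^ 3 * (∫ x, f x * g x ^ 3) + s ^ 4 * ∫ x, g x ^ 4 := by
  have hF : ∀ x, (fun x => (f x ^ 2) ^ 2) x = f x ^ 4 := fun x => by ring
  have f2 : Integrable fun x => (f x ^ 2) ^ 2 := by simpa only [hF] using (funext hF ▸ h4)
  have g2 : Integrable fun x => (g x ^ 2) ^ 2 := by
    refine k4.congr (ae_of_all _ fun x => ?_); ring
  have i2 := integrable_mul_of_sq (hf.pow_const 2) (hg.pow_const 2) f2 g2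
  have i22 : Integrable fun x => (f x * g x) ^ 2 := by
    refine i2.congr (ae_of_all _ fun x => ?_); ring
  have i1 : Integrable fun x => f x ^ 3 * g x :=
    (integrable_mul_of_sq (hf.pow_const 2) (hf.mul hg) f2 i22).congr
      (ae_of_all _ fun x => by simp only [Pi.mul_apply]; ring)
  have i3 : Integrable fun x => f x * g x ^ 3 :=
    (integrable_mul_of_sq (hg.pow_const 2) (hf.mul hg) g2 i22).congr
      (ae_of_all _ fun x => by simp only [Pi.mul_apply]; ring)
  have e : (fun x => (f x + s * g x) ^ 4) = fun x => f x ^ 4 + 4 * s * (f x ^ 3 * g x)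
      + 6 * s ^ 2 * (f x ^ 2 * g x ^ 2) + 4 * s ^ 3 * (f x * g x ^ 3) + s ^ 4 * g x ^ 4 := by
    ext; ring
  have j1 : Integrable fun x => f x ^ 4 + 4 * s * (f x ^ 3 * g x) :=
    h4.add (i1.const_mul (4 * s))
  have j2 : Integrable fun x => f x ^ 4 + 4 * s * (f x ^ 3 * g x)
      + 6 * s ^ 2 * (f x ^ 2 * g x ^ 2) := j1.add (i2.const_mul (6 * s ^ 2))
  have j3 : Integrable fun x => f x ^ 4 + 4 * s * (f x ^ 3 * g x)
      + 6 * s ^ 2 * (f x ^ 2 * g x ^ 2) + 4 * s ^ 3 * (f x * g x ^ 3) :=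
    j2.add (i3.const_mul (4 * s ^ 3))
  rw [e]
  refine ⟨j3.add (k4.const_mul _), ?_⟩
  rw [integral_add j3 (k4.const_mul _), integral_add j2 (i3.const_mul _),
    integral_add j1 (i2.const_mul _), integral_add h4 (i1.const_mul _)]
  simp only [integral_const_mul]

lemma tendsto_integral_mul {F : ℕ → Plane → ℝ} {P g : Plane → ℝ} (hF : ∀ n, Measurable (F n))
    (hP : Measurable P) (hg : Measurable g) (F2 : ∀ n, Integrable fun x => F n x ^ 2)
    (P2 : Integrable fun x => P x ^ 2) (g2 : Integrable fun x => g x ^ 2)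
    (h : Tendsto (fun n => ∫⁻ x, ‖F n x - P x‖ₑ ^ 2) atTop (𝓝 0)) :
    Tendsto (fun n => ∫ x, F n x * g x) atTop (𝓝 (∫ x, P x * g x)) := by
  refine tendsto_integral_of_L1 _ (integrable_mul_of_sq hP hg P2 g2).aestronglyMeasurable
    (Filter.Eventually.of_forall fun n => integrable_mul_of_sq (hF n) hg (F2 n) g2) ?_
  have hb : ∀ n, (∫⁻ x, ‖F n x * g x - P x * g x‖ₑ) ^ 2 ≤
      (∫⁻ x, ‖F n x - P x‖ₑ ^ 2) * ∫⁻ x, ‖g x‖ₑ ^ 2 := fun n => by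
    refine le_trans (le_of_eq ?_) (sq_lintegral_mul_le (by fun_prop) (by fun_prop))
    simp only [← sub_mul, enorm_mul]
  have h0 : Tendsto (fun n => (∫⁻ x, ‖F n x * g x - P x * g x‖ₑ) ^ 2) atTop (𝓝 0) := by
    refine tendsto_of_tendsto_of_tendsto_of_le_of_le tendsto_const_nhds ?_ (fun n => bot_le) hb
    simpa using ENNReal.Tendsto.mul_const h (Or.inr (lintegral_enorm_ne_top g2))
  have h1 := h0.ennrpow_const (1 / 2 : ℝ)
  have e : ∀ t : ℝ≥0∞, (t ^ 2) ^ (1 / 2 : ℝ) = t := fun t => by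
    rw [← ENNReal.rpow_natCast, ← ENNReal.rpow_mul]; norm_num
  simp only [e] at h1
  simpa using h1

lemma IsOpt.integrable_four {A : ℝ} {P : Plane → ℝ} (h : IsOpt A P) :
    Integrable fun x => P x ^ 4 := by
  refine ⟨(h.meas.pow_const 4).aestronglyMeasurable, ?_⟩
  rw [hasFiniteIntegral_iff_enorm]
  simp_rw [enorm_pow]
  rw [h.four]; exact ENNReal.ofReal_lt_top

/-- The weak Euler–Lagrange equation of a Gagliardo–Nirenberg optimiser. -/
theorem IsOpt.weak {A : ℝ} {P : Plane → ℝ} (hGN : GNIneq (ENNReal.ofReal A)) (hA : 0 < A)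
    (h : IsOpt A P) {φ : Plane → ℝ} (hφ : ContDiff ℝ 2 φ) (hc : HasCompactSupport φ) :
    ∫ x, P x * lapR φ x = (∫ x, P x * φ x) - ∫ x, P x ^ 3 * φ x := by
  have h2 : ∫⁻ x, ‖P x‖ₑ ^ 2 ≠ ∞ := by rw [h.mass]; exact ENNReal.ofReal_ne_top
  have P2 := h.integrable_sq
  have P4 := h.integrable_four
  have iP2 : ∫ x, P x ^ 2 = A := by
    have := h.mass
    rwa [lintegral_enorm_sq P2, ENNReal.ofReal_eq_ofReal_iff (integral_nonneg fun x => sq_nonneg _)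
      hA.le] at this
  have iP4 : ∫ x, P x ^ 4 = 2 * A := by
    have := h.four
    rwa [lintegral_enorm_four P4, ENNReal.ofReal_eq_ofReal_iff
      (integral_nonneg fun x => Even.pow_nonneg (by decide) _) (by linarith)] at this
  have φ2 := integrable_pow_of_hasCompactSupport hφ.continuous hc two_ne_zero
  have φ4 := integrable_pow_of_hasCompactSupport hφ.continuous hc four_ne_zero
  have mφ : Measurable φ := hφ.continuous.measurable
  have l2 := integrable_pow_of_hasCompactSupport (continuous_lapR hφ) (hasCompactSupport_lapR hc)
    two_ne_zero
  obtain ⟨ν, hν, -, hC, hd, hs, hl, hae⟩ :=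
    exists_mollified_seq h.meas h2 h.energy ENNReal.ofReal_ne_top
  set F : ℕ → Plane → ℝ := fun n => avg (ν n) P
  have mF : ∀ n, Measurable (F n) := fun n => (hC n).continuous.measurable
  have F2 : ∀ n, Integrable fun x => F n x ^ 2 := fun n => by
    refine ⟨((mF n).pow_const 2).aestronglyMeasurable, ?_⟩
    rw [hasFiniteIntegral_iff_enorm]
    simp_rw [enorm_pow]
    exact (hs n).trans_lt h2.lt_top
  have Fg : ∀ n, Integrable (gradSqR (F n)) := fun n => by
    refine ⟨(continuous_gradSqR (hC n)).aestronglyMeasurable, ?_⟩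
    rw [hasFiniteIntegral_iff_ofReal (ae_of_all _ fun x => gradSqR_nonneg _ x), ← dirE_eq]
    exact (hd n).trans_lt ENNReal.ofReal_lt_top
  have F2A : ∀ n, ∫ x, F n x ^ 2 ≤ A := fun n => by
    have := hs n
    rwa [h.mass, lintegral_enorm_sq (F2 n), ENNReal.ofReal_le_ofReal_iff hA.le] at this
  have FgA : ∀ n, ∫ x, gradSqR (F n) x ≤ A := fun n => by
    have := hd n
    rwa [dirE_eq_ofReal (Fg n), ENNReal.ofReal_le_ofReal_iff hA.le] at this
  have hI := tendsto_integral_mul mF h.meas (continuous_lapR hφ).measurable F2 P2 l2 hl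
  have hJ := tendsto_integral_mul mF h.meas mφ F2 P2 φ2 hl
  have key : ∀ s : ℝ, A * ∫ x, (P x + s * φ x) ^ 4 ≤
      2 * (A - 2 * s * (∫ x, P x * lapR φ x) + s ^ 2 * ∫ x, gradSqR φ x) *
        (A + 2 * s * (∫ x, P x * φ x) + s ^ 2 * ∫ x, φ x ^ 2) := by
    intro s
    set R : ℕ → ℝ := fun n =>
      2 * (A - 2 * s * (∫ x, F n x * lapR φ x) + s ^ 2 * ∫ x, gradSqR φ x) *
        (A + 2 * s * (∫ x, F n x * φ x) + s ^ 2 * ∫ x, φ x ^ 2)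
    have hR : Tendsto R atTop (𝓝 (2 * (A - 2 * s * (∫ x, P x * lapR φ x)
        + s ^ 2 * ∫ x, gradSqR φ x) * (A + 2 * s * (∫ x, P x * φ x) + s ^ 2 * ∫ x, φ x ^ 2))) :=
      (((tendsto_const_nhds.sub (hI.const_mul _)).add_const _).const_mul 2).mul
        ((tendsto_const_nhds.add (hJ.const_mul _)).add_const _)
    have hn : ∀ n, ENNReal.ofReal A * ∫⁻ x, ‖F n x + s * φ x‖ₑ ^ 4 ≤ ENNReal.ofReal (R n) := by
      intro n
      obtain ⟨g1, g2⟩ := integral_gradSqR_add_smul (hC n) hφ hc (Fg n) s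
      obtain ⟨q1, q2⟩ := integral_add_smul_sq (mF n) mφ (F2 n) φ2 s
      have hg0 : 0 ≤ ∫ x, gradSqR (fun x => F n x + s * φ x) x :=
        integral_nonneg fun x => gradSqR_nonneg _ x
      have hq0 : 0 ≤ ∫ x, (F n x + s * φ x) ^ 2 := integral_nonneg fun x => sq_nonneg _
      have := hGN.of_contDiff ENNReal.ofReal_ne_top
        ((hC n).add (contDiff_const.mul (hφ.of_le one_le_two)))
        (f := fun x => F n x + s * φ x) (lintegral_enorm_ne_top q1)
        (by rw [dirE_eq_ofReal g1]; exact ENNReal.ofReal_ne_top)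
      rw [dirE_eq_ofReal g1, lintegral_enorm_sq q1,
        show ∀ c d : ℝ≥0∞, 2 * c * d = ENNReal.ofReal 2 * c * d by simp, ← ENNReal.ofReal_mul zero_le_two, ← ENNReal.ofReal_mul (by positivity)] at this
      refine this.trans (ENNReal.ofReal_le_ofReal ?_)
      refine mul_le_mul (mul_le_mul_of_nonneg_left ?_ zero_le_two) ?_ hq0 ?_
      · rw [g2]; linarith [FgA n]
      · rw [q2]; linarith [F2A n]
      · rw [g2] at hg0; linarith [FgA n]
    obtain ⟨p1, -⟩ := integral_add_smul_four h.meas mφ P4 φ4 s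
    have hlim : ENNReal.ofReal A * ∫⁻ x, ‖P x + s * φ x‖ₑ ^ 4 ≤ ENNReal.ofReal
        (2 * (A - 2 * s * (∫ x, P x * lapR φ x) + s ^ 2 * ∫ x, gradSqR φ x) *
          (A + 2 * s * (∫ x, P x * φ x) + s ^ 2 * ∫ x, φ x ^ 2)) :=
      calc ENNReal.ofReal A * ∫⁻ x, ‖P x + s * φ x‖ₑ ^ 4
          ≤ ENNReal.ofReal A * liminf (fun n => ∫⁻ x, ‖F n x + s * φ x‖ₑ ^ 4) atTop := by
            gcongr
            exact lintegral_enorm_pow_le_liminf 4 (F := fun n x => F n x + s * φ x)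
              (fun n => (mF n).add (mφ.const_mul s)) (hae.mono fun x hx => hx.add_const _)
        _ ≤ liminf (fun n => ENNReal.ofReal A * ∫⁻ x, ‖F n x + s * φ x‖ₑ ^ 4) atTop :=
            (ENNReal.liminf_const_mul_of_ne_top ENNReal.ofReal_ne_top).ge
        _ ≤ liminf (fun n => ENNReal.ofReal (R n)) atTop :=
            liminf_le_liminf (Filter.Eventually.of_forall hn)
        _ = _ := (ENNReal.tendsto_ofReal hR).liminf_eq
    rw [lintegral_enorm_four p1, ← ENNReal.ofReal_mul hA.le] at hlim
    rcases le_or_gt (∫ x, (P x + s * φ x) ^ 4) 0 with h0 | h0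
    · have e0 : ∫ x, (P x + s * φ x) ^ 4 = 0 :=
        le_antisymm h0 (integral_nonneg fun x => Even.pow_nonneg (by decide) _)
      rw [e0, mul_zero]
      refine ge_of_tendsto hR (Filter.Eventually.of_forall fun n => ?_)
      have hg0 : 0 ≤ ∫ x, gradSqR (fun x => F n x + s * φ x) x :=
        integral_nonneg fun x => gradSqR_nonneg _ x
      have hq0 : 0 ≤ ∫ x, (F n x + s * φ x) ^ 2 := integral_nonneg fun x => sq_nonneg _
      rw [(integral_gradSqR_add_smul (hC n) hφ hc (Fg n) s).2] at hg0
      rw [(integral_add_smul_sq (mF n) mφ (F2 n) φ2 s).2] at hq0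
      exact mul_nonneg (mul_nonneg zero_le_two (by linarith [FgA n])) (by linarith [F2A n])
    · exact (ENNReal.ofReal_le_ofReal_iff' .. |>.1 hlim).resolve_right (by
        have := mul_pos hA h0; linarith)
  have hpoly := eq_zero_of_forall_nonneg_poly
    (l := 4 * A * ((∫ x, P x * φ x) - (∫ x, P x * lapR φ x) - ∫ x, P x ^ 3 * φ x))
    (m := 2 * A * (∫ x, φ x ^ 2) + 2 * A * (∫ x, gradSqR φ x)
      - 8 * (∫ x, P x * lapR φ x) * (∫ x, P x * φ x) - 6 * A * ∫ x, P x ^ 2 * φ x ^ 2)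
    (n := 4 * (∫ x, gradSqR φ x) * (∫ x, P x * φ x) - 4 * (∫ x, P x * lapR φ x) * (∫ x, φ x ^ 2)
      - 4 * A * ∫ x, P x * φ x ^ 3)
    (p := 2 * (∫ x, gradSqR φ x) * (∫ x, φ x ^ 2) - A * ∫ x, φ x ^ 4) (fun s => by
      have := key s
      rw [(integral_add_smul_four h.meas mφ P4 φ4 s).2, iP4] at this
      nlinarith)
  have := (mul_eq_zero.1 hpoly).resolve_left (by positivity)
  linarith

/-- The area of the unit disc. -/
def discArea : ℝ := (volume : Measure Plane).real (ball 0 1)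

lemma discArea_pos : 0 < discArea :=
  ENNReal.toReal_pos (measure_ball_pos _ _ one_pos).ne' measure_ball_lt_top.ne

lemma finrank_plane : Module.finrank ℝ Plane = 2 := by simp

lemma integrable_radial_iff {F : ℝ → ℝ} :
    Integrable (fun x : Plane => F (‖x‖ ^ 2)) ↔ IntegrableOn F (Ioi 0) := by
  rw [integrable_fun_norm_addHaar (volume : Measure Plane) (f := fun r => F (r ^ 2)),
    ← integrableOn_Ioi_comp_rpow_iff' F (two_ne_zero (α := ℝ)), finrank_plane]
  norm_num

lemma integral_radial (F : ℝ → ℝ) :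
    ∫ x : Plane, F (‖x‖ ^ 2) = discArea * ∫ t in Ioi 0, F t := by
  rw [integral_fun_norm_addHaar (volume : Measure Plane) (fun r => F (r ^ 2)),
    ← integral_comp_rpow_Ioi F (two_ne_zero (α := ℝ)), finrank_plane, discArea]
  norm_num [mul_assoc, integral_const_mul]
  ring

lemma ae_radial {p q : ℝ → ℝ} (h : ∀ᵐ t, 0 < t → p t = q t) :
    ∀ᵐ x : Plane, p (‖x‖ ^ 2) = q (‖x‖ ^ 2) := by
  have h0 : (fun t => if p t = q t then (0 : ℝ) else 1) =ᵐ[volume.restrict (Ioi 0)] 0 := by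
    refine (ae_restrict_iff' measurableSet_Ioi).2 (h.mono fun t ht h't => ?_)
    simp [ht h't]
  have hi : Integrable fun x : Plane =>
      (fun t => if p t = q t then (0 : ℝ) else 1) (‖x‖ ^ 2) :=
    integrable_radial_iff.2 ((integrable_zero _ _ _).congr h0.symm)
  have hz := integral_radial fun t => if p t = q t then (0 : ℝ) else 1
  rw [integral_congr_ae h0] at hz
  simp only [Pi.zero_apply, integral_zero, mul_zero] at hz
  rw [integral_eq_zero_iff_of_nonneg (fun x => by simp only [Pi.zero_apply]; split_ifs <;> simp)
    hi] at hz
  filter_upwards [hz] with x hx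
  by_contra hne
  simp [hne] at hx

section TestFunction

variable {ψ : ℝ → ℝ} {a b : ℝ}

/-- The primitive of `ψ` vanishing at the origin. -/
def prim (ψ : ℝ → ℝ) (t : ℝ) : ℝ := ∫ s in (0 : ℝ)..t, ψ s

lemma hasDerivAt_prim (hψ : Continuous ψ) (t : ℝ) : HasDerivAt (prim ψ) (ψ t) t :=
  intervalIntegral.integral_hasDerivAt_right (hψ.intervalIntegrable _ _)
    hψ.stronglyMeasurable.stronglyMeasurableAtFilter hψ.continuousAt

lemma prim_eq_zero_of_le (ha : 0 ≤ a) (hl : ∀ t ≤ a, ψ t = 0) {t : ℝ} (ht : t ≤ a) :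
    prim ψ t = 0 := by
  refine (intervalIntegral.integral_congr (g := fun _ => (0 : ℝ)) fun s hs => ?_).trans (by simp)
  exact hl s (hs.2.trans (max_le ha ht))

lemma prim_eq_zero_of_ge (hψ : Continuous ψ) (hr : ∀ t, b ≤ t → ψ t = 0) (h0 : prim ψ b = 0)
    {t : ℝ} (ht : b ≤ t) : prim ψ t = 0 := by
  have := intervalIntegral.integral_add_adjacent_intervals (hψ.intervalIntegrable 0 b)
    (hψ.intervalIntegrable b t) (μ := volume)
  rw [prim, ← this, ← prim, h0, zero_add]
  refine (intervalIntegral.integral_congr (g := fun _ => (0 : ℝ)) fun s hs => ?_).trans (by simp)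
  rw [uIcc_of_le ht] at hs
  exact hr s hs.1

lemma hasDerivAt_prim_div (hψ : Continuous ψ) (ha : 0 < a) (hl : ∀ t ≤ a, ψ t = 0) (t : ℝ) :
    HasDerivAt (fun t => prim ψ t / t) ((ψ t - prim ψ t / t) / t) t := by
  rcases eq_or_ne t 0 with rfl | h0
  · have : (fun t => prim ψ t / t) =ᶠ[𝓝 0] fun _ => 0 := by
      filter_upwards [Iio_mem_nhds ha] with t ht
      rw [prim_eq_zero_of_le ha.le hl ht.le, zero_div]
    simpa using (hasDerivAt_const (0 : ℝ) (0 : ℝ)).congr_of_eventuallyEq this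
  · refine ((hasDerivAt_prim hψ t).div (hasDerivAt_id t) h0).congr_deriv ?_
    simp only [id]
    field_simp

lemma continuous_prim_div_deriv (hψ : Continuous ψ) (ha : 0 < a) (hl : ∀ t ≤ a, ψ t = 0) :
    Continuous fun t => (ψ t - prim ψ t / t) / t := by
  rw [continuous_iff_continuousAt]
  intro t
  rcases eq_or_ne t 0 with rfl | h0
  · have : (fun t => (ψ t - prim ψ t / t) / t) =ᶠ[𝓝 0] fun _ => 0 := by
      filter_upwards [Iio_mem_nhds ha] with t ht
      rw [prim_eq_zero_of_le ha.le hl ht.le, hl t ht.le]; simp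
    exact (continuousAt_const (y := (0 : ℝ))).congr this.symm
  · exact (hψ.continuousAt.sub (hasDerivAt_prim_div hψ ha hl t).continuousAt).div
      continuousAt_id h0

/-- The radial profile whose planar Laplacian is `4 ψ(|x|²)`. -/
def profile (ψ : ℝ → ℝ) (b t : ℝ) : ℝ := ∫ s in b..t, prim ψ s / s

lemma continuous_prim_div (hψ : Continuous ψ) (ha : 0 < a) (hl : ∀ t ≤ a, ψ t = 0) :
    Continuous fun t => prim ψ t / t :=
  continuous_iff_continuousAt.2 fun t => (hasDerivAt_prim_div hψ ha hl t).continuousAt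

lemma hasDerivAt_profile (hψ : Continuous ψ) (ha : 0 < a) (hl : ∀ t ≤ a, ψ t = 0) (t : ℝ) :
    HasDerivAt (profile ψ b) (prim ψ t / t) t :=
  intervalIntegral.integral_hasDerivAt_right
    ((continuous_prim_div hψ ha hl).intervalIntegrable _ _)
    (continuous_prim_div hψ ha hl).stronglyMeasurable.stronglyMeasurableAtFilter
    (continuous_prim_div hψ ha hl).continuousAt

lemma profile_eq_zero_of_ge (hψ : Continuous ψ) (hr : ∀ t, b ≤ t → ψ t = 0)
    (h0 : prim ψ b = 0) {t : ℝ} (ht : b ≤ t) : profile ψ b t = 0 := by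
  refine (intervalIntegral.integral_congr (g := fun _ => (0 : ℝ)) fun s hs => ?_).trans (by simp)
  rw [uIcc_of_le ht] at hs
  change prim ψ s / s = 0
  rw [prim_eq_zero_of_ge hψ hr h0 hs.1, zero_div]

lemma contDiff_profile (hψ : Continuous ψ) (ha : 0 < a) (hl : ∀ t ≤ a, ψ t = 0) :
    ContDiff ℝ 2 (profile ψ b) := by
  have e1 : deriv (profile ψ b) = fun t => prim ψ t / t :=
    funext fun t => (hasDerivAt_profile hψ ha hl t).deriv
  have e2 : deriv (fun t => prim ψ t / t) = fun t => (ψ t - prim ψ t / t) / t :=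
    funext fun t => (hasDerivAt_prim_div hψ ha hl t).deriv
  rw [show (2 : WithTop ℕ∞) = 1 + 1 by norm_num, contDiff_succ_iff_deriv]
  refine ⟨fun t => (hasDerivAt_profile hψ ha hl t).differentiableAt, by simp, ?_⟩
  rw [e1, contDiff_one_iff_deriv, e2]
  exact ⟨fun t => (hasDerivAt_prim_div hψ ha hl t).differentiableAt,
    continuous_prim_div_deriv hψ ha hl⟩

lemma hasFDerivAt_comp_norm_sq {f : ℝ → ℝ} {f' : ℝ} {x : Plane} (h : HasDerivAt f f' (‖x‖ ^ 2)) :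
    HasFDerivAt (fun x : Plane => f (‖x‖ ^ 2)) (f' • (2 • innerSL ℝ x)) x :=
  h.comp_hasFDerivAt x (hasStrictFDerivAt_norm_sq x).hasFDerivAt

lemma norm_sq_plane (x : Plane) : ‖x‖ ^ 2 = x 0 ^ 2 + x 1 ^ 2 := by
  rw [EuclideanSpace.norm_sq_eq]; simp

lemma lapR_profile (hψ : Continuous ψ) (ha : 0 < a) (hl : ∀ t ≤ a, ψ t = 0) (x : Plane) :
    lapR (fun x => profile ψ b (‖x‖ ^ 2)) x = 4 * ψ (‖x‖ ^ 2) := by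
  have E0 : d0R (fun x => profile ψ b (‖x‖ ^ 2)) =
      fun x => prim ψ (‖x‖ ^ 2) / ‖x‖ ^ 2 * (2 * x 0) := by
    ext x
    rw [d0R, (hasFDerivAt_comp_norm_sq (hasDerivAt_profile hψ ha hl _)).fderiv]
    simp [e0, EuclideanSpace.inner_single_right]
  have E1 : d1R (fun x => profile ψ b (‖x‖ ^ 2)) =
      fun x => prim ψ (‖x‖ ^ 2) / ‖x‖ ^ 2 * (2 * x 1) := by
    ext x
    rw [d1R, (hasFDerivAt_comp_norm_sq (hasDerivAt_profile hψ ha hl _)).fderiv]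
    simp [e1, EuclideanSpace.inner_single_right]
  have hc : ∀ i : Fin 2, HasFDerivAt (fun x : Plane => 2 * x i)
      ((2 : ℝ) • (EuclideanSpace.proj i : Plane →L[ℝ] ℝ)) x := fun i =>
    (EuclideanSpace.proj i : Plane →L[ℝ] ℝ).hasFDerivAt.const_mul 2
  have hk := hasFDerivAt_comp_norm_sq (hasDerivAt_prim_div hψ ha hl (‖x‖ ^ 2))
  have F0 : fderiv ℝ (fun x : Plane => prim ψ (‖x‖ ^ 2) / ‖x‖ ^ 2 * (2 * x 0)) x = _ :=
    (hk.mul (hc 0)).fderiv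
  have F1 : fderiv ℝ (fun x : Plane => prim ψ (‖x‖ ^ 2) / ‖x‖ ^ 2 * (2 * x 1)) x = _ :=
    (hk.mul (hc 1)).fderiv
  rw [lapR, E0, E1, F0, F1]
  simp [e0, e1, EuclideanSpace.inner_single_right]
  rcases eq_or_ne (‖x‖ ^ 2) 0 with h0 | h0
  · rw [h0, hl 0 ha.le, prim_eq_zero_of_le ha.le hl ha.le]; simp
  · have hn := norm_sq_plane x
    generalize ‖x‖ ^ 2 = T at *
    linear_combination 4 * div_mul_cancel₀ (ψ T - prim ψ T / T) h0 -
      4 * ((ψ T - prim ψ T / T) / T) * hn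

lemma hasCompactSupport_profile (hψ : Continuous ψ) (hr : ∀ t, b ≤ t → ψ t = 0)
    (h0 : prim ψ b = 0) : HasCompactSupport fun x : Plane => profile ψ b (‖x‖ ^ 2) := by
  refine HasCompactSupport.of_support_subset_isCompact
    (isCompact_closedBall (0 : Plane) (|b| + 1)) fun x hx => ?_
  rw [mem_closedBall_zero_iff]
  by_contra! h
  refine hx (profile_eq_zero_of_ge hψ hr h0 ?_)
  nlinarith [le_abs_self b, abs_nonneg b]

end TestFunction

/-- The nonlinearity of the profile equation integrated from the origin. -/
def srcInt (p : ℝ → ℝ) (t : ℝ) : ℝ := ∫ s in (0 : ℝ)..t, (p s - p s ^ 3)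

def potInt (p : ℝ → ℝ) (t : ℝ) : ℝ := ∫ s in (0 : ℝ)..t, srcInt p s / (4 * s)

section
variable {p : ℝ → ℝ}

lemma intervalIntegrable_src (hm : AEStronglyMeasurable p) (h4 : Integrable fun t => p t ^ 4)
    (a b : ℝ) : IntervalIntegrable (fun s => p s - p s ^ 3) volume a b := by
  refine IntervalIntegrable.mono_fun' (g := fun s => 2 + 2 * p s ^ 4)
    (intervalIntegrable_const.add (h4.intervalIntegrable.const_mul 2))
    (hm.sub (hm.pow 3)).restrict (ae_of_all _ fun s => ?_)
  refine abs_le.2 ⟨?_, ?_⟩ <;>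
    nlinarith [sq_nonneg (p s ^ 2 - 1), sq_nonneg (p s - 1), sq_nonneg (p s + 1),
      sq_nonneg (p s ^ 2 - p s), sq_nonneg (p s ^ 2 + p s), sq_nonneg (p s)]

lemma srcInt_of_nonpos (hz : ∀ t ≤ 0, p t = 0) {t : ℝ} (ht : t ≤ 0) : srcInt p t = 0 := by
  refine (intervalIntegral.integral_congr (g := fun _ => (0 : ℝ)) fun s hs => ?_).trans (by simp)
  rw [uIcc_of_ge ht] at hs
  simp [hz s hs.2]

lemma abs_sub_cube_le {x l : ℝ} (hl : 0 < l) (h1 : l ≤ 1) :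
    |x - x ^ 3| ≤ 2 * (l * x ^ 4 + (l ^ 3)⁻¹) := by
  have h2 : (1 : ℝ) ≤ (l ^ 3)⁻¹ := (one_le_inv₀ (by positivity)).2 (pow_le_one₀ hl.le h1)
  have h3 : |x| ^ 3 ≤ l * x ^ 4 + (l ^ 3)⁻¹ := by
    rcases le_total 1 (l * |x|) with h | h
    · have : |x| ^ 3 ≤ l * x ^ 4 := by
        rw [show x ^ 4 = |x| ^ 4 by rw [pow_abs, abs_of_nonneg (by positivity)]]
        nlinarith [pow_nonneg (abs_nonneg x) 3]
      linarith
    · have : |x| ≤ l⁻¹ := (le_inv_mul_iff₀ hl).2 h |>.trans (by simp)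
      have : |x| ^ 3 ≤ (l ^ 3)⁻¹ := by rw [← inv_pow]; gcongr
      nlinarith [mul_nonneg hl.le (by positivity : 0 ≤ x ^ 4)]
  have h4 : |x| ≤ l * x ^ 4 + (l ^ 3)⁻¹ := by
    rcases le_total 1 |x| with h | h
    · nlinarith [sq_nonneg |x|, pow_le_pow_right₀ h (show 1 ≤ 3 by norm_num)]
    · nlinarith [mul_nonneg hl.le (by positivity : 0 ≤ x ^ 4)]
  calc |x - x ^ 3| ≤ |x| + |x ^ 3| := abs_sub _ _
    _ = |x| + |x| ^ 3 := by rw [abs_pow]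
    _ ≤ _ := by linarith

lemma exists_srcInt_le (h4 : Integrable fun t => p t ^ 4) :
    ∃ C, 0 ≤ C ∧ ∀ t, 0 < t → t ≤ 1 → |srcInt p t| ≤ C * t ^ (1 / 4 : ℝ) := by
  refine ⟨2 * ((∫ t, p t ^ 4) + 1), ?_, fun t ht h1 => ?_⟩
  · have : 0 ≤ ∫ t, p t ^ 4 := integral_nonneg fun t => by positivity
    linarith
  set l := t ^ (1 / 4 : ℝ) with hl
  have l0 : 0 < l := Real.rpow_pos_of_pos ht _
  have l1 : l ≤ 1 := Real.rpow_le_one ht.le h1 (by norm_num)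
  have lt : l ^ 4 = t := by
    rw [hl, ← Real.rpow_natCast, ← Real.rpow_mul ht.le]; norm_num
  have i1 : IntervalIntegrable (fun s => 2 * (l * p s ^ 4 + (l ^ 3)⁻¹)) volume 0 t :=
    ((h4.intervalIntegrable.const_mul l).add intervalIntegrable_const).const_mul 2
  have key : |srcInt p t| ≤ ∫ s in (0 : ℝ)..t, 2 * (l * p s ^ 4 + (l ^ 3)⁻¹) :=
    intervalIntegral.norm_integral_le_of_norm_le (f := fun s => p s - p s ^ 3) ht.le
      (ae_of_all _ fun s _ => abs_sub_cube_le l0 l1) i1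
  have e : ∫ s in (0 : ℝ)..t, 2 * (l * p s ^ 4 + (l ^ 3)⁻¹)
      = 2 * (l * (∫ s in (0 : ℝ)..t, p s ^ 4) + l) := by
    rw [intervalIntegral.integral_const_mul, intervalIntegral.integral_add
      (h4.intervalIntegrable.const_mul l) intervalIntegrable_const,
      intervalIntegral.integral_const_mul, intervalIntegral.integral_const, sub_zero, smul_eq_mul]
    congr 2
    rw [← lt]; field_simp
  have le4 : ∫ s in (0 : ℝ)..t, p s ^ 4 ≤ ∫ s, p s ^ 4 := by
    rw [intervalIntegral.integral_of_le ht.le]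
    exact setIntegral_le_integral h4 (ae_of_all _ fun s => by positivity)
  rw [e] at key
  nlinarith [mul_le_mul_of_nonneg_left le4 l0.le]

lemma continuous_srcInt (hm : AEStronglyMeasurable p) (h4 : Integrable fun t => p t ^ 4) :
    Continuous (srcInt p) :=
  intervalIntegral.continuous_primitive (intervalIntegrable_src hm h4) 0

lemma intervalIntegrable_srcInt_div (hm : AEStronglyMeasurable p)
    (h4 : Integrable fun t => p t ^ 4) (hz : ∀ t ≤ 0, p t = 0) (a b : ℝ) :
    IntervalIntegrable (fun s => srcInt p s / (4 * s)) volume a b := by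
  have hc := continuous_srcInt hm h4
  have h01 : IntervalIntegrable (fun s => srcInt p s / (4 * s)) volume 0 1 := by
    obtain ⟨C, C0, hC⟩ := exists_srcInt_le h4
    refine IntervalIntegrable.mono_fun' (g := fun s => C * s ^ (-(3 / 4) : ℝ))
      ((intervalIntegral.intervalIntegrable_rpow' (by norm_num)).const_mul C)
      (hc.measurable.div (by fun_prop)).aestronglyMeasurable ?_
    rw [uIoc_of_le zero_le_one]
    refine (ae_restrict_iff' measurableSet_Ioc).2 (ae_of_all _ fun s hs => ?_)
    have hr : s ^ (-(3 / 4) : ℝ) = s ^ (1 / 4 : ℝ) / s := by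
      rw [← Real.rpow_sub_one hs.1.ne']; norm_num
    change |srcInt p s / (4 * s)| ≤ C * s ^ (-(3 / 4) : ℝ)
    rw [abs_div, abs_of_pos (by linarith [hs.1] : 0 < 4 * s), hr,
      ← mul_div_assoc, div_le_div_iff₀ (by linarith [hs.1]) hs.1]
    have := hC s hs.1 hs.2
    have h0 : 0 ≤ C * s ^ (1 / 4 : ℝ) := (abs_nonneg _).trans this
    nlinarith [hs.1, mul_le_mul_of_nonneg_right this hs.1.le, mul_nonneg h0 hs.1.le]
  have hneg : ∀ a, a ≤ 0 → IntervalIntegrable (fun s => srcInt p s / (4 * s)) volume 0 a := by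
    intro a ha
    refine (intervalIntegrable_const (c := (0 : ℝ))).congr fun s hs => ?_
    rw [uIoc_of_ge ha] at hs
    simp [srcInt_of_nonpos hz hs.2]
  have hpos : ∀ a, 0 < a → IntervalIntegrable (fun s => srcInt p s / (4 * s)) volume 0 a := by
    intro a ha
    refine h01.trans (ContinuousOn.intervalIntegrable fun s hs => ?_)
    have : 0 < s := (lt_min one_pos ha).trans_le hs.1
    exact (hc.continuousAt.div (by fun_prop) (by positivity)).continuousWithinAt
  have hall : ∀ a, IntervalIntegrable (fun s => srcInt p s / (4 * s)) volume 0 a := fun a =>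
    (le_or_gt a 0).elim (hneg a) (hpos a)
  exact (hall a).symm.trans (hall b)

lemma continuous_potInt (hm : AEStronglyMeasurable p)
    (h4 : Integrable fun t => p t ^ 4) (hz : ∀ t ≤ 0, p t = 0) : Continuous (potInt p) :=
  intervalIntegral.continuous_primitive (intervalIntegrable_srcInt_div hm h4 hz) 0

lemma hasDerivAt_potInt (hm : AEStronglyMeasurable p)
    (h4 : Integrable fun t => p t ^ 4) (hz : ∀ t ≤ 0, p t = 0) {t : ℝ} (ht : 0 < t) :
    HasDerivAt (potInt p) (srcInt p t / (4 * t)) t := by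
  have hc := continuous_srcInt hm h4
  refine intervalIntegral.integral_hasDerivAt_right
    (intervalIntegrable_srcInt_div hm h4 hz 0 t) ?_ ?_
  · exact (hc.measurable.div (by fun_prop)).stronglyMeasurable.stronglyMeasurableAtFilter
  · exact hc.continuousAt.div (by fun_prop) (by positivity)

end

section

open scoped ContDiff

variable {p ψ : ℝ → ℝ} {a b : ℝ}

lemma integral_src_mul (hm : AEStronglyMeasurable p) (h4 : Integrable fun t => p t ^ 4)
    {g g' : ℝ → ℝ} (hg : ∀ t, HasDerivAt g (g' t) t) (hg' : Continuous g') (hb : g b = 0) :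
    ∫ t in (0 : ℝ)..b, (p t - p t ^ 3) * g t = - ∫ t in (0 : ℝ)..b, srcInt p t * g' t := by
  have hi := intervalIntegrable_src hm h4 0 b
  have ac1 : AbsolutelyContinuousOnInterval (srcInt p) 0 b :=
    hi.absolutelyContinuousOnInterval_intervalIntegral (by simp)
  have ac2 : AbsolutelyContinuousOnInterval g 0 b := by
    have e : g = fun t => ∫ s in b..t, g' s := funext fun t => by
      rw [intervalIntegral.integral_eq_sub_of_hasDerivAt (fun s _ => hg s)
        (hg'.intervalIntegrable _ _), hb, sub_zero]
    rw [e]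
    exact (hg'.intervalIntegrable 0 b).absolutelyContinuousOnInterval_intervalIntegral (by simp)
  have h := ac1.integral_mul_deriv_eq_deriv_mul ac2
  have e0 : srcInt p 0 = 0 := by simp [srcInt]
  have e1 : ∫ t in (0 : ℝ)..b, deriv (srcInt p) t * g t
      = ∫ t in (0 : ℝ)..b, (p t - p t ^ 3) * g t := by
    refine intervalIntegral.integral_congr_ae ?_
    filter_upwards [hi.ae_hasDerivAt_integral] with t ht h't
    have := (ht (uIoc_subset_uIcc h't) 0 (by simp)).deriv
    rw [← this]; rfl
  have e2 : ∫ t in (0 : ℝ)..b, srcInt p t * deriv g t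
      = ∫ t in (0 : ℝ)..b, srcInt p t * g' t :=
    intervalIntegral.integral_congr fun t _ => by simp only [(hg t).deriv]
  rw [e2, e1, e0, hb] at h
  rw [h]; ring

lemma integral_potInt_mul (hm : AEStronglyMeasurable p) (h4 : Integrable fun t => p t ^ 4)
    (hz : ∀ t ≤ 0, p t = 0) (hψ : Continuous ψ) (ha : 0 < a) (hab : a ≤ b)
    (hl : ∀ t ≤ a, ψ t = 0) (h0 : prim ψ b = 0) :
    4 * ∫ t in (0 : ℝ)..b, potInt p t * ψ t
      = - ∫ t in (0 : ℝ)..b, srcInt p t * (prim ψ t / t) := by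
  have hc := continuous_srcInt hm h4
  have hpc := continuous_potInt hm h4 hz
  have hqc := continuous_prim_div hψ ha hl
  have s1 : ∫ t in (0 : ℝ)..a, potInt p t * ψ t = 0 := by
    refine (intervalIntegral.integral_congr (g := fun _ => (0 : ℝ)) fun s hs => ?_).trans (by simp)
    rw [uIcc_of_le ha.le] at hs
    simp [hl s hs.2]
  have s2 : ∫ t in (0 : ℝ)..a, srcInt p t * (prim ψ t / t) = 0 := by
    refine (intervalIntegral.integral_congr (g := fun _ => (0 : ℝ)) fun s hs => ?_).trans (by simp)
    rw [uIcc_of_le ha.le] at hs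
    simp [prim_eq_zero_of_le ha.le hl hs.2]
  have t1 := intervalIntegral.integral_add_adjacent_intervals (f := fun t => potInt p t * ψ t)
    ((hpc.mul hψ).intervalIntegrable 0 a) ((hpc.mul hψ).intervalIntegrable (μ := volume) a b)
  have t2 := intervalIntegral.integral_add_adjacent_intervals
    (f := fun t => srcInt p t * (prim ψ t / t))
    ((hc.mul hqc).intervalIntegrable 0 a) ((hc.mul hqc).intervalIntegrable (μ := volume) a b)
  rw [← t1, ← t2, s1, s2]
  have hpos : ∀ t ∈ uIcc a b, 0 < t := fun t ht => by
    rw [uIcc_of_le hab] at ht; exact ha.trans_le ht.1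
  rw [intervalIntegral.integral_mul_deriv_eq_deriv_mul
    (fun t ht => hasDerivAt_potInt hm h4 hz (hpos t ht)) (fun t _ => hasDerivAt_prim hψ t)
    (ContinuousOn.intervalIntegrable fun t ht => ?_) (hψ.intervalIntegrable _ _), h0,
    prim_eq_zero_of_le ha.le hl le_rfl, zero_add, zero_add, mul_zero, mul_zero, sub_zero, zero_sub,
    mul_neg, ← intervalIntegral.integral_const_mul]
  · congr 1
    refine intervalIntegral.integral_congr fun t ht => ?_
    have := (hpos t ht).ne'
    field_simp
  · have := hpos t ht
    exact (hc.continuousAt.div (by fun_prop) (by positivity)).continuousWithinAt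

/-- The radial weak form of `-Δu + u - u³ = 0`, tested against logarithmic potentials. -/
def WeakRadial (p : ℝ → ℝ) : Prop :=
  ∀ ⦃ψ : ℝ → ℝ⦄ ⦃a b : ℝ⦄, Continuous ψ → 0 < a → a ≤ b → (∀ t ≤ a, ψ t = 0) →
    (∀ t, b ≤ t → ψ t = 0) → prim ψ b = 0 →
    4 * ∫ t in Ioi 0, p t * ψ t = ∫ t in Ioi 0, (p t - p t ^ 3) * profile ψ b t

lemma setIntegral_Ioi_eq {f : ℝ → ℝ} (hb : 0 ≤ b) (h : ∀ t, b ≤ t → f t = 0) :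
    ∫ t in Ioi 0, f t = ∫ t in (0 : ℝ)..b, f t := by
  rw [intervalIntegral.integral_of_le hb]
  refine (setIntegral_eq_of_subset_of_forall_sdiff_eq_zero measurableSet_Ioi
    (fun t ht => ht.1) fun t ht => ?_)
  exact h t (not_lt.1 fun hlt => ht.2 ⟨ht.1, hlt.le⟩)

lemma WeakRadial.integral_sub_potInt (hw : WeakRadial p) (hm : AEStronglyMeasurable p)
    (h4 : Integrable fun t => p t ^ 4) (hz : ∀ t ≤ 0, p t = 0) (hψ : Continuous ψ) (ha : 0 < a)
    (hab : a ≤ b) (hl : ∀ t ≤ a, ψ t = 0) (hr : ∀ t, b ≤ t → ψ t = 0) (h0 : prim ψ b = 0) :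
    ∫ t in Ioi 0, p t * ψ t = ∫ t in Ioi 0, potInt p t * ψ t := by
  have h := hw hψ ha hab hl hr h0
  rw [setIntegral_Ioi_eq (f := fun t => (p t - p t ^ 3) * profile ψ b t) (ha.le.trans hab)
      fun t ht => by rw [profile_eq_zero_of_ge hψ hr h0 ht, mul_zero],
    integral_src_mul hm h4 (fun t => hasDerivAt_profile hψ ha hl t) (continuous_prim_div hψ ha hl)
      (profile_eq_zero_of_ge hψ hr h0 le_rfl),
    ← integral_potInt_mul hm h4 hz hψ ha hab hl h0] at h
  rw [setIntegral_Ioi_eq (f := fun t => potInt p t * ψ t) (ha.le.trans hab)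
      fun t ht => by rw [hr t ht, mul_zero]]
  linarith

lemma exists_window {g : ℝ → ℝ} (hg : HasCompactSupport g) (hs : tsupport g ⊆ Ioi 0) :
    ∃ a b, 0 < a ∧ a ≤ b ∧ (∀ t ≤ a, g t = 0) ∧ ∀ t, b ≤ t → g t = 0 := by
  rcases (tsupport g).eq_empty_or_nonempty with he | hne
  · have : ∀ t, g t = 0 := fun t => by
      rw [tsupport_eq_empty_iff.1 he]; rfl
    exact ⟨1, 1, one_pos, le_rfl, fun t _ => this t, fun t _ => this t⟩
  · obtain ⟨m, hm, hmin⟩ := hg.isCompact.exists_isLeast hne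
    obtain ⟨M, hM, hmax⟩ := hg.isCompact.exists_isGreatest hne
    have m0 : 0 < m := hs hm
    refine ⟨m / 2, M + 1, by positivity, by linarith [hmin hM], fun t ht => ?_, fun t ht => ?_⟩
    · exact image_eq_zero_of_notMem_tsupport fun h => by linarith [hmin h]
    · exact image_eq_zero_of_notMem_tsupport fun h => by linarith [hmax h]

lemma WeakRadial.exists_eq (hw : WeakRadial p) (hm : AEStronglyMeasurable p)
    (h4 : Integrable fun t => p t ^ 4) (hz : ∀ t ≤ 0, p t = 0) :
    ∃ c, ∀ᵐ t, 0 < t → p t = potInt p t + c := by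
  have hpc := continuous_potInt hm h4 hz
  have hloc : LocallyIntegrable p := by
    rw [locallyIntegrable_iff]
    intro k hk
    have hfin : IsFiniteMeasure (volume.restrict k) := ⟨by simpa using hk.measure_lt_top⟩
    refine Integrable.mono' (g := fun t => 1 + p t ^ 4)
      ((integrable_const 1).add h4.integrableOn) hm.restrict (ae_of_all _ fun t => ?_)
    refine abs_le.2 ⟨?_, ?_⟩ <;>
      nlinarith [sq_nonneg (p t ^ 2 - 1), sq_nonneg (p t - 1), sq_nonneg (p t + 1)]
  let B : ContDiffBump (2 : ℝ) := ⟨1 / 2, 1, by norm_num, by norm_num⟩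
  let ρ : ℝ → ℝ := B.normed volume
  have hρc : Continuous ρ := B.contDiff_normed (n := 0) |>.continuous
  have hρs : HasCompactSupport ρ := B.hasCompactSupport_normed
  have hρt : tsupport ρ ⊆ Ioi 0 := by
    rw [B.tsupport_normed_eq]
    intro t ht
    rw [Real.closedBall_eq_Icc] at ht
    have := ht.1
    change (2 : ℝ) - 1 ≤ t at this
    exact mem_Ioi.2 (by linarith)
  have hρ1 : ∫ t, ρ t = 1 := B.integral_normed
  have hIoi : ∀ {f g : ℝ → ℝ}, tsupport g ⊆ Ioi 0 →
      ∫ t in Ioi 0, f t * g t = ∫ t, f t * g t := fun {f g} h =>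
    setIntegral_eq_integral_of_forall_compl_eq_zero fun t ht => by
      rw [image_eq_zero_of_notMem_tsupport fun h' => ht (h h'), mul_zero]
  have hpi : ∀ {g : ℝ → ℝ}, Continuous g → HasCompactSupport g →
      Integrable fun t => p t * g t := fun hg hs => by
    simpa only [smul_eq_mul, mul_comm] using hloc.integrable_smul_left_of_hasCompactSupport hg hs
  have hqi : ∀ {g : ℝ → ℝ}, Continuous g → HasCompactSupport g →
      Integrable fun t => potInt p t * g t := fun hg hs =>
    (hpc.mul hg).integrable_of_hasCompactSupport hs.mul_left
  set c := (∫ t, p t * ρ t) - ∫ t, potInt p t * ρ t with hcdef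
  refine ⟨c, ?_⟩
  have hz : ∀ᵐ t, t ∈ Ioi (0 : ℝ) → p t - (potInt p t + c) = 0 := by
    refine isOpen_Ioi.ae_eq_zero_of_integral_contDiff_smul_eq_zero
      ((hloc.sub (hpc.add continuous_const).locallyIntegrable).locallyIntegrableOn _)
      fun g hg hgs hgt => ?_
    have hgc := hg.continuous
    set m := ∫ t, g t with hmdef
    let χ : ℝ → ℝ := fun t => g t - m * ρ t
    have χc : Continuous χ := hgc.sub (continuous_const.mul hρc)
    have χs : HasCompactSupport χ := hgs.sub hρs.mul_left
    have χt : tsupport χ ⊆ Ioi 0 := by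
      refine (tsupport_sub _ _).trans (union_subset hgt (Subset.trans ?_ hρt))
      exact closure_mono (Function.support_mul_subset_right _ _)
    obtain ⟨a, b, a0, ab, hl, hr⟩ := exists_window χs χt
    have gi := hgc.integrable_of_hasCompactSupport hgs (μ := volume)
    have ρi := hρc.integrable_of_hasCompactSupport hρs (μ := volume)
    have χ0 : prim χ b = 0 := by
      have e1 : prim χ b = ∫ t in Ioi 0, χ t := (setIntegral_Ioi_eq (a0.le.trans ab) hr).symm
      have e2 : ∫ t in Ioi 0, χ t = ∫ t, χ t := by
        simpa using hIoi (f := fun _ => 1) χt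
      rw [e1, e2]
      simp only [χ]
      rw [integral_sub gi (ρi.const_mul m), integral_const_mul, hρ1, mul_one, sub_self]
    have key := hw.integral_sub_potInt hm h4 hz χc a0 ab hl hr χ0
    rw [hIoi χt, hIoi χt] at key
    have k1 : ∫ t, p t * χ t = (∫ t, p t * g t) - m * ∫ t, p t * ρ t := by
      rw [← integral_const_mul, ← integral_sub (hpi hgc hgs) ((hpi hρc hρs).const_mul m)]
      exact integral_congr_ae (ae_of_all _ fun t => by simp only [χ]; ring)
    have k2 : ∫ t, potInt p t * χ t
        = (∫ t, potInt p t * g t) - m * ∫ t, potInt p t * ρ t := by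
      rw [← integral_const_mul, ← integral_sub (hqi hgc hgs) ((hqi hρc hρs).const_mul m)]
      exact integral_congr_ae (ae_of_all _ fun t => by simp only [χ]; ring)
    have k3 : ∫ t, g t • (p t - (potInt p t + c))
        = (∫ t, p t * g t) - (∫ t, potInt p t * g t) - c * m := by
      have hi : Integrable fun t => p t * g t - potInt p t * g t :=
        (hpi hgc hgs).sub (hqi hgc hgs)
      rw [hmdef, ← integral_const_mul, ← integral_sub (hpi hgc hgs) (hqi hgc hgs),
        ← integral_sub hi (gi.const_mul c)]
      exact integral_congr_ae (ae_of_all _ fun t => by simp only [smul_eq_mul]; ring)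
    rw [k3, hcdef]
    rw [k1, k2] at key
    linear_combination key
  filter_upwards [hz] with t ht h't
  linarith [ht h't]

end

lemma eq_zero_of_eq_zero_left {y z : ℝ → ℝ} (hy : ∀ t, 0 < t → HasDerivAt y (z t) t)
    (hz : ∀ t, 0 < t → HasDerivAt z (-(z t) / t + y t - y t ^ 3) t) {t₀ t : ℝ}
    (h0 : 0 < t₀) (htt : t₀ ≤ t) (hy0 : y t₀ = 0) (hz0 : z t₀ = 0) : y t = 0 := by
  have hpos : ∀ s ∈ Icc t₀ t, 0 < s := fun s hs => h0.trans_le hs.1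
  have hc : ContinuousOn y (Icc t₀ t) := fun s hs =>
    (hy s (hpos s hs)).continuousAt.continuousWithinAt
  obtain ⟨K, hK⟩ := isCompact_Icc.exists_bound_of_continuousOn hc
  set L := 2 + K ^ 2 with hL
  have hd : ∀ s ∈ Icc t₀ t, HasDerivAt (fun s => Real.exp (-L * s) * (y s ^ 2 + z s ^ 2))
      (Real.exp (-L * s) * (4 * y s * z s - 2 * y s ^ 3 * z s - 2 * (z s ^ 2 / s)
        - L * (y s ^ 2 + z s ^ 2))) s := fun s hs => by
    have hs0 := (hpos s hs).ne'
    have e := ((hasDerivAt_id s).const_mul (-L)).exp.mul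
      (((hy s (hpos s hs)).pow 2).add ((hz s (hpos s hs)).pow 2))
    refine e.congr_deriv ?_
    simp only [id, Nat.cast_ofNat, Nat.add_one_sub_one, pow_one, mul_one, Pi.add_apply,
      Pi.pow_apply]
    field_simp
    ring
  have hm : AntitoneOn (fun s => Real.exp (-L * s) * (y s ^ 2 + z s ^ 2)) (Icc t₀ t) := by
    refine antitoneOn_of_deriv_nonpos (convex_Icc _ _)
      (fun s hs => (hd s hs).continuousAt.continuousWithinAt) (fun s hs => ?_) fun s hs => ?_
    · exact (hd s (interior_subset hs)).differentiableAt.differentiableWithinAt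
    · have hs' := interior_subset hs
      rw [(hd s hs').deriv]
      refine mul_nonpos_of_nonneg_of_nonpos (Real.exp_pos _).le ?_
      have hk : y s ^ 2 ≤ K ^ 2 := by
        have := hK s hs'
        rw [Real.norm_eq_abs] at this
        rw [← sq_abs]; gcongr
      have hq : 0 ≤ z s ^ 2 / s := div_nonneg (sq_nonneg _) (hpos s hs').le
      have h1 := mul_nonneg (sq_nonneg (y s)) (sq_nonneg (y s + z s))
      have h2 := mul_nonneg (sub_nonneg.2 hk) (add_nonneg (sq_nonneg (y s)) (sq_nonneg (z s)))
      have h3 := sq_nonneg (y s - z s)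
      nlinarith
  have h := hm (left_mem_Icc.2 htt) (right_mem_Icc.2 htt) htt
  simp only [hy0, hz0] at h
  have h' : y t ^ 2 + z t ^ 2 ≤ 0 := by
    refine le_of_mul_le_mul_left (h.trans_eq (by simp) : _ ≤ Real.exp (-L * t) * 0)
      (Real.exp_pos _)
  nlinarith [sq_nonneg (y t), sq_nonneg (z t)]

/-- Regularity: a nonnegative nontrivial weak radial solution is a classical one. -/
lemma WeakRadial.exists_radialSol {p : ℝ → ℝ} (hw : WeakRadial p) (hm : AEStronglyMeasurable p)
    (h2 : Integrable fun t => p t ^ 2) (h4 : Integrable fun t => p t ^ 4)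
    (hz : ∀ t ≤ 0, p t = 0) (hnn : ∀ t, 0 ≤ p t) (hne : ¬ ∀ᵐ t, p t = 0) :
    ∃ y z α, RadialSol y z α ∧ ∀ᵐ t, 0 < t → p t = y (√t) := by
  obtain ⟨c, hc⟩ := hw.exists_eq hm h4 hz
  set f : ℝ → ℝ := fun t => potInt p t + c with hf
  have fc : Continuous f := (continuous_potInt hm h4 hz).add continuous_const
  let g : ℝ → ℝ := fun t => ∫ s in (0 : ℝ)..t, (f s - f s ^ 3)
  have hg : ∀ t, HasDerivAt g (f t - f t ^ 3) t := fun t =>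
    have hcc : Continuous fun s => f s - f s ^ 3 := fc.sub (fc.pow 3)
    intervalIntegral.integral_hasDerivAt_right (hcc.intervalIntegrable _ _)
      hcc.stronglyMeasurable.stronglyMeasurableAtFilter hcc.continuousAt
  have hgs : ∀ t, 0 < t → srcInt p t = g t := fun t ht => by
    refine intervalIntegral.integral_congr_ae ?_
    filter_upwards [hc] with s hs h's
    rw [uIoc_of_le ht.le] at h's
    rw [hs h's.1]
  have hfd : ∀ t, 0 < t → HasDerivAt f (g t / (4 * t)) t := fun t ht => by
    rw [← hgs t ht]; exact (hasDerivAt_potInt hm h4 hz ht).add_const c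
  let y : ℝ → ℝ := fun r => f (r ^ 2)
  let z : ℝ → ℝ := fun r => g (r ^ 2) / (2 * r)
  have hsq : ∀ t : ℝ, HasDerivAt (fun r : ℝ => r ^ 2) (2 * t) t := fun t => by
    simpa using hasDerivAt_pow 2 t
  have hy : ∀ t, 0 < t → HasDerivAt y (z t) t := fun t ht =>
    (HasDerivAt.comp t (h₂ := f) (hfd (t ^ 2) (by positivity)) (hsq t)).congr_deriv (by
      have := ht.ne'
      simp only [z]; field_simp; ring)
  have hzd : ∀ t, 0 < t → HasDerivAt z (-(z t) / t + y t - y t ^ 3) t := fun t ht => by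
    have h := ((hg (t ^ 2)).comp t (hsq t)).div ((hasDerivAt_id t).const_mul 2)
      (by simpa using ht.ne')
    refine h.congr_deriv ?_
    have := ht.ne'
    simp only [z, y, id, Function.comp_apply]
    field_simp
    ring
  have hfnn : ∀ t, 0 < t → 0 ≤ f t := by
    by_contra! hcon
    obtain ⟨t, t0, ht⟩ := hcon
    have ho : IsOpen ({s | f s < 0} ∩ Ioi 0) := (isOpen_lt fc continuous_const).inter isOpen_Ioi
    have hpos := ho.measure_pos volume ⟨t, ht, t0⟩
    refine hpos.ne' (measure_mono_null (fun s hs => ?_) (ae_iff.1 hc))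
    intro hs'
    exact absurd (hs' hs.2 ▸ hnn s) (not_le.2 hs.1)
  have hi : IntegrableOn (fun t => t * y t ^ 2) (Ioi 0) := by
    have h := (integrableOn_Ioi_comp_rpow_iff' (fun t => f t ^ 2) (two_ne_zero (α := ℝ))).2
      (h2.integrableOn.congr_fun_ae
        ((ae_restrict_iff' measurableSet_Ioi).2 (hc.mono fun t ht h't => by
          simp only [hf, ht h't])))
    refine h.congr_fun (fun t ht => ?_) measurableSet_Ioi
    norm_num [y]
  have hpos : ∀ t, 0 < t → 0 < y t := by
    intro t₀ ht₀
    refine lt_of_le_of_ne (hfnn _ (by positivity)) fun h0 => hne ?_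
    have hz0 : z t₀ = 0 := by
      refine IsLocalMin.hasDerivAt_eq_zero (f := y) ?_ (hy t₀ ht₀)
      filter_upwards [lt_mem_nhds ht₀] with s hs
      rw [← h0]; exact hfnn _ (by positivity)
    have hy0 : ∀ t, 0 < t → y t = 0 := by
      intro t ht
      rcases le_total t t₀ with h | h
      · exact RadialSol.eq_of_eq_right (y₂ := fun _ => 0) (z₂ := fun _ => 0) hy hzd
          (fun s _ => hasDerivAt_const _ _)
          (fun s _ => (hasDerivAt_const _ _).congr_deriv (by simp)) ht h h0.symm hz0
      · exact eq_zero_of_eq_zero_left hy hzd ht₀ h h0.symm hz0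
    filter_upwards [hc] with t ht
    rcases le_or_gt t 0 with h | h
    · exact hz t h
    · have := hy0 (√t) (Real.sqrt_pos.2 h)
      simp only [y, Real.sq_sqrt h.le] at this
      rw [ht h]; exact this
  refine ⟨y, z, f 0, ⟨hy, hzd, hpos, ?_, ?_, hi⟩, ?_⟩
  · have h1 : Tendsto (fun s => g s / s) (𝓝[≠] 0) (𝓝 (f 0 - f 0 ^ 3)) := by
      have := hasDerivAt_iff_tendsto_slope.1 (hg 0)
      refine this.congr fun s => ?_
      simp [slope_def_field, g]
    have h2 : Tendsto (fun r : ℝ => r ^ 2) (𝓝[>] 0) (𝓝[≠] 0) := by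
      refine tendsto_nhdsWithin_iff.2 ⟨?_, ?_⟩
      · have : Tendsto (fun r : ℝ => r ^ 2) (𝓝 0) (𝓝 (0 ^ 2)) := (continuous_pow 2).tendsto 0
        simpa using this.mono_left nhdsWithin_le_nhds
      · filter_upwards [self_mem_nhdsWithin] with r hr
        exact (pow_pos hr 2).ne'
    have h3 : Tendsto (fun r : ℝ => r / 2) (𝓝[>] 0) (𝓝 0) := by
      have : Tendsto (fun r : ℝ => r / 2) (𝓝 0) (𝓝 (0 / 2)) :=
        (continuous_id.div_const 2).tendsto 0
      simpa using this.mono_left nhdsWithin_le_nhds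
    have h4 := (h1.comp h2).mul h3
    rw [mul_zero] at h4
    refine h4.congr' ?_
    filter_upwards [self_mem_nhdsWithin] with r hr
    have : r ≠ 0 := (mem_Ioi.1 hr).ne'
    simp only [z, Function.comp_apply]
    field_simp
  · have : Tendsto y (𝓝 0) (𝓝 (f (0 ^ 2))) := (fc.comp (continuous_pow 2)).tendsto 0
    simpa using this.mono_left nhdsWithin_le_nhds
  · filter_upwards [hc] with t ht h't
    rw [ht h't]
    simp only [y, Real.sq_sqrt h't.le, hf]

/-- A weak solution of `-Δu + u = u³` on the plane. -/
def WeakSol (P : Plane → ℝ) : Prop := ∀ φ : Plane → ℝ, ContDiff ℝ 2 φ → HasCompactSupport φ →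
  ∫ x, P x * lapR φ x = (∫ x, P x * φ x) - ∫ x, P x ^ 3 * φ x

lemma integrable_cube_mul {P φ : Plane → ℝ} (hP : Measurable P) (hφ : Continuous φ)
    (hc : HasCompactSupport φ) (h4 : Integrable fun x => P x ^ 4) :
    Integrable fun x => P x ^ 3 * φ x := by
  refine (h4.add (integrable_pow_of_hasCompactSupport hφ hc four_ne_zero)).mono'
    ((hP.pow_const 3).mul hφ.measurable).aestronglyMeasurable (ae_of_all _ fun x => ?_)
  simp only [Pi.add_apply]
  generalize P x = s
  generalize φ x = t
  refine abs_le.2 ⟨?_, ?_⟩ <;>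
    nlinarith [sq_nonneg (s ^ 2 + s * t), sq_nonneg (s ^ 2 - s * t), sq_nonneg (s ^ 2 - t ^ 2),
      sq_nonneg (s * t), sq_nonneg (s ^ 2), sq_nonneg (t ^ 2)]

lemma WeakSol.weakRadial {P : Plane → ℝ} {p : ℝ → ℝ} (hw : WeakSol P) (hP : Measurable P)
    (h2 : Integrable fun x => P x ^ 2) (h4 : Integrable fun x => P x ^ 4)
    (he : ∀ᵐ x, P x = p (‖x‖ ^ 2)) : WeakRadial p := by
  intro ψ a b hψ ha hab hl hr h0
  have hc := hasCompactSupport_profile hψ hr h0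
  have hφ : ContDiff ℝ 2 fun x : Plane => profile ψ b (‖x‖ ^ 2) :=
    (contDiff_profile hψ ha hl).comp (contDiff_norm_sq ℝ)
  have h := hw _ hφ hc
  rw [← integral_sub (integrable_mul_of_sq hP hφ.continuous.measurable h2
      (integrable_pow_of_hasCompactSupport hφ.continuous hc two_ne_zero))
      (integrable_cube_mul hP hφ.continuous hc h4)] at h
  have e1 : ∫ x, P x * lapR (fun x : Plane => profile ψ b (‖x‖ ^ 2)) x
      = discArea * ∫ t in Ioi 0, p t * (4 * ψ t) := by
    rw [← integral_radial]
    refine integral_congr_ae (he.mono fun x hx => ?_)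
    simp only [lapR_profile hψ ha hl, hx]
  have e2 : ∫ x, (P x * profile ψ b (‖x‖ ^ 2) - P x ^ 3 * profile ψ b (‖x‖ ^ 2))
      = discArea * ∫ t in Ioi 0, (p t - p t ^ 3) * profile ψ b t := by
    rw [← integral_radial fun t => (p t - p t ^ 3) * profile ψ b t]
    refine integral_congr_ae (he.mono fun x hx => ?_)
    simp only [hx]; ring
  rw [e1, e2] at h
  rw [← mul_left_cancel₀ discArea_pos.ne' h, ← integral_const_mul]
  exact integral_congr_ae (ae_of_all _ fun t => by ring)

lemma WeakSol.exists_radialSol {P : Plane → ℝ} {p : ℝ → ℝ} (hw : WeakSol P) (hP : Measurable P)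
    (h2 : Integrable fun x => P x ^ 2) (h4 : Integrable fun x => P x ^ 4) (hp : Measurable p)
    (hnn : ∀ t, 0 ≤ p t) (he : ∀ᵐ x, P x = p (‖x‖ ^ 2)) (hne : ∫ x, P x ^ 2 ≠ 0) :
    ∃ y z α, RadialSol y z α ∧ ∀ᵐ x : Plane, P x = y ‖x‖ := by
  let q : ℝ → ℝ := fun t => if 0 < t then p t else 0
  have hq : ∀ᵐ x : Plane, P x = q (‖x‖ ^ 2) := by
    filter_upwards [he, ae_radial (p := p) (q := q) (ae_of_all _ fun t ht => by simp [q, ht])]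
      with x h1 h2
    rw [h1, h2]
  have hqm : Measurable q := Measurable.ite measurableSet_Ioi hp measurable_const
  have hqz : ∀ t ≤ 0, q t = 0 := fun t ht => if_neg ht.not_gt
  have h_int : ∀ k : ℕ, k ≠ 0 → (Integrable fun x => P x ^ k) → Integrable fun t => q t ^ k := by
    intro k hk h
    have h' : Integrable fun x : Plane => (fun t => q t ^ k) (‖x‖ ^ 2) :=
      h.congr (hq.mono fun x hx => by simp only [hx])
    refine (integrable_radial_iff.1 h').integrable_of_forall_notMem_eq_zero fun t ht => ?_
    simp [hqz t (not_lt.1 ht), hk]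
  have hne' : ¬ ∀ᵐ t, q t = 0 := by
    intro h0
    have hz := ae_radial (p := q) (q := fun _ => 0) (h0.mono fun t ht _ => ht)
    refine hne ((integral_congr_ae (g := fun _ => (0 : ℝ)) ?_).trans (by simp))
    filter_upwards [hq, hz] with x h1 h2
    simp [h1, h2]
  obtain ⟨y, z, α, hs, hy⟩ := (hw.weakRadial hP h2 h4 hq).exists_radialSol
    hqm.aestronglyMeasurable (h_int 2 two_ne_zero h2) (h_int 4 four_ne_zero h4) hqz
    (fun t => by simp only [q]; split_ifs; exacts [hnn t, le_rfl]) hne'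
  refine ⟨y, z, α, hs, ?_⟩
  filter_upwards [hq, ae_radial (q := fun t => y √t) hy] with x h1 h2
  rw [h1, h2, Real.sqrt_sq (norm_nonneg x)]

lemma setIntegral_closedBall_comp {P : Plane → ℝ} (T : Plane ≃ₗᵢ[ℝ] Plane)
    (h : ∀ᵐ x, P (T x) = P x) (x : Plane) (δ : ℝ) :
    ∫ y in closedBall (T x) δ, P y = ∫ y in closedBall x δ, P y := by
  rw [← T.measurePreserving.setIntegral_preimage_emb T.toHomeomorph.measurableEmbedding,
    T.preimage_closedBall, T.symm_apply_apply]
  exact integral_congr_ae (ae_restrict_of_ae h)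

lemma hrefl_sub {x y : Plane} (h : ‖x‖ = ‖y‖) (hne : x ≠ y) : hrefl (x - y) x = y := by
  have hn : ‖x - y‖ ^ 2 ≠ 0 := by
    have := sub_ne_zero.2 hne
    positivity
  have e : 2 * (inner ℝ (x - y) x / ‖x - y‖ ^ 2) = 1 := by
    have hh : ‖x - y‖ ^ 2 = 2 * inner ℝ (x - y) x := by
      rw [norm_sub_sq_real, inner_sub_left, real_inner_self_eq_norm_sq, real_inner_comm x y, h]
      ring
    rw [← mul_div_assoc, ← hh, div_self hn]
  rw [hrefl_apply, e, one_smul, sub_sub_cancel]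

lemma exists_radial_profile {P : Plane → ℝ} (hP : Measurable P) (hnn : ∀ x, 0 ≤ P x)
    (h2 : Integrable fun x => P x ^ 2)
    (hs : ∀ v : Plane, v ≠ 0 → ∀ᵐ x, P (hrefl v x) = P x) :
    ∃ p : ℝ → ℝ, Measurable p ∧ (∀ t, 0 ≤ p t) ∧ ∀ᵐ x, P x = p (‖x‖ ^ 2) := by
  have hl : LocallyIntegrable P :=
    locallyIntegrable_of_lintegral_sq hP (by rw [lintegral_enorm_sq h2]; exact ENNReal.ofReal_ne_top)
  let δ : ℕ → ℝ := fun n => 1 / ((n : ℝ) + 1)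
  have hδ : Tendsto δ atTop (𝓝[>] 0) := by
    refine tendsto_nhdsWithin_iff.2 ⟨tendsto_one_div_add_atTop_nhds_zero_nat, ?_⟩
    exact Filter.Eventually.of_forall fun n => mem_Ioi.2 (by positivity)
  let T : ℕ → Plane → ℝ := fun n x => ⨍ y in closedBall x (δ n), P y
  have hTm : ∀ n, Measurable (T n) := fun n => by
    have e : T n = fun x => (volume.real (closedBall (0 : Plane) (δ n)))⁻¹ *
        ∫ y, (closedBall x (δ n)).indicator P y := by
      ext x
      simp only [T]
      rw [setAverage_eq, smul_eq_mul, integral_indicator measurableSet_closedBall, Measure.real,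
        Measure.addHaar_closedBall_center, Measure.real]
    rw [e]
    refine measurable_const.mul (StronglyMeasurable.integral_prod_right ?_).measurable
    have hset : MeasurableSet {z : Plane × Plane | dist z.2 z.1 ≤ δ n} :=
      measurableSet_le (by fun_prop) measurable_const
    exact ((hP.comp measurable_snd).indicator hset).stronglyMeasurable
  have hTr : ∀ n x y, ‖x‖ = ‖y‖ → T n x = T n y := fun n x y h => by
    rcases eq_or_ne x y with rfl | hne
    · rfl
    simp only [T]
    rw [setAverage_eq, setAverage_eq, Measure.real, Measure.real,
      Measure.addHaar_closedBall_center, Measure.addHaar_closedBall_center volume y,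
      ← setIntegral_closedBall_comp _ (hs _ (sub_ne_zero.2 hne)) x, hrefl_sub h hne]
  refine ⟨fun t => |limsup (fun n => T n (√t • e0)) atTop|, ?_, fun t => abs_nonneg _, ?_⟩
  · have hme : Measurable fun t : ℝ => √t • e0 := by fun_prop
    exact (Measurable.limsup fun n => (hTm n).comp hme).abs
  · filter_upwards [IsUnifLocDoublingMeasure.ae_tendsto_average volume hl 1] with x hx
    have ht := hx (fun _ => x) δ hδ (Filter.Eventually.of_forall fun n =>
      mem_closedBall_self (by simp only [δ]; positivity))
    have e : (fun n => T n (√(‖x‖ ^ 2) • e0)) = fun n => T n x := funext fun n =>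
      hTr n _ _ (by simp [norm_smul, e0, Real.sqrt_sq])
    rw [e, ht.limsup_eq, abs_of_nonneg (hnn x)]

/-- The symmetric minimizer is a radial solution. -/
lemma IsOpt.exists_radialSol {A : ℝ} {P : Plane → ℝ} (hGN : GNIneq (ENNReal.ofReal A)) (hA : 0 < A)
    (h : IsOpt A P) (hs : ∀ v : Plane, v ≠ 0 → ∀ᵐ x, P (hrefl v x) = P x) :
    ∃ y z α, RadialSol y z α ∧ ∀ᵐ x : Plane, P x = y ‖x‖ := by
  obtain ⟨p, hp, hp0, he⟩ := exists_radial_profile h.meas h.nonneg h.integrable_sq hs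
  refine WeakSol.exists_radialSol (fun φ hφ hc => h.weak hGN hA hφ hc) h.meas h.integrable_sq
    h.integrable_four hp hp0 he fun h0 => ?_
  have := h.mass
  rw [lintegral_enorm_sq h.integrable_sq, h0, ENNReal.ofReal_zero] at this
  exact (ENNReal.ofReal_pos.2 hA).ne this

lemma integral_d0R_mul_d0R {F φ : Plane → ℝ} (hF : ContDiff ℝ 2 F) (hφ : ContDiff ℝ 1 φ)
    (hc : HasCompactSupport φ) :
    ∫ x, d0R F x * d0R φ x = -∫ x, d0R (d0R F) x * φ x :=
  integral_mul_fderiv_eq_neg_fderiv_mul_of_integrable (v := e0)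
    (((continuous_d0R (contDiff_d0R hF)).mul hφ.continuous).integrable_of_hasCompactSupport
      hc.mul_left)
    (((continuous_d0R (hF.of_le one_le_two)).mul
      (continuous_d0R hφ)).integrable_of_hasCompactSupport (hasCompactSupport_d0R hc).mul_left)
    (((continuous_d0R (hF.of_le one_le_two)).mul hφ.continuous).integrable_of_hasCompactSupport
      hc.mul_left)
    (fun x _ => (contDiff_d0R hF).differentiable one_ne_zero x)
    (fun x _ => hφ.differentiable one_ne_zero x)

lemma integral_d1R_mul_d1R {F φ : Plane → ℝ} (hF : ContDiff ℝ 2 F) (hφ : ContDiff ℝ 1 φ)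
    (hc : HasCompactSupport φ) :
    ∫ x, d1R F x * d1R φ x = -∫ x, d1R (d1R F) x * φ x :=
  integral_mul_fderiv_eq_neg_fderiv_mul_of_integrable (v := e1)
    (((continuous_d1R (contDiff_d1R hF)).mul hφ.continuous).integrable_of_hasCompactSupport
      hc.mul_left)
    (((continuous_d1R (hF.of_le one_le_two)).mul
      (continuous_d1R hφ)).integrable_of_hasCompactSupport (hasCompactSupport_d1R hc).mul_left)
    (((continuous_d1R (hF.of_le one_le_two)).mul hφ.continuous).integrable_of_hasCompactSupport
      hc.mul_left)
    (fun x _ => (contDiff_d1R hF).differentiable one_ne_zero x)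
    (fun x _ => hφ.differentiable one_ne_zero x)

lemma integral_mul_lapR {F φ : Plane → ℝ} (hF : ContDiff ℝ 2 F) (hφ : ContDiff ℝ 2 φ)
    (hc : HasCompactSupport φ) : ∫ x, F x * lapR φ x = ∫ x, lapR F x * φ x := by
  have hφ1 : ContDiff ℝ 1 φ := hφ.of_le one_le_two
  have hF1 : ContDiff ℝ 1 F := hF.of_le one_le_two
  have i0 : Integrable fun x => d0R F x * d0R φ x :=
    ((continuous_d0R hF1).mul (continuous_d0R hφ1)).integrable_of_hasCompactSupport
      (hasCompactSupport_d0R hc).mul_left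
  have i1 : Integrable fun x => d1R F x * d1R φ x :=
    ((continuous_d1R hF1).mul (continuous_d1R hφ1)).integrable_of_hasCompactSupport
      (hasCompactSupport_d1R hc).mul_left
  have j0 : Integrable fun x => d0R (d0R F) x * φ x :=
    ((continuous_d0R (contDiff_d0R hF)).mul hφ.continuous).integrable_of_hasCompactSupport
      hc.mul_left
  have j1 : Integrable fun x => d1R (d1R F) x * φ x :=
    ((continuous_d1R (contDiff_d1R hF)).mul hφ.continuous).integrable_of_hasCompactSupport
      hc.mul_left
  have e1 := integral_grad_mul_grad hF1 hφ hc
  rw [integral_add i0 i1, integral_d0R_mul_d0R hF hφ1 hc, integral_d1R_mul_d1R hF hφ1 hc,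
    ← neg_add, neg_inj, ← integral_add j0 j1] at e1
  rw [← e1]
  exact integral_congr_ae (ae_of_all _ fun x => (add_mul _ _ _).symm)

lemma IsGroundState.weakSol {Q : Plane → ℝ} (hQ : IsGroundState Q)
    (h4 : Integrable fun x => Q x ^ 4) : WeakSol Q := by
  intro φ hφ hc
  obtain ⟨hQ2, -, -, hi2, -, heq⟩ := hQ
  have hQm : Measurable Q := hQ2.continuous.measurable
  have m1 := integrable_mul_of_sq hQm hφ.continuous.measurable hi2
    (integrable_pow_of_hasCompactSupport hφ.continuous hc two_ne_zero)
  have m2 := integrable_cube_mul hQm hφ.continuous hc h4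
  rw [integral_mul_lapR hQ2 hφ hc, ← integral_sub m1 m2]
  refine integral_congr_ae (ae_of_all _ fun x => ?_)
  have := heq x
  simp only
  linear_combination - φ x * this

namespace RadialSol

variable {y z : ℝ → ℝ} {α : ℝ}

lemma integrableOn_four (h : RadialSol y z α) : IntegrableOn (fun t => t * y t ^ 4) (Ioi 0) := by
  refine (h.int.const_mul (α ^ 2)).mono' ?_ ?_
  · refine ContinuousOn.aestronglyMeasurable (fun t ht => ?_) measurableSet_Ioi
    exact (continuousAt_id.mul ((h.hy t ht).continuousAt.pow 4)).continuousWithinAt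
  · filter_upwards [ae_restrict_mem measurableSet_Ioi] with t ht
    have ht0 : (0 : ℝ) < t := ht
    have h1 := h.pos t ht
    have h2 := h.lt_top ht
    rw [Real.norm_eq_abs, abs_of_nonneg (by positivity)]
    have h3 : y t ^ 2 ≤ α ^ 2 := by gcongr
    calc t * y t ^ 4 = y t ^ 2 * (t * y t ^ 2) := by ring
      _ ≤ α ^ 2 * (t * y t ^ 2) := by gcongr

lemma tendsto_id_zero : Tendsto (fun t : ℝ => t) (𝓝[>] 0) (𝓝 0) :=
  tendsto_nhdsWithin_of_tendsto_nhds tendsto_id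

lemma integral_four (h : RadialSol y z α) :
    ∫ t in Ioi 0, t * y t ^ 4 = 2 * ∫ t in Ioi 0, t * y t ^ 2 := by
  have hd : ∀ t ∈ Ioi (0 : ℝ), HasDerivAt
      (fun t => t ^ 2 * (z t ^ 2 / 2 + (y t ^ 4 / 4 - y t ^ 2 / 2)))
      (1 / 2 * (t * y t ^ 4) - t * y t ^ 2) t := fun t ht => by
    refine (((hasDerivAt_id t).pow 2).mul (h.hasDerivAt_energy t ht)).congr_deriv ?_
    have : t ≠ 0 := ne_of_gt ht
    simp
    field_simp
    ring
  have h0 : Tendsto (fun t => t ^ 2 * (z t ^ 2 / 2 + (y t ^ 4 / 4 - y t ^ 2 / 2))) (𝓝[>] 0)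
      (𝓝 0) := by
    have := (tendsto_id_zero.pow 2).mul (((h.z_zero.pow 2).div_const 2).add
      (((h.y_zero.pow 4).div_const 4).sub ((h.y_zero.pow 2).div_const 2)))
    simpa using this
  have h1 : Tendsto (fun t => t ^ 2 * (z t ^ 2 / 2 + (y t ^ 4 / 4 - y t ^ 2 / 2))) atTop
      (𝓝 0) := by
    have := ((h.mul_z_top.pow 2).div_const 2).add
      ((((h.mul_y_top.pow 2).mul (h.y_top.pow 2)).div_const 4).sub
        ((h.mul_y_top.pow 2).div_const 2))
    simp only [ne_eq, OfNat.ofNat_ne_zero, not_false_eq_true, zero_pow, zero_div, mul_zero,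
      sub_zero, add_zero] at this
    exact this.congr fun t => by ring
  have i1 : IntegrableOn (fun t => 1 / 2 * (t * y t ^ 4)) (Ioi 0) :=
    h.integrableOn_four.const_mul _
  have key := integral_Ioi_of_hasDerivAt_of_tendsto (a := (0 : ℝ))
    (continuousWithinAt_Ioi_iff_Ici.1 (by simpa [ContinuousWithinAt] using h0)) hd
    (i1.sub h.int) h1
  rw [integral_sub i1 h.int, integral_const_mul] at key
  simp at key
  linarith

lemma integral_deriv_sq (h : RadialSol y z α) (hz : IntegrableOn (fun t => t * z t ^ 2) (Ioi 0)) :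
    ∫ t in Ioi 0, t * z t ^ 2 = ∫ t in Ioi 0, t * y t ^ 2 := by
  have hd : ∀ t ∈ Ioi (0 : ℝ), HasDerivAt (fun t => t * z t * y t)
      (t * z t ^ 2 + (t * y t ^ 2 - t * y t ^ 4)) t := fun t ht => by
    refine ((h.hasDerivAt_mul t ht).mul (h.hy t ht)).congr_deriv ?_
    ring
  have h0 : Tendsto (fun t => t * z t * y t) (𝓝[>] 0) (𝓝 0) := by
    simpa using (tendsto_id_zero.mul h.z_zero).mul h.y_zero
  have h1 : Tendsto (fun t => t * z t * y t) atTop (𝓝 0) := by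
    simpa using h.mul_z_top.mul h.y_top
  have i1 : IntegrableOn (fun t => t * y t ^ 2 - t * y t ^ 4) (Ioi 0) :=
    h.int.sub h.integrableOn_four
  have key := integral_Ioi_of_hasDerivAt_of_tendsto (a := (0 : ℝ))
    (continuousWithinAt_Ioi_iff_Ici.1 (by simpa [ContinuousWithinAt] using h0)) hd
    (hz.add i1) h1
  rw [integral_add hz i1, integral_sub h.int h.integrableOn_four, h.integral_four] at key
  simp at key
  linarith

end RadialSol

lemma integral_comp_norm_plane (f : ℝ → ℝ) :
    ∫ x : Plane, f ‖x‖ = 2 * (volume.real (ball (0 : Plane) 1) * ∫ t in Ioi 0, t * f t) := by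
  have := integral_fun_norm_addHaar (E := Plane) volume f
  rw [finrank_plane] at this
  simpa using this

lemma integrable_comp_norm_plane {f : ℝ → ℝ} :
    Integrable (fun x : Plane => f ‖x‖) ↔ IntegrableOn (fun t => t * f t) (Ioi 0) := by
  have := integrable_fun_norm_addHaar (E := Plane) volume (f := f)
  rw [finrank_plane] at this
  simpa using this

lemma hasFDerivAt_comp_norm {y : ℝ → ℝ} {c : ℝ} {x : Plane} (hx : x ≠ 0)
    (hy : HasDerivAt y c ‖x‖) :
    HasFDerivAt (fun x : Plane => y ‖x‖) ((c / ‖x‖) • innerSL ℝ x) x := by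
  have hn : 0 < ‖x‖ := norm_pos_iff.2 hx
  have hs : Real.sqrt (‖x‖ ^ 2) = ‖x‖ := Real.sqrt_sq hn.le
  have h1 : HasDerivAt (fun s => y (Real.sqrt s)) (c * (1 / (2 * ‖x‖))) (‖x‖ ^ 2) := by
    have h2 := Real.hasDerivAt_sqrt (pow_pos hn 2).ne'
    rw [hs] at h2
    exact HasDerivAt.comp (h₂ := y) (h := Real.sqrt) _ (by rwa [hs]) h2
  have h3 := hasFDerivAt_comp_norm_sq h1
  refine (h3.congr_of_eventuallyEq (Eventually.of_forall fun v => ?_)).congr_fderiv ?_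
  · simp [Real.sqrt_sq (norm_nonneg v)]
  · ext v
    simp
    field_simp

lemma gradSqR_comp_norm {Q : Plane → ℝ} {y : ℝ → ℝ} {c : ℝ} {x : Plane} (hx : x ≠ 0)
    (hQ : ∀ v ≠ 0, Q v = y ‖v‖) (hy : HasDerivAt y c ‖x‖) : gradSqR Q x = c ^ 2 := by
  have hn : 0 < ‖x‖ := norm_pos_iff.2 hx
  have h1 : HasFDerivAt Q ((c / ‖x‖) • innerSL ℝ x) x :=
    (hasFDerivAt_comp_norm hx hy).congr_of_eventuallyEq <| by
      filter_upwards [isOpen_ne.mem_nhds hx] with v hv using hQ v hv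
  have h2 := norm_sq_plane x
  simp only [gradSqR, d0R, d1R, h1.fderiv]
  simp [e0, e1, EuclideanSpace.inner_single_right]
  field_simp
  rw [h2]

namespace IsGroundState

variable {Q : Plane → ℝ}

lemma integral_sq_pos (hQ : IsGroundState Q) : 0 < ∫ x, Q x ^ 2 := by
  obtain ⟨hc, hpos, -, hi, -, -⟩ := hQ
  refine (integral_pos_iff_support_of_nonneg (fun x => sq_nonneg _) hi).2 ?_
  have : Function.support (fun x => Q x ^ 2) = univ :=
    Set.eq_univ_of_forall fun x => (pow_pos (hpos x) 2).ne'
  rw [this]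
  simp

lemma integrable_gradSqR (hQ : IsGroundState Q) : Integrable (gradSqR Q) := by
  obtain ⟨hc, -, -, -, hi, -⟩ := hQ
  refine (hi.const_mul 2).mono' (continuous_gradSqR (hc.of_le one_le_two)).aestronglyMeasurable
    (ae_of_all _ fun x => ?_)
  have h0 : ‖d0R Q x‖ ≤ ‖fderiv ℝ Q x‖ * ‖e0‖ := (fderiv ℝ Q x).le_opNorm e0
  have h1 : ‖d1R Q x‖ ≤ ‖fderiv ℝ Q x‖ * ‖e1‖ := (fderiv ℝ Q x).le_opNorm e1
  have n0 : ‖e0‖ = 1 := by simp [e0]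
  have n1 : ‖e1‖ = 1 := by simp [e1]
  rw [n0, mul_one, Real.norm_eq_abs] at h0
  rw [n1, mul_one, Real.norm_eq_abs] at h1
  rw [Real.norm_eq_abs, abs_of_nonneg (gradSqR_nonneg Q x), gradSqR, ← sq_abs (d0R Q x),
    ← sq_abs (d1R Q x)]
  have := pow_le_pow_left₀ (abs_nonneg _) h0 2
  have := pow_le_pow_left₀ (abs_nonneg _) h1 2
  linarith

lemma integrable_four (hQ : IsGroundState Q) {A : ℝ} (hA : 0 < A)
    (hGN : GNIneq (ENNReal.ofReal A)) : Integrable fun x => Q x ^ 4 := by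
  have hc : ContDiff ℝ 1 Q := hQ.1.of_le one_le_two
  have hd : dirE Q ≠ ∞ := by
    rw [dirE_eq_ofReal hQ.integrable_gradSqR]; exact ENNReal.ofReal_ne_top
  have h2 : ∫⁻ x, ‖Q x‖ₑ ^ 2 ≠ ∞ := by
    rw [lintegral_enorm_sq hQ.2.2.2.1]; exact ENNReal.ofReal_ne_top
  have key := hGN.of_contDiff ENNReal.ofReal_ne_top hc h2 hd
  have h4 : ∫⁻ x, ‖Q x‖ₑ ^ 4 ≠ ∞ := by
    intro h
    rw [h, ENNReal.mul_top (by simpa using hA), top_le_iff] at key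
    exact absurd key (by finiteness)
  refine ⟨(hc.continuous.pow 4).aestronglyMeasurable, ?_⟩
  simp only [HasFiniteIntegral, enorm_pow]
  exact h4.lt_top

lemma exists_radialSol (hQ : IsGroundState Q) {A : ℝ} (hA : 0 < A)
    (hGN : GNIneq (ENNReal.ofReal A)) :
    ∃ y z α, RadialSol y z α ∧ ∀ x, x ≠ 0 → Q x = y ‖x‖ := by
  have hcont : Continuous Q := hQ.1.continuous
  have hq : Measurable fun t : ℝ => Q (Real.sqrt t • e0) := by
    have : Continuous fun t : ℝ => Q (Real.sqrt t • e0) :=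
      hcont.comp (Real.continuous_sqrt.smul continuous_const)
    exact this.measurable
  have h4 := hQ.integrable_four hA hGN
  obtain ⟨y, z, α, hs, he⟩ := (hQ.weakSol h4).exists_radialSol hcont.measurable hQ.2.2.2.1 h4 hq
    (fun t => (hQ.2.1 _).le) (ae_of_all _ fun x => hQ.2.2.1 _ _ (by
      simp [norm_smul, e0, Real.sqrt_sq (norm_nonneg x)])) hQ.integral_sq_pos.ne'
  refine ⟨y, z, α, hs, ?_⟩
  have hcy : ContinuousOn (fun x : Plane => y ‖x‖) {x | x ≠ 0} := fun x hx =>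
    (ContinuousAt.comp (g := y) (hs.hy _ (norm_pos_iff.2 hx)).continuousAt
      continuous_norm.continuousAt).continuousWithinAt
  intro x hx
  exact Measure.eqOn_open_of_ae_eq (ae_restrict_of_ae he) isOpen_ne hcont.continuousOn hcy hx

lemma integral_four_and_gradSqR (hQ : IsGroundState Q) {A : ℝ} (hA : 0 < A)
    (hGN : GNIneq (ENNReal.ofReal A)) :
    ∫ x, Q x ^ 4 = 2 * ∫ x, Q x ^ 2 ∧ ∫ x, gradSqR Q x = ∫ x, Q x ^ 2 := by
  obtain ⟨y, z, α, hs, he⟩ := hQ.exists_radialSol hA hGN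
  have hne : ∀ᵐ x : Plane, x ≠ 0 := by simp [ae_iff]
  have r2 : ∫ x, Q x ^ 2 = ∫ x : Plane, y ‖x‖ ^ 2 :=
    integral_congr_ae (hne.mono fun x hx => by simp only [he x hx])
  have r4 : ∫ x, Q x ^ 4 = ∫ x : Plane, y ‖x‖ ^ 4 :=
    integral_congr_ae (hne.mono fun x hx => by simp only [he x hx])
  have hg : ∀ x : Plane, x ≠ 0 → gradSqR Q x = z ‖x‖ ^ 2 := fun x hx =>
    gradSqR_comp_norm hx he (hs.hy _ (norm_pos_iff.2 hx))
  have rg : ∫ x, gradSqR Q x = ∫ x : Plane, z ‖x‖ ^ 2 := integral_congr_ae (hne.mono hg)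
  have hz : IntegrableOn (fun t => t * z t ^ 2) (Ioi 0) :=
    (integrable_comp_norm_plane (f := fun t => z t ^ 2)).1
      (hQ.integrable_gradSqR.congr (hne.mono hg))
  rw [r2, r4, rg, integral_comp_norm_plane fun t => y t ^ 2,
    integral_comp_norm_plane fun t => y t ^ 4, integral_comp_norm_plane fun t => z t ^ 2,
    hs.integral_four, hs.integral_deriv_sq hz]
  exact ⟨by ring, rfl⟩

lemma integrable_exp_mul_sq (hQ : IsGroundState Q) {A : ℝ} (hA : 0 < A)
    (hGN : GNIneq (ENNReal.ofReal A)) :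
    Integrable fun x => Real.exp (‖x‖ / 2) * Q x ^ 2 := by
  obtain ⟨y, z, α, hs, he⟩ := hQ.exists_radialSol hA hGN
  obtain ⟨C, T, hC, hT, hdec⟩ := hs.exp_decay
  have hexp : Integrable fun x : Plane => Real.exp (-(‖x‖ / 2)) := by
    refine (integrable_comp_norm_plane (f := fun t => Real.exp (-(t / 2)))).2 ?_
    have := integrableOn_rpow_mul_exp_neg_mul_rpow (s := 1) (p := 1) (b := 1 / 2) (by norm_num)
      one_pos (by norm_num)
    refine this.congr_fun (fun t ht => ?_) measurableSet_Ioi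
    simp only [Real.rpow_one]
    ring_nf
  refine ((hexp.const_mul (C ^ 2)).add (hQ.2.2.2.1.const_mul (Real.exp (T / 2)))).mono' ?_
    (ae_of_all _ fun x => ?_)
  · exact (((Real.continuous_exp.comp (continuous_norm.div_const 2)).mul
      (hQ.1.continuous.pow 2))).aestronglyMeasurable
  · rw [Real.norm_eq_abs, abs_of_nonneg (by positivity)]
    simp only [Pi.add_apply]
    rcases le_total T ‖x‖ with h | h
    · have hx : x ≠ 0 := norm_pos_iff.1 (by linarith)
      have h1 : Q x ≤ C * Real.exp (-‖x‖ / 2) := by rw [he x hx]; exact (hdec _ h).1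
      have h2 : Q x ^ 2 ≤ (C * Real.exp (-‖x‖ / 2)) ^ 2 := pow_le_pow_left₀ (hQ.2.1 x).le h1 2
      have h3 : Real.exp (‖x‖ / 2) * Real.exp (-‖x‖ / 2) ^ 2 = Real.exp (-(‖x‖ / 2)) := by
        rw [← Real.exp_nat_mul, ← Real.exp_add]
        congr 1
        push_cast
        ring
      calc Real.exp (‖x‖ / 2) * Q x ^ 2
          ≤ Real.exp (‖x‖ / 2) * (C * Real.exp (-‖x‖ / 2)) ^ 2 := by gcongr
        _ = C ^ 2 * Real.exp (-(‖x‖ / 2)) := by rw [mul_pow, ← h3]; ring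
        _ ≤ _ := le_add_of_nonneg_right (by positivity)
    · have : Real.exp (‖x‖ / 2) ≤ Real.exp (T / 2) := Real.exp_le_exp.2 (by linarith)
      calc Real.exp (‖x‖ / 2) * Q x ^ 2 ≤ Real.exp (T / 2) * Q x ^ 2 := by gcongr
        _ ≤ _ := le_add_of_nonneg_left (by positivity)

lemma integrable_weight_mul_sq (hQ : IsGroundState Q) {A : ℝ} (hA : 0 < A)
    (hGN : GNIneq (ENNReal.ofReal A)) : Integrable fun x => (1 + ‖x‖ ^ 2) * Q x ^ 2 := by
  refine ((hQ.integrable_exp_mul_sq hA hGN).const_mul 9).mono' ?_ (ae_of_all _ fun x => ?_)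
  · exact ((continuous_const.add (continuous_norm.pow 2)).mul
      (hQ.1.continuous.pow 2)).aestronglyMeasurable
  · rw [Real.norm_eq_abs, abs_of_nonneg (by positivity), ← mul_assoc]
    have := Real.quadratic_le_exp_of_nonneg (x := ‖x‖ / 2) (by positivity)
    gcongr
    nlinarith [norm_nonneg x]

lemma energyLE (hQ : IsGroundState Q) : EnergyLE Q (ENNReal.ofReal (∫ x, gradSqR Q x)) := by
  have hd : Differentiable ℝ Q := hQ.1.differentiable two_ne_zero
  have h := energyLE_norm 0 (u := fun x => (Q x : ℂ)) (Complex.ofRealCLM.differentiable.comp hd)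
  have h1 : (fun x => ‖(Q x : ℂ)‖) = Q := by
    ext x
    simp [abs_of_pos (hQ.2.1 x)]
  rw [h1] at h
  convert h using 1
  rw [← dirE_eq_ofReal hQ.integrable_gradSqR, dirE]
  refine lintegral_congr fun x => ?_
  have a0 : d0 (fun x => (Q x : ℂ)) x = (d0R Q x : ℂ) := d0_ofReal hd x
  have a1 : d1 (fun x => (Q x : ℂ)) x = (d1R Q x : ℂ) := d1_ofReal hd x
  have e : ∀ r : ℝ, ‖(r : ℂ)‖ₑ = ‖r‖ₑ := fun r => by
    rw [← ofReal_norm, ← ofReal_norm, Complex.norm_real]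
  simp [mag0, mag1, a0, a1, e]

lemma isOpt (hQ : IsGroundState Q) {A : ℝ} (hA : A = ∫ x, Q x ^ 2)
    (hGN : GNIneq (ENNReal.ofReal A)) : IsOpt A Q := by
  have hA0 : 0 < A := hA ▸ hQ.integral_sq_pos
  obtain ⟨h4, hg⟩ := hQ.integral_four_and_gradSqR hA0 hGN
  refine ⟨hQ.1.continuous.measurable, fun x => (hQ.2.1 x).le, ?_, ?_, ?_, ?_⟩
  · rw [lintegral_enorm_sq hQ.2.2.2.1, hA]
  · have := hQ.energyLE
    rwa [hg, ← hA] at this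
  · rw [lintegral_enorm_four (hQ.integrable_four hA0 hGN), h4, hA]
  · exact logPos_ne_top_of (hQ.integrable_weight_mul_sq hA0 hGN)

theorem logEn_le (hQ : IsGroundState Q) {A : ℝ} (hA : A = ∫ x, Q x ^ 2)
    (hGN : GNIneq (ENNReal.ofReal A)) {P : Plane → ℝ} (hP : IsOpt A P) : logEn Q ≤ logEn P := by
  have hA0 : 0 < A := hA ▸ hQ.integral_sq_pos
  obtain ⟨P₀, h₀, hmin, hs⟩ := exists_isOpt_min_symm hGN hA0 (hQ.isOpt hA hGN)
  obtain ⟨y, z, α, hy, he⟩ := h₀.exists_radialSol hGN hA0 hs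
  obtain ⟨y', z', α', hy', he'⟩ := hQ.exists_radialSol hA0 hGN
  have hne : ∀ᵐ x : Plane, x ≠ 0 := by simp [ae_iff]
  have hQP : ∀ᵐ x, Q x = P₀ x := by
    filter_upwards [he, hne] with x h1 h2
    rw [h1, he' x h2, hy.unique hy' (norm_pos_iff.2 h2)]
  have : logEn Q = logEn P₀ := by
    refine integral_congr_ae ?_
    have q1 := (Measure.quasiMeasurePreserving_fst (μ := (volume : Measure Plane))
      (ν := (volume : Measure Plane))).ae hQP
    have q2 := (Measure.quasiMeasurePreserving_snd (μ := (volume : Measure Plane))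
      (ν := (volume : Measure Plane))).ae hQP
    filter_upwards [q1, q2] with p h1 h2
    simp only [logDens, h1, h2]
  rw [this]
  exact hmin P hP

end IsGroundState

lemma IsMinimizer.eInf_eq {V : Plane → ℝ} {Ω a : ℝ} {u : Plane → ℂ} (h : IsMinimizer V Ω a u) :
    eInf V Ω a = Ea V Ω u :=
  IsLeast.csInf_eq ⟨mem_image_of_mem _ h.1, by rintro _ ⟨v, hv, rfl⟩; exact h.2 v hv⟩

lemma CondV.tendsto_zero {V : Plane → ℝ} {Ω α : ℝ} (hV : CondV V Ω α) :
    Tendsto V (𝓝 0) (𝓝 0) := by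
  obtain ⟨hα, -, hz, hh, -⟩ := hV
  have h0 := (hz 0).2 rfl
  obtain ⟨C, hC⟩ := hh 1 one_pos
  have hn : Tendsto (fun x : Plane => ‖x‖) (𝓝 0) (𝓝 0) := by
    simpa using (continuous_norm (E := Plane)).tendsto 0
  have hp : Tendsto (fun x : Plane => C * ‖x‖ ^ α) (𝓝 0) (𝓝 0) := by
    have := (hn.rpow_const (p := α) (Or.inr hα.1.le)).const_mul C
    simpa [Real.zero_rpow hα.1.ne'] using this
  have h1 : Tendsto (fun x : Plane => V x - Ω ^ 2 / 4 * ‖x‖ ^ 2) (𝓝 0) (𝓝 0) := by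
    refine squeeze_zero_norm' ?_ hp
    filter_upwards [closedBall_mem_nhds (0 : Plane) one_pos] with x hx
    have := hC x hx 0 (mem_closedBall_self zero_le_one)
    rwa [h0, sub_zero, sub_zero] at this
  have h2 := h1.add ((hn.pow 2).const_mul (Ω ^ 2 / 4))
  simpa using h2

lemma CondV.exists_potential_smul_le {V : Plane → ℝ} {Ω α : ℝ} (hV : CondV V Ω α) :
    ∃ C γ : ℝ, ∀ τ : ℝ, γ ≤ τ → 0 < τ → ∀ x : Plane,
      V (τ⁻¹ • x) ≤ C * Real.exp (‖x‖ / 2) := by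
  obtain ⟨C, γ, hγ, h⟩ := hV.2.2.2.2
  refine ⟨|C|, 2 * γ, fun τ hτ hτ0 x => ?_⟩
  refine (h (τ⁻¹ • x)).trans ?_
  refine mul_le_mul (le_abs_self C) (Real.exp_le_exp.2 ?_) (Real.exp_pos _).le (abs_nonneg C)
  · rw [norm_smul, norm_inv, Real.norm_eq_abs, abs_of_pos hτ0]
    have h1 : γ * τ⁻¹ ≤ 1 / 2 := by
      rw [← div_eq_mul_inv, div_le_iff₀ hτ0]; linarith
    calc γ * (τ⁻¹ * ‖x‖) = γ * τ⁻¹ * ‖x‖ := by ring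
      _ ≤ 1 / 2 * ‖x‖ := by gcongr
      _ = ‖x‖ / 2 := by ring

lemma eventually_integrable_potential {V Q : Plane → ℝ} {Ω α : ℝ} (hV : V110 V)
    (hC : CondV V Ω α) (hQ : Measurable Q)
    (hi : Integrable fun x => Real.exp (‖x‖ / 2) * Q x ^ 2) :
    (∀ᶠ τ : ℝ in atTop, Integrable fun x => V (τ⁻¹ • x) * Q x ^ 2) ∧
      Tendsto (fun τ : ℝ => ∫ x, V (τ⁻¹ • x) * Q x ^ 2) atTop (𝓝 0) := by
  obtain ⟨C, γ, h⟩ := hC.exists_potential_smul_le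
  have hm : ∀ τ : ℝ, AEStronglyMeasurable (fun x => V (τ⁻¹ • x) * Q x ^ 2) volume := fun τ =>
    ((hV.1.comp (measurable_const_smul τ⁻¹)).mul (hQ.pow_const 2)).aestronglyMeasurable
  have hb : ∀ᶠ τ : ℝ in atTop, ∀ x, ‖V (τ⁻¹ • x) * Q x ^ 2‖ ≤ C * (Real.exp (‖x‖ / 2) * Q x ^ 2) := by
    filter_upwards [eventually_ge_atTop γ, eventually_gt_atTop 0] with τ h1 h2 x
    rw [Real.norm_eq_abs, abs_of_nonneg (mul_nonneg (hV.2.1 _) (sq_nonneg _)), ← mul_assoc]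
    exact mul_le_mul_of_nonneg_right (h τ h1 h2 x) (sq_nonneg _)
  refine ⟨hb.mono fun τ hτ => (hi.const_mul C).mono' (hm τ) (ae_of_all _ hτ), ?_⟩
  have key := tendsto_integral_filter_of_dominated_convergence (μ := volume) (l := atTop)
    (F := fun (τ : ℝ) x => V (τ⁻¹ • x) * Q x ^ 2) (f := fun _ => (0 : ℝ))
    (fun x => C * (Real.exp (‖x‖ / 2) * Q x ^ 2)) (Eventually.of_forall hm)
    (hb.mono fun τ hτ => ae_of_all _ hτ) (hi.const_mul C) (ae_of_all _ fun x => by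
      have h1 : Tendsto (fun τ : ℝ => τ⁻¹ • x) atTop (𝓝 0) := by
        have h0 : Tendsto (fun τ : ℝ => τ⁻¹) atTop (𝓝 0) := tendsto_inv_atTop_zero
        simpa using h0.smul_const x
      simpa using (hC.tendsto_zero.comp h1).mul_const (Q x ^ 2))
  simpa using key

/-- The energy of the rescaled ground state with the optimal scale. -/
lemma IsGroundState.eInf_le {V Q : Plane → ℝ} {Ω A a τ : ℝ} (hQ : IsGroundState Q)
    (hA : A = ∫ x, Q x ^ 2) (hGN : GNIneq (ENNReal.ofReal A)) {u : Plane → ℂ}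
    (ha : a ∈ Ioo 0 A) (hu : IsMinimizer V Ω a u) (hτ : 0 < τ)
    (hτ2 : τ ^ 2 = a * A / (4 * (A - a)))
    (hVi : Integrable fun x => V (τ⁻¹ • x) * Q x ^ 2) :
    eInf V Ω a ≤ a ^ 2 / 4 + a / A * (∫ x, V (τ⁻¹ • x) * Q x ^ 2)
      + a ^ 2 / (2 * A ^ 2) * logEn Q - a ^ 2 / 4 * Real.log (a * A)
      + a ^ 2 / 4 * Real.log (4 * (A - a)) := by
  have hA0 : 0 < A := ha.1.trans ha.2
  have hδ : 0 < A - a := sub_pos.2 ha.2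
  obtain ⟨h4, hg⟩ := hQ.integral_four_and_gradSqR hA0 hGN
  have hL := integrable_logDens_of hQ.1.continuous.measurable hQ.2.2.2.1
    (hQ.integrable_four hA0 hGN) (hQ.integrable_weight_mul_sq hA0 hGN)
  obtain ⟨hmem, hE⟩ := Ea_trial (V := V) (Ω := Ω) (c := Real.sqrt (a / A)) hτ
    (hQ.1.differentiable two_ne_zero) hQ.2.2.2.1 hQ.integrable_gradSqR hVi hL
  have hc : Real.sqrt (a / A) ^ 2 = a / A := Real.sq_sqrt (div_pos ha.1 hA0).le
  have hc4 : Real.sqrt (a / A) ^ 4 = (a / A) ^ 2 := by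
    rw [show Real.sqrt (a / A) ^ 4 = (Real.sqrt (a / A) ^ 2) ^ 2 by ring, hc]
  have hlog : 2 * Real.log τ = Real.log (a * A) - Real.log (4 * (A - a)) := by
    rw [← Real.log_div (mul_pos ha.1 hA0).ne' (by positivity), ← hτ2, Real.log_pow]
    norm_num
  have hmass : Real.sqrt (a / A) ^ 2 * ∫ x, Q x ^ 2 = a := by
    rw [hc, ← hA, div_mul_cancel₀ _ hA0.ne']
  rw [hmass] at hmem
  rw [hu.eInf_eq]
  refine (hu.2 _ hmem).trans (le_of_eq ?_)
  rw [hE, hc, hc4, h4, hg, ← hA, hτ2]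
  have : Real.log τ = (Real.log (a * A) - Real.log (4 * (A - a))) / 2 := by linarith
  rw [this]
  field_simp
  ring

/-- The pointwise expansion of the magnetic kinetic energy. -/
lemma norm_mag_sq (κ : ℝ) (u : Plane → ℂ) (x : Plane) :
    ‖mag0 κ u x‖ ^ 2 + ‖mag1 κ u x‖ ^ 2
      = gradSq u x - 2 * κ * momentum u x + κ ^ 2 * ‖x‖ ^ 2 * ‖u x‖ ^ 2 := by
  rw [norm_sq_plane]
  simp only [mag0, mag1, gradSq, momentum, ← Complex.normSq_eq_norm_sq, Complex.normSq_apply]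
  simp
  ring

lemma Sset.integrable_weight {V : Plane → ℝ} {Ω α a : ℝ} {u : Plane → ℂ} (hΩ : 0 < Ω)
    (hC : CondV V Ω α) (hu : u ∈ Sset V a) : Integrable fun x => ‖x‖ ^ 2 * ‖u x‖ ^ 2 := by
  obtain ⟨⟨⟨hd, -, -⟩, hi⟩, -⟩ := hu
  refine (hi.const_mul (4 / Ω ^ 2)).mono' ?_ (ae_of_all _ fun x => ?_)
  · exact ((continuous_norm.pow 2).mul (hd.continuous.norm.pow 2)).aestronglyMeasurable
  · rw [Real.norm_eq_abs, abs_of_nonneg (by positivity), ← mul_assoc]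
    refine mul_le_mul_of_nonneg_right ?_ (sq_nonneg _)
    have := hC.2.1 x
    rw [div_mul_eq_mul_div, le_div_iff₀ (by positivity)]
    nlinarith

lemma Sset.integrable_mag {V : Plane → ℝ} {Ω α a : ℝ} {u : Plane → ℂ} (hΩ : 0 < Ω)
    (hC : CondV V Ω α) (hu : u ∈ Sset V a) (κ : ℝ) :
    Integrable fun x => ‖mag0 κ u x‖ ^ 2 + ‖mag1 κ u x‖ ^ 2 := by
  have hw := Sset.integrable_weight hΩ hC hu
  obtain ⟨⟨⟨hd, -, hg⟩, hi⟩, -⟩ := hu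
  refine ((hg.const_mul 2).add (hw.const_mul (2 * κ ^ 2))).mono' ?_ (ae_of_all _ fun x => ?_)
  · exact (((measurable_mag0 κ hd).norm.pow_const 2).add
      ((measurable_mag1 κ hd).norm.pow_const 2)).aestronglyMeasurable
  · rw [Real.norm_eq_abs, abs_of_nonneg (by positivity)]
    have h0 : ‖mag0 κ u x‖ ≤ ‖d0 u x‖ + |κ| * |x 1| * ‖u x‖ := by
      refine (norm_sub_le _ _).trans (le_of_eq ?_)
      simp
    have h1 : ‖mag1 κ u x‖ ≤ ‖d1 u x‖ + |κ| * |x 0| * ‖u x‖ := by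
      refine (norm_sub_le _ _).trans (le_of_eq ?_)
      simp
    have h2 := pow_le_pow_left₀ (norm_nonneg _) h0 2
    have h3 := pow_le_pow_left₀ (norm_nonneg _) h1 2
    have e0 : (|κ| * |x 1| * ‖u x‖) ^ 2 = κ ^ 2 * x 1 ^ 2 * ‖u x‖ ^ 2 := by
      rw [mul_pow, mul_pow, sq_abs, sq_abs]
    have e1 : (|κ| * |x 0| * ‖u x‖) ^ 2 = κ ^ 2 * x 0 ^ 2 * ‖u x‖ ^ 2 := by
      rw [mul_pow, mul_pow, sq_abs, sq_abs]
    have e2 : κ ^ 2 * x 1 ^ 2 * ‖u x‖ ^ 2 + κ ^ 2 * x 0 ^ 2 * ‖u x‖ ^ 2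
        = κ ^ 2 * (‖x‖ ^ 2 * ‖u x‖ ^ 2) := by rw [norm_sq_plane]; ring
    have h4 := add_sq_le (a := ‖d0 u x‖) (b := |κ| * |x 1| * ‖u x‖)
    have h5 := add_sq_le (a := ‖d1 u x‖) (b := |κ| * |x 0| * ‖u x‖)
    simp only [Pi.add_apply, gradSq]
    linarith

lemma Sset.le_energy {V : Plane → ℝ} {Ω α a : ℝ} {u : Plane → ℂ} (hΩ : 0 < Ω)
    (hC : CondV V Ω α) (hu : u ∈ Sset V a) :
    (∫ x, (‖mag0 (Ω / 2) u x‖ ^ 2 + ‖mag1 (Ω / 2) u x‖ ^ 2)) + 1 / 2 * logConv u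
      - 1 / 2 * (∫ x, ‖u x‖ ^ 4) ≤ Ea V Ω u := by
  have hw := Sset.integrable_weight hΩ hC hu
  have hm := Sset.integrable_mag hΩ hC hu (Ω / 2)
  obtain ⟨⟨⟨hd, -, hg⟩, hi⟩, -⟩ := hu
  have hgw : Integrable fun x => gradSq u x + (Ω / 2) ^ 2 * (‖x‖ ^ 2 * ‖u x‖ ^ 2) :=
    hg.add (hw.const_mul _)
  have hmom : Integrable fun x => Ω * momentum u x := by
    refine (hgw.sub hm).congr (ae_of_all _ fun x => ?_)
    simp only [Pi.sub_apply, norm_mag_sq]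
    ring
  have hgv : Integrable fun x => gradSq u x + V x * ‖u x‖ ^ 2 := hg.add hi
  have key : ∫ x, (‖mag0 (Ω / 2) u x‖ ^ 2 + ‖mag1 (Ω / 2) u x‖ ^ 2)
      ≤ (∫ x, (gradSq u x + V x * ‖u x‖ ^ 2)) - Ω * ∫ x, momentum u x := by
    rw [← integral_const_mul, ← integral_sub hgv hmom]
    refine integral_mono hm (hgv.sub hmom) fun x => ?_
    simp only [norm_mag_sq]
    have := mul_nonneg (hC.2.1 x) (sq_nonneg ‖u x‖)
    nlinarith
  unfold Ea
  linarith

lemma lintegral_mag {κ : ℝ} {u : Plane → ℂ}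
    (h : Integrable fun x => ‖mag0 κ u x‖ ^ 2 + ‖mag1 κ u x‖ ^ 2) :
    ∫⁻ x, (‖mag0 κ u x‖ₑ ^ 2 + ‖mag1 κ u x‖ₑ ^ 2)
      = ENNReal.ofReal (∫ x, (‖mag0 κ u x‖ ^ 2 + ‖mag1 κ u x‖ ^ 2)) := by
  rw [ofReal_integral_eq_lintegral_ofReal h (ae_of_all _ fun x => by positivity)]
  refine lintegral_congr fun x => ?_
  rw [ENNReal.ofReal_add (sq_nonneg _) (sq_nonneg _), ENNReal.ofReal_pow (norm_nonneg _),
    ENNReal.ofReal_pow (norm_nonneg _), ofReal_norm, ofReal_norm]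

/-- Minimisation of the scaling parameter. -/
lemma scale_lower_bound {a g s : ℝ} (ha : 0 < a) (hg : 0 < g) (hs : 0 < s) :
    a ^ 2 / 4 - a ^ 2 / 2 * Real.log a + a ^ 2 / 4 * Real.log (4 * g)
      ≤ s ^ 2 * g - a ^ 2 / 2 * Real.log s := by
  have h := Real.log_le_sub_one_of_pos (x := 4 * g * s ^ 2 / a ^ 2) (by positivity)
  rw [Real.log_div (by positivity) (by positivity), Real.log_mul (by positivity) (by positivity),
    Real.log_pow, Real.log_pow] at h
  push_cast at h
  have h2 : a ^ 2 / 4 * (Real.log (4 * g) + 2 * Real.log s - 2 * Real.log a)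
      ≤ a ^ 2 / 4 * (4 * g * s ^ 2 / a ^ 2 - 1) := by gcongr
  have h3 : a ^ 2 / 4 * (4 * g * s ^ 2 / a ^ 2 - 1) = s ^ 2 * g - a ^ 2 / 4 := by
    field_simp
  rw [h3] at h2
  linarith

theorem Sset.exists_profile {V : Plane → ℝ} {Ω α A a : ℝ} {u : Plane → ℂ} (hΩ : 0 < Ω)
    (hC : CondV V Ω α) (hGN : GNIneq (ENNReal.ofReal A)) (ha : a ∈ Ioo 0 A)
    (hu : u ∈ Sset V a) :
    ∃ (w : Plane → ℝ) (c : ℝ), Measurable w ∧ (∀ x, 0 ≤ w x) ∧ EnergyLE w (ENNReal.ofReal A) ∧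
      ∫⁻ x, ‖w x‖ₑ ^ 2 = ENNReal.ofReal a ∧ ∫⁻ x, ‖w x‖ₑ ^ 4 = ENNReal.ofReal c ∧ 0 ≤ c ∧
      c ≤ 2 * a ∧ Integrable (logDens w) ∧
      a ^ 2 / 4 - a ^ 2 / 2 * Real.log a + a ^ 2 / 4 * Real.log (4 * (A - c / 2))
        + 1 / 2 * logEn w ≤ Ea V Ω u := by
  have hA : 0 < A := ha.1.trans ha.2
  have hle := Sset.le_energy hΩ hC hu
  have hw := Sset.integrable_weight hΩ hC hu
  have hm := Sset.integrable_mag hΩ hC hu (Ω / 2)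
  obtain ⟨⟨⟨hd, h2, hg⟩, hi⟩, hmass⟩ := hu
  set f : Plane → ℝ := fun x => ‖u x‖ with hf
  have hfm : Measurable f := hd.continuous.norm.measurable
  set D : ℝ := ∫ x, (‖mag0 (Ω / 2) u x‖ ^ 2 + ‖mag1 (Ω / 2) u x‖ ^ 2) with hD
  have hD0 : 0 ≤ D := integral_nonneg fun x => by positivity
  have hE : EnergyLE f (ENNReal.ofReal D) := by
    have := energyLE_norm (Ω / 2) hd
    rwa [lintegral_mag hm] at this
  have hf2 : ∫⁻ x, ‖f x‖ₑ ^ 2 = ENNReal.ofReal a := by rw [lintegral_enorm_sq h2, hmass]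
  have hGNf := hGN.of_energyLE ENNReal.ofReal_ne_top hfm (by rw [hf2]; finiteness) hE
    ENNReal.ofReal_ne_top
  rw [hf2] at hGNf
  have hf4 : ∫⁻ x, ‖f x‖ₑ ^ 4 ≠ ∞ := by
    intro h
    rw [h, ENNReal.mul_top (by simpa using hA), top_le_iff] at hGNf
    exact absurd hGNf (by finiteness)
  have h4 : Integrable fun x => f x ^ 4 := by
    refine ⟨(hfm.pow_const 4).aestronglyMeasurable, ?_⟩
    simp only [HasFiniteIntegral, enorm_pow]
    exact hf4.lt_top
  have hDpos : 0 < D := by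
    refine hD0.lt_of_ne fun h0 => ?_
    rw [← h0, ENNReal.ofReal_zero, mul_zero, zero_mul, le_zero_iff, mul_eq_zero,
      lintegral_enorm_four h4, ENNReal.ofReal_eq_zero, ENNReal.ofReal_eq_zero] at hGNf
    rcases hGNf with h | h
    · linarith
    · have : ∫ x, f x ^ 2 = 0 := by
        have := (integral_eq_zero_iff_of_nonneg (fun x => by positivity) h4).1
          (le_antisymm h (integral_nonneg fun x => by positivity))
        refine integral_eq_zero_of_ae (this.mono fun x hx => ?_)
        have : f x = 0 := by simpa using hx
        simp [this]
      rw [hmass] at this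
      exact ha.1.ne' this
  have hLf : Integrable (logDens f) := by
    refine integrable_logDens_of hfm h2 h4 ?_
    have : Integrable fun x => f x ^ 2 + ‖x‖ ^ 2 * f x ^ 2 := h2.add hw
    exact this.congr (ae_of_all _ fun x => by simp only; ring)
  set s : ℝ := Real.sqrt (A / D) with hs
  have hs0 : 0 < s := Real.sqrt_pos.2 (div_pos hA hDpos)
  have hs2 : s ^ 2 = A / D := Real.sq_sqrt (div_pos hA hDpos).le
  have hsD : s ^ 2 * D = A := by rw [hs2, div_mul_cancel₀ _ hDpos.ne']
  set w : Plane → ℝ := fun x => s * f (s • x) with hwdef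
  have hwm : Measurable w := (hfm.comp (measurable_const_smul s)).const_mul s
  have w2 : ∫ x, w x ^ 2 = a := by
    simp only [hwdef, mul_pow]
    rw [integral_const_mul, integral_comp_smul_plane (fun x => f x ^ 2) s, hmass]
    field_simp
  have iw2 : Integrable fun x => w x ^ 2 := by
    simp only [hwdef, mul_pow]
    exact (h2.comp_smul hs0.ne').const_mul _
  have w4 : ∫ x, w x ^ 4 = s ^ 2 * ∫ x, f x ^ 4 := by
    simp only [hwdef, mul_pow]
    rw [integral_const_mul, integral_comp_smul_plane (fun x => f x ^ 4) s]
    field_simp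
  have iw4 : Integrable fun x => w x ^ 4 := by
    simp only [hwdef, mul_pow]
    exact (h4.comp_smul hs0.ne').const_mul _
  have hwE : EnergyLE w (ENNReal.ofReal A) := by
    have := (hE.comp_smul hs0).const_mul s
    rwa [← ofReal_sq_eq_enorm, ← ENNReal.ofReal_mul (sq_nonneg s), hsD] at this
  have hc0 : 0 ≤ ∫ x, w x ^ 4 := integral_nonneg fun x => by positivity
  have hGNw := hGN.of_energyLE ENNReal.ofReal_ne_top hwm
    (by rw [lintegral_enorm_sq iw2]; finiteness) hwE ENNReal.ofReal_ne_top
  rw [lintegral_enorm_sq iw2, lintegral_enorm_four iw4, w2, ← ENNReal.ofReal_mul hA.le,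
    show ∀ b c : ℝ≥0∞, 2 * b * c = ENNReal.ofReal 2 * b * c by simp,
    ← ENNReal.ofReal_mul zero_le_two,
    ← ENNReal.ofReal_mul (by positivity),
    ENNReal.ofReal_le_ofReal_iff (mul_nonneg (by positivity) ha.1.le)] at hGNw
  have hc2 : ∫ x, w x ^ 4 ≤ 2 * a := le_of_mul_le_mul_left (by linarith) hA
  obtain ⟨hLw, hLe⟩ := logEn_scale hLf h2 hs0
  refine ⟨w, ∫ x, w x ^ 4, hwm, fun x => mul_nonneg hs0.le (norm_nonneg _), hwE, ?_,
    lintegral_enorm_four iw4, hc0, hc2, hLw, ?_⟩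
  · rw [lintegral_enorm_sq iw2, w2]
  · have hconv : logConv u = logEn f := (logEn_eq_iterated hLf)
    have hgap : 0 < A - (∫ x, w x ^ 4) / 2 := by linarith [ha.2]
    have hmin := scale_lower_bound ha.1 hgap (inv_pos.2 hs0)
    have hinv : s⁻¹ ^ 2 * (A - (∫ x, w x ^ 4) / 2) = D - 1 / 2 * ∫ x, f x ^ 4 := by
      rw [w4, ← hsD]
      field_simp
    rw [hinv, Real.log_inv] at hmin
    have hLe' : logEn w = logEn f - Real.log s * a ^ 2 := by rw [← hmass]; exact hLe
    rw [hLe']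
    rw [hconv] at hle
    linarith

lemma logNeg_toReal_le {w : Plane → ℝ} {A a c : ℝ} (hw : Measurable w) (ha : a ≤ A)
    (hc : c ≤ 2 * A) (h2 : ∫⁻ x, ‖w x‖ₑ ^ 2 = ENNReal.ofReal a)
    (h4 : ∫⁻ x, ‖w x‖ₑ ^ 4 = ENNReal.ofReal c) :
    (logNeg w).toReal
      ≤ ((logSq * ENNReal.ofReal (2 * A)) ^ (1 / 2 : ℝ) * ENNReal.ofReal A).toReal := by
  refine ENNReal.toReal_mono (ENNReal.mul_ne_top (ENNReal.rpow_ne_top_of_nonneg (by norm_num)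
    (ENNReal.mul_ne_top logSq_ne_top ENNReal.ofReal_ne_top)) ENNReal.ofReal_ne_top) ?_
  refine (logNeg_le hw).trans ?_
  rw [h2, h4]
  gcongr

/-- Lower bound: along a sequence approaching the critical mass the energy cannot stay below the
expansion by a fixed amount. -/
lemma not_energy_le_of_tendsto {V Q : Plane → ℝ} {Ω α A ε : ℝ} (hΩ : 0 < Ω) (hC : CondV V Ω α)
    (hQ : IsGroundState Q) (hA : A = ∫ x, Q x ^ 2) (hGN : GNIneq (ENNReal.ofReal A))
    (hε : 0 < ε) {a : ℕ → ℝ} {u : ℕ → Plane → ℂ} (ha : ∀ n, a n ∈ Ioo (A / 2) A)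
    (hlim : Tendsto a atTop (𝓝 A)) (hu : ∀ n, u n ∈ Sset V (a n)) :
    ¬ ∀ n, Ea V Ω (u n) ≤ a n ^ 2 / 4 - a n ^ 2 / 2 * Real.log (a n)
      + a n ^ 2 / 4 * Real.log (4 * (A - a n)) + 1 / 2 * logEn Q - ε := by
  intro hle
  have hA0 : 0 < A := hA ▸ hQ.integral_sq_pos
  have ha' : ∀ n, a n ∈ Ioo 0 A := fun n => ⟨by linarith [(ha n).1], (ha n).2⟩
  choose w c hwm hw0 hwE hw2 hw4 hc0 hc2 hwL hwle using
    fun n => Sset.exists_profile hΩ hC hGN (ha' n) (hu n)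
  have hδ : ∀ n, 0 < A - a n := fun n => sub_pos.2 (ha n).2
  have hgδ : ∀ n, A - a n ≤ A - c n / 2 := fun n => by linarith [hc2 n]
  have hlog : ∀ n, 0 ≤ Real.log (4 * (A - c n / 2)) - Real.log (4 * (A - a n)) := fun n =>
    sub_nonneg.2 (Real.log_le_log (by linarith [hδ n]) (by linarith [hgδ n]))
  have hsum : ∀ n, a n ^ 2 / 4 *
      (Real.log (4 * (A - c n / 2)) - Real.log (4 * (A - a n))) + 1 / 2 * logEn (w n)
        ≤ 1 / 2 * logEn Q - ε := fun n => by linarith [hwle n, hle n]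
  have hLw : ∀ n, logEn (w n) ≤ logEn Q - 2 * ε := fun n => by
    have := mul_nonneg (show 0 ≤ a n ^ 2 / 4 by positivity) (hlog n)
    linarith [hsum n]
  set K := ((logSq * ENNReal.ofReal (2 * A)) ^ (1 / 2 : ℝ) * ENNReal.ofReal A).toReal
  have hK : ∀ n, -K ≤ logEn (w n) := fun n => by
    have h1 := logNeg_toReal_le (hwm n) (ha n).2.le (by linarith [hc2 n, (ha n).2]) (hw2 n) (hw4 n)
    rw [logEn_eq (hwL n)]
    linarith [ENNReal.toReal_nonneg (a := logPos (w n))]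
  obtain ⟨M, hM⟩ : ∃ M : ℝ, ∀ n,
      Real.log (4 * (A - c n / 2)) - Real.log (4 * (A - a n)) ≤ M := by
    refine ⟨16 / A ^ 2 * (1 / 2 * (logEn Q + K)), fun n => ?_⟩
    have h1 : A ^ 2 / 16 ≤ a n ^ 2 / 4 := by nlinarith [(ha n).1]
    have h2 := mul_le_mul_of_nonneg_right h1 (hlog n)
    have h3 : A ^ 2 / 16 * (Real.log (4 * (A - c n / 2)) - Real.log (4 * (A - a n)))
        ≤ 1 / 2 * (logEn Q + K) := by linarith [hsum n, hK n]
    rw [div_mul_eq_mul_div, le_div_iff₀ (by positivity)]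
    linarith
  have hgap : ∀ n, A - c n / 2 ≤ (A - a n) * Real.exp M := fun n => by
    have h1 : 0 < 4 * (A - a n) := by linarith [hδ n]
    have h2 : 0 < 4 * (A - c n / 2) := by linarith [hδ n, hgδ n]
    have h3 : 4 * (A - c n / 2) ≤ Real.exp (M + Real.log (4 * (A - a n))) :=
      (Real.log_le_iff_le_exp h2).1 (by linarith [hM n])
    rw [Real.exp_add, Real.exp_log h1] at h3
    linarith
  have hclim : Tendsto c atTop (𝓝 (2 * A)) := by
    have h1 : Tendsto (fun n => 2 * A - 2 * ((A - a n) * Real.exp M)) atTop (𝓝 (2 * A)) := by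
      have := (((tendsto_const_nhds (x := A)).sub hlim).mul_const (Real.exp M)).const_mul 2
      simpa using (tendsto_const_nhds (x := 2 * A)).sub this
    exact tendsto_of_tendsto_of_tendsto_of_le_of_le h1 tendsto_const_nhds
      (fun n => by linarith [hgap n]) (fun n => by linarith [hc2 n, (ha n).2])
  obtain ⟨P, hP, hPL⟩ := exists_isOpt hGN hA0 hwm hw0 hwE (c := ENNReal.ofReal (A / 2))
    (C2 := ENNReal.ofReal A) (C4 := ENNReal.ofReal (2 * A))
    (by simpa using half_pos hA0) ENNReal.ofReal_ne_top ENNReal.ofReal_ne_top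
    (fun n => by rw [hw2]; exact ENNReal.ofReal_le_ofReal (ha n).1.le)
    (fun n => by rw [hw2]; exact ENNReal.ofReal_le_ofReal (ha n).2.le)
    (fun n => by rw [hw4]; exact ENNReal.ofReal_le_ofReal (by linarith [hc2 n, (ha n).2]))
    (by simp only [hw2]; exact ENNReal.tendsto_ofReal hlim)
    (by simp only [hw4]; exact ENNReal.tendsto_ofReal hclim)
    (fun n => logPos_ne_top (hwL n)) (ℓ := fun _ => logEn Q - 2 * ε) (l := logEn Q - 2 * ε)
    (fun n => by have := hLw n; rw [logEn_eq (hwL n)] at this; linarith) tendsto_const_nhds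
  have := hQ.logEn_le hA hGN hP
  rw [hP.logEn_eq] at this
  linarith

theorem energy_asymptotics
    (V : Plane → ℝ) (Ω α : ℝ) (Q : Plane → ℝ)
    (hV : V110 V) (hΩ : 0 < Ω) (hsub : SubCritical V Ω) (hCV : CondV V Ω α)
    (hQ : IsGroundState Q)
    (astar : ℝ) (hastar : astar = ∫ x : Plane, (Q x) ^ 2)
    (u : ℝ → Plane → ℂ)
    (hmin : ∀ a ∈ Ioo (0 : ℝ) astar, IsMinimizer V Ω a (u a))
 :
    Tendsto (fun a => eInf V Ω a -
        (astar ^ 2 / 4 - astar ^ 2 / 2 * Real.log astar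
          + (1 / 2) * (∫ x : Plane, ∫ y : Plane, Real.log ‖x - y‖ * (Q x) ^ 2 * (Q y) ^ 2)
          + a ^ 2 / 4 * Real.log (4 * (astar - a))))
      (𝓝[<] astar) (𝓝 0) := by
  have hA0 : 0 < astar := hastar ▸ hQ.integral_sq_pos
  have hGN : GNIneq (ENNReal.ofReal astar) :=
    gnIneq_of_energy hV fun a ha => ⟨_, (hmin a ha).2⟩
  rw [logEn_eq_iterated (integrable_logDens_of hQ.1.continuous.measurable hQ.2.2.2.1
    (hQ.integrable_four hA0 hGN) (hQ.integrable_weight_mul_sq hA0 hGN))]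
  have hIoo : ∀ b < astar, ∀ᶠ a in 𝓝[<] astar, a ∈ Ioo b astar := fun b hb =>
    Ioo_mem_nhdsLT hb
  have hid : Tendsto (fun a : ℝ => a) (𝓝[<] astar) (𝓝 astar) :=
    tendsto_id.mono_left nhdsWithin_le_nhds
  rw [tendsto_order]
  constructor
  · intro b hb
    by_contra hcon
    have hr : Tendsto (fun a : ℝ => a ^ 2 / 4 - a ^ 2 / 2 * Real.log a) (𝓝[<] astar)
        (𝓝 (astar ^ 2 / 4 - astar ^ 2 / 2 * Real.log astar)) :=
      ((hid.pow 2).div_const 4).sub (((hid.pow 2).div_const 2).mul (hid.log hA0.ne'))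
    have hr' := hr.eventually (lt_mem_nhds (show astar ^ 2 / 4 - astar ^ 2 / 2 * Real.log astar
      + b / 2 < astar ^ 2 / 4 - astar ^ 2 / 2 * Real.log astar by linarith))
    obtain ⟨s, hs, hs'⟩ := exists_seq_forall_of_frequently
      ((not_eventually.1 hcon).and_eventually (hr'.and (hIoo (astar / 2) (by linarith))))
    have hmem : ∀ n, s n ∈ Ioo 0 astar := fun n =>
      ⟨(half_pos hA0).trans (hs' n).2.2.1, (hs' n).2.2.2⟩
    refine not_energy_le_of_tendsto hΩ hCV hQ hastar hGN (ε := -b / 2) (by linarith)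
      (fun n => (hs' n).2.2) (hs.mono_right nhdsWithin_le_nhds)
      (u := fun n => u (s n)) (fun n => (hmin _ (hmem n)).1) fun n => ?_
    obtain ⟨h1, h2, -⟩ := hs' n
    rw [← (hmin _ (hmem n)).eInf_eq]
    linarith
  · intro b hb
    obtain ⟨hVi, hV0⟩ := eventually_integrable_potential hV hCV hQ.1.continuous.measurable
      (hQ.integrable_exp_mul_sq hA0 hGN)
    set τ : ℝ → ℝ := fun a => Real.sqrt (a * astar / (4 * (astar - a))) with hτ
    have hτ' : Tendsto τ (𝓝[<] astar) atTop := by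
      refine Real.tendsto_sqrt_atTop.comp ?_
      have h1 : Tendsto (fun a : ℝ => 4 * (astar - a)) (𝓝[<] astar) (𝓝[>] 0) := by
        refine tendsto_nhdsWithin_iff.2 ⟨?_, ?_⟩
        · simpa using (hid.const_sub astar).const_mul 4
        · filter_upwards [self_mem_nhdsWithin] with a ha
          have : a < astar := ha
          show 0 < 4 * (astar - a)
          linarith
      have h2 := (hid.mul_const astar).pos_mul_atTop (mul_pos hA0 hA0) h1.inv_tendsto_nhdsGT_zero
      exact h2.congr fun a => by simp [div_eq_mul_inv]
    have hup : Tendsto (fun a : ℝ => a ^ 2 / 4 + a / astar * (∫ x, V ((τ a)⁻¹ • x) * Q x ^ 2)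
        + a ^ 2 / (2 * astar ^ 2) * logEn Q - a ^ 2 / 4 * Real.log (a * astar)) (𝓝[<] astar)
        (𝓝 (astar ^ 2 / 4 + astar / astar * 0
          + astar ^ 2 / (2 * astar ^ 2) * logEn Q
          - astar ^ 2 / 4 * Real.log (astar * astar))) :=
      ((((hid.pow 2).div_const 4).add ((hid.div_const astar).mul (hV0.comp hτ'))).add
        (((hid.pow 2).div_const _).mul_const _)).sub
        (((hid.pow 2).div_const 4).mul ((hid.mul_const astar).log (mul_pos hA0 hA0).ne'))
    have hlim : astar ^ 2 / 4 + astar / astar * 0 + astar ^ 2 / (2 * astar ^ 2) * logEn Q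
        - astar ^ 2 / 4 * Real.log (astar * astar)
        = astar ^ 2 / 4 - astar ^ 2 / 2 * Real.log astar + 1 / 2 * logEn Q := by
      rw [Real.log_mul hA0.ne' hA0.ne']
      field_simp
      ring
    rw [hlim] at hup
    have hup' := hup.eventually (gt_mem_nhds (lt_add_of_pos_right _ hb))
    filter_upwards [hup', hτ'.eventually hVi, hIoo 0 hA0] with a h1 h2 ha
    have hδ : 0 < astar - a := sub_pos.2 ha.2
    have hpos : 0 < a * astar / (4 * (astar - a)) :=
      div_pos (mul_pos ha.1 hA0) (by linarith)
    have h3 := hQ.eInf_le hastar hGN ha (hmin a ha) (Real.sqrt_pos.2 hpos)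
      (Real.sq_sqrt hpos.le) h2
    linarith

end
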